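/- Let n ≥ 3, α ∈ (0,1), and C > 0. Suppose η is a one-form along the boundary {t = 0} of ℝⁿ × [0,∞), with components η_1,…,η_n,η_0 (functions on ℝⁿ), satisfying: (1) ‖η‖_{C^{1,α}} ≤ C; (2) ‖η‖_{C^{1,α}(B_R ∖ B_{R-1})} ≤ C R^{-2n+1/2} for all R > 1; and (3) ∫_{ℝⁿ} η_a dx = ∫_{ℝⁿ} x_i η_a dx = 0 for all i = 1,…,n and every component index a ∈ {0,1,…,n}. Then for every δ ∈ (0,1) there exists a symmetric two-tensor h in C^{2,α}_1 on ℝⁿ × [0,∞) satisfying Lh = 0, β(h)|_{t=0} = η, and the decay estimate ‖h‖_{C^{2,α}_1(A_{R-1,R})} ≤ C' (1+R)^{-n-1+δ} for all R > 0, where C' depends only on n, α, δ and C. -/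

import Mathlib

/-!
Statement 0 (Theorem 3.3 / `thm:Hinverse` of the paper).

We work on the half-space model `ℝⁿ × [0,∞)` with the hyperbolic metric
`g_H = dt² + e^{2t} dx²`.  A symmetric 2-tensor is represented by its
components `h.xx j k`, `h.x0 j` and `h.tt` (the latter being `h_{00}`),
functions of a point `p = (x, t) ∈ ℝⁿ × ℝ`.  The linearized gauge-fixed
Einstein operator `L`, the Bianchi operator `β` and the one-form `I(u)` are
defined componentwise by the explicit formulas of the paper.  Weighted Hölder
norms `C^{k,α}_δ` are realised as suprema of weighted derivative bounds and
Hölder quotients.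
-/

open MeasureTheory Real Set

noncomputable section

/-- A point of `ℝⁿ × ℝ`; the second coordinate is `t`. -/
abbrev Pt (n : ℕ) := EuclideanSpace ℝ (Fin n) × ℝ

/-- A (not necessarily symmetric) 2-tensor on `ℝⁿ × ℝ`, given by its
components `h_{jk}`, `h_{j0}`, `h_{00}`. -/
structure Tensor2 (n : ℕ) where
  xx : Fin n → Fin n → Pt n → ℝ
  x0 : Fin n → Pt n → ℝ
  tt : Pt n → ℝ

/-- Symmetry of a 2-tensor. -/
def Tensor2.Symm {n : ℕ} (h : Tensor2 n) : Prop := ∀ j k, h.xx j k = h.xx k j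

/-- The zero tensor. -/
def Tensor2.zero (n : ℕ) : Tensor2 n := ⟨fun _ _ _ => 0, fun _ _ => 0, fun _ => 0⟩

/-- Spatial partial derivative `∂_i`. -/
def pdx {n : ℕ} (i : Fin n) (f : Pt n → ℝ) : Pt n → ℝ :=
  fun p => fderiv ℝ f p (EuclideanSpace.single i 1, 0)

/-- Time partial derivative `∂_t`. -/
def pdt {n : ℕ} (f : Pt n → ℝ) : Pt n → ℝ :=
  fun p => fderiv ℝ f p (0, 1)

/-- `(Lh)_{jk}`. -/
def Lxx {n : ℕ} (h : Tensor2 n) (j k : Fin n) : Pt n → ℝ := fun p =>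
  Real.exp (-2 * p.2) * (∑ i, pdx i (pdx i (h.xx j k)) p)
    + pdt (pdt (h.xx j k)) p + ((n : ℝ) - 4) * pdt (h.xx j k) p
    + (4 - 2 * (n : ℝ)) * h.xx j k p
    - 2 * (∑ i, h.xx i i p) * (if j = k then 1 else 0)
    + 2 * (pdx j (h.x0 k) p + pdx k (h.x0 j) p)

/-- `(Lh)_{j0}`. -/
def Lx0 {n : ℕ} (h : Tensor2 n) (j : Fin n) : Pt n → ℝ := fun p =>
  Real.exp (-2 * p.2) * (∑ i, pdx i (pdx i (h.x0 j)) p)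
    + pdt (pdt (h.x0 j)) p + ((n : ℝ) - 2) * pdt (h.x0 j) p
    - 2 * (n : ℝ) * h.x0 j p + 2 * pdx j h.tt p
    - 2 * Real.exp (-2 * p.2) * (∑ i, pdx i (h.xx i j) p)

/-- `(Lh)_{00}`. -/
def Ltt {n : ℕ} (h : Tensor2 n) : Pt n → ℝ := fun p =>
  Real.exp (-2 * p.2) * (∑ i, pdx i (pdx i h.tt) p)
    + pdt (pdt h.tt) p + (n : ℝ) * pdt h.tt p - 2 * (n : ℝ) * h.tt p
    - 4 * Real.exp (-2 * p.2) * (∑ i, pdx i (h.x0 i) p)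

/-- `Lh = u` holds at every point of `S`. -/
def LEqOn {n : ℕ} (h u : Tensor2 n) (S : Set (Pt n)) : Prop :=
  ∀ p ∈ S, (∀ j k, Lxx h j k p = u.xx j k p) ∧ (∀ j, Lx0 h j p = u.x0 j p) ∧
    Ltt h p = u.tt p

/-- Spatial component `β(h)_i` of the Bianchi operator. -/
def BianX {n : ℕ} (h : Tensor2 n) (i : Fin n) : Pt n → ℝ := fun p =>
  Real.exp (-2 * p.2) * (∑ j, pdx j (h.xx i j) p)
    + pdt (h.x0 i) p + (n : ℝ) * h.x0 i p
    - (1 / 2) * Real.exp (-2 * p.2) * pdx i (fun q => ∑ k, h.xx k k q) p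
    - (1 / 2) * pdx i h.tt p

/-- Time component `β(h)_0` of the Bianchi operator. -/
def BianT {n : ℕ} (h : Tensor2 n) : Pt n → ℝ := fun p =>
  Real.exp (-2 * p.2) * (∑ i, pdx i (h.x0 i) p)
    + (n : ℝ) * h.tt p + (1 / 2) * pdt h.tt p
    - (1 / 2) * Real.exp (-2 * p.2) * pdt (fun q => ∑ i, h.xx i i q) p

/-- The one-form `I(u)` on `ℝⁿ`: `I(u)_j(x) = ∫₀^∞ u_{j0}(x,t) e^{-2t} dt`. -/
def Iop {n : ℕ} (u : Tensor2 n) (j : Fin n) (x : EuclideanSpace ℝ (Fin n)) : ℝ :=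
  ∫ t in Set.Ioi (0 : ℝ), u.x0 j (x, t) * Real.exp (-2 * t)

/-- The defining set of the weighted `C^{k,α}_δ`-norm of a scalar function on
`S`: weighted sup-norms of the derivatives of order `≤ k` together with the
weighted Hölder quotient of the `k`-th derivative. -/
def holderSet {n : ℕ} (k : ℕ) (α δ : ℝ) (S : Set (Pt n)) (f : Pt n → ℝ) : Set ℝ :=
  (⋃ j ∈ Finset.range (k + 1),
    (fun p : Pt n => Real.exp (δ * p.2) * ‖iteratedFDeriv ℝ j f p‖) '' S) ∪
  {r | ∃ p ∈ S, ∃ q ∈ S, p ≠ q ∧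
    r = Real.exp (δ * min p.2 q.2) *
      ‖iteratedFDeriv ℝ k f p - iteratedFDeriv ℝ k f q‖ / ‖p - q‖ ^ α}

/-- The weighted Hölder norm `‖f‖_{C^{k,α}_δ(S)}` of a scalar function. -/
def hNorm {n : ℕ} (k : ℕ) (α δ : ℝ) (S : Set (Pt n)) (f : Pt n → ℝ) : ℝ :=
  sSup (holderSet k α δ S f)

/-- The weighted Hölder norm of a 2-tensor: the sum of the norms of its
components. -/
def tNorm {n : ℕ} (k : ℕ) (α δ : ℝ) (S : Set (Pt n)) (h : Tensor2 n) : ℝ :=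
  (∑ j, ∑ k', hNorm k α δ S (h.xx j k')) + (∑ j, hNorm k α δ S (h.x0 j))
    + hNorm k α δ S h.tt

/-- Finiteness of the weighted Hölder norm of a 2-tensor. -/
def tBdd {n : ℕ} (k : ℕ) (α δ : ℝ) (S : Set (Pt n)) (h : Tensor2 n) : Prop :=
  (∀ j k', BddAbove (holderSet k α δ S (h.xx j k'))) ∧
  (∀ j, BddAbove (holderSet k α δ S (h.x0 j))) ∧
  BddAbove (holderSet k α δ S h.tt)

/-- `C^k` regularity of the components of a 2-tensor. -/
def tSmooth {n : ℕ} (k : ℕ) (h : Tensor2 n) : Prop :=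
  (∀ j k', ContDiff ℝ k (h.xx j k')) ∧ (∀ j, ContDiff ℝ k (h.x0 j)) ∧
  ContDiff ℝ k h.tt

/-- The half-space `{t ≥ 0}`. -/
def halfSp (n : ℕ) : Set (Pt n) := {p | 0 ≤ p.2}

/-- The region `A_{R-1,R} = (B_R ∖ B_{R-1}) × [0,∞)`. -/
def annRegion (n : ℕ) (R : ℝ) : Set (Pt n) :=
  {p | R - 1 ≤ ‖p.1‖ ∧ ‖p.1‖ < R ∧ 0 ≤ p.2}

/-- `u` is supported in `B₁ × [0,∞)`. -/
def SuppInUnitBall {n : ℕ} (u : Tensor2 n) : Prop :=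
  ∀ p : Pt n, 1 < ‖p.1‖ →
    (∀ j k, u.xx j k p = 0) ∧ (∀ j, u.x0 j p = 0) ∧ u.tt p = 0

/-- The defining set of the (unweighted) `C^{k,α}`-norm of a scalar function on
a subset `S` of `ℝⁿ`. -/
def eHolderSet {n : ℕ} (k : ℕ) (α : ℝ) (S : Set (EuclideanSpace ℝ (Fin n)))
    (f : EuclideanSpace ℝ (Fin n) → ℝ) : Set ℝ :=
  (⋃ j ∈ Finset.range (k + 1),
    (fun x => ‖iteratedFDeriv ℝ j f x‖) '' S) ∪
  {r | ∃ x ∈ S, ∃ y ∈ S, x ≠ y ∧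
    r = ‖iteratedFDeriv ℝ k f x - iteratedFDeriv ℝ k f y‖ / ‖x - y‖ ^ α}

/-- The `C^{k,α}`-norm of a scalar function on `S ⊆ ℝⁿ`. -/
def eNorm {n : ℕ} (k : ℕ) (α : ℝ) (S : Set (EuclideanSpace ℝ (Fin n)))
    (f : EuclideanSpace ℝ (Fin n) → ℝ) : ℝ :=
  sSup (eHolderSet k α S f)

/-- The `C^{k,α}`-norm of a one-form `η = η_i dxⁱ + η₀ dt` along `{t = 0}`:
the sum of the norms of its components. -/
def oNorm {n : ℕ} (k : ℕ) (α : ℝ) (S : Set (EuclideanSpace ℝ (Fin n)))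
    (ηx : Fin n → EuclideanSpace ℝ (Fin n) → ℝ)
    (η0 : EuclideanSpace ℝ (Fin n) → ℝ) : ℝ :=
  (∑ i, eNorm k α S (ηx i)) + eNorm k α S η0

/-- The spatial shell `B_R ∖ B_{R-1} ⊆ ℝⁿ`. -/
def eShell (n : ℕ) (R : ℝ) : Set (EuclideanSpace ℝ (Fin n)) :=
  {x | R - 1 ≤ ‖x‖ ∧ ‖x‖ < R}

open scoped Topology

/-- Power series with real coefficients. -/
def pser (a : ℕ → ℝ) (z : ℂ) : ℂ := ∑' k, (a k : ℂ) * z ^ k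

/-- Coefficients of the derived series. -/
def shc (a : ℕ → ℝ) : ℕ → ℝ := fun k => (k + 1) * a (k + 1)

lemma shc_bound {a : ℕ → ℝ} (ha : ∀ k, |a k| ≤ 1 / (k.factorial : ℝ)) :
    ∀ k, |shc a k| ≤ 1 / (k.factorial : ℝ) := by
  intro k
  have h := ha (k + 1)
  have h1 : (0 : ℝ) < k + 1 := by positivity
  have h2 : (0 : ℝ) < k.factorial := by positivity
  rw [shc, abs_mul, abs_of_pos h1]
  calc ((k : ℝ) + 1) * |a (k + 1)| ≤ (k + 1) * (1 / ((k + 1).factorial : ℝ)) := by gcongr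
    _ = 1 / (k.factorial : ℝ) := by
      rw [Nat.factorial_succ]; push_cast; field_simp

lemma pser_term_bound {a : ℕ → ℝ} (ha : ∀ k, |a k| ≤ 1 / (k.factorial : ℝ)) (z : ℂ) (k : ℕ) :
    ‖(a k : ℂ) * z ^ k‖ ≤ ‖z‖ ^ k / k.factorial := by
  rw [norm_mul, norm_pow, Complex.norm_real, Real.norm_eq_abs]
  calc |a k| * ‖z‖ ^ k ≤ 1 / (k.factorial : ℝ) * ‖z‖ ^ k := by gcongr; exact ha k
    _ = _ := by ring

lemma pser_summable {a : ℕ → ℝ} (ha : ∀ k, |a k| ≤ 1 / (k.factorial : ℝ)) (z : ℂ) :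
    Summable (fun k => (a k : ℂ) * z ^ k) :=
  Summable.of_norm_bounded (Real.summable_pow_div_factorial ‖z‖) (pser_term_bound ha z)

lemma pser_zero (a : ℕ → ℝ) : pser a 0 = a 0 := by
  rw [pser, tsum_eq_single 0]
  · simp
  · intro k hk; simp [hk]

lemma hasDerivAt_pser {a : ℕ → ℝ} (ha : ∀ k, |a k| ≤ 1 / (k.factorial : ℝ)) (z : ℂ) :
    HasDerivAt (pser a) (pser (shc a) z) z := by
  set R := ‖z‖ + 1
  have hR : 0 ≤ R := by positivity
  have hs : Summable (fun k : ℕ => (shc a k : ℂ) * z ^ k) := pser_summable (shc_bound ha) z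
  have hu : Summable (fun k : ℕ => (k : ℝ) / k.factorial * R ^ (k - 1)) := by
    rw [← summable_nat_add_iff 1]
    refine (Real.summable_pow_div_factorial R).congr ?_
    intro k
    rw [Nat.factorial_succ]; push_cast
    have : (0 : ℝ) < k.factorial := by positivity
    field_simp
  have := hasDerivAt_tsum_of_isPreconnected (𝕜 := ℂ) (g := fun (k : ℕ) (w : ℂ) => (a k : ℂ) * w ^ k)
    (g' := fun (k : ℕ) (w : ℂ) => (a k : ℂ) * (k * w ^ (k - 1))) hu (Metric.isOpen_ball (x := (0 : ℂ)) (ε := R))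
    (convex_ball _ _).isPreconnected (fun k y _ => (hasDerivAt_pow k y).const_mul _) ?_
    (y₀ := 0) (y := z) (by simp; positivity) (pser_summable ha 0) (by simp [R])
  · refine HasDerivAt.congr_deriv this ?_
    rw [pser]
    have hs2 : Summable (fun k : ℕ => (a k : ℂ) * (k * z ^ (k - 1))) := by
      rw [← summable_nat_add_iff 1]
      refine hs.congr ?_
      intro k
      simp only [shc, Nat.add_sub_cancel]; push_cast; ring
    rw [hs2.tsum_eq_zero_add]
    simp only [shc, Nat.add_sub_cancel]; push_cast
    simp only [zero_mul, mul_zero, zero_add]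
    refine tsum_congr fun k => by ring
  · intro k y hy
    have hy : ‖y‖ ≤ R := by simpa using (Metric.mem_ball.1 hy).le
    rw [norm_mul, norm_mul, norm_pow, Complex.norm_real, Complex.norm_natCast, Real.norm_eq_abs]
    calc |a k| * (k * ‖y‖ ^ (k - 1)) ≤ 1 / (k.factorial : ℝ) * (k * R ^ (k - 1)) := by
          gcongr; exact ha k
      _ = _ := by ring

/-- Bessel-type coefficients. -/
def bco (c : ℝ) (k : ℕ) : ℝ := ∏ j ∈ Finset.range k, ((2 * (j : ℝ) + 2) * (2 * j + 1 + c))⁻¹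

lemma bco_succ (c : ℝ) (hc : 1 ≤ c) (k : ℕ) :
    bco c (k + 1) * ((2 * (k : ℝ) + 2) * (2 * k + 1 + c)) = bco c k := by
  rw [bco, Finset.prod_range_succ, ← bco]
  have : (2 * (k : ℝ) + 2) * (2 * k + 1 + c) ≠ 0 := by positivity
  field_simp

lemma bco_bound (c : ℝ) (hc : 1 ≤ c) : ∀ k, |bco c k| ≤ 1 / (k.factorial : ℝ) := by
  intro k
  have hnn : ∀ k, 0 ≤ bco c k := fun k => Finset.prod_nonneg fun j _ => by positivity
  rw [abs_of_nonneg (hnn k)]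
  induction k with
  | zero => simp [bco]
  | succ k ih =>
    rw [bco, Finset.prod_range_succ, ← bco, Nat.factorial_succ]
    push_cast
    have h2 : (0 : ℝ) < k.factorial := by positivity
    calc bco c k * ((2 * (k : ℝ) + 2) * (2 * k + 1 + c))⁻¹ ≤ 1 / k.factorial * (((k : ℝ) + 1) * 1)⁻¹ := by
          gcongr
          · linarith
          · linarith
          · linarith
      _ = _ := by field_simp

def Fb (c : ℝ) (z : ℂ) : ℂ := pser (bco c) z
def Fb1 (c : ℝ) (z : ℂ) : ℂ := pser (shc (bco c)) z
def Fb2 (c : ℝ) (z : ℂ) : ℂ := pser (shc (shc (bco c))) z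

lemma Fb_deriv {c : ℝ} (hc : 1 ≤ c) (z : ℂ) : HasDerivAt (Fb c) (Fb1 c z) z :=
  hasDerivAt_pser (bco_bound c hc) z
lemma Fb1_deriv {c : ℝ} (hc : 1 ≤ c) (z : ℂ) : HasDerivAt (Fb1 c) (Fb2 c z) z :=
  hasDerivAt_pser (shc_bound (bco_bound c hc)) z
lemma Fb_zero (c : ℝ) : Fb c 0 = 1 := by simp [Fb, pser_zero, bco]

lemma Fb_ode {c : ℝ} (hc : 1 ≤ c) (z : ℂ) :
    4 * z * Fb2 c z + 2 * (c + 1) * Fb1 c z = Fb c z := by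
  have h0 := bco_bound c hc
  have s1 := pser_summable (shc_bound h0) z
  have s2 := pser_summable (shc_bound (shc_bound h0)) z
  have e2 : z * Fb2 c z = ∑' k : ℕ, ((k * shc (bco c) k : ℝ) : ℂ) * z ^ k := by
    rw [Fb2, pser, ← tsum_mul_left]
    rw [Summable.tsum_eq_zero_add (f := fun k : ℕ => ((k * shc (bco c) k : ℝ) : ℂ) * z ^ k)]
    · simp only [shc]
      push_cast
      simp only [zero_mul, zero_add]
      exact tsum_congr fun k => by ring
    · rw [← summable_nat_add_iff 1]
      refine (s2.mul_left z).congr ?_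
      intro k
      simp only [shc]; push_cast; ring
  have s3 : Summable (fun k : ℕ => ((k * shc (bco c) k : ℝ) : ℂ) * z ^ k) := by
    rw [← summable_nat_add_iff 1]
    refine (s2.mul_left z).congr ?_
    intro k
    simp only [shc]; push_cast; ring
  rw [mul_assoc, e2, Fb1, Fb, pser, pser, ← tsum_mul_left, ← tsum_mul_left,
    ← Summable.tsum_add (s3.mul_left _) (s1.mul_left _)]
  refine tsum_congr fun k => ?_
  rw [← bco_succ c hc k]
  simp only [shc]; push_cast; ring

/-- `φ_c(λ,s)` and its derivatives. -/
def phb (c : ℝ) (l : ℂ) (s : ℝ) : ℂ := Fb c (l * s ^ 2)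
def psb (c : ℝ) (l : ℂ) (s : ℝ) : ℂ := 2 * l * Fb1 c (l * s ^ 2)
def phb1 (c : ℝ) (l : ℂ) (s : ℝ) : ℂ := s ^ 2 * psb c l s
def psb' (c : ℝ) (l : ℂ) (s : ℝ) : ℂ := 4 * l ^ 2 * s * Fb2 c (l * s ^ 2)

lemma arg_deriv (l : ℂ) (s : ℝ) : HasDerivAt (fun s : ℝ => l * (s : ℂ) ^ 2) (2 * l * s) s := by
  have := ((Complex.ofRealCLM.hasDerivAt (x := s)).pow 2).const_mul l
  simp only [Complex.ofRealCLM_apply, Complex.ofReal_one] at this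
  refine HasDerivAt.congr_deriv this ?_
  push_cast; ring

lemma phb_deriv {c : ℝ} (hc : 1 ≤ c) (l : ℂ) (s : ℝ) :
    HasDerivAt (phb c l) (s * psb c l s) s := by
  have := (Fb_deriv hc (l * s ^ 2)).scomp s (arg_deriv l s)
  refine HasDerivAt.congr_deriv this ?_
  simp [psb]; ring

lemma psb_deriv {c : ℝ} (hc : 1 ≤ c) (l : ℂ) (s : ℝ) :
    HasDerivAt (psb c l) (psb' c l s) s := by
  have := ((Fb1_deriv hc (l * s ^ 2)).scomp s (arg_deriv l s)).const_mul (2 * l)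
  refine HasDerivAt.congr_deriv this ?_
  simp [psb']; ring

lemma psb_ode {c : ℝ} (hc : 1 ≤ c) (l : ℂ) (s : ℝ) :
    s * psb' c l s + (c + 1) * psb c l s = l * phb c l s := by
  have := Fb_ode hc (l * s ^ 2)
  rw [psb', psb, phb, ← this]; ring

lemma phb_zero (c : ℝ) (l : ℂ) : phb c l 0 = 1 := by simp [phb, Fb_zero]

lemma phb_diff_l {c : ℝ} (hc : 1 ≤ c) (s : ℝ) : Differentiable ℂ (fun l => phb c l s) := by
  intro l
  have : HasDerivAt (fun l : ℂ => l * (s : ℂ) ^ 2) ((s : ℂ) ^ 2) l := by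
    simpa using (hasDerivAt_id l).mul_const ((s : ℂ) ^ 2)
  exact ((Fb_deriv hc (l * s ^ 2)).comp l this).differentiableAt

lemma phb1_diff_l {c : ℝ} (hc : 1 ≤ c) (s : ℝ) : Differentiable ℂ (fun l => phb1 c l s) := by
  intro l
  have : HasDerivAt (fun l : ℂ => l * (s : ℂ) ^ 2) ((s : ℂ) ^ 2) l := by
    simpa using (hasDerivAt_id l).mul_const ((s : ℂ) ^ 2)
  have h := ((Fb1_deriv hc (l * s ^ 2)).comp l this).differentiableAt
  unfold phb1 psb
  exact ((differentiableAt_id.const_mul 2).mul h).const_mul _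

def Sec : Set ℂ := {l | |l.im| < l.re}
def rh (l : ℂ) : ℝ := √‖l‖
def mub (l : ℂ) : ℝ := √l.re

lemma sec_open : IsOpen Sec := isOpen_lt (by fun_prop) (by fun_prop)
lemma sec_re {l : ℂ} (hl : l ∈ Sec) : 0 < l.re := lt_of_le_of_lt (abs_nonneg _) hl
lemma mub_pos {l : ℂ} (hl : l ∈ Sec) : 0 < mub l := Real.sqrt_pos.2 (sec_re hl)
lemma mub_sq {l : ℂ} (hl : l ∈ Sec) : mub l ^ 2 = l.re := Real.sq_sqrt (sec_re hl).le
lemma rh_nonneg (l : ℂ) : 0 ≤ rh l := Real.sqrt_nonneg _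
lemma rh_sq (l : ℂ) : rh l ^ 2 = ‖l‖ := Real.sq_sqrt (norm_nonneg _)
lemma mub_le_rh (l : ℂ) : mub l ≤ rh l :=
  Real.sqrt_le_sqrt ((le_abs_self _).trans (Complex.abs_re_le_norm l))
lemma rh_le_mub {l : ℂ} (hl : l ∈ Sec) : rh l ≤ 2 * mub l := by
  have h1 : ‖l‖ ≤ 2 * l.re := by
    have h := Complex.norm_le_abs_re_add_abs_im l
    have h2 : |l.im| < l.re := hl
    rw [abs_of_pos (sec_re hl)] at h
    linarith
  have := mub_sq hl
  have h3 := rh_sq l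
  have h4 := mub_pos hl
  nlinarith [rh_nonneg l]
lemma rh_pos {l : ℂ} (hl : l ∈ Sec) : 0 < rh l := (mub_pos hl).trans_le (mub_le_rh l)
lemma sec_ne {l : ℂ} (hl : l ∈ Sec) : l ≠ 0 := by
  rintro rfl; simp [Sec] at hl

/-- squared modulus of φ, and `Re (φ̄ ψ)`. -/
def wb (c : ℝ) (l : ℂ) (s : ℝ) : ℝ := (phb c l s).re ^ 2 + (phb c l s).im ^ 2
def gb (c : ℝ) (l : ℂ) (s : ℝ) : ℝ :=
  (phb c l s).re * (psb c l s).re + (phb c l s).im * (psb c l s).im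
def gb' (c : ℝ) (l : ℂ) (s : ℝ) : ℝ :=
  s * ((psb c l s).re ^ 2 + (psb c l s).im ^ 2) +
  ((phb c l s).re * (psb' c l s).re + (phb c l s).im * (psb' c l s).im)

lemma hasDerivAt_re {f : ℝ → ℂ} {f' : ℂ} {s : ℝ} (h : HasDerivAt f f' s) :
    HasDerivAt (fun s => (f s).re) f'.re s :=
  (Complex.reCLM.hasFDerivAt (x := f s)).comp_hasDerivAt s h
lemma hasDerivAt_im {f : ℝ → ℂ} {f' : ℂ} {s : ℝ} (h : HasDerivAt f f' s) :
    HasDerivAt (fun s => (f s).im) f'.im s :=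
  (Complex.imCLM.hasFDerivAt (x := f s)).comp_hasDerivAt s h

lemma wb_deriv {c : ℝ} (hc : 1 ≤ c) (l : ℂ) (s : ℝ) :
    HasDerivAt (wb c l) (2 * s * gb c l s) s := by
  have h := phb_deriv hc l s
  refine (((hasDerivAt_re h).pow 2).add ((hasDerivAt_im h).pow 2)).congr_deriv ?_
  simp [gb]; ring

lemma gb_deriv {c : ℝ} (hc : 1 ≤ c) (l : ℂ) (s : ℝ) :
    HasDerivAt (gb c l) (gb' c l s) s := by
  have h := phb_deriv hc l s
  have h2 := psb_deriv hc l s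
  refine (((hasDerivAt_re h).mul (hasDerivAt_re h2)).add
    ((hasDerivAt_im h).mul (hasDerivAt_im h2))).congr_deriv ?_
  simp [gb']; ring

lemma gb_ode {c : ℝ} (hc : 1 ≤ c) (l : ℂ) (s : ℝ) :
    s * gb' c l s = s ^ 2 * ((psb c l s).re ^ 2 + (psb c l s).im ^ 2) + l.re * wb c l s
      - (c + 1) * gb c l s := by
  have h := psb_ode hc l s
  have h1 := congrArg Complex.re h
  have h2 := congrArg Complex.im h
  simp at h1 h2
  simp only [gb', wb, gb]
  linear_combination (phb c l s).re * h1 + (phb c l s).im * h2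

lemma wb_norm (c : ℝ) (l : ℂ) (s : ℝ) : wb c l s = ‖phb c l s‖ ^ 2 := by
  rw [← Complex.normSq_eq_norm_sq, Complex.normSq_apply, wb]; ring

lemma wb_zero (c : ℝ) (l : ℂ) : wb c l 0 = 1 := by simp [wb, phb_zero]

lemma gb_lower {c : ℝ} (hc : 1 ≤ c) {l : ℂ} (hl : l ∈ Sec) {s : ℝ} (hs : 0 < s) :
    mub l ^ 2 / (c + 1 + mub l * s) * wb c l s ≤ gb c l s := by
  set m := mub l with hm
  have hm0 : 0 < m := mub_pos hl
  set D : ℝ → ℝ := fun s => s ^ (c + 1) * (gb c l s - m ^ 2 * (c + 1 + m * s)⁻¹ * wb c l s)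
  have hD : ∀ s : ℝ, 0 < s → HasDerivAt D
      ((c + 1) * s ^ (c + 1 - 1) * (gb c l s - m ^ 2 * (c + 1 + m * s)⁻¹ * wb c l s) +
      s ^ (c + 1) * (gb' c l s - (m ^ 2 * (-m / (c + 1 + m * s) ^ 2) * wb c l s +
       m ^ 2 * (c + 1 + m * s)⁻¹ * (2 * s * gb c l s)))) s := by
    intro s hs
    have h1 : HasDerivAt (fun s : ℝ => c + 1 + m * s) m s := by
      simpa using ((hasDerivAt_id s).const_mul m).const_add (c + 1)
    have h2 := (h1.inv (by positivity)).const_mul (m ^ 2)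
    have h3 := (gb_deriv hc l s).sub (h2.mul (wb_deriv hc l s))
    exact (Real.hasDerivAt_rpow_const (p := c + 1) (Or.inl hs.ne')).mul h3
  have hmono : MonotoneOn D (Ici 0) := by
    apply monotoneOn_of_deriv_nonneg (convex_Ici 0)
    · intro s hs
      apply ContinuousAt.continuousWithinAt
      have hs : 0 ≤ s := hs
      have := (gb_deriv hc l s).continuousAt
      have := (wb_deriv hc l s).continuousAt
      have h1 : c + 1 + m * s ≠ 0 := by positivity
      have h2 : ContinuousAt (fun s : ℝ => (c + 1 + m * s)⁻¹) s :=
        ContinuousAt.inv₀ (by fun_prop) h1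
      have h3 : ContinuousAt (fun s : ℝ => s ^ (c + 1)) s :=
        Real.continuousAt_rpow_const _ _ (Or.inr (by linarith))
      fun_prop
    · intro s hs
      rw [interior_Ici] at hs
      exact (hD s hs).differentiableAt.differentiableWithinAt
    · intro s hs
      rw [interior_Ici] at hs
      have hs : 0 < s := hs
      rw [(hD s hs).deriv]
      have e1 : s ^ (c + 1) = s ^ c * s := by rw [Real.rpow_add hs, Real.rpow_one]
      have e2 : c + 1 - 1 = c := by ring
      rw [e1, e2]
      have hode := gb_ode hc l s
      rw [← mub_sq hl, ← hm] at hode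
      set w := wb c l s
      set g := gb c l s
      set A := c + 1 + m * s with hA
      have hA0 : 0 < A := by positivity
      set G := m ^ 2 * A⁻¹ with hG
      have key : (c + 1) * s ^ c * (g - G * w) + s ^ c * s *
          (gb' c l s - (m ^ 2 * (-m / A ^ 2) * w + G * (2 * s * g)))
          = s ^ c * (s ^ 2 * (((psb c l s).re - G * (phb c l s).re) ^ 2 +
            ((psb c l s).im - G * (phb c l s).im) ^ 2) +
            w * (m ^ 2 * ((c + 2) * (m * s)) / A ^ 2)) := by
        have e3 : m ^ 2 - (c + 1) * G + s * m ^ 2 * m / A ^ 2 - s ^ 2 * G ^ 2 =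
            m ^ 2 * ((c + 2) * (m * s)) / A ^ 2 := by
          rw [hG]; field_simp; rw [hA]; ring
        rw [← e3]
        have e4 : (m ^ 2 * (-m / A ^ 2)) = - (m ^ 2 * m / A ^ 2) := by ring
        rw [e4]
        have e5 : w = (phb c l s).re ^ 2 + (phb c l s).im ^ 2 := rfl
        have e6 : g = (phb c l s).re * (psb c l s).re + (phb c l s).im * (psb c l s).im := rfl
        have hode' : s * gb' c l s = s ^ 2 * ((psb c l s).re ^ 2 + (psb c l s).im ^ 2) + m ^ 2 * w
          - (c + 1) * g := hode
        rw [show s * m ^ 2 * m / A ^ 2 = s * (m ^ 2 * m / A ^ 2) by ring]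
        generalize m ^ 2 * m / A ^ 2 = X
        linear_combination s ^ c * hode' + s ^ c * s ^ 2 * G ^ 2 * e5 - 2 * s ^ c * s ^ 2 * G * e6
      have hw : 0 ≤ w := by simp only [w, wb]; positivity
      have : 0 ≤ s ^ c * (s ^ 2 * (((psb c l s).re - G * (phb c l s).re) ^ 2 +
            ((psb c l s).im - G * (phb c l s).im) ^ 2) +
            w * (m ^ 2 * ((c + 2) * (m * s)) / A ^ 2)) := by positivity
      rw [← key] at this
      exact this
  have h0 : D 0 = 0 := by simp [D, Real.zero_rpow (by linarith : c + 1 ≠ 0)]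
  have := hmono (mem_Ici.2 le_rfl) (mem_Ici.2 hs.le) hs.le
  rw [h0] at this
  have h2 := pos_of_mul_pos_left (a := s ^ (c+1)) (b := 1) (by simp; positivity) zero_le_one
  have h3 := nonneg_of_mul_nonneg_right this (by positivity)
  rw [div_eq_mul_inv]
  linarith

lemma gb_nonneg {c : ℝ} (hc : 1 ≤ c) {l : ℂ} (hl : l ∈ Sec) {s : ℝ} (hs : 0 < s) :
    0 ≤ gb c l s := by
  refine le_trans ?_ (gb_lower hc hl hs)
  have := mub_pos hl
  have : 0 ≤ wb c l s := by simp only [wb]; positivity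
  positivity

lemma wb_mono {c : ℝ} (hc : 1 ≤ c) {l : ℂ} (hl : l ∈ Sec) : MonotoneOn (wb c l) (Ici 0) := by
  apply monotoneOn_of_deriv_nonneg (convex_Ici 0)
  · intro s _; exact (wb_deriv hc l s).continuousAt.continuousWithinAt
  · intro s _; exact (wb_deriv hc l s).differentiableAt.differentiableWithinAt
  · intro s hs
    rw [interior_Ici] at hs
    have hs : 0 < s := hs
    rw [(wb_deriv hc l s).deriv]
    have := gb_nonneg hc hl hs
    positivity

lemma phb_mono {c : ℝ} (hc : 1 ≤ c) {l : ℂ} (hl : l ∈ Sec) {σ r : ℝ} (h0 : 0 ≤ σ) (h : σ ≤ r) :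
    ‖phb c l σ‖ ≤ ‖phb c l r‖ := by
  have := wb_mono hc hl (mem_Ici.2 h0) (mem_Ici.2 (h0.trans h)) h
  rw [wb_norm, wb_norm] at this
  exact (sq_le_sq₀ (norm_nonneg _) (norm_nonneg _)).1 this

lemma phb_ge_one {c : ℝ} (hc : 1 ≤ c) {l : ℂ} (hl : l ∈ Sec) {s : ℝ} (h0 : 0 ≤ s) :
    1 ≤ ‖phb c l s‖ := by
  have := phb_mono hc hl le_rfl h0
  simpa [phb_zero] using this

lemma phb_ne {c : ℝ} (hc : 1 ≤ c) {l : ℂ} (hl : l ∈ Sec) {s : ℝ} (h0 : 0 ≤ s) :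
    phb c l s ≠ 0 := by
  have := phb_ge_one hc hl h0
  intro h; rw [h] at this; norm_num at this

lemma wb_pos {c : ℝ} (hc : 1 ≤ c) {l : ℂ} (hl : l ∈ Sec) {s : ℝ} (h0 : 0 ≤ s) :
    0 < wb c l s := by
  rw [wb_norm]; have := phb_ge_one hc hl h0; positivity

lemma one_add_le_two_exp {v : ℝ} : 1 + v ≤ 2 * Real.exp (v / 2) := by
  have := Real.add_one_le_exp (v / 2)
  linarith

lemma phb_decay_mu {c : ℝ} (hc : 1 ≤ c) {l : ℂ} (hl : l ∈ Sec) {σ r : ℝ} (h0 : 0 ≤ σ) (h : σ ≤ r) :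
    ‖phb c l σ‖ ≤ 2 ^ (c + 1) * Real.exp (-(mub l * (r - σ) / 2)) * ‖phb c l r‖ := by
  set m := mub l with hm
  have hm0 : 0 < m := mub_pos hl
  set A := c + 1 with hA
  have hA0 : 0 < A := by positivity
  set H : ℝ → ℝ := fun s => wb c l s * (Real.exp (-(2 * m * s)) * (A + m * s) ^ (2 * A))
  have hH : ∀ s : ℝ, 0 ≤ s → HasDerivAt H
      (2 * s * gb c l s * (Real.exp (-(2 * m * s)) * (A + m * s) ^ (2 * A)) +
        wb c l s * (Real.exp (-(2 * m * s)) * (-(2 * m)) * (A + m * s) ^ (2 * A) +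
          Real.exp (-(2 * m * s)) * (m * (2 * A) * (A + m * s) ^ (2 * A - 1)))) s := by
    intro s hs
    have h1 : HasDerivAt (fun s : ℝ => A + m * s) m s := by
      simpa using ((hasDerivAt_id s).const_mul m).const_add A
    have h2 : HasDerivAt (fun s : ℝ => -(2 * m * s)) (-(2 * m)) s := by
      simpa using (hasDerivAt_id s).const_mul (2 * m) |>.fun_neg
    have h3 := h1.rpow_const (p := 2 * A) (Or.inl (by positivity))
    exact (wb_deriv hc l s).mul (h2.exp.mul h3)
  have hmono : MonotoneOn H (Ici 0) := by
    apply monotoneOn_of_deriv_nonneg (convex_Ici 0)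
    · intro s hs; exact (hH s hs).continuousAt.continuousWithinAt
    · intro s hs
      rw [interior_Ici] at hs
      exact (hH s (le_of_lt hs)).differentiableAt.differentiableWithinAt
    · intro s hs
      rw [interior_Ici] at hs
      have hs : 0 < s := hs
      rw [(hH s hs.le).deriv]
      have hg := gb_lower hc hl hs
      rw [← hm, ← hA] at hg
      have hB : 0 < A + m * s := by positivity
      have e1 : (A + m * s) ^ (2 * A) = (A + m * s) ^ (2 * A - 1) * (A + m * s) := by
        rw [Real.rpow_sub_one hB.ne']; field_simp
      rw [e1]
      have hE : 0 < Real.exp (-(2 * m * s)) * (A + m * s) ^ (2 * A - 1) := by positivity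
      set E := (A + m * s) ^ (2 * A - 1)
      have : 0 ≤ (Real.exp (-(2 * m * s)) * E) * (2 * s * (A + m * s) *
         (gb c l s - m ^ 2 / (A + m * s) * wb c l s)) := by
        have : 0 ≤ gb c l s - m ^ 2 / (A + m * s) * wb c l s := by linarith
        positivity
      convert this using 1
      field_simp
      ring
  have := hmono (mem_Ici.2 h0) (mem_Ici.2 (h0.trans h)) h
  simp only [H] at this
  rw [wb_norm, wb_norm] at this
  have hr0 := h0.trans h
  -- take square roots
  have sq : ∀ s : ℝ, 0 ≤ s → ‖phb c l s‖ ^ 2 * (Real.exp (-(2 * m * s)) * (A + m * s) ^ (2 * A)) =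
      (‖phb c l s‖ * (Real.exp (-(m * s)) * (A + m * s) ^ A)) ^ 2 := by
    intro s hs
    have hB : 0 < A + m * s := by positivity
    have e1 : (A + m * s) ^ (2 * A) = ((A + m * s) ^ A) ^ 2 := by
      rw [mul_comm 2 A, Real.rpow_mul hB.le]; norm_cast
    have e2 : Real.exp (-(2 * m * s)) = Real.exp (-(m * s)) ^ 2 := by
      rw [← Real.exp_nat_mul]; congr 1; push_cast; ring
    rw [e1, e2]; ring
  rw [sq σ h0, sq r hr0] at this
  have h5 := (sq_le_sq₀ (by positivity) (by positivity)).1 this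
  have hBs : 0 < A + m * σ := by positivity
  have hBr : 0 < A + m * r := by positivity
  have h6 : ((A + m * r) / (A + m * σ)) ^ A ≤ 2 ^ A * Real.exp (m * (r - σ) / 2) := by
    have hrs : 0 ≤ m * (r - σ) := mul_nonneg hm0.le (by linarith)
    have e1 : (A + m * r) / (A + m * σ) ≤ 1 + m * (r - σ) / A := by
      rw [div_le_iff₀ hBs]
      have : (1 + m * (r - σ) / A) * (A + m * σ) = A + m * r + m * (r - σ) * (m * σ) / A := by
        field_simp; ring
      rw [this]
      have : 0 ≤ m * (r - σ) * (m * σ) / A := by positivity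
      linarith
    have e2 := one_add_le_two_exp (v := m * (r - σ) / A)
    calc ((A + m * r) / (A + m * σ)) ^ A ≤ (2 * Real.exp (m * (r - σ) / A / 2)) ^ A := by
          apply Real.rpow_le_rpow (by positivity) (e1.trans e2) hA0.le
      _ = 2 ^ A * Real.exp (m * (r - σ) / 2) := by
          rw [Real.mul_rpow (by norm_num) (by positivity), ← Real.exp_mul]
          congr 2; field_simp
  rw [Real.div_rpow hBr.le hBs.le, div_le_iff₀ (by positivity)] at h6
  have h7 : ‖phb c l σ‖ * (Real.exp (-(m * σ)) * (A + m * σ) ^ A) ≤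
     ‖phb c l r‖ * (Real.exp (-(m * r)) * (2 ^ A * Real.exp (m * (r - σ) / 2) * (A + m * σ) ^ A)) := by
    refine h5.trans ?_
    gcongr
  have hP : 0 < Real.exp (-(m * σ)) * (A + m * σ) ^ A := by positivity
  refine le_of_mul_le_mul_right (h7.trans (le_of_eq ?_)) hP
  have : Real.exp (-(m * r)) * Real.exp (m * (r - σ) / 2) =
      Real.exp (-(m * (r - σ) / 2)) * Real.exp (-(m * σ)) := by
    rw [← Real.exp_add, ← Real.exp_add]; congr 1; ring
  linear_combination ‖phb c l r‖ * 2 ^ A * (A + m * σ) ^ A * this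

lemma phb_decay {c : ℝ} (hc : 1 ≤ c) {l : ℂ} (hl : l ∈ Sec) {σ r : ℝ} (h0 : 0 ≤ σ) (h : σ ≤ r) :
    ‖phb c l σ‖ ≤ 2 ^ (c + 1) * Real.exp (-(rh l * (r - σ) / 4)) * ‖phb c l r‖ := by
  refine (phb_decay_mu hc hl h0 h).trans ?_
  have := rh_le_mub hl
  gcongr ?_ * Real.exp ?_ * _
  nlinarith

lemma psb_bound {c : ℝ} (hc : 1 ≤ c) {l : ℂ} (hl : l ∈ Sec) {s : ℝ} (hs : 0 ≤ s) :
    s * ‖psb c l s‖ ≤ 2 * (c + 2) * rh l * ‖phb c l s‖ := by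
  rcases hs.eq_or_lt with rfl | hs
  · simp; have := rh_nonneg l; positivity
  set m := mub l with hm
  have hm0 : 0 < m := mub_pos hl
  set K := 2 * (c + 2) * rh l with hK
  have hK0 : 0 ≤ K := by have := rh_nonneg l; positivity
  set f : ℝ → ℂ := fun s => ((s ^ (c + 1) : ℝ) : ℂ) * psb c l s
  set B : ℝ → ℝ := fun s => K * (s ^ c * √(wb c l s))
  have hf : ∀ s : ℝ, 0 ≤ s → HasDerivAt f (l * (s ^ c : ℝ) * phb c l s) s := by
    intro s hs
    have h1 := (Real.hasDerivAt_rpow_const (x := s) (p := c + 1) (Or.inr (by linarith))).ofReal_comp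
    refine (h1.mul (psb_deriv hc l s)).congr_deriv ?_
    have h2 := psb_ode hc l s
    have e1 : s ^ (c + 1) = s ^ c * s := Real.rpow_add_one' hs (by linarith)
    have e2 : c + 1 - 1 = c := by ring
    rw [e1, e2]; push_cast
    linear_combination ((s ^ c : ℝ) : ℂ) * h2
  have hB : ∀ s : ℝ, 0 ≤ s → HasDerivAt B (K * (c * s ^ (c - 1) * √(wb c l s) +
      s ^ c * (2 * s * gb c l s / (2 * √(wb c l s))))) s := by
    intro s hs
    have h1 := (Real.hasDerivAt_rpow_const (x := s) (p := c) (Or.inr (by linarith)))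
    have h2 := (wb_deriv hc l s).sqrt (wb_pos hc hl hs).ne'
    exact (h1.mul h2).const_mul K
  have := image_norm_le_of_norm_deriv_right_le_deriv_boundary' (f := f) (a := 0) (b := s)
    (f' := fun s => (l * (s ^ c : ℝ) * phb c l s)) (B := B) (B' := fun s => (K * (c * s ^ (c - 1) * √(wb c l s) +
      s ^ c * (2 * s * gb c l s / (2 * √(wb c l s))))))
    (fun x hx => (hf x hx.1).continuousAt.continuousWithinAt)
    (fun x hx => (hf x hx.1).hasDerivWithinAt)
    (by simp [f, B, Real.zero_rpow (by linarith : c + 1 ≠ 0)]; positivity)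
    (fun x hx => (hB x hx.1).continuousAt.continuousWithinAt)
    (fun x hx => (hB x hx.1).hasDerivWithinAt) ?_ (x := s) ⟨hs.le, le_rfl⟩
  · simp only [f, B] at this
    rw [norm_mul, Complex.norm_real, Real.norm_of_nonneg (by positivity), wb_norm,
      Real.sqrt_sq (norm_nonneg _), Real.rpow_add_one hs.ne'] at this
    have hp : 0 < s ^ c := by positivity
    refine le_of_mul_le_mul_left ?_ hp
    linarith
  · intro x hx
    rcases hx.1.eq_or_lt with h0 | hx0
    · rw [← h0]; simp [Real.zero_rpow (by linarith : c ≠ 0)]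
      have : (0:ℝ) ≤ 0 ^ (c - 1) := Real.rpow_nonneg le_rfl _
      positivity
    have hwp := wb_pos hc hl hx0.le
    have hsq : 0 < √(wb c l x) := Real.sqrt_pos.2 hwp
    have hn : ‖phb c l x‖ = √(wb c l x) := by rw [wb_norm, Real.sqrt_sq (norm_nonneg _)]
    have hg := gb_lower hc hl hx0
    rw [norm_mul, norm_mul, Complex.norm_real, Real.norm_of_nonneg (by positivity), hn, ← rh_sq]
    have hgd : m ^ 2 / (c + 1 + m * x) * √(wb c l x) ≤ gb c l x / √(wb c l x) := by
      rw [le_div_iff₀ hsq, mul_assoc, Real.mul_self_sqrt hwp.le]; exact hg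
    have e1 : x ^ (c - 1) = x ^ c / x := Real.rpow_sub_one hx0.ne' c
    have hr := rh_le_mub hl
    rw [← hm] at hr
    have hfin : rh l ≤ 2 * (c + 2) * (c / x + x * (m ^ 2 / (c + 1 + m * x))) := by
      have : m ≤ (c + 2) * (c / x + x * (m ^ 2 / (c + 1 + m * x))) := by
        have hAx : 0 < c + 1 + m * x := by positivity
        have : (c + 2) * (c / x + x * (m ^ 2 / (c + 1 + m * x))) =
          ((c + 2) * (c * (c + 1 + m * x) + m ^ 2 * x ^ 2)) / (x * (c + 1 + m * x)) := by
          field_simp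
        rw [this, le_div_iff₀ (by positivity)]
        have hy : 0 < m * x := by positivity
        set y := m * x
        have e : m * (x * (c + 1 + y)) = y * (c + 1 + y) := by simp only [y]; ring
        have e2 : m ^ 2 * x ^ 2 = y ^ 2 := by simp only [y]; ring
        rw [e, e2]
        nlinarith [sq_nonneg (y - 1), mul_nonneg (by linarith : 0 ≤ c - 1) hy.le,
          mul_nonneg (by linarith : 0 ≤ c - 1) (sq_nonneg y), mul_nonneg (by linarith : 0 ≤ c - 1) (mul_nonneg (by linarith : 0 ≤ c - 1) hy.le),  mul_nonneg (by linarith : 0 ≤ c - 1) (sq_nonneg (y-1))]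
      linarith
    have hrh := rh_nonneg l
    calc rh l ^ 2 * x ^ c * √(wb c l x) ≤ rh l * (2 * (c + 2) * (c / x + x * (m ^ 2 / (c + 1 + m * x)))) * x ^ c * √(wb c l x) := by
          rw [sq]; gcongr
      _ = K * (c * x ^ (c - 1) * √(wb c l x) + x ^ c * (x * (m ^ 2 / (c + 1 + m * x) * √(wb c l x)))) := by
          rw [hK, e1]; ring
      _ ≤ K * (c * x ^ (c - 1) * √(wb c l x) + x ^ c * (x * (gb c l x / √(wb c l x)))) := by
          gcongr
      _ = _ := by congr 3; field_simp

lemma phb1_bound {c : ℝ} (hc : 1 ≤ c) {l : ℂ} (hl : l ∈ Sec) {s : ℝ} (hs : 0 ≤ s) :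
    ‖phb1 c l s‖ ≤ 2 * (c + 2) * rh l * s * ‖phb c l s‖ := by
  have := psb_bound hc hl hs
  rw [phb1, norm_mul, norm_pow, Complex.norm_real, Real.norm_of_nonneg hs]
  calc s ^ 2 * ‖psb c l s‖ = s * (s * ‖psb c l s‖) := by ring
    _ ≤ s * (2 * (c + 2) * rh l * ‖phb c l s‖) := by gcongr
    _ = _ := by ring

lemma phb1_ratio_re {c : ℝ} (hc : 1 ≤ c) {l : ℂ} (hl : l ∈ Sec) :
    (1 + rh l) / (2 * (c + 2)) ≤ 1 + (phb1 c l 1 / phb c l 1).re := by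
  have hg := gb_lower hc hl one_pos
  have hw := wb_pos hc hl zero_le_one
  have e : (phb1 c l 1 / phb c l 1).re = gb c l 1 / wb c l 1 := by
    rw [Complex.div_re, Complex.normSq_apply, ← add_div]
    simp [phb1, gb, wb]; ring
  rw [e]
  have h1 : mub l ^ 2 / (c + 1 + mub l) ≤ gb c l 1 / wb c l 1 := by
    rw [le_div_iff₀ hw]; simpa using hg
  refine le_trans ?_ (add_le_add_right h1 1)
  have hm := mub_pos hl
  have hr := rh_le_mub hl
  have hA : 0 < c + 1 + mub l := by positivity
  rw [div_le_iff₀ (by positivity)]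
  have : (1 + mub l ^ 2 / (c + 1 + mub l)) * (2 * (c + 2)) =
    2 * (c + 2) * (c + 1 + mub l + mub l ^ 2) / (c + 1 + mub l) := by field_simp
  rw [this, le_div_iff₀ hA]
  nlinarith [mul_pos hm hm, mul_nonneg (by linarith : 0 ≤ c - 1) hm.le,mul_nonneg (by linarith : 0 ≤ c - 1) (sq_nonneg (mub l)), mul_le_mul_of_nonneg_right hr hA.le]

lemma one_add_ratio_bound {c : ℝ} (hc : 1 ≤ c) {l : ℂ} (hl : l ∈ Sec) :
    (1 + rh l) / (2 * (c + 2)) ≤ ‖1 + phb1 c l 1 / phb c l 1‖ := by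
  refine (phb1_ratio_re hc hl).trans ?_
  have := Complex.re_le_norm (1 + phb1 c l 1 / phb c l 1)
  simpa using this

lemma holo_integral {X : Type*} [MeasurableSpace X] {μ : Measure X} {G : ℂ → X → ℂ} {U : Set ℂ} (hU : IsOpen U)
    {K : ℂ → ℝ} {b : X → ℝ} (hK : ContinuousOn K U) (hb : Integrable b μ) (hb0 : ∀ᵐ x ∂μ, 0 ≤ b x)
    (hmeas : ∀ l ∈ U, AEStronglyMeasurable (G l) μ)
    (hdiff : ∀ᵐ x ∂μ, DifferentiableOn ℂ (fun l => G l x) U)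
    (hdom : ∀ l ∈ U, ∀ᵐ x ∂μ, ‖G l x‖ ≤ K l * b x)
    (hdom' : ∀ᵐ x ∂μ, ∀ l ∈ U, ‖G l x‖ ≤ K l * b x) :
    DifferentiableOn ℂ (fun l => ∫ x, G l x ∂μ) U := by
  intro l0 hl0
  apply DifferentiableAt.differentiableWithinAt
  have h1 : ∀ᶠ l in 𝓝 l0, l ∈ U ∧ K l < K l0 + 1 :=
    Filter.Eventually.and (hU.mem_nhds hl0)
      ((hK.continuousAt (hU.mem_nhds hl0)).eventually (gt_mem_nhds (lt_add_one _)))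
  obtain ⟨r, hr, hball⟩ := Metric.eventually_nhds_iff_ball.1 h1
  set r2 := r / 2
  have hr2 : 0 < r2 := by positivity
  have hcb : ∀ l ∈ Metric.ball l0 r2, ∀ l' ∈ Metric.closedBall l (r2 / 2 + r2 / 4), l' ∈ Metric.ball l0 r := by
    intro l hl l' hl'
    rw [Metric.mem_ball] at *
    rw [Metric.mem_closedBall] at hl'
    have := dist_triangle l' l l0
    have : r2 = r / 2 := rfl
    linarith
  set e := r2 / 2 + r2 / 4
  have he : 0 < e := by positivity
  have hIn : ∀ l ∈ U, Integrable (G l) μ := fun l hl =>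
    (hb.const_mul (K l)).mono' (hmeas l hl) (hdom l hl)
  have hd0 : ∀ᵐ x ∂μ, ∀ l ∈ Metric.ball l0 r2, HasDerivAt (fun l => G l x) (deriv (fun l => G l x) l) l := by
    filter_upwards [hdiff] with x hx l hl
    have : l ∈ U := (hball l (Metric.ball_subset_ball (by simp only [r2]; linarith) hl)).1
    exact (hx.differentiableAt (hU.mem_nhds this)).hasDerivAt
  have := (hasDerivAt_integral_of_dominated_loc_of_deriv_le (μ := μ) (F := G) (x₀ := l0)
    (s := Metric.ball l0 r2) (bound := fun x => (K l0 + 1) * b x / e)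
    (F' := fun l x => deriv (fun l => G l x) l) (Metric.ball_mem_nhds _ hr2) ?_ (hIn l0 hl0) ?_ ?_ ?_ hd0).2
  · exact this.differentiableAt
  · filter_upwards [hU.mem_nhds hl0] with l hl using hmeas l hl
  · -- measurability of derivative
    have hseq : ∀ k : ℕ, l0 + ((r2 / 2 / (k + 1) : ℝ) : ℂ) ∈ U := by
      intro k
      refine (hball _ ?_).1
      rw [Metric.mem_ball, dist_eq_norm, add_sub_cancel_left, Complex.norm_real,
        Real.norm_of_nonneg (by positivity)]
      have : r2 / 2 / ((k : ℝ) + 1) ≤ r2 / 2 := div_le_self (by positivity) (by linarith [Nat.cast_nonneg (α := ℝ) k])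
      have : r2 = r / 2 := rfl
      linarith
    refine aestronglyMeasurable_of_tendsto_ae (u := Filter.atTop) (f := fun (k : ℕ) x =>
      ((r2 / 2 / (k + 1) : ℝ) : ℂ)⁻¹ • (G (l0 + ((r2 / 2 / (k + 1) : ℝ) : ℂ)) x - G l0 x)) ?_ ?_
    · intro k
      simp only [smul_eq_mul]
      exact ((hmeas _ (hseq k)).sub (hmeas _ hl0)).const_mul _
    · filter_upwards [hd0] with x hx
      have := (hx l0 (Metric.mem_ball_self hr2)).tendsto_slope_zero
      refine this.comp ?_
      rw [tendsto_nhdsWithin_iff]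
      constructor
      · have h3 : Filter.Tendsto (fun k : ℕ => r2 / 2 / ((k : ℝ) + 1)) Filter.atTop (𝓝 0) := by
          have := (tendsto_one_div_add_atTop_nhds_zero_nat (𝕜 := ℝ)).const_mul (r2 / 2)
          simpa [div_eq_mul_inv] using this
        exact_mod_cast (Complex.continuous_ofReal.tendsto 0).comp h3
      · refine Filter.Eventually.of_forall fun k => ?_
        have : (r2 / 2 / ((k : ℝ) + 1)) ≠ 0 := by positivity
        simp only [mem_compl_iff, mem_singleton_iff]
        exact_mod_cast this
  · filter_upwards [hdiff, hdom', hb0] with x hx hxd hx0 l hl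
    apply Complex.norm_deriv_le_of_forall_mem_sphere_norm_le he
    · apply DifferentiableOn.diffContOnCl
      refine hx.mono ?_
      intro l' hl'
      rw [closure_ball _ he.ne'] at hl'
      exact (hball l' (hcb l hl l' hl')).1
    · intro l' hl'
      have h4 := hball l' (hcb l hl l' (Metric.sphere_subset_closedBall hl'))
      refine (hxd l' h4.1).trans ?_
      gcongr
      exact h4.2.le
  · exact (hb.const_mul _).div_const _

/-- Exponential/weight bounds for symbols. -/
def BD (W : ℝ → ℝ) (q : ℝ) (m : ℂ → ℝ → ℂ) : Prop :=
  ∃ C > 0, ∃ κ > 0, ∀ l ∈ Sec, ∀ s ∈ Ioc (0 : ℝ) 1,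
    ‖m l s‖ ≤ C * W (rh l) * s ^ q * Real.exp (-(κ * rh l * (1 - s)))

/-- admissible gauge -/
structure Gauge (W : ℝ → ℝ) : Prop where
  pos : ∀ r > 0, 0 < W r
  cont : ContinuousOn W (Ioi 0)

lemma BD.mono {W W' : ℝ → ℝ} {q q' : ℝ} {m : ℂ → ℝ → ℂ} (h : BD W q m)
    (K : ℝ) (hW' : ∀ r > 0, 0 ≤ W' r) (hWW : ∀ r > 0, W r ≤ K * W' r) (hq : q' ≤ q) : BD W' q' m := by
  obtain ⟨C, hC, κ, hκ, hb⟩ := h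
  refine ⟨C * max K 1, by positivity, κ, hκ, fun l hl s hs => (hb l hl s hs).trans ?_⟩
  have hr := rh_pos hl
  have h1 := hW' _ hr
  have h2 := hWW _ hr
  have h3 : W (rh l) ≤ max K 1 * W' (rh l) :=
    h2.trans (mul_le_mul_of_nonneg_right (le_max_left _ _) h1)
  have h4 : s ^ q ≤ s ^ q' := Real.rpow_le_rpow_of_exponent_ge hs.1 hs.2 hq
  have h5 : 0 < s ^ q := Real.rpow_pos_of_pos hs.1 _
  calc C * W (rh l) * s ^ q * Real.exp (-(κ * rh l * (1 - s)))
      ≤ C * (max K 1 * W' (rh l)) * s ^ q * Real.exp (-(κ * rh l * (1 - s))) := by gcongr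
    _ ≤ C * (max K 1 * W' (rh l)) * s ^ q' * Real.exp (-(κ * rh l * (1 - s))) := by gcongr
    _ = _ := by ring

lemma BD.congr {W : ℝ → ℝ} {q : ℝ} {m m' : ℂ → ℝ → ℂ} (h : BD W q m)
    (he : ∀ l ∈ Sec, ∀ s ∈ Ioc (0 : ℝ) 1, m' l s = m l s) : BD W q m' := by
  obtain ⟨C, hC, κ, hκ, hb⟩ := h
  exact ⟨C, hC, κ, hκ, fun l hl s hs => by rw [he l hl s hs]; exact hb l hl s hs⟩

lemma exp_kappa_mono {κ κ' : ℝ} (h : κ' ≤ κ) (l : ℂ) {s : ℝ} (hs : s ≤ 1) :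
    Real.exp (-(κ * rh l * (1 - s))) ≤ Real.exp (-(κ' * rh l * (1 - s))) := by
  have := mul_nonneg (rh_nonneg l) (by linarith : 0 ≤ 1 - s)
  apply Real.exp_le_exp.2
  nlinarith

lemma BD.add {W : ℝ → ℝ} {q : ℝ} {m m' : ℂ → ℝ → ℂ} (h : BD W q m) (h' : BD W q m')
    (hW : ∀ r > 0, 0 ≤ W r) : BD W q (fun l s => m l s + m' l s) := by
  obtain ⟨C, hC, κ, hκ, hb⟩ := h
  obtain ⟨C', hC', κ', hκ', hb'⟩ := h'
  refine ⟨C + C', by positivity, min κ κ', by positivity, fun l hl s hs => ?_⟩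
  have hw := hW _ (rh_pos hl)
  have h5 : 0 < s ^ q := Real.rpow_pos_of_pos hs.1 _
  calc ‖m l s + m' l s‖ ≤ ‖m l s‖ + ‖m' l s‖ := norm_add_le _ _
    _ ≤ C * W (rh l) * s ^ q * Real.exp (-(min κ κ' * rh l * (1 - s))) +
        C' * W (rh l) * s ^ q * Real.exp (-(min κ κ' * rh l * (1 - s))) := by
      refine add_le_add ((hb l hl s hs).trans ?_) ((hb' l hl s hs).trans ?_)
      · gcongr ?_ * ?_
        exact exp_kappa_mono (min_le_left _ _) l hs.2
      · gcongr ?_ * ?_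
        exact exp_kappa_mono (min_le_right _ _) l hs.2
    _ = _ := by ring

lemma BD.lmul {W V : ℝ → ℝ} {q : ℝ} {m : ℂ → ℝ → ℂ} (h : BD W q m) {a : ℂ → ℂ} (K : ℝ)
    (hW : ∀ r > 0, 0 ≤ W r) (hV : ∀ r > 0, 0 ≤ V r) (ha : ∀ l ∈ Sec, ‖a l‖ ≤ K * V (rh l)) :
    BD (fun r => V r * W r) q (fun l s => a l * m l s) := by
  obtain ⟨C, hC, κ, hκ, hb⟩ := h
  refine ⟨max K 1 * C, by positivity, κ, hκ, fun l hl s hs => ?_⟩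
  have hw := hW _ (rh_pos hl)
  have hv := hV _ (rh_pos hl)
  have h5 : 0 < s ^ q := Real.rpow_pos_of_pos hs.1 _
  have h6 : K * V (rh l) ≤ max K 1 * V (rh l) := mul_le_mul_of_nonneg_right (le_max_left _ _) hv
  rw [norm_mul]
  calc ‖a l‖ * ‖m l s‖ ≤ (max K 1 * V (rh l)) * (C * W (rh l) * s ^ q * Real.exp (-(κ * rh l * (1 - s)))) := by
        gcongr
        · exact (ha l hl).trans h6
        · exact hb l hl s hs
    _ = _ := by ring

lemma BD.cmul {W : ℝ → ℝ} {q : ℝ} {m : ℂ → ℝ → ℂ} (h : BD W q m) (a : ℂ)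
    (hW : ∀ r > 0, 0 ≤ W r) : BD W q (fun l s => a * m l s) := by
  have := h.lmul (V := fun _ => 1) (a := fun _ => a) ‖a‖ hW (by simp) (by simp)
  simpa using this

/-- Source class. -/
structure SC (W : ℝ → ℝ) (q : ℝ) (S : ℂ → ℝ → ℂ) : Prop where
  holo : ∀ s ∈ Ioc (0 : ℝ) 1, DifferentiableOn ℂ (fun l => S l s) Sec
  cont : ∀ l ∈ Sec, ContinuousOn (S l) (Ioi 0)
  bd : BD W q S

/-- First order system. -/
def IsSol (r1 r2 : ℝ) (l : ℂ) (Y Y1 S : ℝ → ℂ) : Prop :=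
  ∀ s > (0 : ℝ), HasDerivAt Y (Y1 s / s) s ∧
    HasDerivAt Y1 (((r1 + r2) * Y1 s - r1 * r2 * Y s + l * s ^ 2 * Y s + S s) / s) s

/-- Field class: `m1 = s ∂_s m`. -/
structure FC (W : ℝ → ℝ) (q : ℝ) (m m1 : ℂ → ℝ → ℂ) : Prop where
  holo : ∀ s ∈ Ioc (0 : ℝ) 1, DifferentiableOn ℂ (fun l => m l s) Sec
  holo1 : ∀ s ∈ Ioc (0 : ℝ) 1, DifferentiableOn ℂ (fun l => m1 l s) Sec
  der : ∀ l ∈ Sec, ∀ s > 0, HasDerivAt (m l) (m1 l s / s) s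
  cont1 : ∀ l ∈ Sec, ContinuousOn (m1 l) (Ioi 0)
  bd : BD W q m
  bd1 : BD (fun r => (1 + r) * W r) q m1

lemma FC.sc {W : ℝ → ℝ} {q : ℝ} {m m1 : ℂ → ℝ → ℂ} (h : FC W q m m1) : SC W q m :=
  ⟨h.holo, fun l hl s hs => (h.der l hl s hs).continuousAt.continuousWithinAt, h.bd⟩

lemma FC.add {W : ℝ → ℝ} {q : ℝ} {m m1 m' m1' : ℂ → ℝ → ℂ} (hW : ∀ r > 0, 0 ≤ W r)
    (h : FC W q m m1) (h' : FC W q m' m1') :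
    FC W q (fun l s => m l s + m' l s) (fun l s => m1 l s + m1' l s) where
  holo s hs := (h.holo s hs).add (h'.holo s hs)
  holo1 s hs := (h.holo1 s hs).add (h'.holo1 s hs)
  der l hl s hs := ((h.der l hl s hs).add (h'.der l hl s hs)).congr_deriv (by ring)
  cont1 l hl := (h.cont1 l hl).add (h'.cont1 l hl)
  bd := h.bd.add h'.bd hW
  bd1 := h.bd1.add h'.bd1 (fun r hr => mul_nonneg (by linarith) (hW r hr))

lemma FC.lmul {W V : ℝ → ℝ} {q : ℝ} {m m1 : ℂ → ℝ → ℂ} (hW : ∀ r > 0, 0 ≤ W r) (hV : ∀ r > 0, 0 ≤ V r)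
    (h : FC W q m m1) {a : ℂ → ℂ} (hah : DifferentiableOn ℂ a Sec) (K : ℝ)
    (ha : ∀ l ∈ Sec, ‖a l‖ ≤ K * V (rh l)) :
    FC (fun r => V r * W r) q (fun l s => a l * m l s) (fun l s => a l * m1 l s) where
  holo s hs := hah.mul (h.holo s hs)
  holo1 s hs := hah.mul (h.holo1 s hs)
  der l hl s hs := ((h.der l hl s hs).const_mul (a l)).congr_deriv (by ring)
  cont1 l hl := continuousOn_const.mul (h.cont1 l hl)
  bd := h.bd.lmul K hW hV ha
  bd1 := by
    have := h.bd1.lmul K (fun r hr => mul_nonneg (by linarith) (hW r hr)) hV ha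
    simpa only [mul_left_comm] using this

lemma FC.mono {W W' : ℝ → ℝ} {q q' : ℝ} {m m1 : ℂ → ℝ → ℂ} (h : FC W q m m1)
    (K : ℝ) (hW' : ∀ r > 0, 0 ≤ W' r) (hWW : ∀ r > 0, W r ≤ K * W' r) (hq : q' ≤ q) :
    FC W' q' m m1 where
  holo := h.holo
  holo1 := h.holo1
  der := h.der
  cont1 := h.cont1
  bd := h.bd.mono K hW' hWW hq
  bd1 := h.bd1.mono K (fun r hr => mul_nonneg (by linarith) (hW' r hr))
    (fun r hr => by
      have := mul_le_mul_of_nonneg_left (hWW r hr) (by linarith : 0 ≤ 1 + r)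
      linarith) hq

lemma SC.add {W : ℝ → ℝ} {q : ℝ} {m m' : ℂ → ℝ → ℂ} (hW : ∀ r > 0, 0 ≤ W r)
    (h : SC W q m) (h' : SC W q m') : SC W q (fun l s => m l s + m' l s) where
  holo s hs := (h.holo s hs).add (h'.holo s hs)
  cont l hl := (h.cont l hl).add (h'.cont l hl)
  bd := h.bd.add h'.bd hW

lemma SC.cmul {W : ℝ → ℝ} {q : ℝ} {m : ℂ → ℝ → ℂ} (hW : ∀ r > 0, 0 ≤ W r)
    (h : SC W q m) (a : ℂ) : SC W q (fun l s => a * m l s) where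
  holo s hs := (h.holo s hs).const_mul a
  cont l hl := continuousOn_const.mul (h.cont l hl)
  bd := h.bd.cmul a hW

lemma SC.mono {W W' : ℝ → ℝ} {q q' : ℝ} {m : ℂ → ℝ → ℂ} (h : SC W q m)
    (K : ℝ) (hW' : ∀ r > 0, 0 ≤ W' r) (hWW : ∀ r > 0, W r ≤ K * W' r) (hq : q' ≤ q) :
    SC W' q' m := ⟨h.holo, h.cont, h.bd.mono K hW' hWW hq⟩

lemma IsSol.add {r1 r2 : ℝ} {l : ℂ} {Y Y1 S Z Z1 T : ℝ → ℂ} (h : IsSol r1 r2 l Y Y1 S)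
    (h' : IsSol r1 r2 l Z Z1 T) :
    IsSol r1 r2 l (fun s => Y s + Z s) (fun s => Y1 s + Z1 s) (fun s => S s + T s) := fun s hs =>
  ⟨((h s hs).1.add (h' s hs).1).congr_deriv (by ring),
   ((h s hs).2.add (h' s hs).2).congr_deriv (by ring)⟩

lemma IsSol.cmul {r1 r2 : ℝ} {l : ℂ} {Y Y1 S : ℝ → ℂ} (h : IsSol r1 r2 l Y Y1 S) (a : ℂ) :
    IsSol r1 r2 l (fun s => a * Y s) (fun s => a * Y1 s) (fun s => a * S s) := fun s hs =>
  ⟨((h s hs).1.const_mul a).congr_deriv (by ring), ((h s hs).2.const_mul a).congr_deriv (by ring)⟩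

def cO (r1 r2 : ℝ) : ℝ := 1 + r1 - r2
/-- integrand of J -/
def jin (r1 r2 : ℝ) (S : ℂ → ℝ → ℂ) (l : ℂ) (σ : ℝ) : ℂ :=
  ((σ ^ (-1 - r2) : ℝ) : ℂ) * phb (cO r1 r2) l σ * S l σ
def Jb (r1 r2 : ℝ) (S : ℂ → ℝ → ℂ) (l : ℂ) (r : ℝ) : ℂ := ∫ σ in (0 : ℝ)..r, jin r1 r2 S l σ
def yin (r1 r2 : ℝ) (S : ℂ → ℝ → ℂ) (l : ℂ) (r : ℝ) : ℂ :=
  ((r ^ (-cO r1 r2) : ℝ) : ℂ) * ((phb (cO r1 r2) l r)⁻¹) ^ 2 * Jb r1 r2 S l r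
def Yb (r1 r2 : ℝ) (S : ℂ → ℝ → ℂ) (l : ℂ) (s : ℝ) : ℂ :=
  -(((s ^ r1 : ℝ) : ℂ) * phb (cO r1 r2) l s * ∫ r in s..1, yin r1 r2 S l r)
def Yb1 (r1 r2 : ℝ) (S : ℂ → ℝ → ℂ) (l : ℂ) (s : ℝ) : ℂ :=
  (r1 + phb1 (cO r1 r2) l s / phb (cO r1 r2) l s) * Yb r1 r2 S l s +
    ((s ^ r2 : ℝ) : ℂ) * (phb (cO r1 r2) l s)⁻¹ * Jb r1 r2 S l s

lemma phb_cont {c : ℝ} (hc : 1 ≤ c) (l : ℂ) : Continuous (phb c l) :=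
  continuous_iff_continuousAt.2 fun s => (phb_deriv hc l s).continuousAt

lemma jin_cont {r1 r2 : ℝ} (hr : r2 ≤ r1) {W : ℝ → ℝ} {q : ℝ} {S : ℂ → ℝ → ℂ}
    (h : SC W q S) {l : ℂ} (hl : l ∈ Sec) : ContinuousOn (jin r1 r2 S l) (Ioi 0) := by
  have hc : 1 ≤ cO r1 r2 := by unfold cO; linarith
  have h1 : ContinuousOn (fun σ : ℝ => σ ^ (-1 - r2)) (Ioi 0) := fun s hs =>
    (Real.continuousAt_rpow_const s _ (Or.inl (ne_of_gt hs))).continuousWithinAt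
  exact ((Complex.continuous_ofReal.comp_continuousOn h1).mul (phb_cont hc l).continuousOn).mul
    (h.cont l hl)

lemma jin_bound {r1 r2 : ℝ} (hr : r2 ≤ r1) {W : ℝ → ℝ} {q : ℝ} (hq : r2 + 1 ≤ q) {S : ℂ → ℝ → ℂ}
    {l : ℂ} (hl : l ∈ Sec) {C κ : ℝ} (hC : 0 ≤ C) (hκ : 0 ≤ κ) (hW : 0 ≤ W (rh l))
    (hb : ∀ s ∈ Ioc (0 : ℝ) 1, ‖S l s‖ ≤ C * W (rh l) * s ^ q * Real.exp (-(κ * rh l * (1 - s))))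
    {r σ : ℝ} (hr1 : r ≤ 1) (h0 : 0 < σ) (hσ : σ ≤ r) :
    ‖jin r1 r2 S l σ‖ ≤ C * W (rh l) * r ^ (q - r2 - 1) * Real.exp (-(κ * rh l * (1 - r))) *
      ‖phb (cO r1 r2) l r‖ := by
  have hc : 1 ≤ cO r1 r2 := by unfold cO; linarith
  have hr0 : 0 < r := h0.trans_le hσ
  rw [jin, norm_mul, norm_mul, Complex.norm_real, Real.norm_of_nonneg (by positivity)]
  have h1 := hb σ ⟨h0, hσ.trans hr1⟩
  have h2 := phb_mono hc hl h0.le hσ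
  have h3 : Real.exp (-(κ * rh l * (1 - σ))) ≤ Real.exp (-(κ * rh l * (1 - r))) := by
    apply Real.exp_le_exp.2
    have := mul_nonneg hκ (rh_nonneg l)
    nlinarith
  have h4 : σ ^ (-1 - r2) * σ ^ q = σ ^ (q - r2 - 1) := by
    rw [← Real.rpow_add h0]; congr 1; ring
  have h5 : σ ^ (q - r2 - 1) ≤ r ^ (q - r2 - 1) :=
    Real.rpow_le_rpow h0.le hσ (by linarith)
  calc σ ^ (-1 - r2) * ‖phb (cO r1 r2) l σ‖ * ‖S l σ‖
      ≤ σ ^ (-1 - r2) * ‖phb (cO r1 r2) l r‖ * (C * W (rh l) * σ ^ q * Real.exp (-(κ * rh l * (1 - r)))) := by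
        gcongr
        exact h1.trans (by gcongr)
    _ = C * W (rh l) * (σ ^ (-1 - r2) * σ ^ q) * Real.exp (-(κ * rh l * (1 - r))) * ‖phb (cO r1 r2) l r‖ := by ring
    _ ≤ _ := by rw [h4]; gcongr

lemma jin_int {r1 r2 : ℝ} (hr : r2 ≤ r1) {W : ℝ → ℝ} (hW : ∀ r > 0, 0 ≤ W r) {q : ℝ} (hq : r2 + 1 ≤ q)
    {S : ℂ → ℝ → ℂ} (h : SC W q S) {l : ℂ} (hl : l ∈ Sec) {r : ℝ} (hr0 : 0 < r) :
    IntervalIntegrable (jin r1 r2 S l) volume 0 r := by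
  obtain ⟨C, hC, κ, hκ, hb⟩ := h.bd
  have hcon := jin_cont hr h hl
  have h1 : IntervalIntegrable (jin r1 r2 S l) volume 0 1 := by
    rw [intervalIntegrable_iff_integrableOn_Ioc_of_le zero_le_one]
    refine Integrable.of_bound ?_ (C * W (rh l) * (1:ℝ) ^ (q - r2 - 1) * Real.exp (-(κ * rh l * (1 - 1))) *
      ‖phb (cO r1 r2) l 1‖) ?_
    · exact (hcon.mono Ioc_subset_Ioi_self).aestronglyMeasurable measurableSet_Ioc
    · refine (ae_restrict_iff' measurableSet_Ioc).2 (Filter.Eventually.of_forall fun σ hσ => ?_)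
      exact jin_bound hr hq hl hC.le hκ.le (hW _ (rh_pos hl)) (hb l hl) le_rfl hσ.1 hσ.2
  refine h1.trans (ContinuousOn.intervalIntegrable (hcon.mono ?_))
  intro x hx
  have : min 1 r ≤ x := hx.1
  exact lt_of_lt_of_le (lt_min one_pos hr0) this

lemma Jb_deriv {r1 r2 : ℝ} (hr : r2 ≤ r1) {W : ℝ → ℝ} (hW : ∀ r > 0, 0 ≤ W r) {q : ℝ} (hq : r2 + 1 ≤ q)
    {S : ℂ → ℝ → ℂ} (h : SC W q S) {l : ℂ} (hl : l ∈ Sec) {r : ℝ} (hr0 : 0 < r) :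
    HasDerivAt (Jb r1 r2 S l) (jin r1 r2 S l r) r := by
  have hcon := jin_cont hr h hl
  refine intervalIntegral.integral_hasDerivAt_right (jin_int hr hW hq h hl hr0) ?_
    (hcon.continuousAt (Ioi_mem_nhds hr0))
  exact hcon.stronglyMeasurableAtFilter isOpen_Ioi r hr0

lemma Jb_bound {r1 r2 : ℝ} (hr : r2 ≤ r1) {W : ℝ → ℝ} {q : ℝ} (hq : r2 + 1 ≤ q) {S : ℂ → ℝ → ℂ}
    {l : ℂ} (hl : l ∈ Sec) {C κ : ℝ} (hC : 0 ≤ C) (hκ : 0 ≤ κ) (hW : 0 ≤ W (rh l))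
    (hb : ∀ s ∈ Ioc (0 : ℝ) 1, ‖S l s‖ ≤ C * W (rh l) * s ^ q * Real.exp (-(κ * rh l * (1 - s))))
    {r : ℝ} (hr0 : 0 < r) (hr1 : r ≤ 1) :
    ‖Jb r1 r2 S l r‖ ≤ C * W (rh l) * r ^ (q - r2) * Real.exp (-(κ * rh l * (1 - r))) *
      ‖phb (cO r1 r2) l r‖ := by
  have := intervalIntegral.norm_integral_le_of_norm_le_const (a := 0) (b := r) (f := jin r1 r2 S l)
    (C := C * W (rh l) * r ^ (q - r2 - 1) * Real.exp (-(κ * rh l * (1 - r))) *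
      ‖phb (cO r1 r2) l r‖) ?_
  · refine this.trans (le_of_eq ?_)
    rw [sub_zero, abs_of_pos hr0, Real.rpow_sub_one hr0.ne']
    field_simp
  · intro σ hσ
    rw [uIoc_of_le hr0.le] at hσ
    exact jin_bound hr hq hl hC hκ hW hb hr1 hσ.1 hσ.2

lemma yin_cont {r1 r2 : ℝ} (hr : r2 ≤ r1) {W : ℝ → ℝ} (hW : ∀ r > 0, 0 ≤ W r) {q : ℝ} (hq : r2 + 1 ≤ q)
    {S : ℂ → ℝ → ℂ} (h : SC W q S) {l : ℂ} (hl : l ∈ Sec) : ContinuousOn (yin r1 r2 S l) (Ioi 0) := by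
  have hc : 1 ≤ cO r1 r2 := by unfold cO; linarith
  intro s hs
  have hs : 0 < s := hs
  apply ContinuousAt.continuousWithinAt
  have h1 : ContinuousAt (fun σ : ℝ => ((σ ^ (-cO r1 r2) : ℝ) : ℂ)) s :=
    Complex.continuous_ofReal.continuousAt.comp (Real.continuousAt_rpow_const s _ (Or.inl hs.ne'))
  exact (h1.mul (((phb_cont hc l).continuousAt.inv₀ (phb_ne hc hl hs.le)).pow 2)).mul
    (Jb_deriv hr hW hq h hl hs).continuousAt

lemma Yb_isSol {r1 r2 : ℝ} (hr : r2 ≤ r1) {W : ℝ → ℝ} (hW : ∀ r > 0, 0 ≤ W r) {q : ℝ} (hq : r2 + 1 ≤ q)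
    {S : ℂ → ℝ → ℂ} (h : SC W q S) {l : ℂ} (hl : l ∈ Sec) :
    IsSol r1 r2 l (Yb r1 r2 S l) (Yb1 r1 r2 S l) (S l) := by
  have hc : 1 ≤ cO r1 r2 := by unfold cO; linarith
  set c := cO r1 r2 with hcd
  intro s hs
  have hs0 : (s : ℂ) ≠ 0 := by exact_mod_cast hs.ne'
  have hφ := phb_deriv hc l s
  have hφ0 := phb_ne hc hl hs.le
  have hψ := psb_deriv hc l s
  have hJ := Jb_deriv hr hW hq h hl hs
  have hycon := yin_cont hr hW hq h hl
  have hI : HasDerivAt (fun s => ∫ r in s..1, yin r1 r2 S l r) (-yin r1 r2 S l s) s := by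
    refine intervalIntegral.integral_hasDerivAt_left ?_ ?_ (hycon.continuousAt (Ioi_mem_nhds hs))
    · refine ContinuousOn.intervalIntegrable (hycon.mono ?_)
      intro x hx
      exact lt_of_lt_of_le (lt_min hs one_pos) hx.1
    · exact hycon.stronglyMeasurableAtFilter isOpen_Ioi s hs
  have hp : ∀ a : ℝ, HasDerivAt (fun s : ℝ => ((s ^ a : ℝ) : ℂ)) (a * ((s ^ a : ℝ) : ℂ) / s) s := by
    intro a
    have h1 := (Real.hasDerivAt_rpow_const (x := s) (p := a) (Or.inl hs.ne')).ofReal_comp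
    refine h1.congr_deriv ?_
    rw [Real.rpow_sub_one hs.ne']; push_cast; ring
  have hY : HasDerivAt (Yb r1 r2 S l) (Yb1 r1 r2 S l s / s) s := by
    refine (((hp r1).mul hφ).mul hI).neg.congr_deriv ?_
    have e1 : ((s ^ r1 : ℝ) : ℂ) * ((s ^ (-c) : ℝ) : ℂ) * s = ((s ^ r2 : ℝ) : ℂ) := by
      rw [← Complex.ofReal_mul, ← Complex.ofReal_mul]
      congr 1
      rw [← Real.rpow_add hs, ← Real.rpow_add_one hs.ne']
      congr 1; rw [hcd, cO]; ring
    simp only [Yb1, Yb, yin, phb1, ← hcd, Pi.mul_apply]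
    rw [← e1]
    field_simp
    ring
  refine ⟨hY, ?_⟩
  have hφ1 : HasDerivAt (phb1 c l) (((1 - c) * phb1 c l s + l * s ^ 2 * phb c l s) / s) s := by
    have h1 : HasDerivAt (fun s : ℝ => (s : ℂ) ^ 2) (2 * s) s := by
      have := arg_deriv 1 s
      simpa using this
    refine (h1.mul hψ).congr_deriv ?_
    rw [← psb_ode hc l s |> fun h => (show (l * s ^ 2 * phb c l s = s ^ 2 * (s * psb' c l s + (c + 1) * psb c l s)) by rw [h]; ring).symm]
    simp only [phb1]
    field_simp
    ring
  have hU := hφ1.div hφ hφ0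
  have hV := ((hp r2).mul (hφ.inv hφ0)).mul hJ
  have e2 : ((s ^ r2 : ℝ) : ℂ) * jin r1 r2 S l s = phb c l s * S l s / s := by
    have : ((s ^ r2 : ℝ) : ℂ) * ((s ^ (-1 - r2) : ℝ) : ℂ) = (s : ℂ)⁻¹ := by
      rw [← Complex.ofReal_mul, ← Complex.ofReal_inv]
      congr 1
      rw [← Real.rpow_add hs, ← Real.rpow_neg_one]
      congr 1; ring
    rw [jin, ← hcd]
    linear_combination phb c l s * S l s * this
  refine (((hU.const_add (r1 : ℂ)).mul hY).add hV).congr_deriv ?_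
  have e3 : (c : ℂ) = 1 + r1 - r2 := by rw [hcd, cO]; push_cast; ring
  have e4 : ((s ^ r2 : ℝ) : ℂ) * (phb c l s)⁻¹ * jin r1 r2 S l s = S l s / s := by
    have : ((s ^ r2 : ℝ) : ℂ) * (phb c l s)⁻¹ * jin r1 r2 S l s =
      (phb c l s)⁻¹ * (((s ^ r2 : ℝ) : ℂ) * jin r1 r2 S l s) := by ring
    rw [this, e2]; field_simp
  simp only [Pi.mul_apply, Pi.inv_apply, Pi.div_apply] at *
  rw [e4]
  simp only [Yb1, ← hcd]
  have e5 : (s : ℂ) * psb c l s = phb1 c l s / s := by rw [phb1]; field_simp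
  rw [e5, e3]
  generalize Yb r1 r2 S l s = Y
  generalize Jb r1 r2 S l s = J
  generalize phb1 c l s = P1
  generalize S l s = SS
  generalize ((s ^ r2 : ℝ) : ℂ) = X
  field_simp
  ring

lemma int_exp_bound {ρ : ℝ} (hρ : 0 < ρ) {s : ℝ} (hs : s ≤ 1) :
    ∫ r in s..1, Real.exp (-(ρ * (r - s) / 8)) ≤ 8 / ρ := by
  have hd : ∀ r : ℝ, HasDerivAt (fun r => -(8 / ρ) * Real.exp (-(ρ * (r - s) / 8))) (Real.exp (-(ρ * (r - s) / 8))) r := by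
    intro r
    have h1 : HasDerivAt (fun r => -(ρ * (r - s) / 8)) (-(ρ / 8)) r := by
      have := ((((hasDerivAt_id r).sub_const s).const_mul ρ).div_const 8).fun_neg
      simpa using this
    refine (h1.exp.const_mul (-(8 / ρ))).congr_deriv ?_
    field_simp
  rw [intervalIntegral.integral_eq_sub_of_hasDerivAt (fun r _ => hd r)
    (Continuous.intervalIntegrable (by fun_prop) _ _)]
  have := Real.exp_pos (-(ρ * (1 - s) / 8))
  have h8 : 0 < 8 / ρ := by positivity
  simp
  nlinarith

lemma one_add_mul_exp {κ ρ : ℝ} (hκ : 0 < κ) (hρ : 0 ≤ ρ) :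
    (1 + ρ) * Real.exp (-(κ * ρ)) ≤ 1 + 1 / κ := by
  have h1 := Real.add_one_le_exp (κ * ρ)
  rw [Real.exp_neg, ← div_eq_mul_inv, div_le_iff₀ (Real.exp_pos _)]
  have h2 : (1 + 1 / κ) * (κ * ρ + 1) = 1 + ρ + κ * ρ + 1 / κ := by field_simp; ring
  have h3 : (1 + 1 / κ) * (κ * ρ + 1) ≤ (1 + 1 / κ) * Real.exp (κ * ρ) := by gcongr
  have : 0 ≤ κ * ρ := by positivity
  have : 0 < 1 / κ := by positivity
  linarith

lemma int_weight_bound {κ ρ : ℝ} (hκ : 0 < κ) (hρ : 0 < ρ) {s : ℝ} (hs0 : 0 < s) (hs : s ≤ 1) :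
    (∫ r in s..1, r ^ (-(3 / 4) : ℝ) * Real.exp (-(ρ * (r - s) / 8))) * Real.exp (-(κ * ρ * (1 - s))) ≤
      (18 + 4 * (1 + 4 / κ)) / (1 + ρ) * Real.exp (-(κ / 2 * ρ * (1 - s))) := by
  have hcon : ContinuousOn (fun r : ℝ => r ^ (-(3 / 4) : ℝ)) (Icc s 1) := fun x hx =>
    (Real.continuousAt_rpow_const x _ (Or.inl (hs0.trans_le hx.1).ne')).continuousWithinAt
  have hIn : IntervalIntegrable (fun r : ℝ => r ^ (-(3 / 4) : ℝ) * Real.exp (-(ρ * (r - s) / 8))) volume s 1 := by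
    apply ContinuousOn.intervalIntegrable
    rw [uIcc_of_le hs]
    exact hcon.mul (by fun_prop)
  have hk : 0 < 4 / κ := by positivity
  rw [div_mul_eq_mul_div, le_div_iff₀ (by positivity)]
  have hE : Real.exp (-(κ * ρ * (1 - s))) = Real.exp (-(κ / 2 * ρ * (1 - s))) * Real.exp (-(κ / 2 * ρ * (1 - s))) := by
    rw [← Real.exp_add]; congr 1; ring
  have hE1 : Real.exp (-(κ / 2 * ρ * (1 - s))) ≤ 1 := by
    rw [Real.exp_le_one_iff]
    have : 0 ≤ κ / 2 * ρ * (1 - s) := by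
      have : 0 ≤ 1 - s := by linarith
      positivity
    linarith
  rcases le_or_gt (1 / 2) s with h | h
  · have h1 : ∫ r in s..1, r ^ (-(3 / 4) : ℝ) * Real.exp (-(ρ * (r - s) / 8)) ≤
        2 * ∫ r in s..1, Real.exp (-(ρ * (r - s) / 8)) := by
      rw [← intervalIntegral.integral_const_mul]
      apply intervalIntegral.integral_mono_on hs hIn (Continuous.intervalIntegrable (by fun_prop) _ _)
      intro x hx
      have hx0 : 0 < x := hs0.trans_le hx.1
      gcongr
      calc x ^ (-(3 / 4) : ℝ) ≤ (1 / 2) ^ (-(3 / 4) : ℝ) :=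
            Real.rpow_le_rpow_of_nonpos (by norm_num) (h.trans hx.1) (by norm_num)
        _ ≤ (1 / 2) ^ (-1 : ℝ) := Real.rpow_le_rpow_of_exponent_ge (by norm_num) (by norm_num) (by norm_num)
        _ = 2 := by rw [Real.rpow_neg_one]; norm_num
    have h2 := int_exp_bound hρ hs
    have h3 : ∫ r in s..1, Real.exp (-(ρ * (r - s) / 8)) ≤ 1 := by
      calc ∫ r in s..1, Real.exp (-(ρ * (r - s) / 8)) ≤ ∫ r in s..1, (1 : ℝ) := by
            apply intervalIntegral.integral_mono_on hs (Continuous.intervalIntegrable (by fun_prop) _ _) (by simp)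
            intro x hx
            rw [Real.exp_le_one_iff]
            have : 0 ≤ ρ * (x - s) := mul_nonneg hρ.le (by linarith [hx.1])
            linarith
        _ ≤ 1 := by simp; linarith
    set X := ∫ r in s..1, Real.exp (-(ρ * (r - s) / 8))
    have hX : X * (1 + ρ) ≤ 9 := by
      have : X * ρ ≤ 8 := by rwa [le_div_iff₀ hρ] at h2
      linarith
    have hI0 : 0 ≤ X := by
      apply intervalIntegral.integral_nonneg hs; intro x _; positivity
    rw [hE]
    set E := Real.exp (-(κ / 2 * ρ * (1 - s)))
    have hE0 : 0 < E := Real.exp_pos _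
    set I := ∫ r in s..1, r ^ (-(3 / 4) : ℝ) * Real.exp (-(ρ * (r - s) / 8))
    calc I * (E * E) * (1 + ρ) ≤ (2 * X) * (E * 1) * (1 + ρ) := by gcongr
      _ = 2 * (X * (1 + ρ)) * E := by ring
      _ ≤ 2 * 9 * E := by gcongr
      _ ≤ _ := by gcongr; linarith
  · have h1 : ∫ r in s..1, r ^ (-(3 / 4) : ℝ) * Real.exp (-(ρ * (r - s) / 8)) ≤ 4 := by
      calc ∫ r in s..1, r ^ (-(3 / 4) : ℝ) * Real.exp (-(ρ * (r - s) / 8))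
          ≤ ∫ r in s..1, r ^ (-(3 / 4) : ℝ) := by
            apply intervalIntegral.integral_mono_on hs hIn
            · apply ContinuousOn.intervalIntegrable; rwa [uIcc_of_le hs]
            intro x hx
            have hx0 : 0 < x := hs0.trans_le hx.1
            have : Real.exp (-(ρ * (x - s) / 8)) ≤ 1 := by
              rw [Real.exp_le_one_iff]
              have : 0 ≤ ρ * (x - s) := mul_nonneg hρ.le (by linarith [hx.1])
              linarith
            have hp : 0 < x ^ (-(3 / 4) : ℝ) := by positivity
            nlinarith
        _ ≤ 4 := by
            rw [integral_rpow (Or.inl (by norm_num))]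
            have : (0:ℝ) < s ^ (-(3 / 4) + 1 : ℝ) := by positivity
            rw [Real.one_rpow]
            norm_num at this ⊢
            linarith
    have h2 := one_add_mul_exp (κ := κ / 4) (by positivity) hρ.le
    have h3 : Real.exp (-(κ / 2 * ρ * (1 - s))) ≤ Real.exp (-(κ / 4 * ρ)) := by
      apply Real.exp_le_exp.2
      have : 0 < κ * ρ := by positivity
      nlinarith
    rw [hE]
    set E := Real.exp (-(κ / 2 * ρ * (1 - s)))
    have hE0 : 0 < E := Real.exp_pos _
    set I := ∫ r in s..1, r ^ (-(3 / 4) : ℝ) * Real.exp (-(ρ * (r - s) / 8))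
    calc I * (E * E) * (1 + ρ) ≤ 4 * (E * Real.exp (-(κ / 4 * ρ))) * (1 + ρ) := by gcongr
      _ = 4 * E * ((1 + ρ) * Real.exp (-(κ / 4 * ρ))) := by ring
      _ ≤ 4 * E * (1 + 1 / (κ / 4)) := by gcongr
      _ ≤ _ := by
        have : 1 / (κ / 4) = 4 / κ := by field_simp
        rw [this]
        nlinarith

lemma Yb_bound {r1 r2 : ℝ} (hr : r2 ≤ r1) {W : ℝ → ℝ} (hW : ∀ r > 0, 0 ≤ W r) {q p : ℝ} (hq : r2 + 1 ≤ q)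
    (hp1 : p ≤ r1) (hpq : p + 1 / 4 ≤ q) {S : ℂ → ℝ → ℂ} (h : SC W q S) {C κ : ℝ} (hC : 0 < C) (hκ : 0 < κ)
    (hκ8 : κ ≤ 1 / 8)
    (hb : ∀ l ∈ Sec, ∀ s ∈ Ioc (0 : ℝ) 1, ‖S l s‖ ≤ C * W (rh l) * s ^ q * Real.exp (-(κ * rh l * (1 - s))))
    {l : ℂ} (hl : l ∈ Sec) {s : ℝ} (hs0 : 0 < s) (hs1 : s ≤ 1) :
    ‖Yb r1 r2 S l s‖ ≤ C * 2 ^ (cO r1 r2 + 1) * (18 + 4 * (1 + 4 / κ)) * (W (rh l) / (1 + rh l)) * s ^ p *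
      Real.exp (-(κ / 2 * rh l * (1 - s))) := by
  have hc : 1 ≤ cO r1 r2 := by unfold cO; linarith
  have hρ := rh_pos hl
  have hw := hW _ hρ
  set c := cO r1 r2 with hcd
  set ρ := rh l
  set A := C * 2 ^ (c + 1) * W ρ * s ^ p * Real.exp (-(κ * ρ * (1 - s))) with hA
  have hA0 : 0 ≤ A := by positivity
  have hφs := phb_ge_one hc hl hs0.le
  have key : ∀ r ∈ Icc s 1, s ^ r1 * ‖phb c l s‖ * ‖yin r1 r2 S l r‖ ≤
      A * (r ^ (-(3 / 4) : ℝ) * Real.exp (-(ρ * (r - s) / 8))) := by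
    intro r hr'
    have hr0 : 0 < r := hs0.trans_le hr'.1
    have h1 := Jb_bound hr hq hl hC.le hκ.le hw (hb l hl) hr0 hr'.2
    have h2 := phb_decay hc hl hs0.le hr'.1
    have hφr := phb_ge_one hc hl hr0.le
    rw [← hcd] at h1
    rw [yin, norm_mul, norm_mul, norm_pow, norm_inv, Complex.norm_real, Real.norm_of_nonneg (by positivity), ← hcd]
    set a := ‖phb c l s‖
    set b := ‖phb c l r‖
    have hb0 : 0 < b := by linarith
    have e1 : s ^ r1 * r ^ (-c) * r ^ (q - r2) ≤ s ^ p * r ^ (-(3 / 4) : ℝ) := by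
      have e2 : s ^ r1 = s ^ p * s ^ (r1 - p) := by rw [← Real.rpow_add hs0]; congr 1; ring
      have e3 : s ^ (r1 - p) ≤ r ^ (r1 - p) := Real.rpow_le_rpow hs0.le hr'.1 (by linarith)
      have e4 : r ^ (r1 - p) * r ^ (-c) * r ^ (q - r2) = r ^ (q - p - 1) := by
        rw [← Real.rpow_add hr0, ← Real.rpow_add hr0]; congr 1; rw [hcd, cO]; ring
      have e5 : r ^ (q - p - 1) ≤ r ^ (-(3 / 4) : ℝ) :=
        Real.rpow_le_rpow_of_exponent_ge hr0 hr'.2 (by linarith)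
      rw [e2]
      calc s ^ p * s ^ (r1 - p) * r ^ (-c) * r ^ (q - r2) ≤ s ^ p * r ^ (r1 - p) * r ^ (-c) * r ^ (q - r2) := by gcongr
        _ = s ^ p * (r ^ (r1 - p) * r ^ (-c) * r ^ (q - r2)) := by ring
        _ ≤ _ := by rw [e4]; gcongr
    have e6 : Real.exp (-(ρ * (r - s) / 4)) * Real.exp (-(κ * ρ * (1 - r))) ≤
        Real.exp (-(κ * ρ * (1 - s))) * Real.exp (-(ρ * (r - s) / 8)) := by
      rw [← Real.exp_add, ← Real.exp_add]
      apply Real.exp_le_exp.2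
      have : 0 ≤ ρ * (r - s) := mul_nonneg hρ.le (by linarith [hr'.1])
      nlinarith
    calc s ^ r1 * a * (r ^ (-c) * b⁻¹ ^ 2 * ‖Jb r1 r2 S l r‖)
        ≤ s ^ r1 * (2 ^ (c + 1) * Real.exp (-(ρ * (r - s) / 4)) * b) * (r ^ (-c) * b⁻¹ ^ 2 *
          (C * W ρ * r ^ (q - r2) * Real.exp (-(κ * ρ * (1 - r))) * b)) := by gcongr
      _ = C * 2 ^ (c + 1) * W ρ * (s ^ r1 * r ^ (-c) * r ^ (q - r2)) *
          (Real.exp (-(ρ * (r - s) / 4)) * Real.exp (-(κ * ρ * (1 - r)))) := by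
            field_simp
      _ ≤ C * 2 ^ (c + 1) * W ρ * (s ^ p * r ^ (-(3 / 4) : ℝ)) *
          (Real.exp (-(κ * ρ * (1 - s))) * Real.exp (-(ρ * (r - s) / 8))) := by gcongr
      _ = _ := by rw [hA]; ring
  have hycon := yin_cont hr hW hq h hl
  have hsub : Icc s 1 ⊆ Ioi 0 := fun x hx => hs0.trans_le hx.1
  have hcon : ContinuousOn (fun r : ℝ => r ^ (-(3 / 4) : ℝ)) (Icc s 1) := fun x hx =>
    (Real.continuousAt_rpow_const x _ (Or.inl (hs0.trans_le hx.1).ne')).continuousWithinAt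
  have hIn : IntervalIntegrable (fun r : ℝ => r ^ (-(3 / 4) : ℝ) * Real.exp (-(ρ * (r - s) / 8))) volume s 1 := by
    apply ContinuousOn.intervalIntegrable
    rw [uIcc_of_le hs1]
    exact hcon.mul (by fun_prop)
  have h3 : ‖Yb r1 r2 S l s‖ ≤ A * ∫ r in s..1, r ^ (-(3 / 4) : ℝ) * Real.exp (-(ρ * (r - s) / 8)) := by
    rw [Yb, norm_neg, norm_mul, norm_mul, Complex.norm_real, Real.norm_of_nonneg (by positivity), ← hcd]
    calc s ^ r1 * ‖phb c l s‖ * ‖∫ r in s..1, yin r1 r2 S l r‖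
        ≤ s ^ r1 * ‖phb c l s‖ * ∫ r in s..1, ‖yin r1 r2 S l r‖ := by
          gcongr
          exact intervalIntegral.norm_integral_le_integral_norm hs1
      _ = ∫ r in s..1, s ^ r1 * ‖phb c l s‖ * ‖yin r1 r2 S l r‖ := by
          rw [intervalIntegral.integral_const_mul]
      _ ≤ ∫ r in s..1, A * (r ^ (-(3 / 4) : ℝ) * Real.exp (-(ρ * (r - s) / 8))) := by
          apply intervalIntegral.integral_mono_on hs1 _ (hIn.const_mul A) key
          apply ContinuousOn.intervalIntegrable
          rw [uIcc_of_le hs1]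
          exact continuousOn_const.mul (hycon.mono hsub).norm
      _ = _ := by rw [intervalIntegral.integral_const_mul]
  have h4 := int_weight_bound hκ hρ hs0 hs1
  refine h3.trans ?_
  set I := ∫ r in s..1, r ^ (-(3 / 4) : ℝ) * Real.exp (-(ρ * (r - s) / 8))
  calc A * I = C * 2 ^ (c + 1) * W ρ * s ^ p * (I * Real.exp (-(κ * ρ * (1 - s)))) := by rw [hA]; ring
    _ ≤ C * 2 ^ (c + 1) * W ρ * s ^ p * ((18 + 4 * (1 + 4 / κ)) / (1 + ρ) * Real.exp (-(κ / 2 * ρ * (1 - s)))) := by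
      gcongr
    _ = _ := by ring

lemma Jb_holo {r1 r2 : ℝ} (hr : r2 ≤ r1) {W : ℝ → ℝ} (hW : Gauge W) {q : ℝ} (hq : r2 + 1 ≤ q)
    {S : ℂ → ℝ → ℂ} (h : SC W q S) {r : ℝ} (hr0 : 0 < r) (hr1 : r ≤ 1) :
    DifferentiableOn ℂ (fun l => Jb r1 r2 S l r) Sec := by
  have hc : 1 ≤ cO r1 r2 := by unfold cO; linarith
  obtain ⟨C, hC, κ, hκ, hb⟩ := h.bd
  have hbd : ∀ l ∈ Sec, ∀ σ ∈ Ioc 0 r, ‖jin r1 r2 S l σ‖ ≤ C * W (rh l) * ‖phb (cO r1 r2) l r‖ * 1 := by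
    intro l hl σ hσ
    have hw := hW.pos _ (rh_pos hl)
    refine (jin_bound hr hq hl hC.le hκ.le hw.le (hb l hl) hr1 hσ.1 hσ.2).trans ?_
    have h1 : r ^ (q - r2 - 1) ≤ 1 := Real.rpow_le_one hr0.le hr1 (by linarith)
    have h2 : Real.exp (-(κ * rh l * (1 - r))) ≤ 1 := by
      rw [Real.exp_le_one_iff]
      have := mul_nonneg (mul_nonneg hκ.le (rh_nonneg l)) (by linarith : 0 ≤ 1 - r)
      linarith
    calc C * W (rh l) * r ^ (q - r2 - 1) * Real.exp (-(κ * rh l * (1 - r))) * ‖phb (cO r1 r2) l r‖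
        ≤ C * W (rh l) * 1 * 1 * ‖phb (cO r1 r2) l r‖ := by gcongr
      _ = _ := by ring
  simp only [Jb, intervalIntegral.integral_of_le hr0.le]
  have hrh : ContinuousOn rh Sec := (Real.continuous_sqrt.comp continuous_norm).continuousOn
  refine holo_integral sec_open (K := fun l => C * W (rh l) * ‖phb (cO r1 r2) l r‖) (b := fun _ => 1) ?_
    (integrable_const _) (Filter.Eventually.of_forall fun _ => zero_le_one) ?_ ?_ ?_ ?_
  · refine (continuousOn_const.mul (hW.cont.comp hrh fun l hl => rh_pos hl)).mul ?_
    exact (phb_diff_l hc r).continuous.norm.continuousOn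
  · intro l hl
    exact ((jin_cont hr h hl).mono Ioc_subset_Ioi_self).aestronglyMeasurable measurableSet_Ioc
  · refine (ae_restrict_iff' measurableSet_Ioc).2 (Filter.Eventually.of_forall fun σ hσ => ?_)
    exact ((phb_diff_l hc σ).differentiableOn.const_mul _).mul (h.holo σ ⟨hσ.1, hσ.2.trans hr1⟩)
  · intro l hl
    exact (ae_restrict_iff' measurableSet_Ioc).2 (Filter.Eventually.of_forall fun σ hσ => hbd l hl σ hσ)
  · exact (ae_restrict_iff' measurableSet_Ioc).2 (Filter.Eventually.of_forall fun σ hσ l hl => hbd l hl σ hσ)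

lemma phb_inv_holo {c : ℝ} (hc : 1 ≤ c) {s : ℝ} (hs : 0 ≤ s) :
    DifferentiableOn ℂ (fun l => (phb c l s)⁻¹) Sec :=
  (phb_diff_l hc s).differentiableOn.inv fun _ hl => phb_ne hc hl hs

lemma Yb_holo {r1 r2 : ℝ} (hr : r2 ≤ r1) {W : ℝ → ℝ} (hW : Gauge W) {q : ℝ} (hq : r2 + 1 ≤ q)
    {S : ℂ → ℝ → ℂ} (h : SC W q S) {s : ℝ} (hs0 : 0 < s) (hs1 : s ≤ 1) :
    DifferentiableOn ℂ (fun l => Yb r1 r2 S l s) Sec := by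
  have hc : 1 ≤ cO r1 r2 := by unfold cO; linarith
  obtain ⟨C, hC, κ, hκ, hb⟩ := h.bd
  have hW0 : ∀ r > 0, 0 ≤ W r := fun r hr => (hW.pos r hr).le
  have hbd : ∀ l ∈ Sec, ∀ r ∈ Ioc s 1, ‖yin r1 r2 S l r‖ ≤ C * W (rh l) * s ^ (-cO r1 r2) := by
    intro l hl r hr'
    have hr0 : 0 < r := hs0.trans hr'.1
    have hw := hW.pos _ (rh_pos hl)
    have h1 := Jb_bound hr hq hl hC.le hκ.le hw.le (hb l hl) hr0 hr'.2
    have hφr := phb_ge_one hc hl hr0.le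
    rw [yin, norm_mul, norm_mul, norm_pow, norm_inv, Complex.norm_real, Real.norm_of_nonneg (by positivity)]
    have e1 : r ^ (-cO r1 r2) ≤ s ^ (-cO r1 r2) :=
      Real.rpow_le_rpow_of_nonpos hs0 hr'.1.le (by linarith)
    have h2 : r ^ (q - r2) ≤ 1 := Real.rpow_le_one hr0.le hr'.2 (by linarith)
    have h3 : Real.exp (-(κ * rh l * (1 - r))) ≤ 1 := by
      rw [Real.exp_le_one_iff]
      have := mul_nonneg (mul_nonneg hκ.le (rh_nonneg l)) (by linarith [hr'.2] : 0 ≤ 1 - r)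
      linarith
    set b := ‖phb (cO r1 r2) l r‖
    have hb0 : 0 < b := by linarith
    calc r ^ (-cO r1 r2) * b⁻¹ ^ 2 * ‖Jb r1 r2 S l r‖
        ≤ s ^ (-cO r1 r2) * b⁻¹ ^ 2 * (C * W (rh l) * 1 * 1 * b) := by
          gcongr
          exact h1.trans (by gcongr)
      _ = C * W (rh l) * s ^ (-cO r1 r2) * b⁻¹ := by field_simp
      _ ≤ C * W (rh l) * s ^ (-cO r1 r2) * 1 := by gcongr; exact inv_le_one_of_one_le₀ hφr
      _ = _ := by ring
  have hI : DifferentiableOn ℂ (fun l => ∫ r in s..1, yin r1 r2 S l r) Sec := by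
    simp only [intervalIntegral.integral_of_le hs1]
    have hrh : ContinuousOn rh Sec := (Real.continuous_sqrt.comp continuous_norm).continuousOn
    refine holo_integral sec_open (K := fun l => C * W (rh l)) (b := fun _ => s ^ (-cO r1 r2)) ?_
      (integrable_const _) (Filter.Eventually.of_forall fun _ => by positivity) ?_ ?_ ?_ ?_
    · exact (continuousOn_const.mul (hW.cont.comp hrh fun l hl => rh_pos hl))
    · intro l hl
      exact ((yin_cont hr hW0 hq h hl).mono (fun x hx => hs0.trans hx.1)).aestronglyMeasurable measurableSet_Ioc
    · refine (ae_restrict_iff' measurableSet_Ioc).2 (Filter.Eventually.of_forall fun r hr' => ?_)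
      have hr0 : 0 < r := hs0.trans hr'.1
      exact (((phb_inv_holo hc hr0.le).pow 2).const_mul _).mul (Jb_holo hr hW hq h hr0 hr'.2)
    · intro l hl
      exact (ae_restrict_iff' measurableSet_Ioc).2 (Filter.Eventually.of_forall fun σ hσ => hbd l hl σ hσ)
    · exact (ae_restrict_iff' measurableSet_Ioc).2 (Filter.Eventually.of_forall fun σ hσ l hl => hbd l hl σ hσ)
  exact (((phb_diff_l hc s).differentiableOn.const_mul _).mul hI).neg

theorem Yb_FC {r1 r2 : ℝ} (hr : r2 ≤ r1) {W : ℝ → ℝ} (hW : Gauge W) {q p : ℝ} (hq : r2 + 1 ≤ q)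
    (hp1 : p ≤ r1) (hpq : p + 1 / 4 ≤ q) {S : ℂ → ℝ → ℂ} (h : SC W q S) :
    FC (fun r => W r / (1 + r)) p (Yb r1 r2 S) (Yb1 r1 r2 S) := by
  have hc : 1 ≤ cO r1 r2 := by unfold cO; linarith
  have hW0 : ∀ r > 0, 0 ≤ W r := fun r hr => (hW.pos r hr).le
  obtain ⟨C, hC, κ0, hκ0, hb0⟩ := h.bd
  set κ := min κ0 (1 / 8)
  have hκ : 0 < κ := by positivity
  have hb : ∀ l ∈ Sec, ∀ s ∈ Ioc (0 : ℝ) 1, ‖S l s‖ ≤ C * W (rh l) * s ^ q * Real.exp (-(κ * rh l * (1 - s))) := by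
    intro l hl s hs
    refine (hb0 l hl s hs).trans ?_
    have := hW0 _ (rh_pos hl)
    have := Real.rpow_pos_of_pos hs.1 q
    gcongr ?_ * ?_
    exact exp_kappa_mono (min_le_left _ _) l hs.2
  have hYb := fun {l : ℂ} (hl : l ∈ Sec) {s : ℝ} (hs : s ∈ Ioc (0:ℝ) 1) => Yb_bound hr hW0 hq hp1 hpq h hC hκ (min_le_right _ _) hb hl hs.1 hs.2
  set K := C * 2 ^ (cO r1 r2 + 1) * (18 + 4 * (1 + 4 / κ)) with hK
  have hK0 : 0 < K := by positivity
  refine ⟨fun s hs => Yb_holo hr hW hq h hs.1 hs.2, fun s hs => ?_, fun l hl s hs => (Yb_isSol hr hW0 hq h hl s hs).1,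
    fun l hl s hs => (Yb_isSol hr hW0 hq h hl s hs).2.continuousAt.continuousWithinAt,
    ⟨K, hK0, κ / 2, by positivity, fun l hl s hs => hYb hl hs⟩, ?_⟩
  · refine DifferentiableOn.add (DifferentiableOn.mul ?_ (Yb_holo hr hW hq h hs.1 hs.2)) ?_
    · refine DifferentiableOn.const_add _ ?_
      exact (phb1_diff_l hc s).differentiableOn.div (phb_diff_l hc s).differentiableOn
        fun l hl => phb_ne hc hl hs.1.le
    · exact ((phb_inv_holo hc hs.1.le).const_mul _).mul (Jb_holo hr hW hq h hs.1 hs.2)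
  · set M := |r1| + 2 * (cO r1 r2 + 2) with hM
    refine ⟨M * K + C, by positivity, κ / 2, by positivity, fun l hl s hs => ?_⟩
    have hρ := rh_pos hl
    have hw := hW0 _ hρ
    set ρ := rh l
    have hsp := Real.rpow_pos_of_pos hs.1 p
    have e0 : (1 + ρ) * (W ρ / (1 + ρ)) = W ρ := by field_simp
    have hE : Real.exp (-(κ * ρ * (1 - s))) ≤ Real.exp (-(κ / 2 * ρ * (1 - s))) :=
      exp_kappa_mono (by linarith) l hs.2
    have hφ := phb_ge_one hc hl hs.1.le
    have h1 : ‖(r1 : ℂ) + phb1 (cO r1 r2) l s / phb (cO r1 r2) l s‖ ≤ M * (1 + ρ) := by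
      refine (norm_add_le _ _).trans ?_
      rw [Complex.norm_real, norm_div, Real.norm_eq_abs]
      have h2 : ‖phb1 (cO r1 r2) l s‖ / ‖phb (cO r1 r2) l s‖ ≤ 2 * (cO r1 r2 + 2) * ρ := by
        rw [div_le_iff₀ (by linarith)]
        refine (phb1_bound hc hl hs.1.le).trans ?_
        have h3 : 2 * (cO r1 r2 + 2) * ρ * s ≤ 2 * (cO r1 r2 + 2) * ρ :=
          mul_le_of_le_one_right (by positivity) hs.2
        exact mul_le_mul_of_nonneg_right h3 (norm_nonneg _)
      have : 0 ≤ |r1| * ρ := by positivity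
      nlinarith
    have h2 : ‖((s ^ r2 : ℝ) : ℂ) * (phb (cO r1 r2) l s)⁻¹ * Jb r1 r2 S l s‖ ≤
        C * W ρ * s ^ p * Real.exp (-(κ / 2 * ρ * (1 - s))) := by
      have hJ := Jb_bound hr hq hl hC.le hκ.le hw (hb l hl) hs.1 hs.2
      have hs0 := hs.1
      rw [norm_mul, norm_mul, norm_inv, Complex.norm_real, Real.norm_of_nonneg (by positivity)]
      set b := ‖phb (cO r1 r2) l s‖
      have hb0 : 0 < b := by linarith
      have e1 : s ^ r2 * s ^ (q - r2) = s ^ q := by rw [← Real.rpow_add hs.1]; congr 1; ring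
      have e2 : s ^ q ≤ s ^ p := Real.rpow_le_rpow_of_exponent_ge hs.1 hs.2 (by linarith)
      calc s ^ r2 * b⁻¹ * ‖Jb r1 r2 S l s‖
          ≤ s ^ r2 * b⁻¹ * (C * W ρ * s ^ (q - r2) * Real.exp (-(κ * ρ * (1 - s))) * b) := by gcongr
        _ = C * W ρ * (s ^ r2 * s ^ (q - r2)) * Real.exp (-(κ * ρ * (1 - s))) := by field_simp
        _ ≤ _ := by rw [e1]; gcongr
    refine (norm_add_le _ _).trans ?_
    show _ ≤ (M * K + C) * ((1 + ρ) * (W ρ / (1 + ρ))) * s ^ p * Real.exp (-(κ / 2 * ρ * (1 - s)))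
    rw [e0, norm_mul]
    calc ‖(r1 : ℂ) + phb1 (cO r1 r2) l s / phb (cO r1 r2) l s‖ * ‖Yb r1 r2 S l s‖ +
          ‖((s ^ r2 : ℝ) : ℂ) * (phb (cO r1 r2) l s)⁻¹ * Jb r1 r2 S l s‖
        ≤ M * (1 + ρ) * (K * (W ρ / (1 + ρ)) * s ^ p * Real.exp (-(κ / 2 * ρ * (1 - s)))) +
          C * W ρ * s ^ p * Real.exp (-(κ / 2 * ρ * (1 - s))) := by
            gcongr
            exact hYb hl hs
      _ = (M * K + C) * W ρ * s ^ p * Real.exp (-(κ / 2 * ρ * (1 - s))) := by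
        field_simp

lemma Yb_one (r1 r2 : ℝ) (S : ℂ → ℝ → ℂ) (l : ℂ) : Yb r1 r2 S l 1 = 0 := by
  simp [Yb]

lemma Yb1_one (r1 r2 : ℝ) (S : ℂ → ℝ → ℂ) (l : ℂ) :
    Yb1 r1 r2 S l 1 = (phb (cO r1 r2) l 1)⁻¹ * Jb r1 r2 S l 1 := by
  simp [Yb1, Yb_one]

/-- homogeneous solution normalised at `s = 1` -/
def hmb (r1 r2 : ℝ) (l : ℂ) (s : ℝ) : ℂ := ((s ^ r1 : ℝ) : ℂ) * (phb (cO r1 r2) l s / phb (cO r1 r2) l 1)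
def hmb1 (r1 r2 : ℝ) (l : ℂ) (s : ℝ) : ℂ :=
  ((s ^ r1 : ℝ) : ℂ) * ((r1 * phb (cO r1 r2) l s + phb1 (cO r1 r2) l s) / phb (cO r1 r2) l 1)

lemma cpow_deriv (r : ℝ) {s : ℝ} (hs : 0 < s) :
    HasDerivAt (fun s : ℝ => ((s ^ r : ℝ) : ℂ)) (r * ((s ^ r : ℝ) : ℂ) / s) s := by
  have := (Real.hasDerivAt_rpow_const (p := r) (Or.inl hs.ne')).ofReal_comp
  refine this.congr_deriv ?_
  rw [Real.rpow_sub hs, Real.rpow_one]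
  push_cast; ring

lemma phb1_deriv {c : ℝ} (hc : 1 ≤ c) (l : ℂ) {s : ℝ} (hs : 0 < s) :
    HasDerivAt (phb1 c l) (((1 - c) * phb1 c l s + l * s ^ 2 * phb c l s) / s) s := by
  have hs' : (s : ℂ) ≠ 0 := by exact_mod_cast hs.ne'
  have h1 : HasDerivAt (fun s : ℝ => (s : ℂ) ^ 2) (2 * s) s := by
    have := arg_deriv 1 s
    simpa using this
  have := h1.mul (psb_deriv hc l s)
  refine HasDerivAt.congr_deriv this ?_
  have h2 := psb_ode hc l s
  have h3 : (s : ℂ) * psb' c l s = l * phb c l s - (c + 1) * psb c l s := by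
    linear_combination h2
  simp only [phb1]
  field_simp
  linear_combination h3

lemma hmb_isSol {r1 r2 : ℝ} (hr : r2 ≤ r1) {l : ℂ} (hl : l ∈ Sec) :
    IsSol r1 r2 l (hmb r1 r2 l) (hmb1 r1 r2 l) (fun _ => 0) := by
  have hc : 1 ≤ cO r1 r2 := by unfold cO; linarith
  intro s hs
  have hs' : (s : ℂ) ≠ 0 := by exact_mod_cast hs.ne'
  have h1 := phb_ne hc hl zero_le_one
  have hp := phb_deriv hc l s
  have hp1 := phb1_deriv hc l hs
  have hcc : ((cO r1 r2 : ℝ) : ℂ) = 1 + r1 - r2 := by simp [cO]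
  have e : phb1 (cO r1 r2) l s = s ^ 2 * psb (cO r1 r2) l s := rfl
  constructor
  · refine HasDerivAt.congr_deriv ((cpow_deriv r1 hs).mul (hp.div_const _)) ?_
    simp only [hmb1, e]
    field_simp
    try ring
  · refine HasDerivAt.congr_deriv ((cpow_deriv r1 hs).mul (((hp.const_mul (r1 : ℂ)).add hp1).div_const _)) ?_
    simp only [hmb1, hmb, e, hcc]
    try simp only [Pi.add_apply, e]
    field_simp
    ring

lemma hmb_FC {r1 r2 : ℝ} (hr : r2 ≤ r1) : FC (fun _ => 1) r1 (hmb r1 r2) (hmb1 r1 r2) := by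
  have hc : 1 ≤ cO r1 r2 := by unfold cO; linarith
  have hi : ∀ l ∈ Sec, phb (cO r1 r2) l 1 ≠ 0 := fun l hl => phb_ne hc hl zero_le_one
  have key : ∀ l ∈ Sec, ∀ s ∈ Ioc (0:ℝ) 1, ‖phb (cO r1 r2) l s / phb (cO r1 r2) l 1‖ ≤
      2 ^ (cO r1 r2 + 1) * Real.exp (-(1 / 4 * rh l * (1 - s))) := fun l hl s hs => by
    have h1 := phb_decay hc hl hs.1.le hs.2
    have h2 := phb_ge_one hc hl zero_le_one
    rw [norm_div, div_le_iff₀ (by linarith)]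
    refine h1.trans (le_of_eq ?_)
    congr 3
    ring
  refine ⟨fun s hs => ?_, fun s hs => ?_, fun l hl s hs => (hmb_isSol hr hl s hs).1,
    fun l hl s hs => (hmb_isSol hr hl s hs).2.continuousAt.continuousWithinAt,
    ⟨2 ^ (cO r1 r2 + 1), by positivity, 1 / 4, by norm_num, fun l hl s hs => ?_⟩,
    ⟨2 ^ (cO r1 r2 + 1) * (|r1| + 2 * (cO r1 r2 + 2)), by positivity, 1 / 4, by norm_num, fun l hl s hs => ?_⟩⟩
  · exact ((phb_diff_l hc s).differentiableOn.div (phb_diff_l hc 1).differentiableOn hi).const_mul _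
  · exact ((((phb_diff_l hc s).const_mul _).add (phb1_diff_l hc s)).differentiableOn.div
      (phb_diff_l hc 1).differentiableOn hi).const_mul _
  · have hp := Real.rpow_pos_of_pos hs.1 r1
    rw [hmb, norm_mul, Complex.norm_real, Real.norm_of_nonneg hp.le]
    have := mul_le_mul_of_nonneg_left (key l hl s hs) hp.le
    linarith
  · have hp := Real.rpow_pos_of_pos hs.1 r1
    rw [hmb1, norm_mul, Complex.norm_real, Real.norm_of_nonneg hp.le, norm_div]
    have h3 : ‖(r1:ℂ) * phb (cO r1 r2) l s + phb1 (cO r1 r2) l s‖ ≤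
        (|r1| + 2 * (cO r1 r2 + 2)) * (1 + rh l) * ‖phb (cO r1 r2) l s‖ := by
      refine (norm_add_le _ _).trans ?_
      rw [norm_mul, Complex.norm_real, Real.norm_eq_abs]
      have h4 := phb1_bound hc hl hs.1.le
      have h5 : 2 * (cO r1 r2 + 2) * rh l * s ≤ 2 * (cO r1 r2 + 2) * rh l :=
        mul_le_of_le_one_right (by have := rh_nonneg l; positivity) hs.2
      have h6 := mul_le_mul_of_nonneg_right h5 (norm_nonneg (phb (cO r1 r2) l s))
      have h7 : 0 ≤ |r1| * rh l * ‖phb (cO r1 r2) l s‖ := by have := rh_nonneg l; positivity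
      have h8 : 0 ≤ 2 * (cO r1 r2 + 2) * ‖phb (cO r1 r2) l s‖ := by positivity
      nlinarith
    have h9 := key l hl s hs
    rw [norm_div] at h9
    have hA : 0 ≤ (|r1| + 2 * (cO r1 r2 + 2)) * (1 + rh l) := by have := rh_nonneg l; positivity
    calc s ^ r1 * (‖(r1:ℂ) * phb (cO r1 r2) l s + phb1 (cO r1 r2) l s‖ / ‖phb (cO r1 r2) l 1‖)
        ≤ s ^ r1 * ((|r1| + 2 * (cO r1 r2 + 2)) * (1 + rh l) * ‖phb (cO r1 r2) l s‖ / ‖phb (cO r1 r2) l 1‖) := by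
          gcongr
      _ = s ^ r1 * (((|r1| + 2 * (cO r1 r2 + 2)) * (1 + rh l)) * (‖phb (cO r1 r2) l s‖ / ‖phb (cO r1 r2) l 1‖)) := by ring
      _ ≤ s ^ r1 * (((|r1| + 2 * (cO r1 r2 + 2)) * (1 + rh l)) * (2 ^ (cO r1 r2 + 1) * Real.exp (-(1 / 4 * rh l * (1 - s))))) := by
          gcongr
      _ = _ := by ring

lemma hmb_one {r1 r2 : ℝ} (hr : r2 ≤ r1) {l : ℂ} (hl : l ∈ Sec) : hmb r1 r2 l 1 = 1 := by
  have hc : 1 ≤ cO r1 r2 := by unfold cO; linarith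
  simp [hmb, phb_ne hc hl zero_le_one]

lemma hmb1_one {r1 r2 : ℝ} (hr : r2 ≤ r1) {l : ℂ} (hl : l ∈ Sec) :
    hmb1 r1 r2 l 1 = r1 + phb1 (cO r1 r2) l 1 / phb (cO r1 r2) l 1 := by
  have hc : 1 ≤ cO r1 r2 := by unfold cO; linarith
  simp [hmb1, add_div, phb_ne hc hl zero_le_one]

/-- uniqueness of decaying solutions vanishing at `s = 1` -/
lemma sol_unique {r1 r2 : ℝ} (hr : r2 ≤ r1) {l : ℂ} (hl : l ∈ Sec) {Y Y1 : ℝ → ℂ}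
    (h : IsSol r1 r2 l Y Y1 (fun _ => 0)) (h1 : Y 1 = 0) {q : ℝ} (hq : r2 < q)
    {K : ℝ} (hb : ∀ s ∈ Ioc (0:ℝ) 1, ‖Y s‖ ≤ K * s ^ q ∧ ‖Y1 s‖ ≤ K * s ^ q) :
    ∀ s > 0, Y s = 0 ∧ Y1 s = 0 := by
  have hc : 1 ≤ cO r1 r2 := by unfold cO; linarith
  have hcc : ((cO r1 r2 : ℝ) : ℂ) = 1 + r1 - r2 := by simp [cO]
  set c := cO r1 r2
  set g : ℝ → ℂ := fun s => ((s ^ (-r2) : ℝ) : ℂ) * (Y1 s * phb c l s - Y s * (r1 * phb c l s + phb1 c l s)) with hg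
  have gd : ∀ s ∈ Ioi (0:ℝ), HasDerivAt g 0 s := by
    intro s hs
    have hs' : (s : ℂ) ≠ 0 := by exact_mod_cast (ne_of_gt hs)
    have hp := phb_deriv hc l s
    have hp1 := phb1_deriv hc l hs
    have e : phb1 c l s = s ^ 2 * psb c l s := rfl
    obtain ⟨hY, hY1⟩ := h s hs
    refine HasDerivAt.congr_deriv ((cpow_deriv (-r2) hs).mul
      ((hY1.mul hp).sub (hY.mul ((hp.const_mul (r1:ℂ)).add hp1)))) ?_
    simp only [Pi.add_apply, Pi.sub_apply, Pi.mul_apply, e, hcc]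
    push_cast
    field_simp
    ring
  have conn : IsPreconnected (Ioi (0:ℝ)) := isPreconnected_Ioi
  have cst : ∀ f : ℝ → ℂ, (∀ s ∈ Ioi (0:ℝ), HasDerivAt f 0 s) → ∀ s > 0, f s = f 1 := by
    intro f hf s hs
    exact isOpen_Ioi.is_const_of_deriv_eq_zero conn (fun x hx => (hf x hx).differentiableAt.differentiableWithinAt)
      (fun x hx => (hf x hx).deriv) hs (by simp)
  have gc := cst g gd
  have g0 : g 1 = 0 := by
    have hlim : Filter.Tendsto g (𝓝[>] 0) (𝓝 0) := by
      have hφ : Filter.Tendsto (fun s : ℝ => K * s ^ (q - r2) * (‖phb c l s‖ + ‖(r1:ℂ) * phb c l s + phb1 c l s‖)) (𝓝[>] 0) (𝓝 0) := by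
        have c1 : Continuous (fun s : ℝ => ‖phb c l s‖ + ‖(r1:ℂ) * phb c l s + phb1 c l s‖) := by
          have a1 := phb_cont hc l
          have a2 : Continuous (phb1 c l) := by
            have : Continuous (psb c l) := continuous_iff_continuousAt.2 fun s => (psb_deriv hc l s).continuousAt
            exact (Complex.continuous_ofReal.pow 2).mul this
          fun_prop
        have c2 : Filter.Tendsto (fun s : ℝ => s ^ (q - r2)) (𝓝[>] 0) (𝓝 0) := by
          have := (Real.continuousAt_rpow_const 0 (q - r2) (Or.inr (by linarith))).tendsto
          rw [Real.zero_rpow (by linarith)] at this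
          exact this.mono_left nhdsWithin_le_nhds
        have := (c2.const_mul K).mul ((c1.tendsto 0).mono_left nhdsWithin_le_nhds)
        simpa using this
      refine squeeze_zero_norm' ?_ hφ
      have : Ioc (0:ℝ) 1 ∈ 𝓝[>] (0:ℝ) := Ioc_mem_nhdsGT zero_lt_one
      filter_upwards [this] with s hs
      obtain ⟨b1, b2⟩ := hb s hs
      have hp := Real.rpow_pos_of_pos hs.1 (-r2)
      rw [hg]
      simp only []
      rw [norm_mul, Complex.norm_real, Real.norm_of_nonneg hp.le]
      have e1 : s ^ (q - r2) = s ^ (-r2) * s ^ q := by rw [← Real.rpow_add hs.1]; congr 1; ring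
      rw [e1]
      calc s ^ (-r2) * ‖Y1 s * phb c l s - Y s * (r1 * phb c l s + phb1 c l s)‖
          ≤ s ^ (-r2) * (‖Y1 s‖ * ‖phb c l s‖ + ‖Y s‖ * ‖r1 * phb c l s + phb1 c l s‖) := by
            gcongr
            refine (norm_sub_le _ _).trans ?_
            rw [norm_mul, norm_mul]
        _ ≤ s ^ (-r2) * (K * s ^ q * ‖phb c l s‖ + K * s ^ q * ‖r1 * phb c l s + phb1 c l s‖) := by gcongr
        _ = _ := by ring
    have hlim2 : Filter.Tendsto g (𝓝[>] 0) (𝓝 (g 1)) := by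
      refine Filter.Tendsto.congr' ?_ tendsto_const_nhds
      filter_upwards [self_mem_nhdsWithin] with s hs
      exact (gc s hs).symm
    exact tendsto_nhds_unique hlim2 hlim
  have rel : ∀ s > 0, Y1 s * phb c l s = Y s * (r1 * phb c l s + phb1 c l s) := by
    intro s hs
    have := gc s hs
    rw [g0] at this
    have hp : ((s ^ (-r2) : ℝ) : ℂ) ≠ 0 := by exact_mod_cast (Real.rpow_pos_of_pos hs _).ne'
    exact sub_eq_zero.1 ((mul_eq_zero.1 this).resolve_left hp)
  have vc := cst (fun s => ((s ^ (-r1) : ℝ) : ℂ) * (Y s / phb c l s)) (fun s hs => by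
    have hs' : (s : ℂ) ≠ 0 := by exact_mod_cast (ne_of_gt hs)
    have hp := phb_deriv hc l s
    have hφ := phb_ne hc hl (le_of_lt hs)
    obtain ⟨hY, hY1⟩ := h s hs
    refine HasDerivAt.congr_deriv ((cpow_deriv (-r1) hs).mul (hY.div hp hφ)) ?_
    have r := rel s hs
    have e : phb1 c l s = s ^ 2 * psb c l s := rfl
    rw [e] at r
    try simp only [Pi.div_apply]
    push_cast
    field_simp
    linear_combination ((s ^ (-r1) : ℝ) : ℂ) * r)
  intro s hs
  have hφ := phb_ne hc hl hs.le
  have hY : Y s = 0 := by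
    have := vc s hs
    simp only [h1, zero_div, mul_zero] at this
    have hp : ((s ^ (-r1) : ℝ) : ℂ) ≠ 0 := by exact_mod_cast (Real.rpow_pos_of_pos hs _).ne'
    have h3 := (mul_eq_zero.1 this).resolve_left hp
    exact (div_eq_zero_iff.1 h3).resolve_right hφ
  refine ⟨hY, ?_⟩
  have := rel s hs
  rw [hY, zero_mul] at this
  exact (mul_eq_zero.1 this).resolve_right hφ

def gk (k : ℕ) (r : ℝ) : ℝ := ((1 + r) ^ k)⁻¹
def pw (k : ℕ) (r : ℝ) : ℝ := (r ^ k)⁻¹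

lemma gk_pos (k : ℕ) (r : ℝ) (hr : 0 < r) : 0 < gk k r := by unfold gk; positivity
lemma gk_nn (k : ℕ) (r : ℝ) (hr : r > 0) : 0 ≤ gk k r := (gk_pos k r hr).le
lemma pw_nn (k : ℕ) (r : ℝ) (hr : r > 0) : 0 ≤ pw k r := by unfold pw; positivity
lemma gk_gauge (k : ℕ) : Gauge (gk k) := ⟨gk_pos k, by
  unfold gk
  refine ContinuousOn.inv₀ (by fun_prop) fun r hr => ?_
  have : (0:ℝ) < r := hr
  positivity⟩
lemma gk_zero : gk 0 = fun _ => 1 := by ext; simp [gk]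
lemma gk_le_pw (k : ℕ) (r : ℝ) (hr : r > 0) : gk k r ≤ 1 * pw k r := by
  rw [one_mul]; unfold gk pw; gcongr; linarith
lemma gk_anti {k k' : ℕ} (h : k' ≤ k) (r : ℝ) (hr : r > 0) : gk k r ≤ 1 * gk k' r := by
  rw [one_mul]; unfold gk; gcongr; linarith
lemma gk_div (k : ℕ) : (fun r => gk k r / (1 + r)) = gk (k + 1) := by
  ext r; simp only [gk, div_eq_mul_inv, pow_succ, mul_inv]
lemma gk_mul (k : ℕ) (r : ℝ) (hr : r > 0) : (1 + r) * gk (k + 1) r = gk k r := by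
  unfold gk; field_simp; ring

/-- coefficient class -/
structure CF (W : ℝ → ℝ) (a : ℂ → ℂ) : Prop where
  holo : DifferentiableOn ℂ a Sec
  bd : ∃ K, ∀ l ∈ Sec, ‖a l‖ ≤ K * W (rh l)

lemma CF.const (a : ℂ) : CF (gk 0) (fun _ => a) := ⟨by fun_prop, ‖a‖, by simp [gk]⟩
lemma CF.mono {W W' : ℝ → ℝ} {a : ℂ → ℂ} (h : CF W a) (K : ℝ) (hW' : ∀ r > 0, 0 ≤ W' r)
    (hWW : ∀ r > 0, W r ≤ K * W' r) (hW : ∀ r > 0, 0 ≤ W r) : CF W' a := by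
  obtain ⟨h1, C, h2⟩ := h
  refine ⟨h1, |C| * K, fun l hl => (h2 l hl).trans ?_⟩
  have hr := rh_pos hl
  have := hWW _ hr
  calc C * W (rh l) ≤ |C| * W (rh l) := mul_le_mul_of_nonneg_right (le_abs_self _) (hW _ hr)
    _ ≤ |C| * (K * W' (rh l)) := by gcongr
    _ = _ := by ring
lemma CF.add {W : ℝ → ℝ} {a b : ℂ → ℂ} (h : CF W a) (h' : CF W b) : CF W (fun l => a l + b l) := by
  obtain ⟨h1, C, h2⟩ := h
  obtain ⟨h1', C', h2'⟩ := h'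
  refine ⟨h1.add h1', C + C', fun l hl => (norm_add_le _ _).trans ?_⟩
  have := h2 l hl; have := h2' l hl; linarith
lemma CF.mul {W V : ℝ → ℝ} {a b : ℂ → ℂ} (h : CF W a) (h' : CF V b) : CF (fun r => W r * V r) (fun l => a l * b l) := by
  obtain ⟨h1, C, h2⟩ := h
  obtain ⟨h1', C', h2'⟩ := h'
  refine ⟨h1.mul h1', C * C', fun l hl => ?_⟩
  rw [norm_mul]
  have i1 := h2 l hl; have i2 := h2' l hl
  calc ‖a l‖ * ‖b l‖ ≤ (C * W (rh l)) * (C' * V (rh l)) :=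
        mul_le_mul i1 i2 (norm_nonneg _) ((norm_nonneg _).trans i1)
    _ = _ := by ring
lemma CF.cmul {W : ℝ → ℝ} {a : ℂ → ℂ} (h : CF W a) (c : ℂ) : CF W (fun l => c * a l) := by
  have := (CF.const c).mul h
  simpa [gk_zero] using this
lemma CF.sub {W : ℝ → ℝ} {a b : ℂ → ℂ} (h : CF W a) (h' : CF W b) : CF W (fun l => a l - b l) := by
  have := h.add (h'.cmul (-1))
  simpa [sub_eq_add_neg] using this
lemma CF.gmul {j k m : ℕ} {a b : ℂ → ℂ} (h : CF (gk j) a) (h' : CF (gk k) b) (e : j + k = m) :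
    CF (gk m) (fun l => a l * b l) := by
  have := h.mul h'
  have e2 : (fun r => gk j r * gk k r) = gk m := by
    ext r; rw [← e]; simp only [gk, pow_add, mul_inv]
  rwa [e2] at this
lemma CF.pmul {j k m : ℕ} {a b : ℂ → ℂ} (h : CF (pw j) a) (h' : CF (pw k) b) (e : j + k = m) :
    CF (pw m) (fun l => a l * b l) := by
  have := h.mul h'
  have e2 : (fun r => pw j r * pw k r) = pw m := by
    ext r; rw [← e]; simp only [pw, pow_add, mul_inv]
  rwa [e2] at this
lemma CF.anti {j k : ℕ} {a : ℂ → ℂ} (h : CF (gk k) a) (e : j ≤ k) : CF (gk j) a :=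
  h.mono 1 (gk_nn j) (gk_anti e) (gk_nn k)
lemma CF.topw {k : ℕ} {a : ℂ → ℂ} (h : CF (gk k) a) : CF (pw k) a :=
  h.mono 1 (pw_nn k) (gk_le_pw k) (gk_nn k)
lemma CF.linv : CF (pw 2) (fun l => l⁻¹) := by
  refine ⟨DifferentiableOn.inv (by fun_prop) fun l hl => sec_ne hl, 1, fun l hl => ?_⟩
  rw [norm_inv, pw, rh_sq, one_mul]

lemma FC.cf0 {W : ℝ → ℝ} {q : ℝ} {m m1 : ℂ → ℝ → ℂ} (h : FC W q m m1) : CF W (fun l => m l 1) := by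
  obtain ⟨C, hC, κ, hκ, hb⟩ := h.bd
  refine ⟨h.holo 1 (by simp), C, fun l hl => ?_⟩
  have := hb l hl 1 (by simp)
  simpa using this
lemma FC.cf1 {W : ℝ → ℝ} {q : ℝ} {m m1 : ℂ → ℝ → ℂ} (h : FC W q m m1) :
    CF (fun r => (1 + r) * W r) (fun l => m1 l 1) := by
  obtain ⟨C, hC, κ, hκ, hb⟩ := h.bd1
  refine ⟨h.holo1 1 (by simp), C, fun l hl => ?_⟩
  have := hb l hl 1 (by simp)
  simpa using this
lemma FC.cf1g {k : ℕ} {q : ℝ} {m m1 : ℂ → ℝ → ℂ} (h : FC (gk (k + 1)) q m m1) :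
    CF (gk k) (fun l => m1 l 1) := by
  obtain ⟨h1, K, h2⟩ := h.cf1
  exact ⟨h1, K, fun l hl => by have := h2 l hl; rwa [gk_mul k _ (rh_pos hl)] at this⟩
lemma FC.cfmul {W V : ℝ → ℝ} {q : ℝ} {m m1 : ℂ → ℝ → ℂ} (hW : ∀ r > 0, 0 ≤ W r) (hV : ∀ r > 0, 0 ≤ V r)
    (h : FC W q m m1) {a : ℂ → ℂ} (ha : CF V a) :
    FC (fun r => V r * W r) q (fun l s => a l * m l s) (fun l s => a l * m1 l s) := by
  obtain ⟨h1, K, h2⟩ := ha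
  exact h.lmul hW hV h1 K h2
lemma FC.gmul {j k n : ℕ} {q : ℝ} {m m1 : ℂ → ℝ → ℂ} (h : FC (gk j) q m m1) {a : ℂ → ℂ} (ha : CF (gk k) a)
    (e : k + j = n) : FC (gk n) q (fun l s => a l * m l s) (fun l s => a l * m1 l s) := by
  have := h.cfmul (gk_nn j) (gk_nn k) ha
  have e2 : (fun r => gk k r * gk j r) = gk n := by
    ext r; rw [← e]; simp only [gk, pow_add, mul_inv]
  rwa [e2] at this
lemma FC.pmul {k : ℕ} {q : ℝ} {m m1 : ℂ → ℝ → ℂ} (h : FC (gk 0) q m m1) {a : ℂ → ℂ} (ha : CF (pw k) a) :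
    FC (pw k) q (fun l s => a l * m l s) (fun l s => a l * m1 l s) := by
  have := h.cfmul (gk_nn 0) (pw_nn k) ha
  simpa [gk_zero] using this
lemma FC.anti {j k : ℕ} {q q' : ℝ} {m m1 : ℂ → ℝ → ℂ} (h : FC (gk k) q m m1) (e : j ≤ k) (hq : q' ≤ q) :
    FC (gk j) q' m m1 := h.mono 1 (gk_nn j) (gk_anti e) hq
lemma FC.topw {k : ℕ} {q q' : ℝ} {m m1 : ℂ → ℝ → ℂ} (h : FC (gk k) q m m1) (hq : q' ≤ q) :
    FC (pw k) q' m m1 := h.mono 1 (pw_nn k) (gk_le_pw k) hq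
lemma SC.anti {j k : ℕ} {q q' : ℝ} {m : ℂ → ℝ → ℂ} (h : SC (gk k) q m) (e : j ≤ k) (hq : q' ≤ q) :
    SC (gk j) q' m := h.mono 1 (gk_nn j) (gk_anti e) hq
lemma SC.sub {W : ℝ → ℝ} {q : ℝ} {m m' : ℂ → ℝ → ℂ} (hW : ∀ r > 0, 0 ≤ W r)
    (h : SC W q m) (h' : SC W q m') : SC W q (fun l s => m l s - m' l s) := by
  have := h.add hW (h'.cmul hW (-1))
  simpa [sub_eq_add_neg] using this
lemma SC.sinv {W : ℝ → ℝ} {q : ℝ} {m : ℂ → ℝ → ℂ} (h : SC W q m) :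
    SC W (q - 2) (fun l s => ((s : ℂ) ^ 2)⁻¹ * m l s) := by
  refine ⟨fun s hs => (h.holo s hs).const_mul _, fun l hl => ContinuousOn.mul ?_ (h.cont l hl), ?_⟩
  · refine ContinuousOn.inv₀ (by fun_prop) fun s hs => ?_
    have : (s : ℂ) ≠ 0 := by exact_mod_cast (ne_of_gt hs)
    positivity
  · obtain ⟨C, hC, κ, hκ, hb⟩ := h.bd
    refine ⟨C, hC, κ, hκ, fun l hl s hs => ?_⟩
    have h1 := hb l hl s hs
    have hs0 := hs.1
    have e : s ^ (q - 2) = (s ^ 2)⁻¹ * s ^ q := by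
      rw [Real.rpow_sub hs0]; norm_num; field_simp
    rw [norm_mul, norm_inv, norm_pow, Complex.norm_real, Real.norm_of_nonneg hs0.le, e]
    have := mul_le_mul_of_nonneg_left h1 (by positivity : 0 ≤ (s ^ 2)⁻¹)
    linarith

lemma yFC {r1 r2 q p : ℝ} {k : ℕ} {S : ℂ → ℝ → ℂ} (h : SC (gk k) q S) (hr : r2 ≤ r1) (hq : r2 + 1 ≤ q)
    (hp1 : p ≤ r1) (hpq : p + 1 / 4 ≤ q) : FC (gk (k + 1)) p (Yb r1 r2 S) (Yb1 r1 r2 S) := by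
  have := Yb_FC hr (gk_gauge k) hq hp1 hpq h
  rwa [gk_div] at this
lemma ySol {r1 r2 q : ℝ} {k : ℕ} {S : ℂ → ℝ → ℂ} (h : SC (gk k) q S) (hr : r2 ≤ r1) (hq : r2 + 1 ≤ q)
    {l : ℂ} (hl : l ∈ Sec) : IsSol r1 r2 l (Yb r1 r2 S l) (Yb1 r1 r2 S l) (S l) :=
  Yb_isSol hr (gk_nn k) hq h hl
lemma hFC {r1 r2 : ℝ} (hr : r2 ≤ r1) : FC (gk 0) r1 (hmb r1 r2) (hmb1 r1 r2) := by
  rw [gk_zero]; exact hmb_FC hr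

/-- pointwise decay -/
def Dec (q : ℝ) (f : ℝ → ℂ) : Prop := ∃ K, ∀ s ∈ Ioc (0:ℝ) 1, ‖f s‖ ≤ K * s ^ q
lemma Dec.add {q : ℝ} {f g : ℝ → ℂ} (h : Dec q f) (h' : Dec q g) : Dec q (fun s => f s + g s) := by
  obtain ⟨K, h⟩ := h; obtain ⟨K', h'⟩ := h'
  exact ⟨K + K', fun s hs => (norm_add_le _ _).trans (by have := h s hs; have := h' s hs; linarith)⟩
lemma Dec.cmul {q : ℝ} {f : ℝ → ℂ} (a : ℂ) (h : Dec q f) : Dec q (fun s => a * f s) := by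
  obtain ⟨K, h⟩ := h
  exact ⟨‖a‖ * K, fun s hs => by
    rw [norm_mul]; have := mul_le_mul_of_nonneg_left (h s hs) (norm_nonneg a); linarith⟩
lemma Dec.sub {q : ℝ} {f g : ℝ → ℂ} (h : Dec q f) (h' : Dec q g) : Dec q (fun s => f s - g s) := by
  simpa [sub_eq_add_neg] using h.add (h'.cmul (-1))
lemma Dec.sq {q : ℝ} {f : ℝ → ℂ} (h : Dec q f) : Dec q (fun s => s ^ 2 * f s) := by
  obtain ⟨K, h⟩ := h
  refine ⟨K, fun s hs => ?_⟩
  rw [norm_mul, norm_pow, Complex.norm_real, Real.norm_of_nonneg hs.1.le]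
  have h1 : s ^ 2 ≤ 1 := pow_le_one₀ hs.1.le hs.2
  exact (mul_le_of_le_one_left (norm_nonneg _) h1).trans (h s hs)
lemma Dec.mono {q q' : ℝ} {f : ℝ → ℂ} (h : Dec q f) (hq : q' ≤ q) : Dec q' f := by
  obtain ⟨K, h⟩ := h
  refine ⟨|K|, fun s hs => (h s hs).trans ?_⟩
  have h4 : s ^ q ≤ s ^ q' := Real.rpow_le_rpow_of_exponent_ge hs.1 hs.2 hq
  have h5 : 0 < s ^ q := Real.rpow_pos_of_pos hs.1 _
  exact (mul_le_mul_of_nonneg_right (le_abs_self K) h5.le).trans (by gcongr)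
lemma BD.dec {W : ℝ → ℝ} {q : ℝ} {m : ℂ → ℝ → ℂ} (h : BD W q m) (hW : ∀ r > 0, 0 ≤ W r) {l : ℂ} (hl : l ∈ Sec) :
    Dec q (m l) := by
  obtain ⟨C, hC, κ, hκ, hb⟩ := h
  refine ⟨C * W (rh l), fun s hs => (hb l hl s hs).trans ?_⟩
  have h1 := hW _ (rh_pos hl)
  have h5 : 0 < s ^ q := Real.rpow_pos_of_pos hs.1 _
  apply mul_le_of_le_one_right (by positivity)
  apply Real.exp_le_one_iff.2
  have := mul_nonneg (mul_nonneg hκ.le (rh_nonneg l)) (by linarith [hs.2] : 0 ≤ 1 - s)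
  linarith

/-- two logarithmic derivatives with decay -/
structure TD (q : ℝ) (f f1 f2 : ℝ → ℂ) : Prop where
  d1 : ∀ s > (0:ℝ), HasDerivAt f (f1 s / s) s
  d2 : ∀ s > (0:ℝ), HasDerivAt f1 (f2 s / s) s
  b0 : Dec q f
  b1 : Dec q f1

lemma TD.add {q : ℝ} {f f1 f2 g g1 g2 : ℝ → ℂ} (h : TD q f f1 f2) (h' : TD q g g1 g2) :
    TD q (fun s => f s + g s) (fun s => f1 s + g1 s) (fun s => f2 s + g2 s) where
  d1 s hs := ((h.d1 s hs).add (h'.d1 s hs)).congr_deriv (by ring)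
  d2 s hs := ((h.d2 s hs).add (h'.d2 s hs)).congr_deriv (by ring)
  b0 := h.b0.add h'.b0
  b1 := h.b1.add h'.b1
lemma TD.cmul {q : ℝ} {f f1 f2 : ℝ → ℂ} (a : ℂ) (h : TD q f f1 f2) :
    TD q (fun s => a * f s) (fun s => a * f1 s) (fun s => a * f2 s) where
  d1 s hs := ((h.d1 s hs).const_mul a).congr_deriv (by ring)
  d2 s hs := ((h.d2 s hs).const_mul a).congr_deriv (by ring)
  b0 := h.b0.cmul a
  b1 := h.b1.cmul a
lemma TD.sub {q : ℝ} {f f1 f2 g g1 g2 : ℝ → ℂ} (h : TD q f f1 f2) (h' : TD q g g1 g2) :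
    TD q (fun s => f s - g s) (fun s => f1 s - g1 s) (fun s => f2 s - g2 s) where
  d1 s hs := ((h.d1 s hs).sub (h'.d1 s hs)).congr_deriv (by ring)
  d2 s hs := ((h.d2 s hs).sub (h'.d2 s hs)).congr_deriv (by ring)
  b0 := h.b0.sub h'.b0
  b1 := h.b1.sub h'.b1
lemma sq_deriv {f : ℝ → ℂ} {f' : ℂ} {s : ℝ} (hs : 0 < s) (h : HasDerivAt f (f' / s) s) :
    HasDerivAt (fun s : ℝ => (s : ℂ) ^ 2 * f s) ((s : ℂ) ^ 2 * (2 * f s + f') / s) s := by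
  have hs' : (s : ℂ) ≠ 0 := by exact_mod_cast hs.ne'
  have h1 : HasDerivAt (fun s : ℝ => (s : ℂ) ^ 2) (2 * s) s := by
    have := arg_deriv 1 s
    simpa using this
  refine HasDerivAt.congr_deriv (h1.mul h) ?_
  field_simp
lemma TD.sq {q : ℝ} {f f1 f2 : ℝ → ℂ} (h : TD q f f1 f2) :
    TD q (fun s => s ^ 2 * f s) (fun s => s ^ 2 * (2 * f s + f1 s)) (fun s => s ^ 2 * (4 * f s + 4 * f1 s + f2 s)) where
  d1 s hs := sq_deriv hs (h.d1 s hs)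
  d2 s hs := (sq_deriv (f := fun s => 2 * f s + f1 s) (f' := 2 * f1 s + f2 s) hs
    ((((h.d1 s hs).const_mul 2).add (h.d2 s hs)).congr_deriv (by ring))).congr_deriv (by ring)
  b0 := h.b0.sq
  b1 := ((h.b0.cmul 2).add h.b1).sq
lemma TD.mono {q q' : ℝ} {f f1 f2 : ℝ → ℂ} (h : TD q f f1 f2) (hq : q' ≤ q) : TD q' f f1 f2 :=
  ⟨h.d1, h.d2, h.b0.mono hq, h.b1.mono hq⟩

lemma IsSol.td {r1 r2 q : ℝ} {l : ℂ} {Y Y1 S : ℝ → ℂ} (h : IsSol r1 r2 l Y Y1 S) (h0 : Dec q Y) (h1 : Dec q Y1) :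
    TD q Y Y1 (fun s => (r1 + r2) * Y1 s - r1 * r2 * Y s + l * s ^ 2 * Y s + S s) :=
  ⟨fun s hs => (h s hs).1, fun s hs => (h s hs).2, h0, h1⟩
lemma IsSol.td1 {r1 r2 q : ℝ} {l : ℂ} {Y Y1 S S1 : ℝ → ℂ} (h : IsSol r1 r2 l Y Y1 S) (h0 : Dec q Y) (h1 : Dec q Y1)
    (hS : Dec q S) (hd : ∀ s > (0:ℝ), HasDerivAt S (S1 s / s) s) :
    TD q Y1 (fun s => (r1 + r2) * Y1 s - r1 * r2 * Y s + l * s ^ 2 * Y s + S s)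
      (fun s => (r1 + r2) * ((r1 + r2) * Y1 s - r1 * r2 * Y s + l * s ^ 2 * Y s + S s) - r1 * r2 * Y1 s
        + l * s ^ 2 * (2 * Y s + Y1 s) + S1 s) where
  d1 s hs := (h s hs).2
  d2 s hs := by
    have a := ((h s hs).2.const_mul ((r1 + r2 : ℂ))).sub ((h s hs).1.const_mul ((r1 * r2 : ℂ)))
    have b := (sq_deriv hs (h s hs).1).const_mul l
    have c := (a.add b).add (hd s hs)
    have e : (fun s => ((r1:ℂ) + r2) * Y1 s - r1 * r2 * Y s + l * s ^ 2 * Y s + S s) =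
      fun s => ((r1:ℂ) + r2) * Y1 s - r1 * r2 * Y s + l * (s ^ 2 * Y s) + S s := by ext s; ring
    rw [e]
    exact HasDerivAt.congr_deriv c (by ring)
  b0 := h1
  b1 := by
    have := (((h1.cmul (r1 + r2)).sub (h0.cmul (r1 * r2))).add (h0.sq.cmul l)).add hS
    refine cast (congrArg (Dec q) ?_) this
    ext s; ring

lemma TD.zero {r1 r2 q : ℝ} (hr : r2 ≤ r1) {l : ℂ} (hl : l ∈ Sec) {Y Y1 Y2 : ℝ → ℂ} (h : TD q Y Y1 Y2)
    (hq : r2 < q) (h1 : Y 1 = 0) (he : ∀ s > (0:ℝ), Y2 s = (r1 + r2) * Y1 s - r1 * r2 * Y s + l * s ^ 2 * Y s) :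
    ∀ s > 0, Y s = 0 ∧ Y1 s = 0 := by
  obtain ⟨K, hK⟩ := h.b0
  obtain ⟨K', hK'⟩ := h.b1
  refine sol_unique hr hl (fun s hs => ⟨h.d1 s hs, (h.d2 s hs).congr_deriv (by rw [he s hs, add_zero])⟩) h1 hq
    (K := max K K') fun s hs => ?_
  have h5 : 0 < s ^ q := Real.rpow_pos_of_pos hs.1 _
  exact ⟨(hK s hs).trans (by gcongr; exact le_max_left _ _), (hK' s hs).trans (by gcongr; exact le_max_right _ _)⟩

namespace Sy

def kap (N : ℝ) : ℝ := (N + √(N ^ 2 + 8 * N)) / 2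
def dd (N : ℝ) (l : ℂ) (s : ℝ) : ℂ := hmb (kap N) (N - kap N) l s
def dd1 (N : ℝ) (l : ℂ) (s : ℝ) : ℂ := hmb1 (kap N) (N - kap N) l s
def td (N : ℝ) (l : ℂ) (s : ℝ) : ℂ := Yb (N + 2) 0 (dd N) l s
def td1 (N : ℝ) (l : ℂ) (s : ℝ) : ℂ := Yb1 (N + 2) 0 (dd N) l s
def De (N : ℝ) (l : ℂ) : ℂ := 1 + 2 * td1 N l 1
def th (N : ℝ) (l : ℂ) : ℂ := hmb1 (N + 2) 0 l 1
def A1 (N : ℝ) (l : ℂ) (s : ℝ) : ℂ := (2 * (De N l)⁻¹) * td N l s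
def A11 (N : ℝ) (l : ℂ) (s : ℝ) : ℂ := (2 * (De N l)⁻¹) * td1 N l s
def A2 (N : ℝ) (l : ℂ) (s : ℝ) : ℂ := hmb (N + 2) 0 l s + (2 * (De N l)⁻¹ * (N - th N l)) * td N l s
def A21 (N : ℝ) (l : ℂ) (s : ℝ) : ℂ := hmb1 (N + 2) 0 l s + (2 * (De N l)⁻¹ * (N - th N l)) * td1 N l s
def HP (N : ℝ) (l : ℂ) (s : ℝ) : ℂ := hmb N (-2) l s
def HP1 (N : ℝ) (l : ℂ) (s : ℝ) : ℂ := hmb1 N (-2) l s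
def B1 (N : ℝ) (l : ℂ) (s : ℝ) : ℂ := Yb N (-2) (fun l s => -2 * A1 N l s) l s
def B11 (N : ℝ) (l : ℂ) (s : ℝ) : ℂ := Yb1 N (-2) (fun l s => -2 * A1 N l s) l s
def B2 (N : ℝ) (l : ℂ) (s : ℝ) : ℂ := Yb N (-2) (fun l s => -2 * A2 N l s) l s
def B21 (N : ℝ) (l : ℂ) (s : ℝ) : ℂ := Yb1 N (-2) (fun l s => -2 * A2 N l s) l s
def GV (N : ℝ) (l : ℂ) : ℂ := phb1 (cO (N + 2) 2) l 1 / phb (cO (N + 2) 2) l 1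
def g1 (N : ℝ) (l : ℂ) : ℂ := -(1 + GV N l)⁻¹ * Yb1 (N + 2) 2 (fun l s => 4 * A1 N l s) l 1
def g2 (N : ℝ) (l : ℂ) : ℂ := -(1 + GV N l)⁻¹ * (1 + Yb1 (N + 2) 2 (fun l s => 4 * A2 N l s) l 1)
def C1 (N : ℝ) (l : ℂ) (s : ℝ) : ℂ := Yb (N + 2) 2 (fun l s => 4 * A1 N l s) l s + g1 N l * hmb (N + 2) 2 l s
def C11 (N : ℝ) (l : ℂ) (s : ℝ) : ℂ := Yb1 (N + 2) 2 (fun l s => 4 * A1 N l s) l s + g1 N l * hmb1 (N + 2) 2 l s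
def C2 (N : ℝ) (l : ℂ) (s : ℝ) : ℂ := Yb (N + 2) 2 (fun l s => 4 * A2 N l s) l s + g2 N l * hmb (N + 2) 2 l s
def C21 (N : ℝ) (l : ℂ) (s : ℝ) : ℂ := Yb1 (N + 2) 2 (fun l s => 4 * A2 N l s) l s + g2 N l * hmb1 (N + 2) 2 l s
def D0 (N : ℝ) (l : ℂ) (s : ℝ) : ℂ := Yb N 0 (fun l s => 2 * HP N l s) l s
def D01 (N : ℝ) (l : ℂ) (s : ℝ) : ℂ := Yb1 N 0 (fun l s => 2 * HP N l s) l s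
def D1 (N : ℝ) (l : ℂ) (s : ℝ) : ℂ := Yb N 0 (fun l s => 2 * B1 N l s - 2 * C1 N l s) l s
def D11 (N : ℝ) (l : ℂ) (s : ℝ) : ℂ := Yb1 N 0 (fun l s => 2 * B1 N l s - 2 * C1 N l s) l s
def D2 (N : ℝ) (l : ℂ) (s : ℝ) : ℂ := Yb N 0 (fun l s => 2 * B2 N l s - 2 * C2 N l s) l s
def D21 (N : ℝ) (l : ℂ) (s : ℝ) : ℂ := Yb1 N 0 (fun l s => 2 * B2 N l s - 2 * C2 N l s) l s
def f0 (N : ℝ) (l : ℂ) : ℂ := -1 * ((1 + D01 N l 1) * l⁻¹)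
def f3 (N : ℝ) (l : ℂ) : ℂ := -((N : ℂ) - 1)⁻¹ * (g1 N l + D11 N l 1 + f0 N l)
def f1 (N : ℝ) (l : ℂ) : ℂ := (f0 N l + f3 N l - D11 N l 1) * l⁻¹
def f4 (N : ℝ) (l : ℂ) : ℂ := -((N : ℂ) - 1)⁻¹ * (g2 N l + D21 N l 1)
def f2 (N : ℝ) (l : ℂ) : ℂ := (f4 N l - D21 N l 1) * l⁻¹
def F0 (N : ℝ) (l : ℂ) (s : ℝ) : ℂ := Yb (N - 2) (-2) (fun l s => -2 * D0 N l s) l s + f0 N l * hmb (N - 2) (-2) l s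
def F01 (N : ℝ) (l : ℂ) (s : ℝ) : ℂ := Yb1 (N - 2) (-2) (fun l s => -2 * D0 N l s) l s + f0 N l * hmb1 (N - 2) (-2) l s
def F1 (N : ℝ) (l : ℂ) (s : ℝ) : ℂ := Yb (N - 2) (-2) (fun l s => -4 * D1 N l s) l s + f1 N l * hmb (N - 2) (-2) l s
def F11 (N : ℝ) (l : ℂ) (s : ℝ) : ℂ := Yb1 (N - 2) (-2) (fun l s => -4 * D1 N l s) l s + f1 N l * hmb1 (N - 2) (-2) l s
def F2 (N : ℝ) (l : ℂ) (s : ℝ) : ℂ := Yb (N - 2) (-2) (fun l s => -4 * D2 N l s) l s + f2 N l * hmb (N - 2) (-2) l s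
def F21 (N : ℝ) (l : ℂ) (s : ℝ) : ℂ := Yb1 (N - 2) (-2) (fun l s => -4 * D2 N l s) l s + f2 N l * hmb1 (N - 2) (-2) l s
def F3 (N : ℝ) (l : ℂ) (s : ℝ) : ℂ :=
  Yb (N - 2) (-2) (fun l s => -2 * (((s : ℂ) ^ 2)⁻¹ * C1 N l s)) l s + f3 N l * hmb (N - 2) (-2) l s
def F31 (N : ℝ) (l : ℂ) (s : ℝ) : ℂ :=
  Yb1 (N - 2) (-2) (fun l s => -2 * (((s : ℂ) ^ 2)⁻¹ * C1 N l s)) l s + f3 N l * hmb1 (N - 2) (-2) l s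
def F4 (N : ℝ) (l : ℂ) (s : ℝ) : ℂ :=
  Yb (N - 2) (-2) (fun l s => -2 * (((s : ℂ) ^ 2)⁻¹ * C2 N l s)) l s + f4 N l * hmb (N - 2) (-2) l s
def F41 (N : ℝ) (l : ℂ) (s : ℝ) : ℂ :=
  Yb1 (N - 2) (-2) (fun l s => -2 * (((s : ℂ) ^ 2)⁻¹ * C2 N l s)) l s + f4 N l * hmb1 (N - 2) (-2) l s

lemma kap_eq {N : ℝ} (hN : 3 ≤ N) : kap N * kap N = N * kap N + 2 * N := by
  have h := Real.sq_sqrt (by positivity : 0 ≤ N ^ 2 + 8 * N)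
  unfold kap; nlinarith
lemma kap_ge {N : ℝ} (hN : 3 ≤ N) : N + 5 / 4 ≤ kap N := by
  have : N + 5 / 2 ≤ √(N ^ 2 + 8 * N) := Real.le_sqrt_of_sq_le (by nlinarith)
  unfold kap; linarith

lemma dd_FC {N : ℝ} (hN : 3 ≤ N) : FC (gk 0) (kap N) (dd N) (dd1 N) := hFC (by have := kap_ge hN; linarith)
lemma dd_sol {N : ℝ} (hN : 3 ≤ N) {l : ℂ} (hl : l ∈ Sec) : IsSol (kap N) (N - kap N) l (dd N l) (dd1 N l) (fun _ => 0) :=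
  hmb_isSol (by have := kap_ge hN; linarith) hl
lemma td_FC {N : ℝ} (hN : 3 ≤ N) : FC (gk 1) (N + 1) (td N) (td1 N) :=
  yFC (dd_FC hN).sc (by linarith) (by have := kap_ge hN; linarith) (by linarith) (by have := kap_ge hN; linarith)
lemma td_sol {N : ℝ} (hN : 3 ≤ N) {l : ℂ} (hl : l ∈ Sec) : IsSol (N + 2) 0 l (td N l) (td1 N l) (dd N l) := by
  have := ySol (r1 := N + 2) (r2 := 0) (dd_FC hN).sc (by linarith) (by have := kap_ge hN; linarith) hl
  exact_mod_cast this

lemma td1_one {N : ℝ} (hN : 3 ≤ N) {l : ℂ} (hl : l ∈ Sec) : ‖td1 N l 1‖ ≤ 1 / 4 := by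
  have hk := kap_ge hN
  have hc : 1 ≤ cO (N + 2) 0 := by unfold cO; linarith
  have hc' : 1 ≤ cO (kap N) (N - kap N) := by unfold cO; linarith
  rw [td1, Yb1_one, norm_mul, norm_inv]
  have h1 := phb_ge_one hc hl zero_le_one
  rw [inv_mul_le_iff₀ (by linarith)]
  have h2 : ‖Jb (N + 2) 0 (dd N) l 1‖ ≤ ∫ σ in (0:ℝ)..1, ‖phb (cO (N + 2) 0) l 1‖ * σ ^ (kap N - 1) := by
    refine intervalIntegral.norm_integral_le_of_norm_le zero_le_one ?_ ?_
    · refine Filter.Eventually.of_forall fun σ hσ => ?_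
      have a1 := phb_mono hc hl hσ.1.le hσ.2
      have a2 := phb_mono hc' hl hσ.1.le hσ.2
      have a3 := phb_ge_one hc' hl zero_le_one
      have p1 := Real.rpow_pos_of_pos hσ.1 (-1 - 0)
      have p2 := Real.rpow_pos_of_pos hσ.1 (kap N)
      rw [jin, dd, hmb, norm_mul, norm_mul, norm_mul, Complex.norm_real, Complex.norm_real,
        Real.norm_of_nonneg p1.le, Real.norm_of_nonneg p2.le, norm_div]
      have a4 : ‖phb (cO (kap N) (N - kap N)) l σ‖ / ‖phb (cO (kap N) (N - kap N)) l 1‖ ≤ 1 :=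
        div_le_one_of_le₀ a2 (norm_nonneg _)
      have e : σ ^ (kap N - 1) = σ ^ (-1 - 0 : ℝ) * σ ^ kap N := by
        rw [← Real.rpow_add hσ.1]; congr 1; ring
      rw [e]
      calc _ ≤ σ ^ (-1 - 0 : ℝ) * ‖phb (cO (N + 2) 0) l 1‖ * (σ ^ kap N * 1) := by gcongr
        _ = _ := by ring
    · exact (intervalIntegral.intervalIntegrable_rpow' (by linarith)).const_mul _
  refine h2.trans ?_
  rw [intervalIntegral.integral_const_mul, integral_rpow (Or.inl (by linarith))]
  have e1 : kap N - 1 + 1 = kap N := by ring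
  rw [e1, Real.one_rpow, Real.zero_rpow (by linarith), sub_zero]
  have : 1 / kap N ≤ 1 / 4 := one_div_le_one_div_of_le (by norm_num) (by linarith)
  gcongr

lemma De_bd {N : ℝ} (hN : 3 ≤ N) {l : ℂ} (hl : l ∈ Sec) : 1 / 2 ≤ ‖De N l‖ := by
  have := td1_one hN hl
  have h1 : ‖(1:ℂ)‖ - ‖-(2 * td1 N l 1)‖ ≤ ‖1 - -(2 * td1 N l 1)‖ := norm_sub_norm_le _ _
  rw [norm_neg, norm_mul, norm_one, sub_neg_eq_add] at h1
  unfold De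
  norm_num at h1
  linarith
lemma De_ne {N : ℝ} (hN : 3 ≤ N) {l : ℂ} (hl : l ∈ Sec) : De N l ≠ 0 := by
  have := De_bd hN hl
  intro h; rw [h] at this; norm_num at this
lemma De_inv {N : ℝ} (hN : 3 ≤ N) : CF (gk 0) (fun l => 2 * (De N l)⁻¹) := by
  refine CF.cmul ⟨?_, 2, fun l hl => ?_⟩ 2
  · have h1 := (td_FC hN).holo1 1 (by simp)
    exact DifferentiableOn.inv ((h1.const_mul 2).const_add 1) fun l hl => De_ne hN hl
  · have := De_bd hN hl
    rw [norm_inv]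
    simp only [gk, pow_zero, inv_one, mul_one]
    exact inv_le_of_inv_le₀ (by norm_num) (by linarith)

lemma A1_FC {N : ℝ} (hN : 3 ≤ N) : FC (gk 1) (N + 1) (A1 N) (A11 N) := (td_FC hN).gmul (De_inv hN) rfl
lemma A1_sol {N : ℝ} (hN : 3 ≤ N) {l : ℂ} (hl : l ∈ Sec) : IsSol (N + 2) 0 l (A1 N l) (A11 N l) (fun s => 2 * (De N l)⁻¹ * dd N l s) :=
  (td_sol hN hl).cmul _
lemma th_CF {N : ℝ} (hN : 3 ≤ N) : CF (fun r => 1 + r) (fun l => (N:ℂ) - th N l) := by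
  have h1 := (hFC (r1 := N + 2) (r2 := 0) (by linarith)).cf1
  have e : (fun r => (1 + r) * gk 0 r) = fun r => 1 + r := by ext r; simp [gk]
  rw [e] at h1
  refine CF.sub ((CF.const (N:ℂ)).mono 1 (fun r hr => by linarith) (fun r hr => ?_) (gk_nn 0)) h1
  simp [gk]; linarith
lemma A2_FC {N : ℝ} (hN : 3 ≤ N) : FC (gk 0) (N + 1) (A2 N) (A21 N) := by
  refine FC.add (gk_nn 0) ((hFC (by linarith)).anti le_rfl (by linarith)) ?_
  have h1 := (td_FC hN).cfmul (gk_nn 1) (V := fun r => gk 0 r * (1 + r)) (fun r hr => ?_)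
    ((De_inv hN).mul (th_CF hN))
  · refine h1.mono 1 (gk_nn 0) (fun r hr => ?_) le_rfl
    simp [gk]
    rw [mul_inv_cancel₀ (by linarith)]
  · have := gk_nn 0 r hr
    have : 0 < 1 + r := by linarith
    positivity
lemma A2_sol {N : ℝ} (hN : 3 ≤ N) {l : ℂ} (hl : l ∈ Sec) : IsSol (N + 2) 0 l (A2 N l) (A21 N l)
    (fun s => 2 * (De N l)⁻¹ * (N - th N l) * dd N l s) := by
  have := (hmb_isSol (r1 := N + 2) (r2 := 0) (by linarith) hl)
  have := IsSol.add (by exact_mod_cast this) ((td_sol hN hl).cmul (2 * (De N l)⁻¹ * (N - th N l)))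
  simp only [zero_add] at this
  exact this
lemma HP_FC {N : ℝ} (hN : 3 ≤ N) : FC (gk 0) N (HP N) (HP1 N) := hFC (by linarith)
lemma HP_sol {N : ℝ} (hN : 3 ≤ N) {l : ℂ} (hl : l ∈ Sec) : IsSol N (-2) l (HP N l) (HP1 N l) (fun _ => 0) := by
  exact hmb_isSol (r1 := N) (r2 := -2) (by linarith) hl
lemma B1_FC {N : ℝ} (hN : 3 ≤ N) : FC (gk 2) N (B1 N) (B11 N) :=
  yFC ((A1_FC hN).sc.cmul (gk_nn 1) (-2)) (by linarith) (by linarith) le_rfl (by linarith)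
lemma B1_sol {N : ℝ} (hN : 3 ≤ N) {l : ℂ} (hl : l ∈ Sec) : IsSol N (-2) l (B1 N l) (B11 N l) (fun s => -2 * A1 N l s) :=
  ySol ((A1_FC hN).sc.cmul (gk_nn 1) (-2)) (by linarith) (by linarith) hl
lemma B2_FC {N : ℝ} (hN : 3 ≤ N) : FC (gk 1) N (B2 N) (B21 N) :=
  yFC ((A2_FC hN).sc.cmul (gk_nn 0) (-2)) (by linarith) (by linarith) le_rfl (by linarith)
lemma B2_sol {N : ℝ} (hN : 3 ≤ N) {l : ℂ} (hl : l ∈ Sec) : IsSol N (-2) l (B2 N l) (B21 N l) (fun s => -2 * A2 N l s) :=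
  ySol ((A2_FC hN).sc.cmul (gk_nn 0) (-2)) (by linarith) (by linarith) hl

lemma GV_ne {N : ℝ} (hN : 3 ≤ N) {l : ℂ} (hl : l ∈ Sec) : 1 + GV N l ≠ 0 := by
  have hc : 1 ≤ cO (N + 2) 2 := by unfold cO; linarith
  have := one_add_ratio_bound hc hl
  have hr := rh_pos hl
  intro h
  rw [GV] at h
  rw [h, norm_zero] at this
  have : 0 < (1 + rh l) / (2 * (cO (N + 2) 2 + 2)) := by positivity
  linarith
lemma GV_CF {N : ℝ} (hN : 3 ≤ N) : CF (gk 1) (fun l => -(1 + GV N l)⁻¹) := by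
  have hc : 1 ≤ cO (N + 2) 2 := by unfold cO; linarith
  refine ⟨DifferentiableOn.neg (DifferentiableOn.inv (DifferentiableOn.const_add _ ?_) fun l hl => GV_ne hN hl),
    2 * (cO (N + 2) 2 + 2), fun l hl => ?_⟩
  · exact (phb1_diff_l hc 1).differentiableOn.div (phb_diff_l hc 1).differentiableOn
        fun l hl => phb_ne hc hl zero_le_one
  · have h := one_add_ratio_bound hc hl
    have hr := rh_pos hl
    rw [norm_neg, norm_inv]
    have h2 := inv_anti₀ (by positivity) h
    refine (show ‖1 + GV N l‖⁻¹ ≤ _ from h2).trans (le_of_eq ?_)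
    simp [gk]; rfl
lemma Y4A1 {N : ℝ} (hN : 3 ≤ N) : FC (gk 2) (N + 3 / 4) (Yb (N + 2) 2 (fun l s => 4 * A1 N l s)) (Yb1 (N + 2) 2 (fun l s => 4 * A1 N l s)) :=
  yFC ((A1_FC hN).sc.cmul (gk_nn 1) 4) (by linarith) (by linarith) (by linarith) (by linarith)
lemma Y4A2 {N : ℝ} (hN : 3 ≤ N) : FC (gk 1) (N + 3 / 4) (Yb (N + 2) 2 (fun l s => 4 * A2 N l s)) (Yb1 (N + 2) 2 (fun l s => 4 * A2 N l s)) :=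
  yFC ((A2_FC hN).sc.cmul (gk_nn 0) 4) (by linarith) (by linarith) (by linarith) (by linarith)
lemma g1_CF {N : ℝ} (hN : 3 ≤ N) : CF (gk 2) (g1 N) := (GV_CF hN).gmul (Y4A1 hN).cf1g rfl
lemma g2_CF {N : ℝ} (hN : 3 ≤ N) : CF (gk 1) (g2 N) := (GV_CF hN).gmul ((CF.const 1).add (Y4A2 hN).cf1g) rfl
lemma C1_FC {N : ℝ} (hN : 3 ≤ N) : FC (gk 2) (N + 3 / 4) (C1 N) (C11 N) :=
  (Y4A1 hN).add (gk_nn 2) (((hFC (by linarith)).gmul (g1_CF hN) rfl).anti le_rfl (by linarith))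
lemma C2_FC {N : ℝ} (hN : 3 ≤ N) : FC (gk 1) (N + 3 / 4) (C2 N) (C21 N) :=
  (Y4A2 hN).add (gk_nn 1) (((hFC (by linarith)).gmul (g2_CF hN) rfl).anti le_rfl (by linarith))
lemma C1_sol {N : ℝ} (hN : 3 ≤ N) {l : ℂ} (hl : l ∈ Sec) : IsSol (N + 2) 2 l (C1 N l) (C11 N l) (fun s => 4 * A1 N l s) := by
  have := (ySol (r1 := N + 2) (r2 := 2) ((A1_FC hN).sc.cmul (gk_nn 1) 4) (by linarith) (by linarith) hl).add
    ((hmb_isSol (r1 := N + 2) (r2 := 2) (by linarith) hl).cmul (g1 N l))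
  simp only [mul_zero, add_zero] at this
  exact this
lemma C2_sol {N : ℝ} (hN : 3 ≤ N) {l : ℂ} (hl : l ∈ Sec) : IsSol (N + 2) 2 l (C2 N l) (C21 N l) (fun s => 4 * A2 N l s) := by
  have := (ySol (r1 := N + 2) (r2 := 2) ((A2_FC hN).sc.cmul (gk_nn 0) 4) (by linarith) (by linarith) hl).add
    ((hmb_isSol (r1 := N + 2) (r2 := 2) (by linarith) hl).cmul (g2 N l))
  simp only [mul_zero, add_zero] at this
  exact this

lemma D0_FC {N : ℝ} (hN : 3 ≤ N) : FC (gk 1) (N - 1 / 4) (D0 N) (D01 N) :=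
  yFC ((HP_FC hN).sc.cmul (gk_nn 0) 2) (by linarith) (by linarith) (by linarith) (by linarith)
lemma D0_sol {N : ℝ} (hN : 3 ≤ N) {l : ℂ} (hl : l ∈ Sec) : IsSol N 0 l (D0 N l) (D01 N l) (fun s => 2 * HP N l s) :=
  ySol ((HP_FC hN).sc.cmul (gk_nn 0) 2) (by linarith) (by linarith) hl
lemma sD1 {N : ℝ} (hN : 3 ≤ N) : SC (gk 2) N (fun l s => 2 * B1 N l s - 2 * C1 N l s) :=
  ((B1_FC hN).sc.cmul (gk_nn 2) 2).sub (gk_nn 2) (((C1_FC hN).sc.cmul (gk_nn 2) 2).anti le_rfl (by linarith))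
lemma sD2 {N : ℝ} (hN : 3 ≤ N) : SC (gk 1) N (fun l s => 2 * B2 N l s - 2 * C2 N l s) :=
  ((B2_FC hN).sc.cmul (gk_nn 1) 2).sub (gk_nn 1) (((C2_FC hN).sc.cmul (gk_nn 1) 2).anti le_rfl (by linarith))
lemma D1_FC {N : ℝ} (hN : 3 ≤ N) : FC (gk 3) (N - 1 / 4) (D1 N) (D11 N) :=
  yFC (sD1 hN) (by linarith) (by linarith) (by linarith) (by linarith)
lemma D1_sol {N : ℝ} (hN : 3 ≤ N) {l : ℂ} (hl : l ∈ Sec) : IsSol N 0 l (D1 N l) (D11 N l) (fun s => 2 * B1 N l s - 2 * C1 N l s) :=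
  ySol (sD1 hN) (by linarith) (by linarith) hl
lemma D2_FC {N : ℝ} (hN : 3 ≤ N) : FC (gk 2) (N - 1 / 4) (D2 N) (D21 N) :=
  yFC (sD2 hN) (by linarith) (by linarith) (by linarith) (by linarith)
lemma D2_sol {N : ℝ} (hN : 3 ≤ N) {l : ℂ} (hl : l ∈ Sec) : IsSol N 0 l (D2 N l) (D21 N l) (fun s => 2 * B2 N l s - 2 * C2 N l s) :=
  ySol (sD2 hN) (by linarith) (by linarith) hl

lemma f0_CF {N : ℝ} (hN : 3 ≤ N) : CF (pw 2) (f0 N) :=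
  ((((CF.const 1).add (D0_FC hN).cf1g).topw).pmul CF.linv rfl).cmul (-1)
lemma f3_CF {N : ℝ} (hN : 3 ≤ N) : CF (pw 2) (f3 N) :=
  (((g1_CF hN).topw.add (D1_FC hN).cf1g.topw).add (f0_CF hN)).cmul _
lemma f1_CF {N : ℝ} (hN : 3 ≤ N) : CF (pw 4) (f1 N) :=
  (((f0_CF hN).add (f3_CF hN)).sub (D1_FC hN).cf1g.topw).pmul CF.linv rfl
lemma f4_CF {N : ℝ} (hN : 3 ≤ N) : CF (pw 1) (f4 N) := ((g2_CF hN).topw.add (D2_FC hN).cf1g.topw).cmul _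
lemma f2_CF {N : ℝ} (hN : 3 ≤ N) : CF (pw 3) (f2 N) := ((f4_CF hN).sub (D2_FC hN).cf1g.topw).pmul CF.linv rfl

lemma Fgen {N : ℝ} (hN : 3 ≤ N) {k : ℕ} {q : ℝ} {S : ℂ → ℝ → ℂ} (hS : SC (gk k) q S) (hq : N - 7 / 4 ≤ q) {a : ℂ → ℂ} {j : ℕ}
    (ha : CF (pw j) a) (hj : j ≤ k + 1) :
    FC (pw j) (N - 2) (fun l s => Yb (N - 2) (-2) S l s + a l * hmb (N - 2) (-2) l s)
      (fun l s => Yb1 (N - 2) (-2) S l s + a l * hmb1 (N - 2) (-2) l s) ∧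
    ∀ l ∈ Sec, IsSol (N - 2) (-2) l (fun s => Yb (N - 2) (-2) S l s + a l * hmb (N - 2) (-2) l s)
      (fun s => Yb1 (N - 2) (-2) S l s + a l * hmb1 (N - 2) (-2) l s) (S l) := by
  constructor
  · refine FC.add (pw_nn j) ?_ ((hFC (by linarith)).pmul ha)
    exact ((yFC hS (by linarith) (by linarith) le_rfl (by linarith)).anti hj le_rfl).topw le_rfl
  · intro l hl
    have := (ySol (r1 := N - 2) (r2 := -2) hS (by linarith) (by linarith) hl).add
      ((hmb_isSol (r1 := N - 2) (r2 := -2) (by linarith) hl).cmul (a l))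
    simpa using this
lemma F0_P {N : ℝ} (hN : 3 ≤ N) : FC (pw 2) (N - 2) (F0 N) (F01 N) ∧ ∀ l ∈ Sec, IsSol (N - 2) (-2) l (F0 N l) (F01 N l) (fun s => -2 * D0 N l s) :=
  Fgen hN ((D0_FC hN).sc.cmul (gk_nn _) (-2)) (by linarith) (f0_CF hN) (by norm_num)
lemma F1_P {N : ℝ} (hN : 3 ≤ N) : FC (pw 4) (N - 2) (F1 N) (F11 N) ∧ ∀ l ∈ Sec, IsSol (N - 2) (-2) l (F1 N l) (F11 N l) (fun s => -4 * D1 N l s) :=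
  Fgen hN ((D1_FC hN).sc.cmul (gk_nn _) (-4)) (by linarith) (f1_CF hN) (by norm_num)
lemma F2_P {N : ℝ} (hN : 3 ≤ N) : FC (pw 3) (N - 2) (F2 N) (F21 N) ∧ ∀ l ∈ Sec, IsSol (N - 2) (-2) l (F2 N l) (F21 N l) (fun s => -4 * D2 N l s) :=
  Fgen hN ((D2_FC hN).sc.cmul (gk_nn _) (-4)) (by linarith) (f2_CF hN) (by norm_num)
lemma F3_P {N : ℝ} (hN : 3 ≤ N) : FC (pw 2) (N - 2) (F3 N) (F31 N) ∧ ∀ l ∈ Sec, IsSol (N - 2) (-2) l (F3 N l) (F31 N l)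
    (fun s => -2 * (((s : ℂ) ^ 2)⁻¹ * C1 N l s)) :=
  Fgen hN ((C1_FC hN).sc.sinv.cmul (gk_nn _) (-2)) (by linarith) (f3_CF hN) (by norm_num)
lemma F4_P {N : ℝ} (hN : 3 ≤ N) : FC (pw 1) (N - 2) (F4 N) (F41 N) ∧ ∀ l ∈ Sec, IsSol (N - 2) (-2) l (F4 N l) (F41 N l)
    (fun s => -2 * (((s : ℂ) ^ 2)⁻¹ * C2 N l s)) :=
  Fgen hN ((C2_FC hN).sc.sinv.cmul (gk_nn _) (-2)) (by linarith) (f4_CF hN) (by norm_num)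
end Sy

namespace Sy

lemma fdec {W : ℝ → ℝ} {q q' : ℝ} {m m1 : ℂ → ℝ → ℂ} (h : FC W q m m1) (hW : ∀ r > 0, 0 ≤ W r) (hq : q' ≤ q)
    {l : ℂ} (hl : l ∈ Sec) : Dec q' (m l) ∧ Dec q' (m1 l) :=
  ⟨(h.bd.dec hW hl).mono hq, (h.bd1.dec (fun r hr => mul_nonneg (by linarith) (hW r hr)) hl).mono hq⟩

lemma A1_at {N : ℝ} (l : ℂ) : A1 N l 1 = 0 := by simp [A1, td, Yb_one]
lemma A2_at {N : ℝ} (hN : 3 ≤ N) {l : ℂ} (hl : l ∈ Sec) : A2 N l 1 = 1 := by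
  simp [A2, td, Yb_one, hmb_one (show (0:ℝ) ≤ N + 2 by linarith) hl]
lemma HP_at {N : ℝ} (hN : 3 ≤ N) {l : ℂ} (hl : l ∈ Sec) : HP N l 1 = 1 := hmb_one (by linarith) hl
lemma B1_at {N : ℝ} (l : ℂ) : B1 N l 1 = 0 := Yb_one ..
lemma B2_at {N : ℝ} (l : ℂ) : B2 N l 1 = 0 := Yb_one ..
lemma D0_at {N : ℝ} (l : ℂ) : D0 N l 1 = 0 := Yb_one ..
lemma D1_at {N : ℝ} (l : ℂ) : D1 N l 1 = 0 := Yb_one ..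
lemma D2_at {N : ℝ} (l : ℂ) : D2 N l 1 = 0 := Yb_one ..
lemma F_at {N : ℝ} (hN : 3 ≤ N) {l : ℂ} (hl : l ∈ Sec) : F0 N l 1 = f0 N l ∧ F1 N l 1 = f1 N l ∧ F2 N l 1 = f2 N l ∧
    F3 N l 1 = f3 N l ∧ F4 N l 1 = f4 N l := by
  have := hmb_one (r1 := N - 2) (r2 := -2) (by linarith) hl
  simp [F0, F1, F2, F3, F4, Yb_one, this]
lemma C_at {N : ℝ} (hN : 3 ≤ N) {l : ℂ} (hl : l ∈ Sec) : C1 N l 1 = g1 N l ∧ C2 N l 1 = g2 N l := by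
  have := hmb_one (r1 := N + 2) (r2 := 2) (by linarith) hl
  simp [C1, C2, Yb_one, this]

lemma T1 {N : ℝ} (hN : 3 ≤ N) {l : ℂ} (hl : l ∈ Sec) : ∀ s > (0:ℝ),
    (N : ℂ) * A1 N l s - A11 N l s + s ^ 2 * (HP N l s - l * B1 N l s) - (De N l)⁻¹ * dd N l s = 0 := by
  have hk := kap_ge hN
  have ke : (kap N : ℂ) * kap N = N * kap N + 2 * N := by exact_mod_cast kap_eq hN
  obtain ⟨a0, a1⟩ := fdec (q' := 1) (A1_FC hN) (gk_nn _) (by linarith) hl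
  obtain ⟨b0, b1⟩ := fdec (q' := 1) (B1_FC hN) (gk_nn _) (by linarith) hl
  obtain ⟨p0, p1⟩ := fdec (q' := 1) (HP_FC hN) (gk_nn _) (by linarith) hl
  obtain ⟨d0, d1⟩ := fdec (q' := 1) (dd_FC hN) (gk_nn _) (by linarith) hl
  have td := (((((A1_sol hN hl).td a0 a1).cmul (N:ℂ)).sub
    ((A1_sol hN hl).td1 (S1 := fun s => 2 * (De N l)⁻¹ * dd1 N l s) a0 a1 (d0.cmul _)
      (fun s hs => ((dd_sol hN hl s hs).1.const_mul _).congr_deriv (by ring)))).add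
    ((((HP_sol hN hl).td p0 p1).sub (((B1_sol hN hl).td b0 b1).cmul l)).sq)).sub
    (((dd_sol hN hl).td d0 d1).cmul ((De N l)⁻¹))
  have := td.zero (r1 := N + 2) (r2 := 0) (by linarith) hl (by norm_num) ?_ ?_
  · exact fun s hs => (this s hs).1
  · have hD := De_ne hN hl
    have hd : dd N l 1 = 1 := hmb_one (by linarith) hl
    simp only [A1_at, HP_at hN hl, B1_at, A11, hd]
    have : td1 N l 1 = (De N l - 1) / 2 := by simp [De]
    rw [this]
    field_simp
    push_cast
    ring
  · intro s hs
    push_cast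
    linear_combination (De N l)⁻¹ * dd N l s * -ke

lemma T2 {N : ℝ} (hN : 3 ≤ N) {l : ℂ} (hl : l ∈ Sec) : ∀ s > (0:ℝ),
    (N : ℂ) * A2 N l s - A21 N l s + s ^ 2 * (- l * B2 N l s) - ((De N l)⁻¹ * (N - th N l)) * dd N l s = 0 := by
  have hk := kap_ge hN
  have ke : (kap N : ℂ) * kap N = N * kap N + 2 * N := by exact_mod_cast kap_eq hN
  obtain ⟨a0, a1⟩ := fdec (q' := 1) (A2_FC hN) (gk_nn _) (by linarith) hl
  obtain ⟨b0, b1⟩ := fdec (q' := 1) (B2_FC hN) (gk_nn _) (by linarith) hl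
  obtain ⟨d0, d1⟩ := fdec (q' := 1) (dd_FC hN) (gk_nn _) (by linarith) hl
  have td := (((((A2_sol hN hl).td a0 a1).cmul (N:ℂ)).sub
    ((A2_sol hN hl).td1 (S1 := fun s => 2 * (De N l)⁻¹ * (N - th N l) * dd1 N l s) a0 a1 (d0.cmul _)
      (fun s hs => ((dd_sol hN hl s hs).1.const_mul _).congr_deriv (by ring)))).add
    ((((B2_sol hN hl).td b0 b1).cmul (-l)).sq)).sub
    (((dd_sol hN hl).td d0 d1).cmul ((De N l)⁻¹ * (N - th N l)))
  have := td.zero (r1 := N + 2) (r2 := 0) (by linarith) hl (by norm_num) ?_ ?_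
  · exact fun s hs => (this s hs).1
  · have hD := De_ne hN hl
    have hd : dd N l 1 = 1 := hmb_one (by linarith) hl
    simp only [A2_at hN hl, B2_at, A21, hd]
    have : td1 N l 1 = (De N l - 1) / 2 := by simp [De]
    have e2 : hmb1 (N + 2) 0 l 1 = th N l := rfl
    rw [this, e2]
    field_simp
    push_cast
    ring
  · intro s hs
    push_cast
    linear_combination (De N l)⁻¹ * (N - th N l) * dd N l s * -ke

lemma N01 {N : ℝ} (hN : 3 ≤ N) {l : ℂ} (hl : l ∈ Sec) : ∀ s > (0:ℝ),
    (s:ℂ) ^ 2 * (D0 N l s - l * D1 N l s) - C11 N l s + (N + 1) * C1 N l s - A1 N l s = 0 := by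
  obtain ⟨a0, a1⟩ := fdec (q' := 5 / 2) (A1_FC hN) (gk_nn _) (by linarith) hl
  obtain ⟨c0, c1⟩ := fdec (q' := 5 / 2) (C1_FC hN) (gk_nn _) (by linarith) hl
  obtain ⟨d0, d1⟩ := fdec (q' := 5 / 2) (D0_FC hN) (gk_nn _) (by linarith) hl
  obtain ⟨e0, e1⟩ := fdec (q' := 5 / 2) (D1_FC hN) (gk_nn _) (by linarith) hl
  have td := (((((D0_sol hN hl).td d0 d1).sub (((D1_sol hN hl).td e0 e1).cmul l)).sq.sub
    ((C1_sol hN hl).td1 (S1 := fun s => 4 * A11 N l s) c0 c1 (a0.cmul _)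
      (fun s hs => ((A1_sol hN hl s hs).1.const_mul _).congr_deriv (by ring)))).add
    (((C1_sol hN hl).td c0 c1).cmul ((N:ℂ) + 1))).sub
    ((A1_sol hN hl).td a0 a1)
  have := td.zero (r1 := N + 2) (r2 := 2) (by linarith) hl (by norm_num) ?_ ?_
  · exact fun s hs => (this s hs).1
  · have hG := GV_ne hN hl
    have h1 : hmb1 (N + 2) 2 l 1 = ((N + 2 : ℝ):ℂ) + GV N l := hmb1_one (by linarith) hl
    simp only [D0_at, D1_at, A1_at, (C_at hN hl).1, C11, h1, g1]
    field_simp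
    push_cast
    ring
  · intro s hs
    have := T1 hN hl s hs
    push_cast
    linear_combination 2 * this

lemma N02 {N : ℝ} (hN : 3 ≤ N) {l : ℂ} (hl : l ∈ Sec) : ∀ s > (0:ℝ),
    (s:ℂ) ^ 2 * (- l * D2 N l s) - C21 N l s + (N + 1) * C2 N l s - A2 N l s = 0 := by
  obtain ⟨a0, a1⟩ := fdec (q' := 5 / 2) (A2_FC hN) (gk_nn _) (by linarith) hl
  obtain ⟨c0, c1⟩ := fdec (q' := 5 / 2) (C2_FC hN) (gk_nn _) (by linarith) hl
  obtain ⟨e0, e1⟩ := fdec (q' := 5 / 2) (D2_FC hN) (gk_nn _) (by linarith) hl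
  have td := (((((D2_sol hN hl).td e0 e1).cmul (-l)).sq.sub
    ((C2_sol hN hl).td1 (S1 := fun s => 4 * A21 N l s) c0 c1 (a0.cmul _)
      (fun s hs => ((A2_sol hN hl s hs).1.const_mul _).congr_deriv (by ring)))).add
    (((C2_sol hN hl).td c0 c1).cmul ((N:ℂ) + 1))).sub
    ((A2_sol hN hl).td a0 a1)
  have := td.zero (r1 := N + 2) (r2 := 2) (by linarith) hl (by norm_num) ?_ ?_
  · exact fun s hs => (this s hs).1
  · have hG := GV_ne hN hl
    have h1 : hmb1 (N + 2) 2 l 1 = ((N + 2 : ℝ):ℂ) + GV N l := hmb1_one (by linarith) hl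
    simp only [D2_at, A2_at hN hl, (C_at hN hl).2, C21, h1, g2]
    field_simp
    push_cast
    ring
  · intro s hs
    have := T2 hN hl s hs
    push_cast
    linear_combination 2 * this

lemma W1 {N : ℝ} (hN : 3 ≤ N) {l : ℂ} (hl : l ∈ Sec) : ∀ s > (0:ℝ),
    (s:ℂ) ^ 2 * (- l * F0 N l s) + N * D0 N l s - D01 N l s - HP N l s = 0 := by
  obtain ⟨a0, a1⟩ := fdec (q' := 1) (F0_P hN).1 (pw_nn _) (by linarith) hl
  obtain ⟨d0, d1⟩ := fdec (q' := 1) (D0_FC hN) (gk_nn _) (by linarith) hl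
  obtain ⟨e0, e1⟩ := fdec (q' := 1) (HP_FC hN) (gk_nn _) (by linarith) hl
  have td := (((((((F0_P hN).2 l hl).td a0 a1).cmul (-l)).sq.add (((D0_sol hN hl).td d0 d1).cmul (N:ℂ))).sub
    ((D0_sol hN hl).td1 (S1 := fun s => 2 * HP1 N l s) d0 d1 (e0.cmul _)
      (fun s hs => ((HP_sol hN hl s hs).1.const_mul _).congr_deriv (by ring)))).sub
    ((HP_sol hN hl).td e0 e1))
  have := td.zero (r1 := N) (r2 := 0) (by linarith) hl (by norm_num) ?_ ?_
  · exact fun s hs => (this s hs).1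
  · have hl0 := sec_ne hl
    simp only [D0_at, HP_at hN hl, (F_at hN hl).1, f0]
    field_simp
    push_cast
    ring
  · intro s hs
    push_cast
    ring

lemma W2 {N : ℝ} (hN : 3 ≤ N) {l : ℂ} (hl : l ∈ Sec) : ∀ s > (0:ℝ),
    (s:ℂ) ^ 2 * (F0 N l s - l * F1 N l s + F3 N l s) + N * D1 N l s - D11 N l s - B1 N l s = 0 := by
  obtain ⟨a0, a1⟩ := fdec (q' := 1) (F0_P hN).1 (pw_nn _) (by linarith) hl
  obtain ⟨a0', a1'⟩ := fdec (q' := 1) (F1_P hN).1 (pw_nn _) (by linarith) hl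
  obtain ⟨a0'', a1''⟩ := fdec (q' := 1) (F3_P hN).1 (pw_nn _) (by linarith) hl
  obtain ⟨d0, d1⟩ := fdec (q' := 1) (D1_FC hN) (gk_nn _) (by linarith) hl
  obtain ⟨e0, e1⟩ := fdec (q' := 1) (B1_FC hN) (gk_nn _) (by linarith) hl
  obtain ⟨c0, c1⟩ := fdec (q' := 1) (C1_FC hN) (gk_nn _) (by linarith) hl
  have td := ((((((((F0_P hN).2 l hl).td a0 a1).sub ((((F1_P hN).2 l hl).td a0' a1').cmul l)).add
    (((F3_P hN).2 l hl).td a0'' a1'')).sq).add (((D1_sol hN hl).td d0 d1).cmul (N:ℂ))).sub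
    ((D1_sol hN hl).td1 (S1 := fun s => 2 * B11 N l s - 2 * C11 N l s) d0 d1 ((e0.cmul _).sub (c0.cmul _))
      (fun s hs => (((B1_sol hN hl s hs).1.const_mul _).sub ((C1_sol hN hl s hs).1.const_mul _)).congr_deriv (by ring)))).sub
    ((B1_sol hN hl).td e0 e1)
  have := td.zero (r1 := N) (r2 := 0) (by linarith) hl (by norm_num) ?_ ?_
  · exact fun s hs => (this s hs).1
  · have hl0 := sec_ne hl
    obtain ⟨i0, i1, i2, i3, i4⟩ := F_at hN hl
    simp only [D1_at, B1_at, i0, i1, i3, f1]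
    field_simp
    push_cast
    ring
  · intro s hs
    have := N01 hN hl s hs
    have hs' : (s : ℂ) ≠ 0 := by exact_mod_cast hs.ne'
    have e : (s:ℂ) ^ 2 * (((s:ℂ) ^ 2)⁻¹ * C1 N l s) = C1 N l s := by field_simp
    push_cast
    linear_combination -2 * this - 2 * e

lemma W3 {N : ℝ} (hN : 3 ≤ N) {l : ℂ} (hl : l ∈ Sec) : ∀ s > (0:ℝ),
    (s:ℂ) ^ 2 * (F4 N l s - l * F2 N l s) + N * D2 N l s - D21 N l s - B2 N l s = 0 := by
  obtain ⟨a0, a1⟩ := fdec (q' := 1) (F4_P hN).1 (pw_nn _) (by linarith) hl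
  obtain ⟨a0', a1'⟩ := fdec (q' := 1) (F2_P hN).1 (pw_nn _) (by linarith) hl
  obtain ⟨d0, d1⟩ := fdec (q' := 1) (D2_FC hN) (gk_nn _) (by linarith) hl
  obtain ⟨e0, e1⟩ := fdec (q' := 1) (B2_FC hN) (gk_nn _) (by linarith) hl
  obtain ⟨c0, c1⟩ := fdec (q' := 1) (C2_FC hN) (gk_nn _) (by linarith) hl
  have td := (((((((F4_P hN).2 l hl).td a0 a1).sub ((((F2_P hN).2 l hl).td a0' a1').cmul l)).sq).add
    (((D2_sol hN hl).td d0 d1).cmul (N:ℂ))).sub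
    ((D2_sol hN hl).td1 (S1 := fun s => 2 * B21 N l s - 2 * C21 N l s) d0 d1 ((e0.cmul _).sub (c0.cmul _))
      (fun s hs => (((B2_sol hN hl s hs).1.const_mul _).sub ((C2_sol hN hl s hs).1.const_mul _)).congr_deriv (by ring)))).sub
    ((B2_sol hN hl).td e0 e1)
  have := td.zero (r1 := N) (r2 := 0) (by linarith) hl (by norm_num) ?_ ?_
  · exact fun s hs => (this s hs).1
  · have hl0 := sec_ne hl
    obtain ⟨i0, i1, i2, i3, i4⟩ := F_at hN hl
    simp only [D2_at, B2_at, i2, i4, f2]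
    field_simp
    push_cast
    ring
  · intro s hs
    have := N02 hN hl s hs
    have hs' : (s : ℂ) ≠ 0 := by exact_mod_cast hs.ne'
    have e : (s:ℂ) ^ 2 * (((s:ℂ) ^ 2)⁻¹ * C2 N l s) = C2 N l s := by field_simp
    push_cast
    linear_combination -2 * this - 2 * e

lemma W4 {N : ℝ} (hN : 3 ≤ N) {l : ℂ} (hl : l ∈ Sec) : ∀ s > (0:ℝ),
    (s:ℂ) ^ 2 * (2 * F0 N l s - l * F1 N l s + N * F3 N l s) + C1 N l s = 0 := by
  obtain ⟨a0, a1⟩ := fdec (q' := 1) (F0_P hN).1 (pw_nn _) (by linarith) hl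
  obtain ⟨a0', a1'⟩ := fdec (q' := 1) (F1_P hN).1 (pw_nn _) (by linarith) hl
  obtain ⟨a0'', a1''⟩ := fdec (q' := 1) (F3_P hN).1 (pw_nn _) (by linarith) hl
  obtain ⟨c0, c1⟩ := fdec (q' := 1) (C1_FC hN) (gk_nn _) (by linarith) hl
  have td := (((((((F0_P hN).2 l hl).td a0 a1).cmul 2).sub ((((F1_P hN).2 l hl).td a0' a1').cmul l)).add
    ((((F3_P hN).2 l hl).td a0'' a1'').cmul (N:ℂ))).sq).add ((C1_sol hN hl).td c0 c1)
  have := td.zero (r1 := N) (r2 := 0) (by linarith) hl (by norm_num) ?_ ?_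
  · exact fun s hs => (this s hs).1
  · have hl0 := sec_ne hl
    have hn1 : (N:ℂ) - 1 ≠ 0 := by
      have : N - 1 ≠ 0 := by linarith
      exact_mod_cast this
    obtain ⟨i0, i1, i2, i3, i4⟩ := F_at hN hl
    have e3 : ((N:ℂ) - 1) * f3 N l = -(g1 N l + D11 N l 1 + f0 N l) := by rw [f3]; field_simp
    have e1 : l * f1 N l = f0 N l + f3 N l - D11 N l 1 := by rw [f1]; field_simp
    simp only [(C_at hN hl).1, i0, i1, i3]
    push_cast
    linear_combination e3 - e1
  · intro s hs
    have := N01 hN hl s hs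
    have hs' : (s : ℂ) ≠ 0 := by exact_mod_cast hs.ne'
    have e : (s:ℂ) ^ 2 * (((s:ℂ) ^ 2)⁻¹ * C1 N l s) = C1 N l s := by field_simp
    push_cast
    linear_combination -4 * this - 2 * N * e

lemma W5 {N : ℝ} (hN : 3 ≤ N) {l : ℂ} (hl : l ∈ Sec) : ∀ s > (0:ℝ),
    (s:ℂ) ^ 2 * (N * F4 N l s - l * F2 N l s) + C2 N l s = 0 := by
  obtain ⟨a0, a1⟩ := fdec (q' := 1) (F4_P hN).1 (pw_nn _) (by linarith) hl
  obtain ⟨a0', a1'⟩ := fdec (q' := 1) (F2_P hN).1 (pw_nn _) (by linarith) hl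
  obtain ⟨c0, c1⟩ := fdec (q' := 1) (C2_FC hN) (gk_nn _) (by linarith) hl
  have td := ((((((F4_P hN).2 l hl).td a0 a1).cmul (N:ℂ)).sub ((((F2_P hN).2 l hl).td a0' a1').cmul l)).sq).add
    ((C2_sol hN hl).td c0 c1)
  have := td.zero (r1 := N) (r2 := 0) (by linarith) hl (by norm_num) ?_ ?_
  · exact fun s hs => (this s hs).1
  · have hl0 := sec_ne hl
    have hn1 : (N:ℂ) - 1 ≠ 0 := by
      have : N - 1 ≠ 0 := by linarith
      exact_mod_cast this
    obtain ⟨i0, i1, i2, i3, i4⟩ := F_at hN hl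
    have e3 : ((N:ℂ) - 1) * f4 N l = -(g2 N l + D21 N l 1) := by rw [f4]; field_simp
    have e1 : l * f2 N l = f4 N l - D21 N l 1 := by rw [f2]; field_simp
    simp only [(C_at hN hl).2, i2, i4]
    push_cast
    linear_combination e3 - e1
  · intro s hs
    have := N02 hN hl s hs
    have hs' : (s : ℂ) ≠ 0 := by exact_mod_cast hs.ne'
    have e : (s:ℂ) ^ 2 * (((s:ℂ) ^ 2)⁻¹ * C2 N l s) = C2 N l s := by field_simp
    push_cast
    linear_combination -4 * this - 2 * N * e
end Sy

/-- Horizontal contour shift. -/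
lemma contour_shift {H : ℂ → ℂ} {θ K c : ℝ} (hc : 0 < c)
    (hd : DifferentiableOn ℂ H {w | w.im ∈ uIcc 0 θ})
    (hb : ∀ u : ℝ, ∀ τ ∈ uIcc 0 θ, ‖H (u + τ * Complex.I)‖ ≤ K * Real.exp (-c * u ^ 2)) :
    ∫ u : ℝ, H u = ∫ u : ℝ, H (u + θ * Complex.I) := by
  have hg : Integrable (fun u : ℝ => K * Real.exp (-c * u ^ 2)) := (integrable_exp_neg_mul_sq hc).const_mul K
  have hcont : ∀ τ ∈ uIcc 0 θ, Continuous fun u : ℝ => H (u + τ * Complex.I) := by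
    intro τ hτ
    refine hd.continuousOn.comp_continuous (by fun_prop) (fun u => ?_)
    simpa using hτ
  have hIn : ∀ τ ∈ uIcc 0 θ, Integrable fun u : ℝ => H (u + τ * Complex.I) := fun τ hτ =>
    hg.mono' (hcont τ hτ).aestronglyMeasurable (Filter.Eventually.of_forall fun u => hb u τ hτ)
  have h0 : (0:ℝ) ∈ uIcc 0 θ := left_mem_uIcc
  have h1 : θ ∈ uIcc 0 θ := right_mem_uIcc
  have t0 := intervalIntegral_tendsto_integral (hIn 0 h0) Filter.tendsto_neg_atTop_atBot Filter.tendsto_id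
  have t1 := intervalIntegral_tendsto_integral (hIn θ h1) Filter.tendsto_neg_atTop_atBot Filter.tendsto_id
  have hz : Filter.Tendsto (fun R : ℝ => K * Real.exp (-c * R ^ 2) * |θ - 0|) Filter.atTop (𝓝 0) := by
    have : Filter.Tendsto (fun R : ℝ => Real.exp (-c * R ^ 2)) Filter.atTop (𝓝 0) := by
      apply Real.tendsto_exp_atBot.comp
      have h2 : Filter.Tendsto (fun R : ℝ => R ^ 2) Filter.atTop Filter.atTop :=
        Filter.tendsto_pow_atTop two_ne_zero
      exact h2.const_mul_atTop_of_neg (by linarith)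
    simpa using (this.const_mul K).mul_const |θ - 0|
  have s1 : Filter.Tendsto (fun R : ℝ => ∫ y in (0:ℝ)..θ, H (R + y * Complex.I)) Filter.atTop (𝓝 0) := by
    apply squeeze_zero_norm (fun R => ?_) hz
    apply intervalIntegral.norm_integral_le_of_norm_le_const
    intro y hy
    exact hb R y (uIoc_subset_uIcc hy)
  have s2 : Filter.Tendsto (fun R : ℝ => ∫ y in (0:ℝ)..θ, H ((-R : ℝ) + y * Complex.I)) Filter.atTop (𝓝 0) := by
    apply squeeze_zero_norm (fun R => ?_) hz
    apply intervalIntegral.norm_integral_le_of_norm_le_const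
    intro y hy
    have := hb (-R) y (uIoc_subset_uIcc hy)
    simpa using this
  have key : ∀ R : ℝ, (∫ u in (-R)..R, H (u + (0:ℝ) * Complex.I)) - (∫ u in (-R)..R, H (u + θ * Complex.I))
      + Complex.I • (∫ y in (0:ℝ)..θ, H (R + y * Complex.I)) - Complex.I • (∫ y in (0:ℝ)..θ, H ((-R : ℝ) + y * Complex.I)) = 0 := by
    intro R
    have := Complex.integral_boundary_rect_eq_zero_of_differentiableOn H (⟨-R, 0⟩ : ℂ) (⟨R, θ⟩ : ℂ) (hd.mono ?_)
    · simpa using this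
    · intro w hw
      exact hw.2
  have lim := ((t0.sub t1).add (s1.const_smul Complex.I)).sub (s2.const_smul Complex.I)
  have lim2 := lim.congr (fun R => by simpa using key R)
  have := tendsto_nhds_unique lim2 tendsto_const_nhds
  simp only [smul_zero, add_zero, sub_zero, Complex.ofReal_zero, zero_mul] at this
  exact sub_eq_zero.1 this

lemma sinh_cov {F : Type*} [NormedAddCommGroup F] [NormedSpace ℝ F] (f : ℝ → F) {a : ℝ} (ha : 0 < a) :
    ∫ σ, f σ = ∫ u : ℝ, (a * Real.cosh u) • f (a * Real.sinh u) := by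
  have hd : ∀ u ∈ (univ : Set ℝ), HasDerivWithinAt (fun u => a * Real.sinh u) (a * Real.cosh u) univ u := fun u _ =>
    ((Real.hasDerivAt_sinh u).const_mul a).hasDerivWithinAt
  have hi : InjOn (fun u => a * Real.sinh u) univ := by
    intro u _ v _ h
    have : Real.sinh u = Real.sinh v := by
      simpa [ha.ne'] using h
    exact Real.sinh_injective this
  have := integral_image_eq_integral_abs_deriv_smul MeasurableSet.univ hd hi f
  have hs : (fun u => a * Real.sinh u) '' univ = univ := by
    rw [image_univ, Set.range_eq_univ]
    intro y
    obtain ⟨u, hu⟩ := Real.sinh_surjective (y / a)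
    exact ⟨u, by simp only [hu]; field_simp⟩
  rw [hs, setIntegral_univ, setIntegral_univ] at this
  rw [this]
  congr 1 with u
  rw [abs_of_pos (mul_pos ha (Real.cosh_pos u))]

lemma trig_small {τ : ℝ} (h : |τ| ≤ 1 / 4) : 31 / 32 ≤ Real.cos τ ∧ |Real.sin τ| ≤ 1 / 4 := by
  have h1 := Real.one_sub_sq_div_two_le_cos (x := τ)
  have h2 : τ ^ 2 ≤ (1/4) ^ 2 := by rw [← sq_abs]; gcongr
  refine ⟨by nlinarith, (Real.abs_sin_le_abs (x := τ)).trans h⟩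

lemma cosh_re_im (u τ : ℝ) : (Complex.cosh (u + τ * Complex.I)) = ⟨Real.cosh u * Real.cos τ, Real.sinh u * Real.sin τ⟩ := by
  rw [Complex.cosh_add, Complex.cosh_mul_I, Complex.sinh_mul_I]
  apply Complex.ext
  · simp [← Complex.ofReal_cosh, ← Complex.ofReal_sinh, ← Complex.ofReal_cos, ← Complex.ofReal_sin]
  · simp [← Complex.ofReal_cosh, ← Complex.ofReal_sinh, ← Complex.ofReal_cos, ← Complex.ofReal_sin]

lemma sinh_re_im (u τ : ℝ) : (Complex.sinh (u + τ * Complex.I)) = ⟨Real.sinh u * Real.cos τ, Real.cosh u * Real.sin τ⟩ := by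
  rw [Complex.sinh_add, Complex.cosh_mul_I, Complex.sinh_mul_I]
  apply Complex.ext
  · simp [← Complex.ofReal_cosh, ← Complex.ofReal_sinh, ← Complex.ofReal_cos, ← Complex.ofReal_sin]
  · simp [← Complex.ofReal_cosh, ← Complex.ofReal_sinh, ← Complex.ofReal_cos, ← Complex.ofReal_sin]

lemma abs_sinh_le (u : ℝ) : |Real.sinh u| ≤ Real.cosh u := by
  apply abs_le_of_sq_le_sq _ (Real.cosh_pos u).le
  rw [Real.cosh_sq]; linarith

lemma norm_sinh_le (u τ : ℝ) : ‖Complex.sinh (u + τ * Complex.I)‖ ≤ Real.cosh u := by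
  rw [Complex.norm_def, sinh_re_im]
  apply Real.sqrt_le_iff.2 ⟨(Real.cosh_pos u).le, ?_⟩
  rw [Complex.normSq_mk]
  have h := Real.sin_sq_add_cos_sq τ
  have h2 := Real.cosh_sq u
  nlinarith [sq_nonneg (Real.cos τ), sq_nonneg (Real.sin τ), sq_nonneg (Real.sinh u)]

lemma norm_cosh_le (u τ : ℝ) : ‖Complex.cosh (u + τ * Complex.I)‖ ≤ Real.cosh u := by
  rw [Complex.norm_def, cosh_re_im]
  apply Real.sqrt_le_iff.2 ⟨(Real.cosh_pos u).le, ?_⟩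
  rw [Complex.normSq_mk]
  have h := Real.sin_sq_add_cos_sq τ
  have h2 := Real.cosh_sq u
  nlinarith [sq_nonneg (Real.cos τ), sq_nonneg (Real.sin τ), sq_nonneg (Real.sinh u)]

lemma norm_cosh_ge {u τ : ℝ} (h : |τ| ≤ 1 / 4) : Real.cosh u / 2 ≤ ‖Complex.cosh (u + τ * Complex.I)‖ := by
  refine le_trans ?_ (Complex.abs_re_le_norm _)
  rw [cosh_re_im]
  refine le_trans ?_ (le_abs_self _)
  have := (trig_small h).1
  have := Real.cosh_pos u
  simp only
  nlinarith

lemma cosh_sq_sec {a u τ : ℝ} (ha : 0 < a) (h : |τ| ≤ 1 / 4) :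
    (4 * π ^ 2 * a ^ 2 : ℝ) * Complex.cosh (u + τ * Complex.I) ^ 2 ∈ Sec := by
  have h1 := trig_small h
  have h2 := Real.cosh_pos u
  have h3 := abs_sinh_le u
  have h4 := Real.cos_le_one τ
  set x := Real.cosh u * Real.cos τ
  set y := Real.sinh u * Real.sin τ with hy
  have hx1 : x ≤ Real.cosh u := by simp only [x]; nlinarith
  have hx2 : 31/32 * Real.cosh u ≤ x := by simp only [x]; nlinarith
  have hy1 : |y| ≤ Real.cosh u / 4 := by
    rw [hy, abs_mul]
    calc _ ≤ Real.cosh u * (1/4) := by gcongr; exact h1.2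
      _ = _ := by ring
  have hP : 0 < 4 * π ^ 2 * a ^ 2 := by positivity
  rw [cosh_re_im]
  show |((_ : ℂ)).im| < ((_ : ℂ)).re
  rw [Complex.re_ofReal_mul, Complex.im_ofReal_mul, abs_mul, abs_of_pos hP]
  apply mul_lt_mul_of_pos_left _ hP
  have e1 : ((⟨x, y⟩ : ℂ) ^ 2).re = x ^ 2 - y ^ 2 := by simp [sq]
  have e2 : ((⟨x, y⟩ : ℂ) ^ 2).im = 2 * x * y := by simp [sq]; ring
  rw [e1, e2, abs_mul, abs_mul, abs_of_pos (by linarith : 0 < x), abs_two]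
  have : y ^ 2 ≤ (Real.cosh u / 4) ^ 2 := by rw [← sq_abs]; gcongr
  nlinarith [abs_nonneg y]

lemma rh_cosh {a : ℝ} (ha : 0 < a) (w : ℂ) :
    rh ((4 * π ^ 2 * a ^ 2 : ℝ) * Complex.cosh w ^ 2) = 2 * π * a * ‖Complex.cosh w‖ := by
  unfold rh
  rw [norm_mul, norm_pow, Complex.norm_real, Real.norm_of_nonneg (by positivity)]
  rw [show 4 * π ^ 2 * a ^ 2 * ‖Complex.cosh w‖ ^ 2 = (2 * π * a * ‖Complex.cosh w‖) ^ 2 by ring]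
  exact Real.sqrt_sq (by positivity)

abbrev EE (n : ℕ) := EuclideanSpace ℝ (Fin n)

/-- `4π²|ξ|²` -/
def lam {n : ℕ} (ξ : EE n) : ℂ := ((4 * π ^ 2 * ‖ξ‖ ^ 2 : ℝ) : ℂ)
/-- `2πiξ_j` -/
def zz {n : ℕ} (ξ : EE n) (j : Fin n) : ℂ := 2 * π * Complex.I * (ξ j : ℂ)
def zmon {n : ℕ} (p : List (Fin n)) (ξ : EE n) : ℂ := (p.map (zz ξ)).prod
def ee {n : ℕ} (x ξ : EE n) : ℂ := Complex.exp (2 * π * Complex.I * ((∑ j, x j * ξ j : ℝ) : ℂ))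

/-- complexified integrand -/
def Gc {n : ℕ} (m : ℂ → ℂ) (p : List (Fin n)) (x : EE n) (ζ : Fin n → ℂ) : ℂ :=
  Complex.exp (2 * π * Complex.I * (∑ j, (x j : ℂ) * ζ j)) * (p.map fun j => 2 * π * Complex.I * ζ j).prod
    * m (4 * π ^ 2 * ∑ j, ζ j ^ 2)

lemma Gc_real {n : ℕ} (m : ℂ → ℂ) (p : List (Fin n)) (x ξ : EE n) :
    Gc m p x (fun j => (ξ j : ℂ)) = ee x ξ * zmon p ξ * m (lam ξ) := by
  unfold Gc ee zmon zz lam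
  congr 2
  · push_cast; rfl
  · rw [EuclideanSpace.norm_sq_eq]; push_cast
    congr 2; ext j
    rw [← Complex.ofReal_pow, ← Complex.ofReal_pow, Real.norm_eq_abs, sq_abs]

lemma list_prod_diff {ι : Type*} (p : List ι) {f : ι → ℂ → ℂ} (hf : ∀ j, Differentiable ℂ (f j)) :
    Differentiable ℂ (fun w => (p.map fun j => f j w).prod) := by
  induction p with
  | nil => simp
  | cons a p ih => simp only [List.map_cons, List.prod_cons]; exact (hf a).mul ih

lemma list_prod_norm {ι : Type*} (p : List ι) {f : ι → ℂ} {A : ℝ} (hA : 0 ≤ A) (hf : ∀ j, ‖f j‖ ≤ A) :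
    ‖(p.map f).prod‖ ≤ A ^ p.length := by
  induction p with
  | nil => simp
  | cons a p ih =>
    simp only [List.map_cons, List.prod_cons, List.length_cons, norm_mul, pow_succ']
    exact mul_le_mul (hf a) ih (norm_nonneg _) hA

lemma poly_exp (N : ℕ) {c : ℝ} (hc : 0 < c) : ∃ K > 0, ∀ ϱ ≥ (0:ℝ), (1 + ϱ) ^ N ≤ K * Real.exp (c * ϱ) := by
  refine ⟨N.factorial / c ^ N * Real.exp c, by positivity, fun ϱ hϱ => ?_⟩
  have h := Real.pow_div_factorial_le_exp (c * (1 + ϱ)) (by positivity) N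
  rw [mul_pow, mul_add, mul_one, Real.exp_add] at h
  have h2 : 0 < c ^ N := by positivity
  have h3 : (0:ℝ) < N.factorial := by positivity
  rw [div_le_iff₀ h3] at h
  rw [div_mul_eq_mul_div, div_mul_eq_mul_div, le_div_iff₀ h2]
  nlinarith

/-- line version of point `ins i σ y` in complex coordinates -/
lemma Gc_line_bound {k : ℕ} {m : ℂ → ℂ} {N b g : ℕ} {A κ : ℝ} (hA : 0 < A) (hκ : 0 < κ)
    (hm : DifferentiableOn ℂ m Sec)
    (hb : ∀ l ∈ Sec, ‖m l‖ ≤ A * ((1 + rh l) ^ b * pw (1 + g) (rh l)) * Real.exp (-(κ * rh l)))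
    (p : List (Fin (N + 1))) (hp : p.length = g + k) (x : EE (N + 1)) (i : Fin (N + 1)) (y : Fin N → ℝ)
    (hy : y ≠ 0) :
    ‖∫ σ : ℝ, Gc m p x (i.insertNth (σ : ℂ) (fun j => (y j : ℂ)))‖ ≤
      ∫ σ : ℝ, (fun ϱ => A * 8 ^ b * (2 * π) ^ (g + k) * (ϱ ^ k * ϱ⁻¹ * (1 + ϱ) ^ b) *
        Real.exp (-((κ + |x i| / 2) * ϱ))) (√(σ ^ 2 + ∑ j, y j ^ 2)) := by
  set a := √(∑ j, y j ^ 2) with ha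
  have hs0 : 0 < ∑ j, y j ^ 2 := by
    obtain ⟨j, hj⟩ := Function.ne_iff.1 hy
    have : 0 < y j ^ 2 := by simp only [Pi.zero_apply] at hj; positivity
    exact this.trans_le (Finset.single_le_sum (f := fun j => y j ^ 2) (fun _ _ => sq_nonneg _) (Finset.mem_univ j))
  have ha0 : 0 < a := Real.sqrt_pos.2 hs0
  have hasq : a ^ 2 = ∑ j, y j ^ 2 := Real.sq_sqrt hs0.le
  have hya : ∀ j, |y j| ≤ a := fun j => by
    rw [ha]; apply Real.le_sqrt_of_sq_le; rw [sq_abs]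
    exact Finset.single_le_sum (f := fun j => y j ^ 2) (fun _ _ => sq_nonneg _) (Finset.mem_univ j)
  rw [sinh_cov _ ha0, sinh_cov (fun σ => (fun ϱ => A * 8 ^ b * (2 * π) ^ (g + k) * (ϱ ^ k * ϱ⁻¹ * (1 + ϱ) ^ b) *
        Real.exp (-((κ + |x i| / 2) * ϱ))) (√(σ ^ 2 + ∑ j, y j ^ 2))) ha0]
  have hsq : ∀ u, √((a * Real.sinh u) ^ 2 + ∑ j, y j ^ 2) = a * Real.cosh u := by
    intro u
    rw [← hasq, show (a * Real.sinh u) ^ 2 + a ^ 2 = (a * Real.cosh u) ^ 2 by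
      rw [mul_pow, mul_pow, Real.cosh_sq]; ring]
    exact Real.sqrt_sq (by have := Real.cosh_pos u; positivity)
  simp only [hsq]
  set ζ : ℂ → Fin (N + 1) → ℂ := fun w => i.insertNth (a * Complex.sinh w) (fun j => (y j : ℂ)) with hζ
  set H : ℂ → ℂ := fun w => (a * Complex.cosh w) * Gc m p x (ζ w) with hH
  have hHr : ∀ u : ℝ, (a * Real.cosh u) • Gc m p x (i.insertNth ((a * Real.sinh u : ℝ) : ℂ) (fun j => (y j : ℂ))) = H u := by
    intro u; simp only [hH, hζ]; push_cast; rw [Complex.real_smul]; push_cast; rfl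
  simp only [hHr]
  have hlam : ∀ w, 4 * (π:ℂ) ^ 2 * ∑ j, ζ w j ^ 2 = (4 * π ^ 2 * a ^ 2 : ℝ) * Complex.cosh w ^ 2 := by
    intro w
    rw [Fin.sum_univ_succAbove _ i]
    simp only [hζ, Fin.insertNth_apply_same, Fin.insertNth_apply_succAbove]
    have : (∑ j, (y j : ℂ) ^ 2) = (a : ℂ) ^ 2 := by rw [← Complex.ofReal_pow, hasq]; push_cast; rfl
    rw [this, mul_pow, Complex.sinh_sq]; push_cast; ring
  -- sign
  obtain ⟨θ, hθ, hθx⟩ : ∃ θ : ℝ, |θ| = 1 / 4 ∧ ((0 ≤ x i ∧ θ = 1/4) ∨ (x i ≤ 0 ∧ θ = -(1/4))) := by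
    rcases le_total 0 (x i) with h | h
    · exact ⟨1/4, by norm_num, Or.inl ⟨h, rfl⟩⟩
    · exact ⟨-(1/4), by norm_num, Or.inr ⟨h, rfl⟩⟩
  have hτ : ∀ τ ∈ uIcc 0 θ, |τ| ≤ 1/4 ∧ 0 ≤ x i * Real.sin τ := by
    intro τ hτ
    rcases hθx with ⟨h, rfl⟩ | ⟨h, rfl⟩
    · rw [uIcc_of_le (by norm_num)] at hτ
      refine ⟨abs_le.2 ⟨by linarith [hτ.1], hτ.2⟩, mul_nonneg h ?_⟩
      exact Real.sin_nonneg_of_nonneg_of_le_pi hτ.1 (by linarith [hτ.2, Real.pi_gt_three])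
    · rw [uIcc_of_ge (by norm_num)] at hτ
      refine ⟨abs_le.2 ⟨hτ.1, by linarith [hτ.2]⟩, mul_nonneg_of_nonpos_of_nonpos h ?_⟩
      exact Real.sin_nonpos_of_nonpos_of_neg_pi_le hτ.2 (by linarith [hτ.1, Real.pi_gt_three])
  have hbound : ∀ u τ : ℝ, |τ| ≤ 1/4 → ‖H (u + τ * Complex.I)‖ ≤ (a * Real.cosh u) *
      (A * 8 ^ b * (2 * π) ^ (g + k) * ((a * Real.cosh u) ^ k * (a * Real.cosh u)⁻¹ * (1 + (a * Real.cosh u)) ^ b) *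
        Real.exp (-(κ * (a * Real.cosh u) + 2 * π * (x i * Real.sin τ) * (a * Real.cosh u)))) := by
    intro u τ h
    have hcu := Real.cosh_pos u
    set ϱ := a * Real.cosh u with hϱ
    have hϱ0 : 0 < ϱ := by positivity
    have haϱ : a ≤ ϱ := by rw [hϱ]; nlinarith [Real.one_le_cosh u]
    set w : ℂ := u + τ * Complex.I with hw
    have hn1 : ‖(a:ℂ) * Complex.cosh w‖ ≤ ϱ := by
      rw [norm_mul, Complex.norm_real, Real.norm_of_nonneg ha0.le]
      exact mul_le_mul_of_nonneg_left (norm_cosh_le u τ) ha0.le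
    have hn2 : ∀ j, ‖2 * π * Complex.I * ζ w j‖ ≤ 2 * π * ϱ := by
      intro j
      have : ‖ζ w j‖ ≤ ϱ := by
        rcases Fin.eq_self_or_eq_succAbove i j with rfl | ⟨j', rfl⟩
        · simp only [hζ, Fin.insertNth_apply_same]
          rw [norm_mul, Complex.norm_real, Real.norm_of_nonneg ha0.le]
          exact mul_le_mul_of_nonneg_left (norm_sinh_le u τ) ha0.le
        · simp only [hζ, Fin.insertNth_apply_succAbove, Complex.norm_real, Real.norm_eq_abs]
          exact (hya j').trans haϱ
      rw [norm_mul, norm_mul, norm_mul, Complex.norm_I, Complex.norm_real, Real.norm_of_nonneg Real.pi_pos.le]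
      simp only [Complex.norm_ofNat, mul_one]
      gcongr
    have hn3 : ‖Complex.exp (2 * π * Complex.I * (∑ j, (x j : ℂ) * ζ w j))‖ = Real.exp (-(2 * π * (x i * Real.sin τ) * ϱ)) := by
      rw [Complex.norm_exp]
      congr 1
      rw [Fin.sum_univ_succAbove _ i]
      simp only [hζ, Fin.insertNth_apply_same, Fin.insertNth_apply_succAbove]
      rw [hw, sinh_re_im]
      have : ∑ j, ((x (i.succAbove j) : ℂ)) * (y j : ℂ) = ((∑ j, x (i.succAbove j) * y j : ℝ) : ℂ) := by push_cast; rfl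
      rw [this]
      simp [hϱ]; ring
    have hsec := cosh_sq_sec (u := u) ha0 h
    rw [← hw] at hsec
    have hrh := rh_cosh ha0 w
    set l : ℂ := (4 * π ^ 2 * a ^ 2 : ℝ) * Complex.cosh w ^ 2
    have hr1 : rh l ≤ 7 * ϱ := by
      rw [hrh]; have := norm_cosh_le u τ
      calc 2 * π * a * ‖Complex.cosh w‖ ≤ 2 * 3.5 * a * Real.cosh u := by
            gcongr; linarith [Real.pi_lt_d2]
        _ = _ := by rw [hϱ]; ring
    have hr2 : ϱ ≤ rh l := by
      rw [hrh]; have := norm_cosh_ge (u := u) h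
      calc ϱ = 2 * 1 * a * (Real.cosh u / 2) := by rw [hϱ]; ring
        _ ≤ _ := by gcongr; linarith [Real.pi_gt_three]
    have hn4 : ‖m l‖ ≤ A * (8 ^ b * (1 + ϱ) ^ b * (ϱ ^ (1 + g))⁻¹) * Real.exp (-(κ * ϱ)) := by
      refine (hb l hsec).trans ?_
      unfold pw
      rw [← mul_pow]
      have hrp : 0 < rh l := hϱ0.trans_le hr2
      gcongr
      linarith
    simp only [hH, Gc]
    rw [hlam w, norm_mul _ (_ * _), norm_mul (_ * _) (m _), norm_mul (Complex.exp _), hn3]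
    calc _ ≤ ϱ * (Real.exp (-(2 * π * (x i * Real.sin τ) * ϱ)) * (2 * π * ϱ) ^ p.length *
          (A * (8 ^ b * (1 + ϱ) ^ b * (ϱ ^ (1 + g))⁻¹) * Real.exp (-(κ * ϱ)))) := by
          gcongr
          exact list_prod_norm p (by positivity) hn2
      _ = _ := by
          rw [hp, neg_add, Real.exp_add, mul_pow, pow_add ϱ g k, pow_add ϱ 1 g]
          field_simp
  obtain ⟨K, hK, hKb⟩ := poly_exp (k + b) (c := κ / 2) (by positivity)
  have hgauss : ∀ u : ℝ, (a * Real.cosh u) * (A * 8 ^ b * (2 * π) ^ (g + k) * ((a * Real.cosh u) ^ k * (a * Real.cosh u)⁻¹ * (1 + (a * Real.cosh u)) ^ b) * Real.exp (-(κ * (a * Real.cosh u)))) ≤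
      A * 8 ^ b * (2 * π) ^ (g + k) * K * Real.exp (-(κ * a / 4) * u ^ 2) := by
    intro u
    have hcu := Real.cosh_pos u
    have hcu2 : u ^ 2 / 2 ≤ Real.cosh u := by
      have := Real.cosh_sq u
      have h3 : 1 + u ^ 2 / 2 ≤ Real.cosh u := by
        have := Real.cosh_two_mul (u / 2)
        rw [show 2 * (u / 2) = u by ring] at this
        have h4 : |u/2| ≤ |Real.sinh (u/2)| := by
          rw [Real.abs_sinh]; exact Real.self_le_sinh_iff.2 (abs_nonneg _)
        have h5 : (u/2)^2 ≤ Real.sinh (u/2) ^ 2 := sq_le_sq.2 h4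
        rw [this, Real.cosh_sq]; nlinarith
      linarith
    set ϱ := a * Real.cosh u with hϱ
    have hϱ0 : 0 < ϱ := by positivity
    calc _ = A * 8 ^ b * (2 * π) ^ (g + k) * (ϱ ^ k * (1 + ϱ) ^ b * Real.exp (-(κ * ϱ))) := by
          field_simp
      _ ≤ A * 8 ^ b * (2 * π) ^ (g + k) * ((1 + ϱ) ^ k * (1 + ϱ) ^ b * Real.exp (-(κ * ϱ))) := by
          gcongr; linarith
      _ ≤ A * 8 ^ b * (2 * π) ^ (g + k) * (K * Real.exp (κ / 2 * ϱ) * Real.exp (-(κ * ϱ))) := by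
          rw [← pow_add]; gcongr; exact hKb ϱ hϱ0.le
      _ = A * 8 ^ b * (2 * π) ^ (g + k) * K * Real.exp (-(κ / 2 * ϱ)) := by
          rw [mul_assoc K, ← Real.exp_add, show κ / 2 * ϱ + -(κ * ϱ) = -(κ / 2 * ϱ) by ring, mul_assoc]; ring
      _ ≤ _ := by
          gcongr
          have : a * (u ^ 2 / 2) ≤ ϱ := by rw [hϱ]; gcongr
          nlinarith
  have hshift : ∫ u : ℝ, H u = ∫ u : ℝ, H (u + θ * Complex.I) := by
    refine contour_shift (θ := θ) (K := A * 8 ^ b * (2 * π) ^ (g + k) * K) (c := κ * a / 4) (by positivity) ?_ ?_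
    · have hζd : ∀ j, Differentiable ℂ (fun w => ζ w j) := by
        intro j
        rcases Fin.eq_self_or_eq_succAbove i j with rfl | ⟨j', rfl⟩
        · simp only [hζ, Fin.insertNth_apply_same]; fun_prop
        · simp only [hζ, Fin.insertNth_apply_succAbove]; fun_prop
      simp only [hH, Gc]
      refine DifferentiableOn.mul (by fun_prop) (DifferentiableOn.mul (Differentiable.differentiableOn ?_) ?_)
      · refine Differentiable.mul (by fun_prop) (list_prod_diff p fun j => (hζd j).const_mul _)
      · simp only [hlam]
        refine hm.comp (by fun_prop) ?_
        intro w hw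
        have := cosh_sq_sec (u := w.re) ha0 (hτ _ hw).1
        rwa [Complex.re_add_im] at this
    · intro u τ hτ'
      obtain ⟨h1, h2⟩ := hτ τ hτ'
      refine (hbound u τ h1).trans ?_
      have hcu := Real.cosh_pos u
      refine le_trans ?_ (hgauss u)
      gcongr
      have : 0 ≤ 2 * π * (x i * Real.sin τ) * (a * Real.cosh u) := by positivity
      linarith
  rw [hshift]
  have hθ4 : |θ| ≤ 1/4 := hθ.le
  have hsin : |x i| / 2 ≤ 2 * π * (x i * Real.sin θ) := by
    have hs : 1/8 ≤ Real.sin (1/4) := by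
      have := Real.sin_gt_sub_cube (x := 1/4) (by norm_num)
      norm_num at this ⊢; linarith
    have hp := Real.pi_gt_three
    rcases hθx with ⟨h, rfl⟩ | ⟨h, rfl⟩
    · rw [abs_of_nonneg h]
      have : x i * (1/8) ≤ x i * Real.sin (1/4) := by gcongr
      have h0 : 0 ≤ x i * Real.sin (1/4) := le_trans (by positivity) this
      nlinarith
    · rw [abs_of_nonpos h, Real.sin_neg]
      have : (-x i) * (1/8) ≤ (-x i) * Real.sin (1/4) := by gcongr; linarith
      have h0 : 0 ≤ (-x i) * Real.sin (1/4) := le_trans (by linarith) this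
      nlinarith
  refine norm_integral_le_of_norm_le ?_ (Filter.Eventually.of_forall fun u => (hbound u θ hθ4).trans ?_)
  · have hcont : Continuous fun u => (a * Real.cosh u) • (A * 8 ^ b * (2 * π) ^ (g + k) *
        ((a * Real.cosh u) ^ k * (a * Real.cosh u)⁻¹ * (1 + a * Real.cosh u) ^ b) *
        Real.exp (-((κ + |x i| / 2) * (a * Real.cosh u)))) := by
      have : ∀ u, a * Real.cosh u ≠ 0 := fun u => (mul_pos ha0 (Real.cosh_pos u)).ne'
      have hc := Real.continuous_cosh
      have := (continuous_const.mul hc : Continuous fun u => a * Real.cosh u).inv₀ this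
      fun_prop
    have hg : Integrable (fun u : ℝ => A * 8 ^ b * (2 * π) ^ (g + k) * K * Real.exp (-(κ * a / 4) * u ^ 2)) :=
      (integrable_exp_neg_mul_sq (by positivity)).const_mul _
    refine hg.mono' hcont.aestronglyMeasurable (Filter.Eventually.of_forall fun u => ?_)
    have hcu := Real.cosh_pos u
    rw [smul_eq_mul, Real.norm_of_nonneg (by positivity)]
    refine le_trans ?_ (hgauss u)
    gcongr
    have := abs_nonneg (x i)
    linarith
  · rw [smul_eq_mul]
    have hcu := Real.cosh_pos u
    gcongr
    rw [add_mul]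
    have : |x i| / 2 * (a * Real.cosh u) ≤ 2 * π * (x i * Real.sin θ) * (a * Real.cosh u) := by
      gcongr
    linarith

lemma line_fubini {N : ℕ} (hN : 1 ≤ N) (i : Fin (N + 1)) (F : EE (N + 1) → ℂ) (B : EE (N + 1) → ℝ)
    (hB : Integrable B) (hB0 : ∀ ξ, 0 ≤ B ξ)
    (h : ∀ y : Fin N → ℝ, y ≠ 0 → ‖∫ σ : ℝ, F (WithLp.toLp 2 (i.insertNth σ y))‖ ≤ ∫ σ : ℝ, B (WithLp.toLp 2 (i.insertNth σ y))) :
    ‖∫ ξ, F ξ‖ ≤ ∫ ξ, B ξ := by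
  by_cases hF : Integrable F
  swap
  · rw [integral_undef hF, norm_zero]; exact integral_nonneg hB0
  have : Nonempty (Fin N) := ⟨⟨0, hN⟩⟩
  have mp1 := PiLp.volume_preserving_toLp (Fin (N + 1))
  have me1 : MeasurableEmbedding (@WithLp.toLp 2 (Fin (N + 1) → ℝ)) := (MeasurableEquiv.toLp 2 (Fin (N + 1) → ℝ)).measurableEmbedding
  have mp2 := (volume_preserving_piFinSuccAbove (fun _ : Fin (N + 1) => ℝ) i).symm
  have me2 := (MeasurableEquiv.piFinSuccAbove (fun _ : Fin (N + 1) => ℝ) i).symm.measurableEmbedding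
  have key : ∀ {X : Type} [NormedAddCommGroup X] [NormedSpace ℝ X] (f : EE (N + 1) → X), Integrable f →
      Integrable (fun q : ℝ × (Fin N → ℝ) => f (WithLp.toLp 2 (i.insertNth q.1 q.2))) (volume.prod volume) ∧
      ∫ ξ, f ξ = ∫ y : Fin N → ℝ, ∫ σ : ℝ, f (WithLp.toLp 2 (i.insertNth σ y)) := by
    intro X _ _ f hf
    have i1 : Integrable (fun v => f (WithLp.toLp 2 v)) := (mp1.integrable_comp_emb me1).2 hf
    have i2 : Integrable (fun q : ℝ × (Fin N → ℝ) => f (WithLp.toLp 2 (i.insertNth q.1 q.2))) (volume.prod volume) :=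
      (mp2.integrable_comp_emb me2).2 i1
    refine ⟨i2, ?_⟩
    rw [← mp1.integral_comp me1, ← mp2.integral_comp me2]
    exact integral_prod_symm _ i2
  rw [(key F hF).2, (key B hB).2]
  refine norm_integral_le_of_norm_le (key B hB).1.integral_prod_right ?_
  have : ∀ᵐ y : Fin N → ℝ, y ≠ 0 := by
    rw [ae_iff]; simp
  filter_upwards [this] with y hy using h y hy

lemma radial_integrable {n : ℕ} (hn : 2 ≤ n) (k : ℕ) {c : ℝ} (hc : 0 < c) :
    Integrable (fun ξ : EE n => ‖ξ‖ ^ k * ‖ξ‖⁻¹ * Real.exp (-(c * ‖ξ‖))) := by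
  have : Nontrivial (EE n) := by
    have : Nonempty (Fin n) := ⟨⟨0, by omega⟩⟩
    infer_instance
  rw [integrable_fun_norm_addHaar (volume : Measure (EE n)) (f := fun y => y ^ k * y⁻¹ * Real.exp (-(c * y)))]
  have h2 : IntegrableOn (fun y : ℝ => y ^ (n - 2 + k) * Real.exp (-(c * y))) (Ioi 0) := by
    have h3 := integrableOn_rpow_mul_exp_neg_mul_rpow (p := 1) (s := ((n - 2 + k : ℕ) : ℝ)) (b := c)
      (by have : (0:ℝ) ≤ ((n - 2 + k : ℕ) : ℝ) := Nat.cast_nonneg _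
          linarith) one_pos hc
    refine h3.congr_fun (fun y hy => ?_) measurableSet_Ioi
    simp only [Real.rpow_one, Real.rpow_natCast, neg_mul]
  refine h2.congr_fun (fun y hy => ?_) measurableSet_Ioi
  have hy : 0 < y := hy
  simp only [finrank_euclideanSpace, Fintype.card_fin, smul_eq_mul]
  obtain ⟨m, rfl⟩ : ∃ m, n = m + 2 := ⟨n - 2, by omega⟩
  simp only [Nat.add_sub_cancel, show m + 2 - 1 = m + 1 by omega]
  field_simp
  ring

lemma radial_scale {n : ℕ} (hn : 2 ≤ n) (k : ℕ) {c r : ℝ} (hr : 0 < r) :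
    ∫ ξ : EE n, ‖ξ‖ ^ k * ‖ξ‖⁻¹ * Real.exp (-(c * r * ‖ξ‖)) =
      (r ^ (n - 1 + k))⁻¹ * ∫ ξ : EE n, ‖ξ‖ ^ k * ‖ξ‖⁻¹ * Real.exp (-(c * ‖ξ‖)) := by
  have h := Measure.integral_comp_smul (volume : Measure (EE n)) (fun ξ : EE n => ‖ξ‖ ^ k * ‖ξ‖⁻¹ * Real.exp (-(c * ‖ξ‖))) r
  have e : ∀ ξ : EE n, ‖r • ξ‖ ^ k * ‖r • ξ‖⁻¹ * Real.exp (-(c * ‖r • ξ‖)) =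
      (r ^ k * r⁻¹) * (‖ξ‖ ^ k * ‖ξ‖⁻¹ * Real.exp (-(c * r * ‖ξ‖))) := by
    intro ξ
    rw [norm_smul, Real.norm_of_nonneg hr.le, mul_pow, mul_inv, ← mul_assoc c]; ring
  simp only [e, integral_const_mul] at h
  rw [finrank_euclideanSpace, Fintype.card_fin, smul_eq_mul, abs_of_pos (by positivity)] at h
  have h2 : 0 < r ^ k * r⁻¹ := by positivity
  rw [← mul_right_inj' h2.ne', h, ← mul_assoc]
  congr 1
  obtain ⟨m, rfl⟩ : ∃ m, n = m + 1 := ⟨n - 1, by omega⟩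
  rw [Nat.add_sub_cancel]
  field_simp
  ring

lemma kernel_bound {n : ℕ} (hn : 2 ≤ n) {b g : ℕ} (hb1 : b ≤ 1) {m : ℂ → ℝ → ℂ}
    (hol : ∀ s ∈ Ioc (0 : ℝ) 1, DifferentiableOn ℂ (fun l => m l s) Sec)
    (hbd : BD (fun r => (1 + r) ^ b * pw (1 + g) r) 1 m) (k : ℕ) :
    ∃ C > 0, ∀ s ∈ Ioo (0:ℝ) 1, ∀ p : List (Fin n), p.length = g + k → ∀ x : EE n,
      ‖∫ ξ, ee x ξ * zmon p ξ * m (lam ξ) s‖ ≤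
        C * s * ((‖x‖ + (1 - s)) ^ (n - 1 + k))⁻¹ * (1 + (‖x‖ + (1 - s))⁻¹) ^ b := by
  obtain ⟨N, rfl⟩ : ∃ N, n = N + 1 := ⟨n - 1, by omega⟩
  obtain ⟨A, hA, κ, hκ, hbb⟩ := hbd
  set c := min κ (1 / (2 * ((N:ℝ) + 1))) with hc
  have hc0 : 0 < c := by positivity
  set J : ℕ → ℝ := fun k => ∫ ξ : EE (N + 1), ‖ξ‖ ^ k * ‖ξ‖⁻¹ * Real.exp (-(c * ‖ξ‖)) with hJ
  have hJ0 : ∀ k, 0 ≤ J k := fun k => integral_nonneg fun ξ => by positivity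
  refine ⟨A * 8 ^ b * (2 * π) ^ (g + k) * (J k + J (k + 1) + 1), by
    have := hJ0 k; have := hJ0 (k + 1); positivity, fun s hs p hp x => ?_⟩
  -- choose coordinate
  obtain ⟨i, hi⟩ : ∃ i, ‖x‖ ≤ ((N:ℝ) + 1) * |x i| := by
    obtain ⟨i, -, hi⟩ := Finset.exists_max_image Finset.univ (fun i => |x i|) ⟨(0 : Fin (N + 1)), Finset.mem_univ _⟩
    refine ⟨i, ?_⟩
    rw [EuclideanSpace.norm_eq]
    apply Real.sqrt_le_iff.2 ⟨by positivity, ?_⟩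
    calc ∑ j, ‖x j‖ ^ 2 ≤ ∑ j : Fin (N + 1), |x i| ^ 2 := by
          apply Finset.sum_le_sum; intro j _; rw [Real.norm_eq_abs]; exact pow_le_pow_left₀ (abs_nonneg _) (hi j (Finset.mem_univ _)) 2
      _ = ((N:ℝ) + 1) * |x i| ^ 2 := by simp
      _ ≤ _ := by
          rw [mul_pow]; gcongr
          nlinarith [(Nat.cast_nonneg N : (0:ℝ) ≤ N)]
  have hd : 0 < 1 - s := by linarith [hs.2]
  set r := ‖x‖ + (1 - s) with hr
  have hr0 : 0 < r := by positivity
  have hcr : c * r ≤ κ * (1 - s) + |x i| / 2 := by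
    have h1 : c * ‖x‖ ≤ |x i| / 2 := by
      calc c * ‖x‖ ≤ 1 / (2 * ((N:ℝ) + 1)) * (((N:ℝ) + 1) * |x i|) := by
            gcongr; exact min_le_right _ _
        _ = _ := by field_simp
    have h2 : c * (1 - s) ≤ κ * (1 - s) := by gcongr; exact min_le_left _ _
    rw [hr]; linarith
  have hs1 : s ∈ Ioc (0:ℝ) 1 := ⟨hs.1, hs.2.le⟩
  set Q := A * s * 8 ^ b * (2 * π) ^ (g + k) with hQ
  have hs0 := hs.1
  have hQ0 : 0 < Q := by positivity
  have hI : ∀ k, Integrable (fun ξ : EE (N + 1) => ‖ξ‖ ^ k * ‖ξ‖⁻¹ * Real.exp (-(c * r * ‖ξ‖))) := fun k =>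
    radial_integrable hn k (by positivity)
  set B : EE (N + 1) → ℝ := fun ξ => Q * (‖ξ‖ ^ k * ‖ξ‖⁻¹ * (1 + ‖ξ‖) ^ b) * Real.exp (-((κ * (1 - s) + |x i| / 2) * ‖ξ‖)) with hB
  have hBle : ∀ ξ, B ξ ≤ Q * (‖ξ‖ ^ k * ‖ξ‖⁻¹ * (1 + ‖ξ‖) ^ b) * Real.exp (-(c * r * ‖ξ‖)) := by
    intro ξ; simp only [hB]; gcongr
  have hBI : Integrable (fun ξ : EE (N + 1) => Q * (‖ξ‖ ^ k * ‖ξ‖⁻¹ * (1 + ‖ξ‖) ^ b) * Real.exp (-(c * r * ‖ξ‖))) ∧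
      (∫ ξ : EE (N + 1), Q * (‖ξ‖ ^ k * ‖ξ‖⁻¹ * (1 + ‖ξ‖) ^ b) * Real.exp (-(c * r * ‖ξ‖))) ≤
        Q * (J k + J (k + 1) + 1) * ((r ^ (N + 1 - 1 + k))⁻¹ * (1 + r⁻¹) ^ b) := by
    interval_cases b
    · simp only [pow_zero, mul_one]
      simp only [mul_assoc Q]
      refine ⟨(hI k).const_mul _, ?_⟩
      rw [integral_const_mul, radial_scale hn k hr0]
      have := hJ0 k; have := hJ0 (k + 1)
      rw [mul_comm _ (∫ _, _)]
      change Q * (J k * _) ≤ _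
      refine mul_le_mul_of_nonneg_left (mul_le_mul_of_nonneg_right ?_ (by positivity)) hQ0.le
      linarith
    · have e : ∀ ξ : EE (N + 1), Q * (‖ξ‖ ^ k * ‖ξ‖⁻¹ * (1 + ‖ξ‖) ^ 1) * Real.exp (-(c * r * ‖ξ‖)) =
          Q * (‖ξ‖ ^ k * ‖ξ‖⁻¹ * Real.exp (-(c * r * ‖ξ‖)) + ‖ξ‖ ^ (k + 1) * ‖ξ‖⁻¹ * Real.exp (-(c * r * ‖ξ‖))) := by
        intro ξ; ring
      simp only [e]
      refine ⟨((hI k).add (hI (k + 1))).const_mul _, ?_⟩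
      rw [integral_const_mul, integral_add (hI k) (hI (k + 1)), radial_scale hn k hr0, radial_scale hn (k + 1) hr0]
      have h0 := hJ0 k; have h1 := hJ0 (k + 1)
      rw [mul_assoc Q]
      gcongr
      change _ * J k + _ * J (k + 1) ≤ _
      rw [← add_assoc, pow_succ r (N + 1 - 1 + k), mul_inv, pow_one]
      have h2 : 0 < (r ^ (N + 1 - 1 + k))⁻¹ := by positivity
      have h3 : 0 < r⁻¹ := by positivity
      calc _ = (r ^ (N + 1 - 1 + k))⁻¹ * (J k * 1 + J (k + 1) * r⁻¹) := by ring
        _ ≤ (r ^ (N + 1 - 1 + k))⁻¹ * ((J k + J (k+1) + 1) * (1 + r⁻¹)) := by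
          gcongr; nlinarith [mul_nonneg h0 h3.le]
        _ = _ := by ring
  have hBint : Integrable B := by
    refine hBI.1.mono' ?_ (Filter.Eventually.of_forall fun ξ => ?_)
    · apply Measurable.aestronglyMeasurable; simp only [hB]; fun_prop
    · rw [Real.norm_of_nonneg (by simp only [hB]; positivity)]; exact hBle ξ
  refine (line_fubini (by omega) i _ B hBint (fun ξ => by simp only [hB]; positivity) ?_).trans ?_
  · intro y hy
    have hnorm : ∀ σ : ℝ, ‖(WithLp.toLp 2 (i.insertNth σ y : Fin (N + 1) → ℝ) : EE (N + 1))‖ = √(σ ^ 2 + ∑ j, y j ^ 2) := by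
      intro σ
      rw [EuclideanSpace.norm_eq, Fin.sum_univ_succAbove _ i]
      simp
    have := Gc_line_bound (k := k) (m := fun l => m l s) (b := b) (g := g) (A := A * s) (κ := κ * (1 - s)) (by positivity)
      (by positivity) (hol s hs1) (fun l hl => by
        refine (hbb l hl s hs1).trans (le_of_eq ?_)
        rw [Real.rpow_one]; ring_nf) p hp x i y hy
    refine le_trans (le_of_eq ?_) (this.trans (le_of_eq ?_))
    · congr 2 with σ
      rw [← Gc_real (fun l => m l s)]
      congr 1
      ext j
      rcases Fin.eq_self_or_eq_succAbove i j with rfl | ⟨j', rfl⟩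
      · simp
      · simp
    · congr 1 with σ
      simp only [hB, hnorm, hQ]
  · refine (integral_mono hBint hBI.1 hBle).trans (hBI.2.trans (le_of_eq ?_))
    rw [hQ]; ring

lemma ee_norm {n : ℕ} (x ξ : EE n) : ‖ee x ξ‖ = 1 := by
  unfold ee
  rw [show 2 * (π:ℂ) * Complex.I * ((∑ j, x j * ξ j : ℝ) : ℂ) = ((2 * π * (∑ j, x j * ξ j) : ℝ) : ℂ) * Complex.I by
    push_cast; ring]
  exact Complex.norm_exp_ofReal_mul_I _

lemma ee_cont {n : ℕ} (x : EE n) : Continuous (fun ξ => ee x ξ) := by unfold ee; fun_prop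
lemma ee_cont2 {n : ℕ} : Continuous (fun q : EE n × EE n => ee q.1 q.2) := by unfold ee; fun_prop
lemma zz_cont {n : ℕ} (j : Fin n) : Continuous (fun ξ : EE n => zz ξ j) := by unfold zz; fun_prop
lemma zmon_cont {n : ℕ} (p : List (Fin n)) : Continuous (fun ξ : EE n => zmon p ξ) := by
  induction p with
  | nil => unfold zmon; simp only [List.map_nil, List.prod_nil]; fun_prop
  | cons a p ih =>
    have : (fun ξ : EE n => zmon (a :: p) ξ) = fun ξ => zz ξ a * zmon p ξ := by
      ext ξ; simp [zmon]
    rw [this]; exact (zz_cont a).mul ih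
lemma zmon_cons {n : ℕ} (a : Fin n) (p : List (Fin n)) (ξ : EE n) : zmon (a :: p) ξ = zz ξ a * zmon p ξ := by
  simp [zmon]
lemma zmon_append {n : ℕ} (p q : List (Fin n)) (ξ : EE n) : zmon (p ++ q) ξ = zmon p ξ * zmon q ξ := by
  simp [zmon]
lemma zz_norm {n : ℕ} (ξ : EE n) (j : Fin n) : ‖zz ξ j‖ ≤ 2 * π * ‖ξ‖ := by
  unfold zz
  have : |ξ j| ≤ ‖ξ‖ := by simpa using PiLp.norm_apply_le ξ j
  simp only [norm_mul, Complex.norm_I, Complex.norm_real, Real.norm_eq_abs, abs_of_pos pi_pos, mul_one, Complex.norm_ofNat]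
  gcongr
lemma zmon_norm {n : ℕ} (p : List (Fin n)) (ξ : EE n) : ‖zmon p ξ‖ ≤ (2 * π * ‖ξ‖) ^ p.length :=
  list_prod_norm p (by positivity) (zz_norm ξ)

/-- gradient functional -/
def gr {n : ℕ} (a : Fin n → ℝ) (b : ℝ) : Pt n →L[ℝ] ℝ :=
  ∑ j, a j • ((EuclideanSpace.proj j : EE n →L[ℝ] ℝ).comp (ContinuousLinearMap.fst ℝ (EE n) ℝ)) +
    b • ContinuousLinearMap.snd ℝ (EE n) ℝ
lemma gr_apply {n : ℕ} (a : Fin n → ℝ) (b : ℝ) (v : Pt n) : gr a b v = ∑ j, a j * v.1 j + b * v.2 := by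
  simp [gr]

def grC {n : ℕ} (a : Fin n → ℂ) (b : ℂ) : Pt n →L[ℝ] ℂ :=
  ∑ j, ((EuclideanSpace.proj j : EE n →L[ℝ] ℝ).comp (ContinuousLinearMap.fst ℝ (EE n) ℝ)).smulRight (a j) +
    (ContinuousLinearMap.snd ℝ (EE n) ℝ).smulRight b
lemma grC_apply {n : ℕ} (a : Fin n → ℂ) (b : ℂ) (v : Pt n) : grC a b v = ∑ j, (v.1 j : ℂ) * a j + v.2 * b := by
  simp [grC]
lemma coord_le {n : ℕ} (v : EE n) (j : Fin n) : |v j| ≤ ‖v‖ := by simpa using PiLp.norm_apply_le v j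
lemma grC_norm {n : ℕ} (a : Fin n → ℂ) (b : ℂ) : ‖grC a b‖ ≤ ∑ j, ‖a j‖ + ‖b‖ := by
  refine ContinuousLinearMap.opNorm_le_bound _ (by positivity) fun v => ?_
  rw [grC_apply, add_mul, Finset.sum_mul]
  refine (norm_add_le _ _).trans (add_le_add ((norm_sum_le _ _).trans (Finset.sum_le_sum fun j _ => ?_)) ?_)
  · rw [norm_mul, Complex.norm_real, mul_comm]
    gcongr
    exact (coord_le v.1 j).trans (norm_fst_le v)
  · rw [norm_mul, Complex.norm_real, mul_comm]
    gcongr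
    exact norm_snd_le v
lemma gr_norm {n : ℕ} (a : Fin n → ℝ) (b : ℝ) : ‖gr a b‖ ≤ ∑ j, |a j| + |b| := by
  refine ContinuousLinearMap.opNorm_le_bound _ (by positivity) fun v => ?_
  rw [gr_apply, add_mul, Finset.sum_mul]
  refine (norm_add_le _ _).trans (add_le_add ((norm_sum_le _ _).trans (Finset.sum_le_sum fun j _ => ?_)) ?_)
  · rw [norm_mul, Real.norm_eq_abs]
    gcongr
    exact (coord_le v.1 j).trans (norm_fst_le v)
  · rw [norm_mul, Real.norm_eq_abs]
    gcongr
    exact norm_snd_le v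

def Vf {n : ℕ} (Φ : EE n → ℝ → ℂ) (p : Pt n) : ℝ := (∫ ξ, ee p.1 ξ * Φ ξ p.2).re

/-- decaying symbols -/
structure SDec {n : ℕ} (Φ : EE n → ℝ → ℂ) : Prop where
  meas : ∀ t > 0, AEStronglyMeasurable (fun ξ => Φ ξ t) volume
  bd : ∃ C κ : ℝ, ∃ N : ℕ, 0 < C ∧ 0 < κ ∧ ∀ ξ, ξ ≠ 0 → ∀ t > 0,
    ‖Φ ξ t‖ ≤ C * (‖ξ‖⁻¹ * (1 + ‖ξ‖) ^ N * Real.exp (-(κ * (1 - Real.exp (-t)) * ‖ξ‖)))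

lemma dt_pos {t : ℝ} (ht : 0 < t) : 0 < 1 - Real.exp (-t) := by
  have := Real.exp_lt_exp.2 (show -t < 0 by linarith); rw [Real.exp_zero] at this; linarith

lemma SDec.bd' {n : ℕ} {Φ : EE n → ℝ → ℂ} (h : SDec Φ) {t0 : ℝ} (h0 : 0 < t0) :
    ∃ C c : ℝ, 0 < C ∧ 0 < c ∧ ∀ ξ, ξ ≠ 0 → ∀ t ≥ t0, ‖Φ ξ t‖ ≤ C * (‖ξ‖ ^ 0 * ‖ξ‖⁻¹ * Real.exp (-(c * ‖ξ‖))) := by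
  obtain ⟨C, κ, N, hC, hκ, hb⟩ := h.bd
  have hd := dt_pos h0
  obtain ⟨K, hK, hp⟩ := poly_exp N (c := κ * (1 - Real.exp (-t0)) / 2) (by positivity)
  refine ⟨C * K, κ * (1 - Real.exp (-t0)) / 2, by positivity, by positivity, fun ξ hξ t ht => (hb ξ hξ t (by linarith)).trans ?_⟩
  have h1 := hp ‖ξ‖ (norm_nonneg _)
  have h2 : Real.exp (-(κ * (1 - Real.exp (-t)) * ‖ξ‖)) ≤ Real.exp (-(κ * (1 - Real.exp (-t0)) * ‖ξ‖)) := by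
    gcongr
  have h3 : Real.exp (κ * (1 - Real.exp (-t0)) / 2 * ‖ξ‖) * Real.exp (-(κ * (1 - Real.exp (-t0)) * ‖ξ‖)) =
     Real.exp (-(κ * (1 - Real.exp (-t0)) / 2 * ‖ξ‖)) := by
    rw [← Real.exp_add]; congr 1; ring
  calc _ ≤ C * (‖ξ‖⁻¹ * (K * Real.exp (κ * (1 - Real.exp (-t0)) / 2 * ‖ξ‖)) * Real.exp (-(κ * (1 - Real.exp (-t0)) * ‖ξ‖))) := by
        gcongr
    _ = C * K * (‖ξ‖⁻¹ * (Real.exp (κ * (1 - Real.exp (-t0)) / 2 * ‖ξ‖) * Real.exp (-(κ * (1 - Real.exp (-t0)) * ‖ξ‖)))) := by ring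
    _ = _ := by rw [h3]; ring

lemma ae_ne_zero {n : ℕ} (hn : 2 ≤ n) : ∀ᵐ ξ : EE n, ξ ≠ 0 := by
  have : Nontrivial (EE n) := by
    have : Nonempty (Fin n) := ⟨⟨0, by omega⟩⟩
    infer_instance
  exact Measure.ae_ne volume 0

lemma SDec.int {n : ℕ} (hn : 2 ≤ n) {Φ : EE n → ℝ → ℂ} (h : SDec Φ) {t : ℝ} (ht : 0 < t) :
    Integrable (fun ξ => Φ ξ t) := by
  obtain ⟨C, c, hC, hc, hb⟩ := h.bd' ht
  refine ((radial_integrable hn 0 hc).const_mul C).mono' (h.meas t ht) ?_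
  filter_upwards [ae_ne_zero hn] with ξ hξ using hb ξ hξ t le_rfl

lemma SDec.inte {n : ℕ} (hn : 2 ≤ n) {Φ : EE n → ℝ → ℂ} (h : SDec Φ) {t : ℝ} (ht : 0 < t) (x : EE n) :
    Integrable (fun ξ => ee x ξ * Φ ξ t) :=
  (h.int hn ht).bdd_mul (c := 1) (ee_cont x).aestronglyMeasurable (Filter.Eventually.of_forall fun ξ => (ee_norm x ξ).le)

lemma SDec.mulpoly {n : ℕ} {Φ : EE n → ℝ → ℂ} (h : SDec Φ) {q : EE n → ℝ → ℂ} (hq : ∀ t > 0, AEStronglyMeasurable (fun ξ => q ξ t) volume)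
    {A : ℝ} {k : ℕ} (hb : ∀ ξ, ∀ t > 0, ‖q ξ t‖ ≤ A * (1 + ‖ξ‖) ^ k) : SDec (fun ξ t => q ξ t * Φ ξ t) := by
  obtain ⟨C, κ, N, hC, hκ, hbd⟩ := h.bd
  refine ⟨fun t ht => (hq t ht).mul (h.meas t ht), (|A| + 1) * C, κ, k + N, by positivity, hκ, fun ξ hξ t ht => ?_⟩
  rw [norm_mul]
  calc _ ≤ ((|A| + 1) * (1 + ‖ξ‖) ^ k) * (C * (‖ξ‖⁻¹ * (1 + ‖ξ‖) ^ N * Real.exp (-(κ * (1 - Real.exp (-t)) * ‖ξ‖)))) := by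
        refine mul_le_mul ((hb ξ t ht).trans ?_) (hbd ξ hξ t ht) (norm_nonneg _) (by positivity)
        gcongr
        linarith [le_abs_self A]
    _ = _ := by rw [pow_add]; ring

lemma SDec.zmul {n : ℕ} {Φ : EE n → ℝ → ℂ} (h : SDec Φ) (j : Fin n) : SDec (fun ξ t => zz ξ j * Φ ξ t) :=
  h.mulpoly (q := fun ξ _ => zz ξ j) (fun t _ => (zz_cont j).aestronglyMeasurable) (A := 2 * π) (k := 1) fun ξ t _ =>
    (zz_norm ξ j).trans (by gcongr; rw [pow_one]; linarith)
lemma SDec.monmul {n : ℕ} {Φ : EE n → ℝ → ℂ} (h : SDec Φ) (p : List (Fin n)) : SDec (fun ξ t => zmon p ξ * Φ ξ t) :=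
  h.mulpoly (q := fun ξ _ => zmon p ξ) (fun t _ => (zmon_cont p).aestronglyMeasurable) (A := (2 * π) ^ p.length) (k := p.length) fun ξ t _ =>
    (zmon_norm p ξ).trans (by rw [mul_pow]; gcongr; linarith)
lemma SDec.tmul {n : ℕ} {Φ : EE n → ℝ → ℂ} (h : SDec Φ) (c : ℝ → ℂ) {A : ℝ} (hc : ∀ t > 0, ‖c t‖ ≤ A) : SDec (fun ξ t => c t * Φ ξ t) :=
  h.mulpoly (q := fun _ t => c t) (fun t _ => aestronglyMeasurable_const) (A := A) (k := 0) fun ξ t ht => by simpa using hc t ht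
lemma SDec.cmul {n : ℕ} {Φ : EE n → ℝ → ℂ} (h : SDec Φ) (c : ℂ) : SDec (fun ξ t => c * Φ ξ t) :=
  h.tmul (fun _ => c) (A := ‖c‖) fun _ _ => le_rfl
lemma SDec.add {n : ℕ} {Φ Ψ : EE n → ℝ → ℂ} (h : SDec Φ) (h' : SDec Ψ) : SDec (fun ξ t => Φ ξ t + Ψ ξ t) := by
  obtain ⟨C, κ, N, hC, hκ, hbd⟩ := h.bd
  obtain ⟨C', κ', N', hC', hκ', hbd'⟩ := h'.bd
  refine ⟨fun t ht => (h.meas t ht).add (h'.meas t ht), C + C', min κ κ', max N N', by positivity, by positivity, fun ξ hξ t ht => ?_⟩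
  have hd := dt_pos ht
  refine (norm_add_le _ _).trans ?_
  rw [add_mul]
  have h1 : (1:ℝ) ≤ 1 + ‖ξ‖ := by linarith [norm_nonneg ξ]
  refine add_le_add ((hbd ξ hξ t ht).trans ?_) ((hbd' ξ hξ t ht).trans ?_)
  · gcongr
    · exact le_max_left _ _
    · exact min_le_left _ _
  · gcongr
    · exact le_max_right _ _
    · exact min_le_right _ _
lemma SDec.zero {n : ℕ} : SDec (fun (_ : EE n) (_ : ℝ) => (0:ℂ)) :=
  ⟨fun t _ => aestronglyMeasurable_const, 1, 1, 0, one_pos, one_pos, fun ξ _ t _ => by rw [norm_zero]; positivity⟩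
lemma SDec.sum {n : ℕ} {ι : Type*} (s : Finset ι) {Φ : ι → EE n → ℝ → ℂ} (h : ∀ i, SDec (Φ i)) :
    SDec (fun ξ t => ∑ i ∈ s, Φ i ξ t) := by
  classical
  induction s using Finset.induction_on with
  | empty => simpa using SDec.zero
  | insert a s ha ih => simp only [Finset.sum_insert ha]; exact (h a).add ih

lemma Vf_add {n : ℕ} (hn : 2 ≤ n) {Φ Ψ : EE n → ℝ → ℂ} (h : SDec Φ) (h' : SDec Ψ) {p : Pt n} (hp : 0 < p.2) :
    Vf (fun ξ t => Φ ξ t + Ψ ξ t) p = Vf Φ p + Vf Ψ p := by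
  unfold Vf
  simp only [mul_add]
  rw [integral_add (h.inte hn hp _) (h'.inte hn hp _), Complex.add_re]
lemma Vf_sum {n : ℕ} (hn : 2 ≤ n) {ι : Type*} (s : Finset ι) {Φ : ι → EE n → ℝ → ℂ} (h : ∀ i, SDec (Φ i)) {p : Pt n} (hp : 0 < p.2) :
    Vf (fun ξ t => ∑ i ∈ s, Φ i ξ t) p = ∑ i ∈ s, Vf (Φ i) p := by
  unfold Vf
  simp only [Finset.mul_sum]
  rw [integral_finsetSum _ fun i _ => (h i).inte hn hp _, Complex.re_sum]
lemma Vf_tmul {n : ℕ} (Φ : EE n → ℝ → ℂ) (c : ℝ → ℝ) (p : Pt n) :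
    Vf (fun ξ t => (c t : ℂ) * Φ ξ t) p = c p.2 * Vf Φ p := by
  unfold Vf
  simp only [mul_left_comm (ee _ _)]
  rw [integral_const_mul, Complex.re_ofReal_mul]
lemma Vf_congr {n : ℕ} (hn : 2 ≤ n) {Φ Ψ : EE n → ℝ → ℂ} {p : Pt n} (h : ∀ ξ, ξ ≠ 0 → Φ ξ p.2 = Ψ ξ p.2) :
    Vf Φ p = Vf Ψ p := by
  unfold Vf
  congr 1
  apply integral_congr_ae
  filter_upwards [ae_ne_zero hn] with ξ hξ
  rw [h ξ hξ]

lemma ee_hasFDeriv {n : ℕ} (ξ : EE n) (p : Pt n) :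
    HasFDerivAt (fun q : Pt n => ee q.1 ξ) (grC (fun j => ee p.1 ξ * zz ξ j) 0) p := by
  have h1 : HasFDerivAt (fun q : Pt n => 2 * (π:ℂ) * Complex.I * ((∑ j, q.1 j * ξ j : ℝ) : ℂ)) (grC (fun j => zz ξ j) 0) p := by
    have : (fun q : Pt n => 2 * (π:ℂ) * Complex.I * ((∑ j, q.1 j * ξ j : ℝ) : ℂ)) = fun q => grC (fun j => zz ξ j) 0 q := by
      ext q; rw [grC_apply]; push_cast; rw [Finset.mul_sum]; simp only [mul_zero, add_zero, zz]
      refine Finset.sum_congr rfl fun j _ => by ring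
    rw [this]; exact (grC (fun j => zz ξ j) 0).hasFDerivAt
  have := h1.cexp
  refine HasFDerivAt.congr_fderiv this ?_
  ext v
  · simp [grC, ee, Finset.mul_sum, mul_left_comm]
  · simp [grC]

theorem Vf_hasFDeriv {n : ℕ} (hn : 2 ≤ n) {Φ Φ' : EE n → ℝ → ℂ} (h : SDec Φ) (h' : SDec Φ')
    (hd : ∀ ξ, ξ ≠ 0 → ∀ t > 0, HasDerivAt (Φ ξ) (Φ' ξ t) t) {p : Pt n} (hp : 0 < p.2) :
    HasFDerivAt (Vf Φ) (gr (fun j => Vf (fun ξ t => zz ξ j * Φ ξ t) p) (Vf Φ' p)) p := by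
  have hz : ∀ j, SDec (fun ξ t => zz ξ j * Φ ξ t) := fun j => h.zmul j
  choose C c hC hc hb using fun j => (hz j).bd' (half_pos hp)
  obtain ⟨C', c', hC', hc', hb'⟩ := h'.bd' (half_pos hp)
  have key := hasFDerivAt_integral_of_dominated_of_fderiv_le (𝕜 := ℝ) (μ := volume) (x₀ := p)
    (s := {q : Pt n | p.2 / 2 < q.2}) (F := fun (q : Pt n) ξ => ee q.1 ξ * Φ ξ q.2)
    (F' := fun q ξ => grC (fun j => ee q.1 ξ * (zz ξ j * Φ ξ q.2)) (ee q.1 ξ * Φ' ξ q.2))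
    (bound := fun ξ => ∑ j, C j * (‖ξ‖ ^ 0 * ‖ξ‖⁻¹ * Real.exp (-(c j * ‖ξ‖))) + C' * (‖ξ‖ ^ 0 * ‖ξ‖⁻¹ * Real.exp (-(c' * ‖ξ‖))))
    ((isOpen_lt continuous_const continuous_snd).mem_nhds (show p.2 / 2 < p.2 by linarith)) ?_ ?_ ?_ ?_ ?_ ?_
  · have h2 := Complex.reCLM.hasFDerivAt.comp p key
    refine HasFDerivAt.congr_fderiv h2 ?_
    have hIn : Integrable (fun ξ => grC (fun j => ee p.1 ξ * (zz ξ j * Φ ξ p.2)) (ee p.1 ξ * Φ' ξ p.2)) := by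
      have i1 := fun j => (ContinuousLinearMap.smulRightL ℝ (Pt n) ℂ ((EuclideanSpace.proj j : EE n →L[ℝ] ℝ).comp (ContinuousLinearMap.fst ℝ (EE n) ℝ))).integrable_comp ((hz j).inte hn hp p.1)
      have i2 := (ContinuousLinearMap.smulRightL ℝ (Pt n) ℂ (ContinuousLinearMap.snd ℝ (EE n) ℝ)).integrable_comp (h'.inte hn hp p.1)
      exact Integrable.add (integrable_finsetSum Finset.univ fun j _ => i1 j) i2
    refine ContinuousLinearMap.ext fun v => ?_
    rw [gr_apply, ContinuousLinearMap.comp_apply, ContinuousLinearMap.integral_apply hIn]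
    simp only [grC_apply]
    rw [integral_add (integrable_finsetSum _ fun j _ => ((hz j).inte hn hp p.1).const_mul _) ((h'.inte hn hp p.1).const_mul _),
      integral_finsetSum _ fun j _ => ((hz j).inte hn hp p.1).const_mul _]
    simp only [integral_const_mul, Complex.reCLM_apply, Complex.add_re, Complex.re_sum, Complex.re_ofReal_mul, Vf]
    congr 1
    · exact Finset.sum_congr rfl fun j _ => mul_comm _ _
    · exact mul_comm _ _
  · filter_upwards [(isOpen_lt continuous_const continuous_snd).mem_nhds (show (p : Pt n) ∈ {q : Pt n | 0 < q.2} from hp)] with q hq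
    exact (h.inte hn hq q.1).1
  · exact h.inte hn hp p.1
  · unfold grC
    refine AEStronglyMeasurable.add (Finset.aestronglyMeasurable_fun_sum _ fun j _ => ?_) ?_
    · exact (ContinuousLinearMap.smulRightL ℝ (Pt n) ℂ _).continuous.comp_aestronglyMeasurable ((hz j).inte hn hp p.1).1
    · exact (ContinuousLinearMap.smulRightL ℝ (Pt n) ℂ _).continuous.comp_aestronglyMeasurable (h'.inte hn hp p.1).1
  · filter_upwards [ae_ne_zero hn] with ξ hξ q hq
    refine (grC_norm _ _).trans (add_le_add (Finset.sum_le_sum fun j _ => ?_) ?_)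
    · rw [norm_mul, ee_norm, one_mul]; exact hb j ξ hξ _ (le_of_lt hq)
    · rw [norm_mul, ee_norm, one_mul]; exact hb' ξ hξ _ (le_of_lt hq)
  · exact Integrable.add (integrable_finsetSum _ fun j _ => (radial_integrable hn 0 (hc j)).const_mul _)
      ((radial_integrable hn 0 hc').const_mul _)
  · filter_upwards [ae_ne_zero hn] with ξ hξ q hq
    have hq0 : 0 < q.2 := lt_trans (half_pos hp) hq
    have h1 := ee_hasFDeriv ξ q
    have h2 : HasFDerivAt (fun q : Pt n => Φ ξ q.2) (grC (fun _ => 0) (Φ' ξ q.2)) q := by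
      have := (hd ξ hξ q.2 hq0).hasFDerivAt.comp q (ContinuousLinearMap.snd ℝ (EE n) ℝ).hasFDerivAt
      refine HasFDerivAt.congr_fderiv this ?_
      ext v
      · simp [grC]
      · simp [grC]
    refine HasFDerivAt.congr_fderiv (h1.mul h2) ?_
    refine ContinuousLinearMap.ext fun v => ?_
    simp only [add_apply, smul_apply, grC_apply, smul_eq_mul, mul_zero, Finset.sum_const_zero,
      zero_add, add_zero, Finset.mul_sum]
    rw [add_comm]
    congr 1
    · exact Finset.sum_congr rfl fun j _ => by ring
    · ring

def asym {n : ℕ} (p : List (Fin n)) (m : ℂ → ℝ → ℂ) (ξ : EE n) (t : ℝ) : ℂ := zmon p ξ * m (lam ξ) (Real.exp (-t))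

lemma lam_sec {n : ℕ} {ξ : EE n} (h : ξ ≠ 0) : lam ξ ∈ Sec := by
  have : 0 < ‖ξ‖ := norm_pos_iff.2 h
  show |(lam ξ).im| < (lam ξ).re
  unfold lam
  rw [Complex.ofReal_im, Complex.ofReal_re, abs_zero]; positivity
lemma rh_lam {n : ℕ} (ξ : EE n) : rh (lam ξ) = 2 * π * ‖ξ‖ := by
  unfold rh lam
  rw [Complex.norm_real, Real.norm_of_nonneg (by positivity), show 4 * π ^ 2 * ‖ξ‖ ^ 2 = (2 * π * ‖ξ‖) ^ 2 by ring]
  exact Real.sqrt_sq (by positivity)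
lemma et_mem {t : ℝ} (ht : 0 < t) : Real.exp (-t) ∈ Ioo (0:ℝ) 1 :=
  ⟨Real.exp_pos _, by linarith [dt_pos ht]⟩
lemma et_mem' {t : ℝ} (ht : 0 < t) : Real.exp (-t) ∈ Ioc (0:ℝ) 1 := ⟨(et_mem ht).1, (et_mem ht).2.le⟩

lemma msym_meas {n : ℕ} (hn : 2 ≤ n) {m : ℂ → ℂ} (hol : DifferentiableOn ℂ m Sec) :
    AEStronglyMeasurable (fun ξ : EE n => m (lam ξ)) volume := by
  have h1 : ContinuousOn (fun ξ : EE n => m (lam ξ)) {0}ᶜ := by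
    refine hol.continuousOn.comp (t := Sec) ?_ fun ξ hξ => lam_sec hξ
    unfold lam; fun_prop
  have h2 := h1.aestronglyMeasurable (μ := volume) (measurableSet_singleton _).compl
  have h3 : (volume : Measure (EE n)).restrict {0}ᶜ = volume := by
    apply Measure.restrict_eq_self_of_ae_mem
    filter_upwards [ae_ne_zero hn] with ξ hξ using hξ
  rwa [h3] at h2

lemma asym_dec {n : ℕ} (hn : 2 ≤ n) {b g : ℕ} {m : ℂ → ℝ → ℂ}
    (hol : ∀ s ∈ Ioc (0 : ℝ) 1, DifferentiableOn ℂ (fun l => m l s) Sec)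
    (hbd : BD (fun r => (1 + r) ^ b * pw (1 + g) r) 1 m) (p : List (Fin n)) (hp : g ≤ p.length) : SDec (asym p m) := by
  obtain ⟨A, hA, κ, hκ, hb⟩ := hbd
  obtain ⟨k, hk⟩ := Nat.exists_eq_add_of_le hp
  refine ⟨fun t ht => (zmon_cont p).aestronglyMeasurable.mul (msym_meas hn (hol _ (et_mem' ht))),
    A * (2 * π) ^ (k + b) , κ * (2 * π), k + b, by positivity, by positivity, fun ξ hξ t ht => ?_⟩
  have h0 : 0 < ‖ξ‖ := norm_pos_iff.2 hξ
  have hz := zmon_norm p ξ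
  have hm := hb _ (lam_sec hξ) _ (et_mem' ht)
  rw [rh_lam, Real.rpow_one] at hm
  have hs := et_mem ht
  have hpi : (1:ℝ) ≤ 2 * π := by linarith [Real.pi_gt_three]
  unfold asym
  rw [norm_mul]
  calc _ ≤ (2 * π * ‖ξ‖) ^ p.length * (A * ((1 + 2 * π * ‖ξ‖) ^ b * pw (1 + g) (2 * π * ‖ξ‖)) * 1 * Real.exp (-(κ * (2 * π * ‖ξ‖) * (1 - Real.exp (-t))))) := by
        refine mul_le_mul hz (hm.trans ?_) (norm_nonneg _) (by positivity)
        have : 0 ≤ pw (1 + g) (2 * π * ‖ξ‖) := by unfold pw; positivity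
        gcongr
        exact hs.2.le
    _ = A * ((2 * π) ^ k * ‖ξ‖ ^ k * (1 + 2 * π * ‖ξ‖) ^ b * (2 * π * ‖ξ‖)⁻¹ * Real.exp (-(κ * (2 * π) * (1 - Real.exp (-t)) * ‖ξ‖))) := by
        rw [hk, pow_add, show κ * (2 * π * ‖ξ‖) * (1 - Real.exp (-t)) = κ * (2 * π) * (1 - Real.exp (-t)) * ‖ξ‖ by ring]
        unfold pw; rw [pow_add]
        field_simp
        rw [mul_pow]
    _ ≤ A * ((2 * π) ^ k * (1 + ‖ξ‖) ^ k * (2 * π * (1 + ‖ξ‖)) ^ b * ‖ξ‖⁻¹ * Real.exp (-(κ * (2 * π) * (1 - Real.exp (-t)) * ‖ξ‖))) := by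
        have e1 : (2 * π * ‖ξ‖)⁻¹ ≤ ‖ξ‖⁻¹ := by
          gcongr; nlinarith
        gcongr
        · linarith
        · linarith
    _ = _ := by rw [mul_pow (2 * π) (1 + ‖ξ‖) b, pow_add, pow_add]; ring

lemma Vf_conv {n : ℕ} (hn : 2 ≤ n) {Φ : EE n → ℝ → ℂ} (h : SDec Φ) {θ : EE n → ℝ} (hθ : Integrable θ) {p : Pt n} (hp : 0 < p.2) :
    Vf (fun ξ t => Φ ξ t * ∫ y, ee (-y) ξ * (θ y : ℂ)) p = ∫ y, Vf Φ (p.1 - y, p.2) * θ y := by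
  have eadd : ∀ x y ξ : EE n, ee (x - y) ξ = ee x ξ * ee (-y) ξ := by
    intro x y ξ; unfold ee; rw [← Complex.exp_add]; congr 1
    rw [← mul_add, ← Complex.ofReal_add, ← Finset.sum_add_distrib]
    congr 3; ext j; simp; ring
  have hI : Integrable (fun q : EE n × EE n => ee (p.1 - q.2) q.1 * (Φ q.1 p.2 * (θ q.2 : ℂ))) (volume.prod volume) := by
    refine ((h.int hn hp).mul_prod hθ.ofReal).bdd_mul (c := 1) ?_ (Filter.Eventually.of_forall fun q => (ee_norm _ _).le)
    apply Continuous.aestronglyMeasurable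
    exact ee_cont2.comp (by fun_prop : Continuous fun q : EE n × EE n => (p.1 - q.2, q.1))
  have hF := integral_integral_swap (f := fun ξ y => ee (p.1 - y) ξ * (Φ ξ p.2 * (θ y : ℂ))) hI
  unfold Vf
  have e1 : ∀ ξ, ee p.1 ξ * (Φ ξ p.2 * ∫ y, ee (-y) ξ * (θ y : ℂ)) = ∫ y, ee (p.1 - y) ξ * (Φ ξ p.2 * (θ y : ℂ)) := by
    intro ξ
    rw [← mul_assoc, ← integral_const_mul]
    congr 1; ext y; rw [eadd]; ring
  have e2 : ∀ y, ∫ ξ, ee (p.1 - y) ξ * (Φ ξ p.2 * (θ y : ℂ)) = (∫ ξ, ee (p.1 - y) ξ * Φ ξ p.2) * (θ y : ℂ) := by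
    intro y
    rw [← integral_mul_const]
    congr 1; ext ξ; ring
  simp only [e1]
  rw [hF]
  have h3 := hI.integral_prod_right
  simp only [e2] at h3 ⊢
  have := integral_re h3
  simp only [RCLike.re_to_complex] at this
  rw [← this]
  congr 1; ext y
  rw [Complex.re_mul_ofReal]

/-- Fourier transform of a real function -/
def hat {n : ℕ} (θ : EE n → ℝ) (ξ : EE n) : ℂ := ∫ y, ee (-y) ξ * (θ y : ℂ)

lemma hat_eq {n : ℕ} (θ : EE n → ℝ) : hat θ = FourierTransform.fourier (fun y => (θ y : ℂ)) := by
  ext ξ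
  rw [Real.fourier_eq']
  unfold hat
  congr 1; ext y
  unfold ee
  rw [smul_eq_mul]
  congr 2
  rw [PiLp.inner_apply]
  push_cast
  rw [Finset.mul_sum, Finset.mul_sum, Finset.sum_mul]
  refine Finset.sum_congr rfl fun j _ => ?_
  simp; ring

lemma hat_cont {n : ℕ} {θ : EE n → ℝ} (hθ : Integrable θ) : Continuous (hat θ) := by
  rw [hat_eq]
  exact VectorFourier.fourierIntegral_continuous Real.continuous_fourierChar (by exact continuous_inner) hθ.ofReal
lemma hat_norm {n : ℕ} (θ : EE n → ℝ) (ξ : EE n) : ‖hat θ ξ‖ ≤ ∫ y, |θ y| := by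
  refine (norm_integral_le_integral_norm _).trans (le_of_eq ?_)
  congr 1; ext y; rw [norm_mul, ee_norm, one_mul, Complex.norm_real, Real.norm_eq_abs]

lemma hat_deriv {n : ℕ} {θ : EE n → ℝ} (h1 : ContDiff ℝ 1 θ) (hθ : Integrable θ) (hd : Integrable (fun x => fderiv ℝ θ x)) (j : Fin n)
    (ξ : EE n) : hat (fun x => fderiv ℝ θ x (EuclideanSpace.single j 1)) ξ = zz ξ j * hat θ ξ := by
  have hD : Differentiable ℝ θ := h1.differentiable (by norm_num)
  have hf : ∀ x, HasFDerivAt (fun y => (θ y : ℂ)) (Complex.ofRealCLM.comp (fderiv ℝ θ x)) x := fun x =>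
    Complex.ofRealCLM.hasFDerivAt.comp x (hD x).hasFDerivAt
  have hfe : fderiv ℝ (fun y => (θ y : ℂ)) = fun x => Complex.ofRealCLM.comp (fderiv ℝ θ x) := by
    ext1 x; exact (hf x).fderiv
  have hI2 : Integrable (fun x => Complex.ofRealCLM.comp (fderiv ℝ θ x)) :=
    ((ContinuousLinearMap.compL ℝ (EE n) ℝ ℂ) Complex.ofRealCLM).integrable_comp hd
  have := Real.fourier_fderiv (f := fun y => (θ y : ℂ)) hθ.ofReal (fun x => (hf x).differentiableAt) (by rw [hfe]; exact hI2)
  have h2 := congrFun this ξ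
  rw [hfe] at h2
  have h3 := congrArg (fun L => L (EuclideanSpace.single j 1)) h2
  simp only at h3
  rw [Real.fourier_eq', ContinuousLinearMap.integral_apply] at h3
  · rw [hat_eq, hat_eq, Real.fourier_eq']
    refine Eq.trans ?_ (h3.trans ?_)
    · rfl
    · rw [VectorFourier.fourierSMulRight_apply]
      have : (innerSL ℝ) ξ (EuclideanSpace.single j 1) = ξ j := by
        simp [innerSL_apply_apply, EuclideanSpace.inner_single_right]
      simp [zz, this]
      try ring
  · have hi := (Real.fourierIntegral_convergent_iff (V := EE n) (μ := volume) ξ).2 hI2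
    refine hi.congr (Filter.Eventually.of_forall fun v => ?_)
    simp only [Circle.smul_def, Real.fourierChar_apply]
    congr 2
    push_cast; ring

lemma SDec.freeze {n : ℕ} {Φ : EE n → ℝ → ℂ} (h : SDec Φ) {t0 : ℝ} (h0 : 0 < t0) : SDec (fun ξ (_ : ℝ) => Φ ξ t0) := by
  obtain ⟨C, κ, N, hC, hκ, hb⟩ := h.bd
  have hd := dt_pos h0
  refine ⟨fun t _ => h.meas t0 h0, C, κ * (1 - Real.exp (-t0)), N, hC, by positivity, fun ξ hξ t ht => (hb ξ hξ t0 h0).trans ?_⟩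
  have h1 : 1 - Real.exp (-t) ≤ 1 := by linarith [Real.exp_pos (-t)]
  have k1 : κ * (1 - Real.exp (-t0)) * (1 - Real.exp (-t)) * ‖ξ‖ ≤ κ * (1 - Real.exp (-t0)) * ‖ξ‖ :=
    mul_le_mul_of_nonneg_right (mul_le_of_le_one_right (by positivity) h1) (norm_nonneg _)
  exact mul_le_mul_of_nonneg_left (mul_le_mul_of_nonneg_left (Real.exp_le_exp.2 (neg_le_neg k1)) (by positivity)) hC.le

def grx {n : ℕ} (a : Fin n → ℝ) : EE n →L[ℝ] ℝ := (gr a 0).comp (ContinuousLinearMap.inl ℝ (EE n) ℝ)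
lemma grx_apply {n : ℕ} (a : Fin n → ℝ) (v : EE n) : grx a v = ∑ j, a j * v j := by
  simp [grx, gr_apply]
lemma grx_abs {n : ℕ} (a : Fin n → ℝ) (v : EE n) {M : ℝ} (h : ∀ j, |a j| ≤ M) : |grx a v| ≤ n * M * ‖v‖ := by
  rw [grx_apply]
  refine (Finset.abs_sum_le_sum_abs _ _).trans ?_
  calc _ ≤ ∑ _j : Fin n, M * ‖v‖ := Finset.sum_le_sum fun j _ => by
        rw [abs_mul]; exact mul_le_mul (h j) (coord_le v j) (abs_nonneg _) ((abs_nonneg _).trans (h j))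
    _ = _ := by simp; ring

lemma Vf_spatial {n : ℕ} (hn : 2 ≤ n) {Φ : EE n → ℝ → ℂ} (h : SDec Φ) {t : ℝ} (ht : 0 < t) (x : EE n) :
    HasFDerivAt (fun y => Vf Φ (y, t)) (grx (fun j => Vf (fun ξ t => zz ξ j * Φ ξ t) (x, t))) x := by
  have h1 := Vf_hasFDeriv hn (h.freeze ht) SDec.zero (fun ξ _ t _ => hasDerivAt_const t (Φ ξ _)) (p := (x, t)) ht
  have h2 : HasFDerivAt (fun y : EE n => ((y, t) : Pt n)) (ContinuousLinearMap.inl ℝ (EE n) ℝ) x :=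
    hasFDerivAt_prodMk_left x t
  have h3 := HasFDerivAt.comp x h1 h2
  refine HasFDerivAt.congr_fderiv h3 ?_
  unfold grx
  congr 2
  simp [Vf]

lemma scal_int {n : ℕ} {α : ℝ} (hα : α < 1) : ∃ C > 0, ∀ d > 0,
    Integrable (fun z : EE n => (‖z‖ + d) ^ (-((n:ℝ) + 1 - α))) ∧ ∫ z : EE n, (‖z‖ + d) ^ (-((n:ℝ) + 1 - α)) ≤ C * d ^ (α - 1) := by
  set ρ : ℝ := (n:ℝ) + 1 - α with hρ
  have hI : Integrable (fun x : EE n => (1 + ‖x‖) ^ (-ρ)) := integrable_one_add_norm (by simp; linarith)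
  refine ⟨(∫ x : EE n, (1 + ‖x‖) ^ (-ρ)) + 1, ?_, fun d hd => ?_⟩
  · have : 0 ≤ ∫ x : EE n, (1 + ‖x‖) ^ (-ρ) := integral_nonneg fun x => by positivity
    linarith
  have e : (fun z : EE n => (‖z‖ + d) ^ (-ρ)) = fun z => d ^ (-ρ) * (fun x : EE n => (1 + ‖x‖) ^ (-ρ)) (d⁻¹ • z) := by
    ext z
    simp only
    rw [norm_smul, ← Real.mul_rpow hd.le (by positivity), Real.norm_of_nonneg (by positivity)]
    congr 1; field_simp; ring
  rw [e]
  refine ⟨(hI.comp_smul (inv_ne_zero hd.ne')).const_mul _, ?_⟩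
  rw [integral_const_mul, Measure.integral_comp_smul volume (fun x : EE n => (1 + ‖x‖) ^ (-ρ)) d⁻¹, smul_eq_mul, finrank_euclideanSpace_fin]
  have e2 : d ^ (α - 1) = d ^ (-ρ) * |((d⁻¹) ^ n)⁻¹| := by
    rw [inv_pow, inv_inv, abs_of_pos (by positivity), ← Real.rpow_natCast, ← Real.rpow_add hd]
    congr 1; rw [hρ]; ring
  have h0 : 0 ≤ d ^ (α - 1) := by positivity
  rw [← mul_assoc, ← e2]
  nlinarith

def chi (n : ℕ) : ContDiffBump (0 : EE n) := ⟨1/8, 1/4, by norm_num, by norm_num⟩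
lemma chi_nn {n : ℕ} (x : EE n) : 0 ≤ chi n x := (chi n).nonneg
lemma chi_le {n : ℕ} (x : EE n) : chi n x ≤ 1 := (chi n).le_one
lemma chi_one {n : ℕ} {x : EE n} (h : ‖x‖ ≤ 1/8) : chi n x = 1 := (chi n).one_of_mem_closedBall (by simpa [chi] using h)
lemma chi_zero {n : ℕ} {x : EE n} (h : 1/4 ≤ ‖x‖) : chi n x = 0 := (chi n).zero_of_le_dist (by simpa [chi] using h)
lemma chi_cont (n : ℕ) : Continuous (chi n) := (chi n).continuous
lemma chi_cd (n : ℕ) : ContDiff ℝ 1 (chi n) := (chi n).contDiff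
lemma chi_fd0 {n : ℕ} {x : EE n} (h : ‖x‖ < 1/8) : fderiv ℝ (chi n) x = 0 := by
  have := (chi n).eventuallyEq_one_of_mem_ball (x := x) (by simpa [chi] using h)
  rw [this.fderiv_eq]; simp
lemma chi_cs (n : ℕ) : HasCompactSupport (chi n) := (chi n).hasCompactSupport
lemma chi_fc (n : ℕ) (v : EE n) : Continuous (fun x => fderiv ℝ (chi n) x v) :=
  ((chi_cd n).continuous_fderiv (by norm_num)).clm_apply continuous_const
lemma chi_fs (n : ℕ) (v : EE n) : HasCompactSupport (fun x => fderiv ℝ (chi n) x v) :=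
  (chi_cs n).fderiv_apply ℝ v

lemma chi_int {n : ℕ} {L : EE n → ℝ} (h : Continuous L) : Integrable (fun z => chi n z * L z) :=
  ((chi_cont n).mul h).integrable_of_hasCompactSupport ((chi_cs n).mul_right)

/-- Kernels -/
structure Ker {n : ℕ} (α B d : ℝ) (L : EE n → ℝ) (L1 : Fin n → EE n → ℝ) (L2 : Fin n → Fin n → EE n → ℝ) : Prop where
  d1 : ∀ x, HasFDerivAt L (grx (fun j => L1 j x)) x
  d2 : ∀ j x, HasFDerivAt (L1 j) (grx (fun k => L2 k j x)) x
  near : ∀ z, ‖z‖ ≤ 1/4 → |L z| ≤ B * ((‖z‖ + d) ^ (n+1))⁻¹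
  f0 : ∀ z, 1/8 ≤ ‖z‖ → |L z| ≤ B * (‖z‖ ^ (n-1))⁻¹
  f1 : ∀ j z, 1/8 ≤ ‖z‖ → |L1 j z| ≤ B * (‖z‖ ^ n)⁻¹
  f2 : ∀ k j z, 1/8 ≤ ‖z‖ → |L2 k j z| ≤ B * (‖z‖ ^ (n+1))⁻¹
  mean : |∫ z, chi n z * L z| ≤ B * d ^ (α - 1)

lemma inv_pow_up {r : ℝ} (h0 : 0 < r) (h2 : r ≤ 2) {a c : ℕ} (h : a ≤ c) : (r ^ a)⁻¹ ≤ 2 ^ (c - a) * (r ^ c)⁻¹ := by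
  obtain ⟨e, rfl⟩ := Nat.exists_eq_add_of_le h
  rw [Nat.add_sub_cancel_left, pow_add, mul_inv, mul_left_comm]
  have : 1 ≤ 2 ^ e * (r ^ e)⁻¹ := by
    rw [← inv_pow, ← mul_pow]; apply one_le_pow₀
    rw [← div_eq_mul_inv, one_le_div h0]; exact h2
  exact le_mul_of_one_le_right (by positivity) this

lemma asym_cons {n : ℕ} (j : Fin n) (p : List (Fin n)) (m : ℂ → ℝ → ℂ) : asym (j :: p) m = fun ξ t => zz ξ j * asym p m ξ t := by
  ext ξ t; unfold asym; rw [zmon_cons, mul_assoc]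

lemma Vf_asym_bound {n : ℕ} (hn : 2 ≤ n) {b g : ℕ} (hb1 : b ≤ 1) {m : ℂ → ℝ → ℂ}
    (hol : ∀ s ∈ Ioc (0 : ℝ) 1, DifferentiableOn ℂ (fun l => m l s) Sec)
    (hbd : BD (fun r => (1 + r) ^ b * pw (1 + g) r) 1 m) (k : ℕ) :
    ∃ C > 0, ∀ t > 0, ∀ p : List (Fin n), p.length = g + k → ∀ x : EE n,
    |Vf (asym p m) (x, t)| ≤ C * Real.exp (-t) * ((‖x‖ + (1 - Real.exp (-t))) ^ (n-1+k))⁻¹ * (1 + (‖x‖ + (1 - Real.exp (-t)))⁻¹) ^ b := by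
  obtain ⟨C, hC, h⟩ := kernel_bound hn hb1 hol hbd k
  refine ⟨C, hC, fun t ht p hp x => ?_⟩
  refine le_trans ?_ (h _ (et_mem ht) p hp x)
  unfold Vf asym
  refine (Complex.abs_re_le_norm _).trans (le_of_eq ?_)
  congr 2; ext ξ; ring

lemma far_b {n k b : ℕ} {z d : ℝ} (hz : 1/8 ≤ z) (hd : 0 < d) {e : ℕ} (he : e ≤ n - 1 + k) :
    ((z + d) ^ (n-1+k))⁻¹ * (1 + (z + d)⁻¹) ^ b ≤ 8 ^ (n-1+k-e) * 9 ^ b * (z ^ e)⁻¹ := by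
  have h1 : (z + d)⁻¹ ≤ 8 := by
    rw [inv_le_comm₀ (by linarith) (by norm_num)]; linarith
  have h2 : ((z + d) ^ (n-1+k))⁻¹ ≤ 8 ^ (n-1+k-e) * (z ^ e)⁻¹ := by
    obtain ⟨f, hf⟩ := Nat.exists_eq_add_of_le he
    rw [hf, Nat.add_sub_cancel_left, pow_add, mul_inv, mul_comm]
    have : 0 < z := by linarith
    rw [← inv_pow (z + d) f]
    gcongr
    linarith
  have h3 : (1 + (z + d)⁻¹) ^ b ≤ 9 ^ b := by
    have : 0 < z + d := by linarith
    gcongr; linarith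
  calc _ ≤ (8 ^ (n-1+k-e) * (z ^ e)⁻¹) * 9 ^ b := mul_le_mul h2 h3 (by have : 0 < z + d := by linarith
                                                                       positivity) (by have : 0 < z := by linarith
                                                                                       positivity)
    _ = _ := by ring

lemma near_b {n k b : ℕ} (hb : b ≤ 1) {r : ℝ} (h0 : 0 < r) (h2 : r ≤ 2) {e : ℕ} (he : n - 1 + k + b ≤ e) :
    (r ^ (n-1+k))⁻¹ * (1 + r⁻¹) ^ b ≤ 3 * 2 ^ e * (r ^ e)⁻¹ := by
  have h3 : (1 + r⁻¹) ^ b ≤ 3 * (r ^ b)⁻¹ := by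
    interval_cases b
    · norm_num
    · rw [pow_one, pow_one]
      have : 1 ≤ 2 * r⁻¹ := by rw [← div_eq_mul_inv, one_le_div h0]; exact h2
      linarith
  calc _ ≤ (r ^ (n-1+k))⁻¹ * (3 * (r ^ b)⁻¹) := by gcongr
    _ = 3 * (r ^ (n-1+k+b))⁻¹ := by rw [pow_add r (n-1+k) b]; field_simp
    _ ≤ 3 * (2 ^ (e - (n-1+k+b)) * (r ^ e)⁻¹) := by gcongr; exact inv_pow_up h0 h2 he
    _ ≤ 3 * (2 ^ e * (r ^ e)⁻¹) := by gcongr; norm_num; omega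
    _ = _ := by ring

theorem ker_exists {n : ℕ} (hn : 3 ≤ n) {α : ℝ} (hα : α ∈ Ioo (0:ℝ) 1) {b g k : ℕ} (hb1 : b ≤ 1) (hkb : k + b ≤ 2) {m : ℂ → ℝ → ℂ}
    (hol : ∀ s ∈ Ioc (0 : ℝ) 1, DifferentiableOn ℂ (fun l => m l s) Sec)
    (hbd : BD (fun r => (1 + r) ^ b * pw (1 + g) r) 1 m) :
    ∃ B > 0, ∀ t > 0, ∀ p : List (Fin n), p.length = g + k →
      Ker α (B * Real.exp (-t)) (1 - Real.exp (-t)) (fun x => Vf (asym p m) (x, t)) (fun j x => Vf (asym (j :: p) m) (x, t))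
        (fun k j x => Vf (asym (k :: j :: p) m) (x, t)) := by
  have hn2 : 2 ≤ n := by omega
  obtain ⟨C0, hC0, b0⟩ := Vf_asym_bound hn2 hb1 hol hbd k
  obtain ⟨C1, hC1, b1⟩ := Vf_asym_bound hn2 hb1 hol hbd (k+1)
  obtain ⟨C2, hC2, b2⟩ := Vf_asym_bound hn2 hb1 hol hbd (k+2)
  obtain ⟨Cm, hCm, bm⟩ := Vf_asym_bound hn2 hb1 hol hbd (k-1)
  obtain ⟨S, hS, sc⟩ := scal_int (n := n) hα.2
  set X : ℝ := ∑ j : Fin n, ∫ x, |fderiv ℝ (chi n) x (EuclideanSpace.single j 1)| with hX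
  have hX0 : 0 ≤ X := Finset.sum_nonneg fun j _ => integral_nonneg fun x => abs_nonneg _
  set B1 := C0 * (3 * 2 ^ (n+1)) with hB1
  set B2 := C0 * (8 ^ (n-1+k) * 9 ^ b) with hB2
  set B3 := C1 * (8 ^ (n+k) * 9 ^ b) with hB3
  set B4 := C2 * (8 ^ (n+1+k) * 9 ^ b) with hB4
  set B5 := C0 * (3 * 2 ^ n) * 2 * S with hB5
  set B6 := X * (Cm * (8 ^ (n+k) * 9 ^ b)) with hB6
  have p1 : 0 < B1 := by positivity
  have p2 : 0 < B2 := by positivity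
  have p3 : 0 < B3 := by positivity
  have p4 : 0 < B4 := by positivity
  have p5 : 0 < B5 := by positivity
  have p6 : 0 ≤ B6 := by positivity
  refine ⟨B1 + B2 + B3 + B4 + B5 + B6, by positivity, fun t ht p hp => ?_⟩
  have hE := Real.exp_pos (-t)
  have hd := dt_pos ht
  have hd1 : 1 - Real.exp (-t) ≤ 1 := by linarith
  have dec : ∀ q : List (Fin n), g ≤ q.length → SDec (asym q m) := fun q hq => asym_dec hn2 hol hbd q hq
  have up : ∀ {Bi Y Z : ℝ}, Bi ≤ B1 + B2 + B3 + B4 + B5 + B6 → 0 ≤ Z → Y ≤ Bi * Real.exp (-t) * Z →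
      Y ≤ (B1 + B2 + B3 + B4 + B5 + B6) * Real.exp (-t) * Z := fun h1 h2 h3 => h3.trans (by gcongr)
  have far : ∀ (q : List (Fin n)) (k' : ℕ) (e : ℕ) (C' : ℝ), 0 < C' → e ≤ n-1+k' → q.length = g + k' →
      (∀ t > 0, ∀ p : List (Fin n), p.length = g + k' → ∀ x : EE n, |Vf (asym p m) (x, t)| ≤ C' * Real.exp (-t) * ((‖x‖ + (1 - Real.exp (-t))) ^ (n-1+k'))⁻¹ * (1 + (‖x‖ + (1 - Real.exp (-t)))⁻¹) ^ b) →
      ∀ z, 1/8 ≤ ‖z‖ → |Vf (asym q m) (z, t)| ≤ (C' * (8 ^ (n-1+k'-e) * 9 ^ b)) * Real.exp (-t) * (‖z‖ ^ e)⁻¹ := by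
    intro q k' e C' hC' he hq hb z hz
    refine (hb t ht q hq z).trans ?_
    have := far_b (n := n) (k := k') (b := b) hz hd he
    calc _ = C' * Real.exp (-t) * (((‖z‖ + (1 - Real.exp (-t))) ^ (n-1+k'))⁻¹ * (1 + (‖z‖ + (1 - Real.exp (-t)))⁻¹) ^ b) := by ring
      _ ≤ _ := mul_le_mul_of_nonneg_left this (by positivity)
      _ = _ := by ring
  have p8 : ∀ {a c : ℕ}, a ≤ c → (8:ℝ) ^ a ≤ 8 ^ c := fun h => pow_le_pow_right₀ (by norm_num) h
  have hder : ∀ q : List (Fin n), g ≤ q.length → ∀ x, HasFDerivAt (fun x => Vf (asym q m) (x, t)) (grx (fun j => Vf (asym (j :: q) m) (x, t))) x := by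
    intro q hq x
    refine HasFDerivAt.congr_fderiv (Vf_spatial hn2 (dec q hq) ht x) ?_
    congr 1; ext j; rw [asym_cons]
  have near : ∀ z : EE n, ‖z‖ ≤ 1/4 → ∀ e, n - 1 + k + b ≤ e → |Vf (asym p m) (z, t)| ≤ C0 * (3 * 2 ^ e) * Real.exp (-t) * ((‖z‖ + (1 - Real.exp (-t))) ^ e)⁻¹ := by
    intro z hz e he
    refine (b0 t ht p hp z).trans ?_
    have h0 : 0 < ‖z‖ + (1 - Real.exp (-t)) := by positivity
    have := near_b (n := n) hb1 h0 (by linarith) he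
    calc _ = C0 * Real.exp (-t) * (((‖z‖ + (1 - Real.exp (-t))) ^ (n-1+k))⁻¹ * (1 + (‖z‖ + (1 - Real.exp (-t)))⁻¹) ^ b) := by ring
      _ ≤ _ := mul_le_mul_of_nonneg_left this (by positivity)
      _ = _ := by ring
  have hcont : Continuous (fun x => Vf (asym p m) (x, t)) :=
    continuous_iff_continuousAt.2 fun x => (hder p (by omega) x).continuousAt
  refine ⟨hder p (by omega), fun j x => hder (j :: p) (by simp; omega) x, fun z hz => ?_, fun z hz => ?_, fun j z hz => ?_, fun i j z hz => ?_, ?_⟩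
  · exact up (Bi := B1) (by linarith) (by positivity) (near z hz (n+1) (by omega))
  · refine up (Bi := B2) (by linarith) (by positivity) ((far p k (n-1) C0 hC0 (by omega) hp b0 z hz).trans ?_)
    rw [hB2]; gcongr ?_ * _ * _; gcongr C0 * (?_ * _); exact p8 (by omega)
  · refine up (Bi := B3) (by linarith) (by positivity) ((far (j :: p) (k+1) n C1 hC1 (by omega) (by simp; omega) b1 z hz).trans ?_)
    rw [hB3]; gcongr ?_ * _ * _; gcongr C1 * (?_ * _); exact p8 (by omega)
  · refine up (Bi := B4) (by linarith) (by positivity) ((far (i :: j :: p) (k+2) (n+1) C2 hC2 (by omega) (by simp; omega) b2 z hz).trans ?_)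
    rw [hB4]; gcongr ?_ * _ * _; gcongr C2 * (?_ * _); exact p8 (by omega)
  · rcases Nat.eq_zero_or_pos k with hk | hk
    · refine up (Bi := B5) (by linarith) (by positivity) ?_
      obtain ⟨i1, i2⟩ := sc _ hd
      have : ∀ z : EE n, ‖chi n z * Vf (asym p m) (z, t)‖ ≤ C0 * (3 * 2 ^ n) * 2 * Real.exp (-t) * (‖z‖ + (1 - Real.exp (-t))) ^ (-((n:ℝ) + 1 - α)) := by
        intro z
        rcases le_total (‖z‖) (1/4) with hz | hz
        · rw [norm_mul, Real.norm_of_nonneg (chi_nn z), Real.norm_eq_abs]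
          refine (mul_le_of_le_one_left (abs_nonneg _) (chi_le z)).trans ((near z hz n (by omega)).trans ?_)
          have h0 : 0 < ‖z‖ + (1 - Real.exp (-t)) := by positivity
          set r := ‖z‖ + (1 - Real.exp (-t)) with hr
          have : (r ^ n)⁻¹ ≤ 2 * r ^ (-((n:ℝ) + 1 - α)) := by
            have e1 : (r ^ n)⁻¹ = r ^ (1 - α) * r ^ (-((n:ℝ) + 1 - α)) := by
              rw [← Real.rpow_add h0, ← Real.rpow_natCast, ← Real.rpow_neg h0.le]; congr 1; ring
            rw [e1]
            gcongr
            calc r ^ (1 - α) ≤ 2 ^ (1 - α) := Real.rpow_le_rpow h0.le (by linarith) (by linarith [hα.2])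
              _ ≤ 2 ^ (1:ℝ) := Real.rpow_le_rpow_of_exponent_le (by norm_num) (by linarith [hα.1])
              _ = 2 := Real.rpow_one _
          calc _ ≤ C0 * (3 * 2 ^ n) * Real.exp (-t) * (2 * r ^ (-((n:ℝ) + 1 - α))) := mul_le_mul_of_nonneg_left this (by positivity)
            _ = _ := by ring
        · rw [chi_zero hz, zero_mul, norm_zero]; positivity
      have h2 := norm_integral_le_of_norm_le (i1.const_mul _) (Filter.Eventually.of_forall this)
      rw [Real.norm_eq_abs] at h2
      refine h2.trans ?_
      rw [integral_const_mul]
      calc _ ≤ C0 * (3 * 2 ^ n) * 2 * Real.exp (-t) * (S * (1 - Real.exp (-t)) ^ (α - 1)) := mul_le_mul_of_nonneg_left i2 (by positivity)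
        _ = _ := by rw [hB5]; ring
    · refine up (Bi := B6) (by linarith) (by positivity) ?_
      obtain ⟨j, q, rfl⟩ : ∃ j q, p = j :: q := by
        cases p with
        | nil => simp at hp; omega
        | cons j q => exact ⟨j, q, rfl⟩
      have hq : q.length = g + (k - 1) := by simp at hp; omega
      have hL : ∀ x, fderiv ℝ (fun x => Vf (asym q m) (x, t)) x (EuclideanSpace.single j 1) = Vf (asym (j :: q) m) (x, t) := by
        intro x
        rw [(hder q (by omega) x).fderiv, grx_apply]
        simp
      have hqc : Continuous (fun x => Vf (asym q m) (x, t)) :=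
        continuous_iff_continuousAt.2 fun x => (hder q (by omega) x).continuousAt
      have ip := integral_mul_fderiv_eq_neg_fderiv_mul_of_integrable (μ := volume) (f := chi n) (g := fun x => Vf (asym q m) (x, t)) (v := EuclideanSpace.single j 1)
        (((chi_fc n _).mul hqc).integrable_of_hasCompactSupport ((chi_fs n _).mul_right))
        (by simp only [hL]; exact chi_int hcont) (chi_int hqc)
        (fun x _ => (chi_cd n).differentiable (by norm_num) x) (fun x _ => (hder q (by omega) x).differentiableAt)
      simp only [hL] at ip
      rw [ip, abs_neg]
      have hi : Integrable (fun x => |fderiv ℝ (chi n) x (EuclideanSpace.single j 1)|) :=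
        ((chi_fc n _).integrable_of_hasCompactSupport (chi_fs n _)).abs
      set M : ℝ := Cm * (8 ^ (n+k) * 9 ^ b) * Real.exp (-t) with hM
      have bd : ∀ x : EE n, ‖fderiv ℝ (chi n) x (EuclideanSpace.single j 1) * Vf (asym q m) (x, t)‖ ≤ |fderiv ℝ (chi n) x (EuclideanSpace.single j 1)| * M := by
        intro x
        rw [norm_mul, Real.norm_eq_abs, Real.norm_eq_abs]
        rcases lt_or_ge (‖x‖) (1/8) with hx | hx
        · rw [chi_fd0 hx]; simp
        · have := far q (k-1) 0 Cm hCm (by omega) hq bm x hx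
          gcongr
          refine this.trans ?_
          rw [hM, pow_zero, inv_one, mul_one]
          gcongr ?_ * _; gcongr Cm * (?_ * _); exact p8 (by omega)
      have h2 := norm_integral_le_of_norm_le (hi.mul_const M) (Filter.Eventually.of_forall bd)
      rw [integral_mul_const, Real.norm_eq_abs] at h2
      have h3 : ∫ x, |fderiv ℝ (chi n) x (EuclideanSpace.single j 1)| ≤ X :=
        Finset.single_le_sum (f := fun j : Fin n => ∫ x, |fderiv ℝ (chi n) x (EuclideanSpace.single j 1)|) (fun j _ => integral_nonneg fun x => abs_nonneg _) (Finset.mem_univ j)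
      have h4 : 1 ≤ (1 - Real.exp (-t)) ^ (α - 1) := Real.one_le_rpow_of_pos_of_le_one_of_nonpos hd hd1 (by linarith [hα.2])
      calc _ ≤ _ := h2
        _ ≤ X * M := by gcongr
        _ = B6 * Real.exp (-t) * 1 := by rw [hB6, hM]; ring
        _ ≤ _ := by gcongr

def Vw {n : ℕ} (y : EE n) : ℝ := (1 + ‖y‖) ^ (-(2 * (n:ℝ) - 5/2))
def Ww {n : ℕ} (y : EE n) : ℝ := Vw y * ((1 + ‖y‖) ^ 2)⁻¹
def wn {n : ℕ} (y : EE n) : ℝ := ((1 + ‖y‖) ^ (n + 1))⁻¹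
lemma Vw_pos {n : ℕ} (y : EE n) : 0 < Vw y := by unfold Vw; positivity
lemma Ww_pos {n : ℕ} (y : EE n) : 0 < Ww y := mul_pos (Vw_pos y) (by positivity)
lemma wn_pos {n : ℕ} (y : EE n) : 0 < wn y := by unfold wn; positivity
lemma Vw_int {n : ℕ} (hn : 3 ≤ n) : Integrable (Vw : EE n → ℝ) := by
  refine integrable_one_add_norm ?_
  have : (3:ℝ) ≤ n := by exact_mod_cast hn
  simp; linarith
lemma Vw_cont {n : ℕ} : Continuous (Vw : EE n → ℝ) := by
  unfold Vw
  exact (by fun_prop : Continuous fun y : EE n => 1 + ‖y‖).rpow_const fun y => Or.inl (by positivity)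
lemma Ww_eq {n : ℕ} (y : EE n) : Ww y = wn y * (1 + ‖y‖) ^ (-((n:ℝ) - 3/2)) := by
  have h : 0 < 1 + ‖y‖ := by positivity
  unfold Ww wn Vw
  rw [← Real.rpow_natCast, ← Real.rpow_natCast, ← Real.rpow_neg h.le, ← Real.rpow_neg h.le, ← Real.rpow_add h, ← Real.rpow_add h]
  congr 1; push_cast; ring
lemma Ww_le_wn {n : ℕ} (hn : 3 ≤ n) (y : EE n) : Ww y ≤ wn y := by
  rw [Ww_eq]
  refine mul_le_of_le_one_right (wn_pos y).le (Real.rpow_le_one_of_one_le_of_nonpos (by linarith [norm_nonneg y]) ?_)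
  have : (3:ℝ) ≤ n := by exact_mod_cast hn
  linarith
lemma Ww_le_Vw {n : ℕ} (y : EE n) : Ww y ≤ Vw y :=
  mul_le_of_le_one_right (Vw_pos y).le (inv_le_one_of_one_le₀ (one_le_pow₀ (by linarith [norm_nonneg y])))

lemma mix_le {n : ℕ} (hn : 3 ≤ n) (z y : EE n) :
    ((1 + ‖z‖) ^ (n-1))⁻¹ * (1 + ‖y‖) ^ (-((n:ℝ) - 3/2)) ≤ Vw z + Vw y := by
  have hn' : (3:ℝ) ≤ n := by exact_mod_cast hn
  have e : ∀ u : EE n, Vw u = ((1 + ‖u‖) ^ (n-1))⁻¹ * (1 + ‖u‖) ^ (-((n:ℝ) - 3/2)) := by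
    intro u
    have h : 0 < 1 + ‖u‖ := by positivity
    unfold Vw
    rw [← Real.rpow_natCast, ← Real.rpow_neg h.le, ← Real.rpow_add h]
    congr 1
    rw [Nat.cast_sub (by omega)]; push_cast; ring
  rcases le_total (‖z‖) (‖y‖) with h | h
  · have : (1 + ‖y‖) ^ (-((n:ℝ) - 3/2)) ≤ (1 + ‖z‖) ^ (-((n:ℝ) - 3/2)) :=
      Real.rpow_le_rpow_of_nonpos (by positivity) (by linarith) (by linarith)
    calc _ ≤ Vw z := by rw [e z]; gcongr
      _ ≤ _ := by linarith [Vw_pos y]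
  · calc _ ≤ Vw y := by rw [e y]; gcongr
      _ ≤ _ := by linarith [Vw_pos z]

/-- admissible data -/
structure Dat {n : ℕ} (α A : ℝ) (θ : EE n → ℝ) : Prop where
  A0 : 0 ≤ A
  cont : Continuous θ
  bd : ∀ y, |θ y| ≤ A * Ww y
  hol : ∀ x y, ‖x - y‖ ≤ 1/2 → |θ x - θ y| ≤ A * Ww x * ‖x - y‖ ^ α
  m0 : ∫ y, θ y = 0
  m1 : ∀ i : Fin n, ∫ y : EE n, y i * θ y = 0

lemma Dat.bdV {n : ℕ} {α A : ℝ} {θ : EE n → ℝ} (h : Dat α A θ) (y : EE n) : |θ y| ≤ A * Vw y :=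
  (h.bd y).trans (mul_le_mul_of_nonneg_left (Ww_le_Vw y) h.A0)
lemma Dat.int {n : ℕ} (hn : 3 ≤ n) {α A : ℝ} {θ : EE n → ℝ} (h : Dat α A θ) : Integrable θ :=
  ((Vw_int hn).const_mul A).mono' h.cont.aestronglyMeasurable (Filter.Eventually.of_forall h.bdV)
lemma Dat.int1 {n : ℕ} (hn : 3 ≤ n) {α A : ℝ} {θ : EE n → ℝ} (h : Dat α A θ) (i : Fin n) : Integrable (fun y : EE n => y i * θ y) := by
  have hc := h.cont
  refine ((Vw_int hn).const_mul A).mono' (by fun_prop) (Filter.Eventually.of_forall fun y => ?_)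
  rw [norm_mul, Real.norm_eq_abs, Real.norm_eq_abs]
  calc |y i| * |θ y| ≤ (1 + ‖y‖) ^ 2 * (A * Ww y) := by
        refine mul_le_mul ?_ (h.bd y) (abs_nonneg _) (by positivity)
        nlinarith [coord_le y i, norm_nonneg y]
    _ = A * Vw y := by unfold Ww; field_simp

lemma grx_op {n : ℕ} (a : Fin n → ℝ) {M : ℝ} (hM : 0 ≤ M) (h : ∀ j, |a j| ≤ M) : ‖grx a‖ ≤ n * M :=
  ContinuousLinearMap.opNorm_le_bound _ (by positivity) fun v => grx_abs a v h

lemma Ker.taylor {n : ℕ} {α B d : ℝ} {L : EE n → ℝ} {L1 L2} (h : Ker α B d L L1 L2) (hB : 0 ≤ B) {x y : EE n} (hx : 1 ≤ ‖x‖) (hy : ‖y‖ ≤ ‖x‖ / 2) :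
    |L (x - y) - L x + grx (fun j => L1 j x) y| ≤ n ^ 2 * (B * ((‖x‖ / 2) ^ (n+1))⁻¹) * ‖y‖ ^ 2 := by
  set S := Metric.closedBall x (‖y‖) with hS
  have hcv : Convex ℝ S := convex_closedBall _ _
  have hxS : x ∈ S := Metric.mem_closedBall_self (norm_nonneg _)
  have hyS : x - y ∈ S := by simp [hS]
  have hn1 : ∀ z ∈ S, ‖x‖ / 2 ≤ ‖z‖ := by
    intro z hz
    rw [hS, mem_closedBall_iff_norm] at hz
    have := norm_sub_norm_le x z
    rw [norm_sub_rev] at this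
    linarith
  set M := B * ((‖x‖ / 2) ^ (n+1))⁻¹ with hM
  have hM0 : 0 ≤ M := by positivity
  have h1 : ∀ z ∈ S, ∀ j, |L1 j z - L1 j x| ≤ n * M * ‖y‖ := by
    intro z hz j
    have := hcv.norm_image_sub_le_of_norm_hasFDerivWithin_le (f := L1 j) (C := n * M) (fun w _ => (h.d2 j w).hasFDerivWithinAt)
      (fun w hw => grx_op _ hM0 fun k => (h.f2 k j w (by linarith [hn1 w hw])).trans (by rw [hM]; gcongr; exact hn1 w hw)) hxS hz
    rw [Real.norm_eq_abs] at this
    refine this.trans ?_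
    gcongr
    rwa [hS, mem_closedBall_iff_norm] at hz
  have hg : ∀ z, HasFDerivAt (fun z => L z - grx (fun j => L1 j x) z) (grx (fun j => L1 j z - L1 j x)) z := by
    intro z
    refine HasFDerivAt.congr_fderiv ((h.d1 z).sub (grx (fun j => L1 j x)).hasFDerivAt) ?_
    refine ContinuousLinearMap.ext fun v => ?_
    simp only [sub_apply, grx_apply, sub_mul, Finset.sum_sub_distrib]
  have := hcv.norm_image_sub_le_of_norm_hasFDerivWithin_le (C := n * (n * M * ‖y‖)) (fun w _ => (hg w).hasFDerivWithinAt)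
      (fun w hw => grx_op _ (by positivity) (h1 w hw)) hxS hyS
  rw [Real.norm_eq_abs, map_sub, sub_sub_cancel_left, norm_neg] at this
  refine le_trans (le_of_eq ?_) (this.trans (le_of_eq ?_))
  · congr 1; ring
  · ring

lemma inv_pow_cmp {a b c : ℝ} (ha : 0 < a) (hc : 0 < c) (h : a ≤ c * b) (k : ℕ) : (b ^ k)⁻¹ ≤ c ^ k * (a ^ k)⁻¹ := by
  have hb : 0 < b := by
    by_contra hb
    have := mul_nonpos_of_nonneg_of_nonpos hc.le (not_lt.1 hb)
    linarith
  rw [← div_eq_mul_inv, inv_le_comm₀ (by positivity) (by positivity), inv_div, div_le_iff₀ (by positivity), ← mul_pow]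
  gcongr; linarith

def Mk {n : ℕ} (L : EE n → ℝ) (z : EE n) : ℝ := (1 - chi n z) * L z

lemma Ker.cont {n : ℕ} {α B d : ℝ} {L : EE n → ℝ} {L1 L2} (h : Ker α B d L L1 L2) : Continuous L :=
  continuous_iff_continuousAt.2 fun x => (h.d1 x).continuousAt
lemma Ker.Mk_cont {n : ℕ} {α B d : ℝ} {L : EE n → ℝ} {L1 L2} (h : Ker α B d L L1 L2) : Continuous (Mk L) :=
  (continuous_const.sub (chi_cont n)).mul h.cont

lemma Ker.Mk_bd {n : ℕ} {α B d : ℝ} {L : EE n → ℝ} {L1 L2} (h : Ker α B d L L1 L2) (hB : 0 ≤ B) (z : EE n) :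
    |Mk L z| ≤ B * 9 ^ (n-1) * ((1 + ‖z‖) ^ (n-1))⁻¹ := by
  unfold Mk
  rcases le_total (‖z‖) (1/8) with hz | hz
  · rw [chi_one hz]; simp; positivity
  · rw [abs_mul, abs_of_nonneg (by linarith [chi_le z])]
    refine (mul_le_of_le_one_left (abs_nonneg _) (by linarith [chi_nn z])).trans ((h.f0 z hz).trans ?_)
    rw [mul_assoc]
    gcongr
    exact inv_pow_cmp (by positivity) (by norm_num) (by linarith) _

lemma Ker.far_pt {n : ℕ} (hn : 3 ≤ n) {α A B d : ℝ} {L : EE n → ℝ} {L1 L2} (h : Ker α B d L L1 L2) (hB : 0 ≤ B) {θ : EE n → ℝ} (hθ : Dat α A θ)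
    {x : EE n} (hx : 1 ≤ ‖x‖) (y : EE n) :
    |(Mk L (x - y) - L x + grx (fun j => L1 j x) y) * θ y| ≤ (2 * n ^ 2 + 2) * 20 ^ (n+1) * (B * A * wn x * (Vw (x - y) + Vw y)) := by
  have hn' : (3:ℝ) ≤ n := by exact_mod_cast hn
  have v1 := Vw_pos y
  have v2 := Vw_pos (x - y)
  have w0 := wn_pos x
  have A0 := hθ.A0
  have hby := hθ.bd y
  have hy0 := norm_nonneg y
  have xx : ∀ k, (‖x‖ ^ k)⁻¹ ≤ 2 ^ k * ((1 + ‖x‖) ^ k)⁻¹ := fun k => inv_pow_cmp (by positivity) (by norm_num) (by linarith) k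
  rw [abs_mul]
  rcases le_or_gt (‖y‖) (‖x‖ / 2) with hy | hy
  · have hM : Mk L (x - y) = L (x - y) := by
      unfold Mk
      have := norm_sub_norm_le x y
      rw [chi_zero (by linarith), sub_zero, one_mul]
    rw [hM]
    have h1 := h.taylor hB hx hy
    have h2 : ((‖x‖ / 2) ^ (n+1))⁻¹ ≤ 4 ^ (n+1) * wn x := inv_pow_cmp (by positivity) (by norm_num) (by linarith) _
    have h3 : ‖y‖ ^ 2 * ((1 + ‖y‖) ^ 2)⁻¹ ≤ 1 := by
      rw [← div_eq_mul_inv, div_le_one (by positivity)]; gcongr; linarith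
    calc _ ≤ (n ^ 2 * (B * ((‖x‖ / 2) ^ (n+1))⁻¹) * ‖y‖ ^ 2) * (A * Ww y) := mul_le_mul h1 hby (abs_nonneg _) (by positivity)
      _ = (n ^ 2 * (B * ((‖x‖ / 2) ^ (n+1))⁻¹)) * (A * Vw y * (‖y‖ ^ 2 * ((1 + ‖y‖) ^ 2)⁻¹)) := by unfold Ww; ring
      _ ≤ (n ^ 2 * (B * (4 ^ (n+1) * wn x))) * (A * Vw y * 1) := by gcongr
      _ = n ^ 2 * 4 ^ (n+1) * (B * A * wn x * Vw y) := by ring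
      _ ≤ (2 * n ^ 2 + 2) * 20 ^ (n+1) * (B * A * wn x * (Vw (x - y) + Vw y)) := by gcongr <;> first | linarith | nlinarith
  · have hxy : 1 + ‖x‖ ≤ 2 * (1 + ‖y‖) := by linarith
    have h1 := h.Mk_bd hB (x - y)
    have h2 := h.f0 x (by linarith)
    have h3 := grx_abs (fun j => L1 j x) y (fun j => h.f1 j x (by linarith))
    have yy : ∀ k, ((1 + ‖y‖) ^ k)⁻¹ ≤ 2 ^ k * ((1 + ‖x‖) ^ k)⁻¹ := fun k => inv_pow_cmp (by positivity) (by norm_num) hxy k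
    have t1 : |Mk L (x - y)| * |θ y| ≤ 18 ^ (n+1) * (B * A * wn x * (Vw (x - y) + Vw y)) := by
      calc _ ≤ (B * 9 ^ (n-1) * ((1 + ‖x - y‖) ^ (n-1))⁻¹) * (A * Ww y) := mul_le_mul h1 hby (abs_nonneg _) (by positivity)
        _ = B * A * 9 ^ (n-1) * (wn y * (((1 + ‖x - y‖) ^ (n-1))⁻¹ * (1 + ‖y‖) ^ (-((n:ℝ) - 3/2)))) := by rw [Ww_eq]; ring
        _ ≤ B * A * 9 ^ (n+1) * ((2 ^ (n+1) * wn x) * (Vw (x - y) + Vw y)) := by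
            have := mix_le hn (x - y) y
            have h5 := yy (n+1)
            have h6 : (9:ℝ) ^ (n-1) ≤ 9 ^ (n+1) := pow_le_pow_right₀ (by norm_num) (by omega)
            have h7 : wn y ≤ 2 ^ (n+1) * wn x := h5
            have := wn_pos y
            gcongr
        _ = _ := by rw [show (18:ℝ) = 9 * 2 by norm_num, mul_pow]; ring
    have t2 : |L x| * |θ y| ≤ 2 ^ (n+1) * (B * A * wn x * Vw y) := by
      calc _ ≤ (B * (‖x‖ ^ (n-1))⁻¹) * (A * Ww y) := mul_le_mul h2 hby (abs_nonneg _) (by positivity)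
        _ ≤ (B * (2 ^ (n-1) * ((1 + ‖x‖) ^ (n-1))⁻¹)) * (A * (Vw y * (2 ^ 2 * ((1 + ‖x‖) ^ 2)⁻¹))) := by
            unfold Ww
            gcongr
            · exact xx _
            · exact yy 2
        _ = (2 ^ (n-1) * 2 ^ 2) * (B * A * (((1 + ‖x‖) ^ (n-1))⁻¹ * ((1 + ‖x‖) ^ 2)⁻¹) * Vw y) := by ring
        _ = _ := by rw [← mul_inv, ← pow_add, ← pow_add, show n - 1 + 2 = n + 1 by omega]; rfl
    have t3 : |grx (fun j => L1 j x) y| * |θ y| ≤ n * 2 ^ (n+1) * (B * A * wn x * Vw y) := by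
      have h5 : ‖y‖ * ((1 + ‖y‖) ^ 2)⁻¹ ≤ 2 * (1 + ‖x‖)⁻¹ := by
        calc _ ≤ (1 + ‖y‖) * ((1 + ‖y‖) ^ 2)⁻¹ := by gcongr; linarith
          _ = (1 + ‖y‖)⁻¹ := by field_simp
          _ ≤ _ := by have := yy 1; simpa using this
      calc _ ≤ (n * (B * (‖x‖ ^ n)⁻¹) * ‖y‖) * (A * Ww y) := mul_le_mul h3 hby (abs_nonneg _) (by positivity)
        _ = n * (B * (‖x‖ ^ n)⁻¹) * (A * Vw y * (‖y‖ * ((1 + ‖y‖) ^ 2)⁻¹)) := by unfold Ww; ring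
        _ ≤ n * (B * (2 ^ n * ((1 + ‖x‖) ^ n)⁻¹)) * (A * Vw y * (2 * (1 + ‖x‖)⁻¹)) := by
            gcongr
            exact xx _
        _ = _ := by unfold wn; rw [pow_succ, pow_succ, mul_inv]; ring
    set Q := B * A * wn x * (Vw (x - y) + Vw y) with hQ
    have hQ0 : 0 ≤ Q := by positivity
    have hQ1 : B * A * wn x * Vw y ≤ Q := by rw [hQ]; gcongr; linarith
    have a1 : (18:ℝ) ^ (n+1) ≤ 20 ^ (n+1) := by gcongr; norm_num
    have a2 : (2:ℝ) ^ (n+1) ≤ 20 ^ (n+1) := by gcongr; norm_num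
    have tri : |Mk L (x - y) - L x + grx (fun j => L1 j x) y| ≤ |Mk L (x - y)| + |L x| + |grx (fun j => L1 j x) y| :=
      (abs_add_le _ _).trans (by gcongr; exact abs_sub _ _)
    calc _ ≤ (|Mk L (x - y)| + |L x| + |grx (fun j => L1 j x) y|) * |θ y| := by gcongr
      _ = |Mk L (x - y)| * |θ y| + |L x| * |θ y| + |grx (fun j => L1 j x) y| * |θ y| := by ring
      _ ≤ 20 ^ (n+1) * Q + 20 ^ (n+1) * Q + n * 20 ^ (n+1) * Q := by
          refine add_le_add (add_le_add (t1.trans ?_) (t2.trans ?_)) (t3.trans ?_) <;> gcongr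
      _ = (2 + n) * 20 ^ (n+1) * Q := by ring
      _ ≤ _ := by gcongr ?_ * _ * _; nlinarith

lemma Vw_shift {n : ℕ} (hn : 3 ≤ n) (x : EE n) : Integrable (fun y => Vw (x - y) + Vw y) ∧ ∫ y, (Vw (x - y) + Vw y) = 2 * ∫ y : EE n, Vw y := by
  have i1 : Integrable (fun y => Vw (x - y)) := (Vw_int hn).comp_sub_left x
  refine ⟨i1.add (Vw_int hn), ?_⟩
  rw [integral_add i1 (Vw_int hn), integral_sub_left_eq_self (fun y => Vw y) volume x]; ring

theorem conv_est {n : ℕ} (hn : 3 ≤ n) {α : ℝ} (hα : α ∈ Ioo (0:ℝ) 1) : ∃ K > 0, ∀ (A B d : ℝ) (L : EE n → ℝ) (L1) (L2) (θ : EE n → ℝ),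
    0 < B → 0 < d → d ≤ 1 → Ker α B d L L1 L2 → Dat α A θ → ∀ x, |∫ y, L (x - y) * θ y| ≤ K * (B * A) * wn x * d ^ (α - 1) := by
  obtain ⟨S, hS, sc⟩ := scal_int (n := n) hα.2
  set V := ∫ y : EE n, Vw y with hV
  have hV0 : 0 ≤ V := integral_nonneg fun y => (Vw_pos y).le
  set K1 := (2 * (n:ℝ) ^ 2 + 2) * 20 ^ (n+1) * (2 * V) with hK1
  set K2 := 9 ^ (n-1) * V * 2 ^ (n+1) with hK2
  have hK10 : 0 ≤ K1 := by positivity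
  have hK20 : 0 ≤ K2 := by positivity
  refine ⟨K1 + K2 + S + 1, by positivity, fun A B d L L1 L2 θ hB hd hd1 hk hθ x => ?_⟩
  have A0 := hθ.A0
  have w0 := wn_pos x
  have hdp : 1 ≤ d ^ (α - 1) := Real.one_le_rpow_of_pos_of_le_one_of_nonpos hd hd1 (by linarith [hα.2])
  have hLc := hk.cont
  have hMc := hk.Mk_cont
  have hθc := hθ.cont
  have hMb : ∀ z, ‖Mk L z‖ ≤ B * 9 ^ (n-1) := fun z => (hk.Mk_bd hB.le z).trans
    (mul_le_of_le_one_right (by positivity) (inv_le_one_of_one_le₀ (one_le_pow₀ (by linarith [norm_nonneg z]))))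
  have hMi : Integrable (fun y => Mk L (x - y) * θ y) :=
    (hθ.int hn).bdd_mul (c := B * 9 ^ (n-1)) (by fun_prop) (Filter.Eventually.of_forall fun y => hMb _)
  have hE : |∫ y, Mk L (x - y) * θ y| ≤ (K1 + K2) * (B * A) * wn x := by
    rcases le_or_gt 1 (‖x‖) with hx | hx
    · have hgi : Integrable (fun y => grx (fun j => L1 j x) y * θ y) := by
        simp only [grx_apply, Finset.sum_mul, mul_assoc]
        exact integrable_finsetSum _ fun j _ => (hθ.int1 hn j).const_mul _
      have hg0 : ∫ y, grx (fun j => L1 j x) y * θ y = 0 := by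
        simp only [grx_apply, Finset.sum_mul, mul_assoc]
        rw [integral_finsetSum _ fun j _ => (hθ.int1 hn j).const_mul _]
        refine Finset.sum_eq_zero fun j _ => ?_
        rw [integral_const_mul, hθ.m1, mul_zero]
      have hLi := (hθ.int hn).const_mul (L x)
      have e : ∫ y, Mk L (x - y) * θ y = ∫ y, (Mk L (x - y) - L x + grx (fun j => L1 j x) y) * θ y := by
        have i1 : Integrable (fun y => Mk L (x - y) * θ y - L x * θ y) := hMi.sub hLi
        have : (fun y => (Mk L (x - y) - L x + grx (fun j => L1 j x) y) * θ y) = fun y => (Mk L (x - y) * θ y - L x * θ y) + grx (fun j => L1 j x) y * θ y := by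
          ext y; ring
        rw [this, integral_add i1 hgi, integral_sub hMi hLi, integral_const_mul, hθ.m0, hg0]; simp
      rw [e]
      obtain ⟨i1, i2⟩ := Vw_shift hn x
      have := norm_integral_le_of_norm_le ((i1.const_mul (B * A * wn x)).const_mul ((2 * (n:ℝ) ^ 2 + 2) * 20 ^ (n+1)))
        (Filter.Eventually.of_forall fun y => by rw [Real.norm_eq_abs]; exact hk.far_pt hn hB.le hθ hx y)
      rw [Real.norm_eq_abs, integral_const_mul, integral_const_mul, i2] at this
      refine this.trans ?_
      calc _ = K1 * (B * A) * wn x := by rw [hK1, hV]; ring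
        _ ≤ _ := by gcongr; linarith
    · have := norm_integral_le_of_norm_le (f := fun y => Mk L (x - y) * θ y) ((Vw_int hn).const_mul (B * 9 ^ (n-1) * A)) (Filter.Eventually.of_forall fun y => by
        rw [norm_mul, Real.norm_eq_abs (θ y), mul_assoc]
        exact mul_le_mul (hMb _) (hθ.bdV y) (abs_nonneg _) (by positivity))
      rw [Real.norm_eq_abs, integral_const_mul] at this
      refine this.trans ?_
      have h1 : 1 ≤ 2 ^ (n+1) * wn x := by
        have := inv_pow_cmp (a := 1 + ‖x‖) (b := 1) (c := 2) (by positivity) (by norm_num) (by linarith) (n+1)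
        simpa [wn] using this
      calc B * 9 ^ (n-1) * A * V = 9 ^ (n-1) * V * (B * A) * 1 := by ring
        _ ≤ 9 ^ (n-1) * V * (B * A) * (2 ^ (n+1) * wn x) := by gcongr
        _ = K2 * (B * A) * wn x := by rw [hK2]; ring
        _ ≤ _ := by gcongr; linarith
  obtain ⟨s1, s2⟩ := sc d hd
  have hWw := Ww_pos x
  have hci : Integrable (fun z => chi n z * L z) := chi_int hLc
  have hci2 : Integrable (fun z => chi n z * L z * (θ (x - z) - θ x)) := by
    have : (fun z => chi n z * L z * (θ (x - z) - θ x)) = fun z => chi n z * (L z * (θ (x - z) - θ x)) := by ext z; ring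
    rw [this]; exact chi_int (by fun_prop)
  have hci3 : Integrable (fun z => chi n z * L z * θ (x - z)) := by
    have : (fun z => chi n z * L z * θ (x - z)) = fun z => chi n z * (L z * θ (x - z)) := by ext z; ring
    rw [this]; exact chi_int (by fun_prop)
  have hN : |∫ z, chi n z * L z * (θ (x - z) - θ x)| ≤ S * (B * A) * wn x * d ^ (α - 1) := by
    have hp : ∀ z, ‖chi n z * L z * (θ (x - z) - θ x)‖ ≤ B * A * Ww x * (‖z‖ + d) ^ (-((n:ℝ) + 1 - α)) := by
      intro z
      rcases le_or_gt (1/4) (‖z‖) with hz | hz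
      · rw [chi_zero hz]; simp; positivity
      · have h0 : 0 < ‖z‖ + d := by positivity
        rw [norm_mul, norm_mul, Real.norm_of_nonneg (chi_nn z), Real.norm_eq_abs, Real.norm_eq_abs, abs_sub_comm]
        have h1 := hθ.hol x (x - z) (by rw [sub_sub_cancel]; linarith)
        rw [sub_sub_cancel] at h1
        calc _ ≤ 1 * (B * ((‖z‖ + d) ^ (n+1))⁻¹) * (A * Ww x * (‖z‖ + d) ^ α) := by
              refine mul_le_mul (mul_le_mul (chi_le z) (hk.near z hz.le) (abs_nonneg _) (by norm_num)) (h1.trans ?_) (abs_nonneg _) (by positivity)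
              gcongr
              · exact hα.1.le
              · linarith
          _ = B * A * Ww x * (((‖z‖ + d) ^ (n+1))⁻¹ * (‖z‖ + d) ^ α) := by ring
          _ = _ := by
              rw [← Real.rpow_natCast, ← Real.rpow_neg h0.le, ← Real.rpow_add h0]
              congr 2; push_cast; ring
    have := norm_integral_le_of_norm_le (s1.const_mul _) (Filter.Eventually.of_forall hp)
    rw [Real.norm_eq_abs, integral_const_mul] at this
    refine this.trans ?_
    calc _ ≤ B * A * wn x * (S * d ^ (α - 1)) := by gcongr; exact Ww_le_wn hn x
      _ = _ := by ring
  have hC : |θ x * ∫ z, chi n z * L z| ≤ 1 * (B * A) * wn x * d ^ (α - 1) := by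
    rw [abs_mul]
    calc _ ≤ (A * wn x) * (B * d ^ (α - 1)) := mul_le_mul ((hθ.bd x).trans (by gcongr; exact Ww_le_wn hn x)) hk.mean (abs_nonneg _) (by positivity)
      _ = _ := by ring
  have split : ∫ y, L (x - y) * θ y = (∫ y, Mk L (x - y) * θ y) + ((∫ z, chi n z * L z * (θ (x - z) - θ x)) + θ x * ∫ z, chi n z * L z) := by
    have e1 : (∫ z, chi n z * L z * (θ (x - z) - θ x)) + θ x * ∫ z, chi n z * L z = ∫ z, chi n z * L z * θ (x - z) := by
      rw [← integral_const_mul, ← integral_add hci2 (hci.const_mul _)]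
      congr 1; ext z; ring
    have e2 := integral_sub_left_eq_self (fun z => chi n z * L z * θ (x - z)) volume x
    rw [e1, ← e2]
    have i3 := hci3.comp_sub_left x
    rw [← integral_add hMi i3]
    congr 1; ext y; unfold Mk; rw [sub_sub_cancel]; ring
  rw [split]
  calc _ ≤ (K1 + K2) * (B * A) * wn x * d ^ (α - 1) + (S * (B * A) * wn x * d ^ (α - 1) + 1 * (B * A) * wn x * d ^ (α - 1)) :=
        (abs_add_le _ _).trans (add_le_add (hE.trans (le_mul_of_one_le_right (by positivity) hdp)) ((abs_add_le _ _).trans (add_le_add hN hC)))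
    _ = _ := by ring

def pj {n : ℕ} (j : Fin n) (η : EE n → ℝ) : EE n → ℝ := fun x => fderiv ℝ η x (EuclideanSpace.single j 1)

structure Dat2 {n : ℕ} (α A : ℝ) (η : EE n → ℝ) : Prop where
  cd : ContDiff ℝ 1 η
  d0 : Dat α A η
  d1 : ∀ j, Dat α A (pj j η)
  fi : Integrable (fun x => fderiv ℝ η x)

lemma Ww_int0 {n : ℕ} (hn : 3 ≤ n) {F : Type*} [NormedAddCommGroup F] {A : ℝ} {θ : EE n → F} (hA : 0 ≤ A) (hc : Continuous θ) (h : ∀ y, ‖θ y‖ ≤ A * Ww y) :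
    Integrable θ :=
  ((Vw_int hn).const_mul A).mono' hc.aestronglyMeasurable (Filter.Eventually.of_forall fun y => (h y).trans (mul_le_mul_of_nonneg_left (Ww_le_Vw y) hA))
lemma Ww_int1 {n : ℕ} (hn : 3 ≤ n) {A : ℝ} {θ : EE n → ℝ} (hc : Continuous θ) (h : ∀ y, |θ y| ≤ A * Ww y) (i : Fin n) :
    Integrable (fun y : EE n => y i * θ y) := by
  refine ((Vw_int hn).const_mul A).mono' (by fun_prop) (Filter.Eventually.of_forall fun y => ?_)
  rw [norm_mul, Real.norm_eq_abs, Real.norm_eq_abs]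
  calc |y i| * |θ y| ≤ (1 + ‖y‖) ^ 2 * (A * Ww y) := by
        refine mul_le_mul ?_ (h y) (abs_nonneg _) (by positivity)
        nlinarith [coord_le y i, norm_nonneg y]
    _ = A * Vw y := by unfold Ww; field_simp

lemma Ww_rpow {n : ℕ} (y : EE n) : Ww y = (1 + ‖y‖) ^ (-2 * (n:ℝ) + 1/2) := by
  have h : 0 < 1 + ‖y‖ := by positivity
  unfold Ww Vw
  rw [← Real.rpow_natCast, ← Real.rpow_neg h.le, ← Real.rpow_add h]
  congr 1; push_cast; ring

lemma Ww_cmp {n : ℕ} (hn : 3 ≤ n) {r : ℝ} {x : EE n} (hr : 1 + ‖x‖ ≤ 2 * r) : r ^ (-2 * (n:ℝ) + 1/2) ≤ 2 ^ (2 * (n:ℝ)) * Ww x := by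
  have hn' : (3:ℝ) ≤ n := by exact_mod_cast hn
  have hx := norm_nonneg x
  have h1 : r ^ (-2 * (n:ℝ) + 1/2) ≤ ((1 + ‖x‖) / 2) ^ (-2 * (n:ℝ) + 1/2) :=
    Real.rpow_le_rpow_of_nonpos (by positivity) (by linarith) (by linarith)
  rw [Real.div_rpow (by positivity) (by norm_num), ← Ww_rpow, div_eq_mul_inv (Ww x), ← Real.rpow_neg (by norm_num), mul_comm (Ww x)] at h1
  refine h1.trans ?_
  have := Ww_pos x
  gcongr
  · norm_num
  · linarith

lemma eH_nn {n : ℕ} {k : ℕ} {α : ℝ} {S : Set (EE n)} {f : EE n → ℝ} : ∀ r ∈ eHolderSet k α S f, 0 ≤ r := by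
  rintro r (hr | ⟨x, _, y, _, _, rfl⟩)
  · simp only [mem_iUnion] at hr
    obtain ⟨j, _, x, _, rfl⟩ := hr
    exact norm_nonneg _
  · positivity
lemma eNorm_nn {n : ℕ} {k : ℕ} {α : ℝ} {S : Set (EE n)} {f : EE n → ℝ} : 0 ≤ eNorm k α S f := Real.sSup_nonneg eH_nn

lemma eH_mono {n : ℕ} {k : ℕ} {α : ℝ} {S T : Set (EE n)} {f : EE n → ℝ} (h : S ⊆ T) : eHolderSet k α S f ⊆ eHolderSet k α T f := by
  rintro r (hr | ⟨x, hx, y, hy, hxy, rfl⟩)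
  · left
    simp only [mem_iUnion] at hr ⊢
    obtain ⟨j, hj, x, hx, rfl⟩ := hr
    exact ⟨j, hj, x, h hx, rfl⟩
  · exact Or.inr ⟨x, h hx, y, h hy, hxy, rfl⟩

lemma eN_facts {n : ℕ} {α : ℝ} {S : Set (EE n)} {f : EE n → ℝ} (hb : BddAbove (eHolderSet 1 α univ f)) :
    (∀ x ∈ S, |f x| ≤ eNorm 1 α S f) ∧ (∀ x ∈ S, ‖fderiv ℝ f x‖ ≤ eNorm 1 α S f) ∧
    (∀ x ∈ S, ∀ y ∈ S, ∀ j, |pj j f x - pj j f y| ≤ eNorm 1 α S f * ‖x - y‖ ^ α) := by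
  have hb' := hb.mono (eH_mono (subset_univ S))
  refine ⟨fun x hx => ?_, fun x hx => ?_, fun x hx y hy j => ?_⟩
  · have : ‖iteratedFDeriv ℝ 0 f x‖ ≤ eNorm 1 α S f := le_csSup hb' (Or.inl (by
      simp only [mem_iUnion]; exact ⟨0, by simp, x, hx, rfl⟩))
    simpa using this
  · have : ‖iteratedFDeriv ℝ 1 f x‖ ≤ eNorm 1 α S f := le_csSup hb' (Or.inl (by
      simp only [mem_iUnion]; exact ⟨1, by simp, x, hx, rfl⟩))
    rwa [norm_iteratedFDeriv_one] at this
  · rcases eq_or_ne x y with rfl | hxy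
    · simp only [sub_self, abs_zero]; exact mul_nonneg eNorm_nn (by positivity)
    have h1 : ‖iteratedFDeriv ℝ 1 f x - iteratedFDeriv ℝ 1 f y‖ / ‖x - y‖ ^ α ≤ eNorm 1 α S f :=
      le_csSup hb' (Or.inr ⟨x, hx, y, hy, hxy, rfl⟩)
    have h0 : 0 < ‖x - y‖ := norm_pos_iff.2 (sub_ne_zero.2 hxy)
    rw [div_le_iff₀ (by positivity)] at h1
    refine le_trans ?_ h1
    have := (iteratedFDeriv ℝ 1 f x - iteratedFDeriv ℝ 1 f y).le_opNorm (fun _ => EuclideanSpace.single j 1)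
    simpa [iteratedFDeriv_one_apply, pj] using this

theorem data_of {n : ℕ} (hn : 3 ≤ n) {α C : ℝ} (hα : α ∈ Ioo (0:ℝ) 1) (hC : 0 < C) : ∃ A > 0, ∀ η : EE n → ℝ, ContDiff ℝ 1 η →
    BddAbove (eHolderSet 1 α univ η) → eNorm 1 α univ η ≤ C → (∀ R > (1:ℝ), eNorm 1 α (eShell n R) η ≤ C * R ^ (-2 * (n:ℝ) + 1/2)) →
    (∫ x, η x = 0) → (∀ i : Fin n, ∫ x, x i * η x = 0) → Dat2 α A η := by
  set T : ℝ := 2 ^ (2 * (n:ℝ)) with hT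
  have hT1 : 1 ≤ T := Real.one_le_rpow (by norm_num) (by positivity)
  refine ⟨C * T * T, by positivity, fun η hcd hb hu hs m0 m1 => ?_⟩
  have key : ∀ M ≥ (0:ℝ), ∃ S : Set (EE n), (∀ z : EE n, M - 1/2 ≤ ‖z‖ → ‖z‖ ≤ M → z ∈ S) ∧ ∀ x : EE n, ‖x‖ ≤ M → eNorm 1 α S η ≤ C * T * Ww x := by
    intro M hM
    rcases le_or_gt M (1/2) with h | h
    · refine ⟨univ, fun _ _ _ => mem_univ _, fun x hx => hu.trans ?_⟩
      have := Ww_cmp hn (r := 1) (x := x) (by linarith)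
      rw [Real.one_rpow] at this
      rw [mul_assoc]
      exact le_mul_of_one_le_right hC.le this
    · refine ⟨eShell n (M + 1/2), fun z h1 h2 => ⟨by linarith, by linarith⟩, fun x hx => (hs _ (by linarith)).trans ?_⟩
      rw [mul_assoc]
      gcongr
      exact Ww_cmp hn (by linarith)
  have b0 : ∀ x, |η x| ≤ C * T * Ww x := fun x => by
    obtain ⟨S, h1, h2⟩ := key (‖x‖) (norm_nonneg _)
    exact ((eN_facts hb).1 x (h1 x (by linarith) le_rfl)).trans (h2 x le_rfl)
  have bf : ∀ x, ‖fderiv ℝ η x‖ ≤ C * T * Ww x := fun x => by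
    obtain ⟨S, h1, h2⟩ := key (‖x‖) (norm_nonneg _)
    exact ((eN_facts hb).2.1 x (h1 x (by linarith) le_rfl)).trans (h2 x le_rfl)
  have b1 : ∀ j x, |pj j η x| ≤ C * T * Ww x := fun j x => by
    have := (fderiv ℝ η x).le_opNorm (EuclideanSpace.single j 1)
    simp only [EuclideanSpace.norm_single, norm_one, mul_one] at this
    exact this.trans (bf x)
  have up : ∀ x : EE n, C * T * Ww x ≤ C * T * T * Ww x := fun x => by
    have := Ww_pos x
    gcongr; exact le_mul_of_one_le_right (by positivity) hT1
  have near : ∀ x y : EE n, ‖x - y‖ ≤ 1/2 → |‖x‖ - ‖y‖| ≤ 1/2 := fun x y h => (abs_norm_sub_norm_le x y).trans h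
  have cfd : Continuous (fderiv ℝ η) := hcd.continuous_fderiv (by norm_num)
  have cpj : ∀ j, Continuous (pj j η) := fun j => cfd.clm_apply continuous_const
  have hdiff : Differentiable ℝ η := hcd.differentiable (by norm_num)
  have CT : 0 ≤ C * T := by positivity
  have i0 := Ww_int0 hn CT hcd.continuous b0
  have ij : ∀ j, Integrable (pj j η) := fun j => Ww_int0 hn CT (cpj j) (b1 j)
  have i01 := Ww_int1 hn hcd.continuous b0
  have ij1 : ∀ j, ∀ i, Integrable (fun y : EE n => y i * pj j η y) := fun j => Ww_int1 hn (cpj j) (b1 j)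
  refine ⟨hcd, ⟨by positivity, hcd.continuous, fun y => (b0 y).trans (up y), fun x y hxy => ?_, m0, m1⟩, fun j =>
    ⟨by positivity, cpj j, fun y => (b1 j y).trans (up y), fun x y hxy => ?_, ?_, fun i => ?_⟩, Ww_int0 hn CT cfd bf⟩
  · have hc := (convex_closedBall x (1/2)).norm_image_sub_le_of_norm_hasFDerivWithin_le (f := η) (C := C * T * T * Ww x)
      (fun w _ => (hdiff w).hasFDerivAt.hasFDerivWithinAt) (fun w hw => ?_) (x := y) (y := x) (by rwa [mem_closedBall_iff_norm, norm_sub_rev])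
      (Metric.mem_closedBall_self (by norm_num))
    · rw [Real.norm_eq_abs] at hc
      refine hc.trans (mul_le_mul_of_nonneg_left ?_ (by have := Ww_pos x; positivity))
      rcases eq_or_lt_of_le (norm_nonneg (x - y)) with h0 | h0
      · rw [← h0]; positivity
      · calc ‖x - y‖ = ‖x - y‖ ^ (1:ℝ) := (Real.rpow_one _).symm
          _ ≤ _ := Real.rpow_le_rpow_of_exponent_ge h0 (by linarith) hα.2.le
    · refine (bf w).trans ?_
      rw [mul_assoc _ T (Ww x), Ww_rpow w]
      gcongr
      rw [mem_closedBall_iff_norm] at hw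
      have := abs_le.1 (near w x hw)
      exact Ww_cmp hn (by linarith [norm_nonneg w])
  · obtain ⟨S, h1, h2⟩ := key (max ‖x‖ ‖y‖) (by positivity)
    have hh := abs_le.1 (near x y hxy)
    have hx : x ∈ S := h1 x (by rw [sub_le_iff_le_add]; exact max_le (by linarith) (by linarith)) (le_max_left _ _)
    have hy : y ∈ S := h1 y (by rw [sub_le_iff_le_add]; exact max_le (by linarith) (by linarith)) (le_max_right _ _)
    refine ((eN_facts hb).2.2 x hx y hy j).trans ?_
    gcongr
    exact (h2 x (le_max_left _ _)).trans (up x)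
  · have := integral_mul_fderiv_eq_neg_fderiv_mul_of_integrable (μ := volume) (f := fun _ : EE n => (1:ℝ)) (g := η) (v := EuclideanSpace.single j 1)
      (by simp) (by simp only [one_mul]; exact ij j) (by simpa using i0) (fun x _ => differentiableAt_const _) (fun x _ => hdiff x)
    simpa [pj] using this
  · have hf : ∀ x : EE n, HasFDerivAt (fun y : EE n => y i) (EuclideanSpace.proj i : EE n →L[ℝ] ℝ) x := fun x =>
      (EuclideanSpace.proj i : EE n →L[ℝ] ℝ).hasFDerivAt
    have := integral_mul_fderiv_eq_neg_fderiv_mul_of_integrable (μ := volume) (f := fun y : EE n => y i) (g := η) (v := EuclideanSpace.single j 1)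
      (by simp only [(hf _).fderiv]; exact i0.const_mul _) (ij1 j i) (i01 i) (fun x _ => (hf x).differentiableAt) (fun x _ => hdiff x)
    simp only [(hf _).fderiv, integral_const_mul, m0] at this
    simpa [pj] using this

/-- weighted bound for `t > 0` -/
def wB {n : ℕ} (α K : ℝ) (u : Pt n → ℝ) : Prop :=
  ∀ p : Pt n, 0 < p.2 → |u p| ≤ K * wn p.1 * Real.exp (-p.2) * (1 - Real.exp (-p.2)) ^ (α - 1)

lemma wB.mono {n : ℕ} {α K K' : ℝ} {u : Pt n → ℝ} (h : wB α K u) (hK : K ≤ K') : wB α K' u := fun p hp => by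
  refine (h p hp).trans ?_
  have := wn_pos p.1; have := dt_pos hp
  gcongr
lemma wB.congr {n : ℕ} {α K : ℝ} {u v : Pt n → ℝ} (h : wB α K u) (e : ∀ p : Pt n, 0 < p.2 → v p = u p) : wB α K v := fun p hp => by
  rw [e p hp]; exact h p hp
lemma wB.add {n : ℕ} {α K K' : ℝ} {u v : Pt n → ℝ} (h : wB α K u) (h' : wB α K' v) : wB α (K + K') (fun p => u p + v p) := fun p hp =>
  (abs_add_le _ _).trans ((add_le_add (h p hp) (h' p hp)).trans_eq (by ring))
lemma wB.mul {n : ℕ} {α K M : ℝ} {u : Pt n → ℝ} (h : wB α K u) (hM : 0 ≤ M) {c : ℝ → ℝ} (hc : ∀ t > 0, |c t| ≤ M) : wB α (M * K) (fun p => c p.2 * u p) :=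
  fun p hp => by
    rw [abs_mul]
    exact (mul_le_mul (hc _ hp) (h p hp) (abs_nonneg _) hM).trans_eq (by ring)

lemma SDec.hmul {n : ℕ} {Φ : EE n → ℝ → ℂ} (h : SDec Φ) {θ : EE n → ℝ} (hθ : Integrable θ) : SDec (fun ξ t => Φ ξ t * hat θ ξ) := by
  have := h.mulpoly (q := fun ξ _ => hat θ ξ) (fun t _ => (hat_cont hθ).aestronglyMeasurable) (A := ∫ y, |θ y|) (k := 0)
    (fun ξ t _ => by simpa using hat_norm θ ξ)
  simpa only [mul_comm] using this

lemma atomV {n : ℕ} (hn : 3 ≤ n) {α : ℝ} (hα : α ∈ Ioo (0:ℝ) 1) {b g : ℕ} (hb1 : b ≤ 1) {m : ℂ → ℝ → ℂ}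
    (hol : ∀ s ∈ Ioc (0 : ℝ) 1, DifferentiableOn ℂ (fun l => m l s) Sec)
    (hbd : BD (fun r => (1 + r) ^ b * pw (1 + g) r) 1 m) :
    ∃ K > 0, ∀ (A : ℝ) (η : EE n → ℝ) (p0 P : List (Fin n)), Dat2 α A η → p0.length = g → P.length + b ≤ 3 →
      wB α (K * A) (Vf (fun ξ t => zmon P ξ * (asym p0 m ξ t * hat η ξ))) := by
  have hn2 : 2 ≤ n := by omega
  obtain ⟨Kc, hKc, ce⟩ := conv_est hn hα
  have : ∀ k, ∃ B > 0, k + b ≤ 2 → ∀ t > 0, ∀ p : List (Fin n), p.length = g + k →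
      Ker α (B * Real.exp (-t)) (1 - Real.exp (-t)) (fun x => Vf (asym p m) (x, t)) (fun j x => Vf (asym (j :: p) m) (x, t))
        (fun k j x => Vf (asym (k :: j :: p) m) (x, t)) := fun k => by
    by_cases hk : k + b ≤ 2
    · obtain ⟨B, hB, h⟩ := ker_exists hn hα (k := k) hb1 hk hol hbd
      exact ⟨B, hB, fun _ => h⟩
    · exact ⟨1, one_pos, fun h => absurd h hk⟩
  choose B hB hk using this
  have st : ∀ (k : ℕ), k + b ≤ 2 → ∀ (A : ℝ) (θ : EE n → ℝ) (q : List (Fin n)), Dat α A θ → q.length = g + k →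
      wB α (Kc * (B 0 + B 1 + B 2) * A) (Vf (fun ξ t => asym q m ξ t * hat θ ξ)) := by
    intro k hkb A θ q hθ hq p hp
    have e := Vf_conv hn2 (asym_dec hn2 hol hbd q (by omega)) (hθ.int hn) hp
    unfold hat
    rw [e]
    have hd := dt_pos hp
    refine (ce A _ _ _ _ _ θ (by have := hB k; positivity) hd (by have := Real.exp_pos (-p.2); linarith) (hk k hkb p.2 hp q hq) hθ p.1).trans ?_
    have hw := wn_pos p.1
    have hA := hθ.A0
    have hBk : B k ≤ B 0 + B 1 + B 2 := by
      have := hB 0; have := hB 1; have := hB 2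
      have : k ≤ 2 := by omega
      interval_cases k <;> linarith
    calc _ = Kc * B k * A * wn p.1 * Real.exp (-p.2) * (1 - Real.exp (-p.2)) ^ (α - 1) := by ring
      _ ≤ _ := by gcongr
  refine ⟨Kc * (B 0 + B 1 + B 2), by have := hB 0; have := hB 1; have := hB 2; positivity, fun A η p0 P hη h0 hP => ?_⟩
  cases P with
  | nil =>
    refine (st 0 (by omega) A η p0 hη.d0 (by omega)).congr fun p _ => ?_
    simp [zmon]
  | cons j P' =>
    simp only [List.length_cons] at hP
    refine (st P'.length (by omega) A (pj j η) (P' ++ p0) (hη.d1 j) (by simp; omega)).congr fun p _ => ?_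
    congr 1; funext ξ t
    have := hat_deriv hη.cd (hη.d0.int hn) hη.fi j ξ
    change hat (pj j η) ξ = _ at this
    rw [this]; unfold asym; rw [zmon_cons, zmon_append]; ring

structure GF {n : ℕ} (α K : ℝ) (Φ Φ' : EE n → ℝ → ℂ) : Prop where
  s0 : SDec Φ
  s1 : SDec Φ'
  der : ∀ ξ, ξ ≠ 0 → ∀ t > 0, HasDerivAt (Φ ξ) (Φ' ξ t) t
  b0 : ∀ P : List (Fin n), P.length ≤ 3 → wB α K (Vf (fun ξ t => zmon P ξ * Φ ξ t))
  b1 : ∀ P : List (Fin n), P.length ≤ 2 → wB α K (Vf (fun ξ t => zmon P ξ * Φ' ξ t))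

lemma exp_comp {m : ℝ → ℂ} {a : ℂ} {t : ℝ} (h : HasDerivAt m (a / (Real.exp (-t) : ℝ)) (Real.exp (-t))) :
    HasDerivAt (fun t => m (Real.exp (-t))) (-a) t := by
  have h1 : HasDerivAt (fun t : ℝ => Real.exp (-t)) (-Real.exp (-t)) t :=
    HasDerivAt.congr_deriv ((Real.hasDerivAt_exp (-t)).comp t (hasDerivAt_neg t)) (by ring)
  refine HasDerivAt.congr_deriv (h.scomp t h1) ?_
  have : ((Real.exp (-t) : ℝ) : ℂ) ≠ 0 := by exact_mod_cast (Real.exp_pos (-t)).ne'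
  rw [Complex.real_smul]
  push_cast at this ⊢
  field_simp

lemma GF.atom {n : ℕ} (hn : 3 ≤ n) {α : ℝ} (hα : α ∈ Ioo (0:ℝ) 1) {g : ℕ} {m m1 : ℂ → ℝ → ℂ} (h : FC (pw (1 + g)) 1 m m1) :
    ∃ K > 0, ∀ (A : ℝ) (η : EE n → ℝ) (p0 : List (Fin n)), Dat2 α A η → p0.length = g →
      GF α (K * A) (fun ξ t => asym p0 m ξ t * hat η ξ) (fun ξ t => -(asym p0 m1 ξ t * hat η ξ)) := by
  have hn2 : 2 ≤ n := by omega
  have nn : ∀ b, ∀ r > (0:ℝ), 0 ≤ (1 + r) ^ b * pw (1 + g) r := fun b r hr => mul_nonneg (by positivity) (pw_nn _ r hr)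
  have hb0 : BD (fun r => (1 + r) ^ 0 * pw (1 + g) r) 1 m := h.bd.mono 1 (nn 0) (fun r hr => by simp) le_rfl
  have hb1 : BD (fun r => (1 + r) ^ 1 * pw (1 + g) r) 1 m1 := h.bd1.mono 1 (nn 1) (fun r hr => by simp) le_rfl
  obtain ⟨K0, h0, k0⟩ := atomV hn hα (by norm_num) h.holo hb0
  obtain ⟨K1, h1, k1⟩ := atomV hn hα (by norm_num) h.holo1 hb1
  refine ⟨K0 + K1, by positivity, fun A η p0 hη hp => ?_⟩
  have hA := hη.d0.A0
  have s1 := (asym_dec hn2 h.holo1 hb1 p0 hp.ge).hmul (hη.d0.int hn)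
  refine ⟨(asym_dec hn2 h.holo hb0 p0 hp.ge).hmul (hη.d0.int hn), by simpa using s1.cmul (-1), fun ξ hξ t ht => ?_, fun P hP => ?_, fun P hP => ?_⟩
  · have := exp_comp (h.der _ (lam_sec hξ) _ (Real.exp_pos (-t)))
    refine HasDerivAt.congr_deriv ((this.const_mul (zmon p0 ξ)).mul_const (hat η ξ)) ?_
    unfold asym; ring
  · exact (k0 A η p0 P hη hp (by omega)).mono (by nlinarith)
  · have := ((k1 A η p0 P hη hp (by omega)).mul (c := fun _ => -1) zero_le_one (by simp)).mono (K' := (K0 + K1) * A) (by nlinarith)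
    refine this.congr fun p hp => ?_
    rw [← Vf_tmul _ (fun _ => -1)]; congr 1; funext ξ t; push_cast; ring

lemma GF.mono {n : ℕ} {α K K' : ℝ} {Φ Φ' : EE n → ℝ → ℂ} (h : GF α K Φ Φ') (hK : K ≤ K') : GF α K' Φ Φ' :=
  ⟨h.s0, h.s1, h.der, fun P hP => (h.b0 P hP).mono hK, fun P hP => (h.b1 P hP).mono hK⟩
lemma GF.add {n : ℕ} (hn : 2 ≤ n) {α K K' : ℝ} {Φ Φ' Ψ Ψ' : EE n → ℝ → ℂ} (h : GF α K Φ Φ') (h' : GF α K' Ψ Ψ') :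
    GF α (K + K') (fun ξ t => Φ ξ t + Ψ ξ t) (fun ξ t => Φ' ξ t + Ψ' ξ t) := by
  refine ⟨h.s0.add h'.s0, h.s1.add h'.s1, fun ξ hξ t ht => (h.der ξ hξ t ht).fun_add (h'.der ξ hξ t ht), fun P hP => ?_, fun P hP => ?_⟩
  · refine ((h.b0 P hP).add (h'.b0 P hP)).congr fun p hp => ?_
    rw [← Vf_add hn (h.s0.monmul P) (h'.s0.monmul P) hp]; simp only [mul_add]
  · refine ((h.b1 P hP).add (h'.b1 P hP)).congr fun p hp => ?_
    rw [← Vf_add hn (h.s1.monmul P) (h'.s1.monmul P) hp]; simp only [mul_add]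
lemma GF.zero {n : ℕ} {α : ℝ} : GF α 0 (fun (_ : EE n) (_ : ℝ) => (0:ℂ)) (fun _ _ => 0) := by
  have : ∀ P : List (Fin n), wB α 0 (Vf (fun ξ _ => zmon P ξ * 0)) := fun P p hp => by simp [Vf]
  exact ⟨SDec.zero, SDec.zero, fun ξ _ t _ => hasDerivAt_const _ _, fun P _ => this P, fun P _ => this P⟩
lemma GF.sum {n : ℕ} (hn : 2 ≤ n) {α K : ℝ} {ι : Type*} (s : Finset ι) {Φ Φ' : ι → EE n → ℝ → ℂ} (h : ∀ i, GF α K (Φ i) (Φ' i)) :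
    GF α (s.card * K) (fun ξ t => ∑ i ∈ s, Φ i ξ t) (fun ξ t => ∑ i ∈ s, Φ' i ξ t) := by
  classical
  induction s using Finset.induction_on with
  | empty => simpa using GF.zero
  | insert a s ha ih =>
    simp only [Finset.sum_insert ha, Finset.card_insert_of_notMem ha]
    exact ((h a).add hn ih).mono (by push_cast; linarith)
lemma GF.ite {n : ℕ} {α K : ℝ} (hK : 0 ≤ K) {Φ Φ' : EE n → ℝ → ℂ} (h : GF α K Φ Φ') (c : Prop) [Decidable c] :
    GF α K (fun ξ t => (if c then 1 else 0) * Φ ξ t) (fun ξ t => (if c then 1 else 0) * Φ' ξ t) := by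
  split_ifs with hc
  · simpa using h
  · simpa using GF.zero.mono hK

lemma dpow_le {α t : ℝ} (hα : α ∈ Ioo (0:ℝ) 1) (ht : 0 < t) : (1 - Real.exp (-t)) ^ (α - 1) ≤ 1 + t ^ (α - 1) := by
  have h1 : t / (1 + t) ≤ 1 - Real.exp (-t) := by
    have := Real.add_one_le_exp t
    have h2 : Real.exp (-t) ≤ 1 / (1 + t) := by
      rw [Real.exp_neg, inv_eq_one_div]; exact one_div_le_one_div_of_le (by linarith) (by linarith)
    have : t / (1 + t) = 1 - 1 / (1 + t) := by field_simp; ring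
    linarith
  have h3 : (1 - Real.exp (-t)) ^ (α - 1) ≤ (t / (1 + t)) ^ (α - 1) :=
    Real.rpow_le_rpow_of_nonpos (by positivity) h1 (by linarith [hα.2])
  have h4 : (t / (1 + t)) ^ (α - 1) = (1 + 1 / t) ^ (1 - α) := by
    rw [show (1 + 1 / t) = (t / (1 + t))⁻¹ by field_simp; ring, ← Real.rpow_neg_one, ← Real.rpow_mul (by positivity)]
    congr 1; ring
  have h5 := Real.rpow_add_le_add_rpow (a := 1) (b := 1 / t) (p := 1 - α) (by norm_num) (by positivity) (by linarith [hα.2]) (by linarith [hα.1])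
  rw [Real.one_rpow, one_div, Real.inv_rpow ht.le, ← Real.rpow_neg ht.le, neg_sub] at h5
  rw [h4, one_div] at h3; exact h3.trans h5

/-- weighted Hölder class on the open half space -/
structure Ho {n : ℕ} (α K : ℝ) (u : Pt n → ℝ) : Prop where
  bd : ∀ p : Pt n, 0 < p.2 → |u p| ≤ K * wn p.1 * Real.exp (-p.2)
  ho : ∀ p q : Pt n, 0 < p.2 → 0 < q.2 → |u p - u q| ≤ K * (max (wn p.1) (wn q.1) * Real.exp (-min p.2 q.2)) * ‖p - q‖ ^ α

lemma rho_le {α r : ℝ} (hα : α ∈ Ioo (0:ℝ) 1) (h0 : 0 ≤ r) (h1 : r ≤ 1) : r ≤ r ^ α := by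
  rcases h0.eq_or_lt with rfl | h
  · positivity
  · simpa using Real.rpow_le_rpow_of_exponent_ge h h1 hα.2.le

theorem Ho.of {n : ℕ} {α K : ℝ} (hα : α ∈ Ioo (0:ℝ) 1) (hK : 0 ≤ K) {u : Pt n → ℝ} {u' : Pt n → Pt n →L[ℝ] ℝ}
    (hd : ∀ p : Pt n, 0 < p.2 → HasFDerivAt u (u' p) p) (h0 : wB α K u) (h1 : wB α K (fun p => ‖u' p‖)) :
    Ho α (4 * (3 + 1/α + 2 ^ (n + 1)) * K) u := by
  have a0 := hα.1
  have h0' : ∀ p : Pt n, 0 < p.2 → |u p| ≤ K * wn p.1 * Real.exp (-p.2) * (1 + p.2 ^ (α - 1)) := fun p hp =>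
    (h0 p hp).trans (mul_le_mul_of_nonneg_left (dpow_le hα hp) (by have := wn_pos p.1; positivity))
  have h1' : ∀ p : Pt n, 0 < p.2 → ‖u' p‖ ≤ K * wn p.1 * Real.exp (-p.2) * (1 + p.2 ^ (α - 1)) := fun p hp =>
    (le_abs_self _).trans ((h1 p hp).trans (mul_le_mul_of_nonneg_left (dpow_le hα hp) (by have := wn_pos p.1; positivity)))
  -- vertical estimate
  have vert : ∀ (x : EE n) (a b : ℝ), 0 < a → a ≤ b → |u (x, b) - u (x, a)| ≤ K * wn x * Real.exp (-a) * ((b - a) + (b - a) ^ α / α) := by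
    intro x a b ha hab
    have hw := wn_pos x
    set M := K * wn x * Real.exp (-a) with hM
    have hM0 : 0 ≤ M := by positivity
    have hl : ∀ τ > 0, HasDerivAt (fun τ => u (x, τ) - u (x, a)) (u' (x, τ) (0, 1)) τ := fun τ hτ => by
      have : HasDerivAt (fun τ : ℝ => ((x, τ) : Pt n)) (0, 1) τ := (hasDerivAt_const τ x).prodMk (hasDerivAt_id τ)
      exact ((hd (x, τ) hτ).comp_hasDerivAt τ this).sub_const _
    have hB : ∀ τ > 0, HasDerivAt (fun τ => M * ((τ - a) + (τ ^ α - a ^ α) / α)) (M * (1 + τ ^ (α - 1))) τ := fun τ hτ => by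
      have h2 := ((Real.hasDerivAt_rpow_const (p := α) (Or.inl hτ.ne')).sub_const (a ^ α)).div_const α
      refine HasDerivAt.congr_deriv ((((hasDerivAt_id τ).sub_const a).add h2).const_mul M) ?_
      field_simp
    have key := image_norm_le_of_norm_deriv_right_le_deriv_boundary' (f := fun τ => u (x, τ) - u (x, a)) (f' := fun τ => u' (x, τ) (0, 1))
      (a := a) (b := b) (B := fun τ => M * ((τ - a) + (τ ^ α - a ^ α) / α)) (B' := fun τ => M * (1 + τ ^ (α - 1)))
      (fun τ hτ => (hl τ (by linarith [hτ.1])).continuousAt.continuousWithinAt) (fun τ hτ => (hl τ (by linarith [hτ.1])).hasDerivWithinAt)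
      (by simp)
      (fun τ hτ => (hB τ (by linarith [hτ.1])).continuousAt.continuousWithinAt) (fun τ hτ => (hB τ (by linarith [hτ.1])).hasDerivWithinAt) ?_ (right_mem_Icc.2 hab)
    · refine (key : |u (x, b) - u (x, a)| ≤ _).trans (mul_le_mul_of_nonneg_left ?_ hM0)
      have := Real.rpow_add_le_add_rpow (a := a) (b := b - a) (p := α) ha.le (by linarith) hα.1.le hα.2.le
      rw [add_sub_cancel] at this
      gcongr; linarith
    · intro τ hτ
      have t0 : 0 < τ := by linarith [hτ.1]
      refine ((u' (x, τ)).le_opNorm _).trans ?_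
      have : ‖((0 : EE n), (1:ℝ))‖ ≤ 1 := by simp [Prod.norm_def]
      refine ((mul_le_of_le_one_right (norm_nonneg _) this).trans (h1' (x, τ) t0)).trans ?_
      have : Real.exp (-τ) ≤ Real.exp (-a) := Real.exp_le_exp.2 (by linarith [hτ.1])
      rw [hM]
      have := Real.rpow_nonneg t0.le (α - 1)
      gcongr
  have bdd : ∀ p : Pt n, 0 < p.2 → |u p| ≤ (3 + 1/α) * K * wn p.1 * Real.exp (-p.2) := by
    have big : ∀ p : Pt n, 1 ≤ p.2 → |u p| ≤ 2 * (K * wn p.1 * Real.exp (-p.2)) := fun p hp => by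
      have e : p.2 ^ (α - 1) ≤ 1 := Real.rpow_le_one_of_one_le_of_nonpos hp (by linarith [hα.2])
      have := h0' p (by linarith)
      have hw := wn_pos p.1
      have : K * wn p.1 * Real.exp (-p.2) * (1 + p.2 ^ (α - 1)) ≤ K * wn p.1 * Real.exp (-p.2) * 2 := by gcongr; linarith
      linarith
    rintro ⟨x, t⟩ ht
    simp only at ht
    have hw := wn_pos x
    have hY : 0 ≤ K * wn x * Real.exp (-t) := by positivity
    have ia : 0 < 1 / α := by positivity
    rcases le_total 1 t with h | h
    · have := big (x, t) h
      simp only at this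
      calc _ ≤ _ := this
        _ ≤ (3 + 1/α) * (K * wn x * Real.exp (-t)) := by gcongr; linarith
        _ = _ := by ring
    · have v := vert x t 1 ht h
      have b := big (x, 1) le_rfl
      simp only at b
      have e1 : Real.exp (-1) ≤ Real.exp (-t) := Real.exp_le_exp.2 (by linarith)
      have e2 : K * wn x * Real.exp (-1) ≤ K * wn x * Real.exp (-t) := by gcongr
      have e3 : (1 - t) + (1 - t) ^ α / α ≤ 1 + 1 / α := by
        have : (1 - t) ^ α ≤ 1 := Real.rpow_le_one (by linarith) (by linarith) hα.1.le
        gcongr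
        linarith
      have e4 : K * wn x * Real.exp (-t) * ((1 - t) + (1 - t) ^ α / α) ≤ K * wn x * Real.exp (-t) * (1 + 1 / α) := by gcongr
      have := abs_sub_abs_le_abs_sub (u (x, t)) (u (x, 1))
      rw [abs_sub_comm] at this
      calc |u (x, t)| ≤ (3 + 1/α) * (K * wn x * Real.exp (-t)) := by linarith
        _ = _ := by ring
  have c0 : 0 < 3 + 1 / α := by positivity
  have c1 : (0:ℝ) < 2 ^ (n + 1) := by positivity
  refine ⟨fun p hp => (bdd p hp).trans ?_, ?_⟩
  · have := wn_pos p.1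
    gcongr; linarith
  rintro ⟨x, t⟩ ⟨x', t'⟩ ht ht'
  simp only at ht ht'
  set ρ := ‖((x, t) : Pt n) - (x', t')‖ with hρ
  set W := max (wn x) (wn x') * Real.exp (-min t t') with hW
  have hw := wn_pos x
  have hw' := wn_pos x'
  have et : Real.exp (-t) ≤ Real.exp (-min t t') := Real.exp_le_exp.2 (by linarith [min_le_left t t'])
  have et' : Real.exp (-t') ≤ Real.exp (-min t t') := Real.exp_le_exp.2 (by linarith [min_le_right t t'])
  have hW0 : 0 < W := by positivity
  have wt : wn x * Real.exp (-t) ≤ W := mul_le_mul (le_max_left _ _) et (by positivity) (by positivity)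
  have wt' : wn x' * Real.exp (-t') ≤ W := mul_le_mul (le_max_right _ _) et' (by positivity) (by positivity)
  have r0 : 0 ≤ ρ := norm_nonneg _
  have rx : ‖x - x'‖ ≤ ρ := by rw [hρ]; exact norm_fst_le ((x, t) - (x', t') : Pt n)
  have rt : |t - t'| ≤ ρ := by rw [hρ]; exact norm_snd_le ((x, t) - (x', t') : Pt n)
  show |u (x, t) - u (x', t')| ≤ 4 * (3 + 1/α + 2 ^ (n + 1)) * K * W * ρ ^ α
  rcases le_or_gt (1/2) ρ with hr | hr
  · have e : (1/2 : ℝ) ≤ ρ ^ α := by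
      calc (1/2 : ℝ) ≤ (1/2) ^ α := rho_le hα (by norm_num) (by norm_num)
        _ ≤ _ := by gcongr
    have b1 := bdd (x, t) ht
    have b2 := bdd (x', t') ht'
    simp only at b1 b2
    have k1 : (3 + 1/α) * K * wn x * Real.exp (-t) ≤ (3 + 1/α) * K * W := by rw [mul_assoc _ (wn x)]; gcongr
    have k2 : (3 + 1/α) * K * wn x' * Real.exp (-t') ≤ (3 + 1/α) * K * W := by rw [mul_assoc _ (wn x')]; gcongr
    have := abs_sub (u (x, t)) (u (x', t'))
    calc _ ≤ 4 * ((3 + 1/α) * K * W) * (1/2) := by linarith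
      _ ≤ 4 * ((3 + 1/α) * K * W) * ρ ^ α := by gcongr
      _ = 4 * (3 + 1/α) * K * W * ρ ^ α := by ring
      _ ≤ _ := mul_le_mul_of_nonneg_right (mul_le_mul_of_nonneg_right (mul_le_mul_of_nonneg_right (by linarith) hK) hW0.le) (by positivity)
  · rcases r0.eq_or_lt with h | hr0
    · have : ((x, t) : Pt n) = (x', t') := by rw [← sub_eq_zero, ← norm_eq_zero]; exact h.symm
      rw [this, sub_self, abs_zero]; positivity
    set T := max t t' + ρ with hT
    have rr := rho_le hα hr0.le (by linarith : ρ ≤ 1)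
    have up : ∀ (y : EE n) (a : ℝ), 0 < a → a ≤ T → T - a ≤ 2 * ρ → wn y * Real.exp (-a) ≤ W →
        |u (y, T) - u (y, a)| ≤ K * W * (2 * (1 + 1/α) * ρ ^ α) := fun y a ha hT1 hT2 hwa => by
      refine (vert y a T ha hT1).trans ?_
      have hwy := wn_pos y
      have q1 : (T - a) ^ α ≤ 2 * ρ ^ α := by
        calc (T - a) ^ α ≤ (2 * ρ) ^ α := Real.rpow_le_rpow (by linarith) hT2 a0.le
          _ = 2 ^ α * ρ ^ α := Real.mul_rpow (by norm_num) hr0.le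
          _ ≤ 2 * ρ ^ α := by
            gcongr
            calc (2:ℝ) ^ α ≤ 2 ^ (1:ℝ) := Real.rpow_le_rpow_of_exponent_le (by norm_num) hα.2.le
              _ = 2 := by simp
      have q2 : (T - a) + (T - a) ^ α / α ≤ 2 * (1 + 1/α) * ρ ^ α := by
        calc _ ≤ 2 * ρ ^ α + 2 * ρ ^ α / α := by gcongr; linarith
          _ = _ := by ring
      have q3 : 0 ≤ (T - a) + (T - a) ^ α / α := by have : 0 ≤ T - a := by linarith
                                                    positivity
      rw [mul_assoc K]
      gcongr
    have m1 := le_max_left t t'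
    have m2 := le_max_right t t'
    have tt := abs_le.1 rt
    have v1 := up x t ht (by linarith) (by rcases max_choice t t' with h | h <;> rw [hT, h] <;> linarith) wt
    have v2 := up x' t' ht' (by linarith) (by rcases max_choice t t' with h | h <;> rw [hT, h] <;> linarith) wt'
    have hor : |u (x, T) - u (x', T)| ≤ K * W * (2 * 2 ^ (n + 1) * ρ ^ α) := by
      have T0 : ρ ≤ T := by linarith
      have hh : ∀ w ∈ Metric.closedBall x (1/2), HasFDerivWithinAt (fun y : EE n => u (y, T)) ((u' (w, T)).comp (ContinuousLinearMap.inl ℝ (EE n) ℝ)) (Metric.closedBall x (1/2)) w :=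
        fun w _ => ((hd (w, T) (by simp only; linarith)).comp w ((hasFDerivAt_id w).prodMk (hasFDerivAt_const T w))).hasFDerivWithinAt
      have := (convex_closedBall x (1/2)).norm_image_sub_le_of_norm_hasFDerivWithin_le (C := K * (2 ^ (n + 1) * W) * (1 + ρ ^ (α - 1))) hh (fun w hw => ?_)
        (x := x') (y := x) (by rw [mem_closedBall_iff_norm, norm_sub_rev]; linarith) (Metric.mem_closedBall_self (by norm_num))
      · rw [Real.norm_eq_abs] at this
        refine this.trans ?_
        have s1 : ρ ^ (α - 1) * ρ = ρ ^ α := by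
          rw [← Real.rpow_add_one hr0.ne']; congr 1; ring
        calc _ ≤ K * (2 ^ (n + 1) * W) * (1 + ρ ^ (α - 1)) * ρ := by gcongr
          _ = K * (2 ^ (n + 1) * W) * (ρ + ρ ^ α) := by rw [← s1]; ring
          _ ≤ K * (2 ^ (n + 1) * W) * (ρ ^ α + ρ ^ α) := by gcongr
          _ = _ := by ring
      · refine (ContinuousLinearMap.opNorm_comp_le _ _).trans ?_
        refine (mul_le_of_le_one_right (norm_nonneg _) (ContinuousLinearMap.norm_inl_le_one ℝ _ _)).trans ?_
        refine (h1' (w, T) (by simp only; linarith)).trans ?_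
        simp only
        rw [mem_closedBall_iff_norm] at hw
        have n1 : ‖x‖ ≤ ‖w‖ + 1/2 := by
          have := norm_sub_norm_le x w; rw [norm_sub_rev] at this; linarith
        have n2 : wn w ≤ 2 ^ (n + 1) * wn x := inv_pow_cmp (by positivity) (by norm_num) (by linarith [norm_nonneg w]) _
        have n3 : Real.exp (-T) ≤ Real.exp (-t) := Real.exp_le_exp.2 (by linarith)
        have n4 : T ^ (α - 1) ≤ ρ ^ (α - 1) := Real.rpow_le_rpow_of_nonpos hr0 T0 (by linarith [hα.2])
        have n5 : wn w * Real.exp (-T) ≤ 2 ^ (n + 1) * W := by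
          have := wn_pos w
          calc _ ≤ (2 ^ (n + 1) * wn x) * Real.exp (-t) := by gcongr
            _ = 2 ^ (n + 1) * (wn x * Real.exp (-t)) := by ring
            _ ≤ _ := by gcongr
        have : 0 ≤ T ^ (α - 1) := Real.rpow_nonneg (by linarith) _
        rw [mul_assoc K]
        gcongr
    have tri : |u (x, t) - u (x', t')| ≤ |u (x, T) - u (x, t)| + |u (x, T) - u (x', T)| + |u (x', T) - u (x', t')| := by
      have e : u (x, t) - u (x', t') = -(u (x, T) - u (x, t)) + (u (x, T) - u (x', T)) + (u (x', T) - u (x', t')) := by ring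
      rw [e]
      refine (abs_add_le _ _).trans (add_le_add ((abs_add_le _ _).trans_eq ?_) le_rfl)
      rw [abs_neg]
    have ra : 0 < ρ ^ α := by positivity
    calc _ ≤ K * W * ((4 * (1 + 1/α) + 2 * 2 ^ (n + 1)) * ρ ^ α) := by linarith
      _ ≤ K * W * ((4 * (3 + 1/α + 2 ^ (n + 1))) * ρ ^ α) := by gcongr; linarith
      _ = _ := by ring

lemma Ho.mono {n : ℕ} {α K K' : ℝ} {u : Pt n → ℝ} (h : Ho α K u) (hK : K ≤ K') : Ho α K' u := by
  refine ⟨fun p hp => (h.bd p hp).trans ?_, fun p q hp hq => (h.ho p q hp hq).trans ?_⟩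
  · have := wn_pos p.1; gcongr
  · have := wn_pos p.1; have := wn_pos q.1; gcongr
lemma Ho.congr {n : ℕ} {α K : ℝ} {u v : Pt n → ℝ} (h : Ho α K u) (e : ∀ p : Pt n, 0 < p.2 → v p = u p) : Ho α K v :=
  ⟨fun p hp => by rw [e p hp]; exact h.bd p hp, fun p q hp hq => by rw [e p hp, e q hq]; exact h.ho p q hp hq⟩
lemma Ho.add {n : ℕ} {α K K' : ℝ} {u v : Pt n → ℝ} (h : Ho α K u) (h' : Ho α K' v) : Ho α (K + K') (fun p => u p + v p) := by
  refine ⟨fun p hp => (abs_add_le _ _).trans ((add_le_add (h.bd p hp) (h'.bd p hp)).trans_eq (by ring)), fun p q hp hq => ?_⟩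
  rw [add_sub_add_comm]
  exact (abs_add_le _ _).trans ((add_le_add (h.ho p q hp hq) (h'.ho p q hp hq)).trans_eq (by ring))
lemma Ho.mul {n : ℕ} {α K M : ℝ} (hα : 0 < α) {u : Pt n → ℝ} (h : Ho α K u) (hK : 0 ≤ K) {c : ℝ → ℝ} (hc : ∀ t > 0, |c t| ≤ M)
    (hc' : ∀ t > 0, ∀ t' > 0, |c t - c t'| ≤ M * |t - t'| ^ α) : Ho α (2 * M * K) (fun p => c p.2 * u p) := by
  have hM : 0 ≤ M := (abs_nonneg _).trans (hc 1 one_pos)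
  refine ⟨fun p hp => ?_, fun p q hp hq => ?_⟩
  · rw [abs_mul]
    have := wn_pos p.1
    calc _ ≤ M * (K * wn p.1 * Real.exp (-p.2)) := mul_le_mul (hc _ hp) (h.bd p hp) (abs_nonneg _) hM
      _ = M * K * wn p.1 * Real.exp (-p.2) := by ring
      _ ≤ _ := by gcongr; linarith
  · have hw := wn_pos q.1; have hw' := wn_pos p.1
    have e : c p.2 * u p - c q.2 * u q = c p.2 * (u p - u q) + (c p.2 - c q.2) * u q := by ring
    have a1 : |c p.2 * (u p - u q)| ≤ M * (K * (max (wn p.1) (wn q.1) * Real.exp (-min p.2 q.2)) * ‖p - q‖ ^ α) := by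
      rw [abs_mul]; exact mul_le_mul (hc _ hp) (h.ho p q hp hq) (abs_nonneg _) hM
    have a2 : |(c p.2 - c q.2) * u q| ≤ (M * ‖p - q‖ ^ α) * (K * (max (wn p.1) (wn q.1) * Real.exp (-min p.2 q.2))) := by
      rw [abs_mul]
      refine mul_le_mul ((hc' _ hp _ hq).trans ?_) ((h.bd q hq).trans ?_) (abs_nonneg _) (by positivity)
      · exact mul_le_mul_of_nonneg_left (Real.rpow_le_rpow (abs_nonneg _) (norm_snd_le (p - q)) hα.le) hM
      · rw [mul_assoc]
        refine mul_le_mul_of_nonneg_left (mul_le_mul (le_max_right _ _) (Real.exp_le_exp.2 (by linarith [min_le_right p.2 q.2])) (by positivity) (by positivity)) hK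
    rw [e]
    exact (abs_add_le _ _).trans ((add_le_add a1 a2).trans_eq (by ring))

def VZ {n : ℕ} (P : List (Fin n)) (Φ : EE n → ℝ → ℂ) : Pt n → ℝ := Vf (fun ξ t => zmon P ξ * Φ ξ t)

lemma VZ_fd {n : ℕ} (hn : 2 ≤ n) {Φ Φ' : EE n → ℝ → ℂ} (h : SDec Φ) (h' : SDec Φ')
    (hd : ∀ ξ, ξ ≠ 0 → ∀ t > 0, HasDerivAt (Φ ξ) (Φ' ξ t) t) (P : List (Fin n)) {p : Pt n} (hp : 0 < p.2) :
    HasFDerivAt (VZ P Φ) (gr (fun j => VZ (j :: P) Φ p) (VZ P Φ' p)) p := by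
  have := Vf_hasFDeriv hn (h.monmul P) (h'.monmul P) (fun ξ hξ t ht => (hd ξ hξ t ht).const_mul (zmon P ξ)) hp
  unfold VZ; simp only [zmon_cons, mul_assoc]; exact this

lemma wB.gr {n : ℕ} {α K K' : ℝ} {a : Fin n → Pt n → ℝ} {b : Pt n → ℝ} (h : ∀ j, wB α K (a j)) (h' : wB α K' b) :
    wB α (n * K + K') (fun p => ‖gr (fun j => a j p) (b p)‖) := fun p hp => by
  rw [abs_of_nonneg (norm_nonneg _)]
  refine (gr_norm _ _).trans ((add_le_add (Finset.sum_le_sum fun j _ => h j p hp) (h' p hp)).trans_eq ?_)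
  simp; ring

/-- a `C^{2,α}` package on the open half space -/
structure Pk {n : ℕ} (α K : ℝ) (f : Pt n → ℝ) (fj : Fin n → Pt n → ℝ) (ft : Pt n → ℝ) (fjk : Fin n → Fin n → Pt n → ℝ)
    (fjt : Fin n → Pt n → ℝ) (ftt : Pt n → ℝ) : Prop where
  h0 : Ho α K f
  hj : ∀ j, Ho α K (fj j)
  ht : Ho α K ft
  hjk : ∀ j k, Ho α K (fjk j k)
  hjt : ∀ j, Ho α K (fjt j)
  htt : Ho α K ftt
  d0 : ∀ p : Pt n, 0 < p.2 → HasFDerivAt f (gr (fun j => fj j p) (ft p)) p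
  dj : ∀ k, ∀ p : Pt n, 0 < p.2 → HasFDerivAt (fj k) (gr (fun j => fjk k j p) (fjt k p)) p
  dt : ∀ p : Pt n, 0 < p.2 → HasFDerivAt ft (gr (fun j => fjt j p) (ftt p)) p

lemma wB.sum {n : ℕ} {ι : Type*} (s : Finset ι) {α K : ℝ} {u : ι → Pt n → ℝ} (h : ∀ i, wB α K (u i)) :
    wB α (s.card * K) (fun p => ∑ i ∈ s, u i p) := fun p hp =>
  (Finset.abs_sum_le_sum_abs _ _).trans ((Finset.sum_le_sum fun i _ => h i p hp).trans_eq (by simp; ring))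
lemma Ho.sum {n : ℕ} {ι : Type*} (s : Finset ι) {α K : ℝ} {u : ι → Pt n → ℝ} (h : ∀ i, Ho α K (u i)) :
    Ho α (s.card * K) (fun p => ∑ i ∈ s, u i p) := by
  refine ⟨fun p hp => (Finset.abs_sum_le_sum_abs _ _).trans ((Finset.sum_le_sum fun i _ => (h i).bd p hp).trans_eq (by simp; ring)), fun p q hp hq => ?_⟩
  rw [← Finset.sum_sub_distrib]
  exact (Finset.abs_sum_le_sum_abs _ _).trans ((Finset.sum_le_sum fun i _ => (h i).ho p q hp hq).trans_eq (by simp; ring))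

def cB (n : ℕ) (a M c : ℝ) : ℝ := n + 1 + |a| + c * M
def cH (n : ℕ) (α a M c : ℝ) : ℝ := (1 + 2 * |a| + 2 * c * M) * (4 * (3 + 1/α + 2 ^ (n + 1)) * cB n a M c)

theorem pk_of {n : ℕ} (hn : 2 ≤ n) {α K a M : ℝ} (hα : α ∈ Ioo (0:ℝ) 1) (hK : 0 ≤ K) (hM : 0 ≤ M) {ι : Type} [Fintype ι] {Φ Φ' : EE n → ℝ → ℂ} (h : GF α K Φ Φ')
    {Ψ Ψ' : ι → EE n → ℝ → ℂ} (hΨ : ∀ i, GF α K (Ψ i) (Ψ' i)) {Q : ι → List (Fin n)} (hQ : ∀ i, (Q i).length ≤ 2) {c : ι → ℝ → ℝ}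
    (hc : ∀ i, ∀ t > 0, |c i t| ≤ M) (hc' : ∀ i, ∀ t > 0, ∀ t' > 0, |c i t - c i t'| ≤ M * |t - t'| ^ α)
    (hd : ∀ ξ, ξ ≠ 0 → ∀ t > 0, HasDerivAt (Φ' ξ) (((a : ℝ) : ℂ) * Φ' ξ t + ∑ i, ((c i t : ℝ) : ℂ) * (zmon (Q i) ξ * Ψ i ξ t)) t) :
    Pk α (cH n α a M (Fintype.card ι) * K) (VZ [] Φ) (fun j => VZ [j] Φ) (VZ [] Φ') (fun k j => VZ [j, k] Φ) (fun j => VZ [j] Φ')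
      (fun p => a * VZ [] Φ' p + ∑ i, c i p.2 * VZ (Q i) (Ψ i) p) := by
  set Φ2 : EE n → ℝ → ℂ := fun ξ t => ((a : ℝ) : ℂ) * Φ' ξ t + ∑ i, ((c i t : ℝ) : ℂ) * (zmon (Q i) ξ * Ψ i ξ t) with hΦ2
  have a0 := hα.1
  have aa := abs_nonneg a
  have sd : SDec Φ2 := (h.s1.cmul _).add (SDec.sum _ fun i => ((hΨ i).s0.monmul (Q i)).tmul (fun t => ((c i t : ℝ) : ℂ)) (A := M) fun t ht => by
    rw [Complex.norm_real]; exact hc i t ht)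
  have vz : ∀ P : List (Fin n), ∀ p : Pt n, 0 < p.2 → VZ P Φ2 p = a * VZ P Φ' p + ∑ i, c i p.2 * VZ (P ++ Q i) (Ψ i) p := by
    intro P p hp
    have e : VZ P Φ2 p = Vf (fun ξ t => ((a : ℝ) : ℂ) * (zmon P ξ * Φ' ξ t) + ∑ i, ((c i t : ℝ) : ℂ) * (zmon (P ++ Q i) ξ * Ψ i ξ t)) p := by
      unfold VZ; congr 1; funext ξ t; rw [hΦ2]
      simp only [mul_add, Finset.mul_sum, zmon_append]
      congr 1
      · ring
      · exact Finset.sum_congr rfl fun i _ => by ring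
    have sd' : ∀ i, SDec (fun ξ t => ((c i t : ℝ) : ℂ) * (zmon (P ++ Q i) ξ * Ψ i ξ t)) := fun i =>
      ((hΨ i).s0.monmul (P ++ Q i)).tmul (fun t => ((c i t : ℝ) : ℂ)) (A := M) fun t ht => by rw [Complex.norm_real]; exact hc i t ht
    rw [e, Vf_add hn ((h.s1.monmul P).cmul _) (SDec.sum _ sd') hp, Vf_sum hn _ sd' hp, Vf_tmul _ (fun _ => a)]
    congr 1
    exact Finset.sum_congr rfl fun i _ => Vf_tmul _ (c i) p
  have w2 : ∀ P : List (Fin n), P.length ≤ 1 → wB α ((|a| + Fintype.card ι * M) * K) (VZ P Φ2) := fun P hP => by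
    have w := ((h.b1 P (by omega)).mul (c := fun _ => a) aa (fun _ _ => le_rfl)).add
      (wB.sum Finset.univ fun i => ((hΨ i).b0 (P ++ Q i) (by have := hQ i; rw [List.length_append]; omega)).mul hM (hc i))
    exact (w.mono (le_of_eq (by rw [Finset.card_univ]; ring))).congr (vz P)
  set c4 := 4 * (3 + 1/α + 2 ^ (n + 1)) with hc4
  have c40 : 0 < c4 := by positivity
  have cM : 0 ≤ Fintype.card ι * M := by positivity
  have n0 : (0:ℝ) ≤ n := Nat.cast_nonneg n
  have B0 : 0 ≤ cB n a M (Fintype.card ι) := by unfold cB; positivity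
  have kb : ∀ k, 0 ≤ k → k ≤ (1 + |a| + Fintype.card ι * M) * K → n * K + k ≤ cB n a M (Fintype.card ι) * K := fun k _ h => by unfold cB; linarith
  have k1 : K ≤ (1 + |a| + Fintype.card ι * M) * K := le_mul_of_one_le_left hK (by linarith)
  have k2 : K ≤ cB n a M (Fintype.card ι) * K := le_mul_of_one_le_left hK (by unfold cB; linarith)
  have H0 : ∀ P : List (Fin n), P.length ≤ 2 → Ho α (c4 * (cB n a M (Fintype.card ι) * K)) (VZ P Φ) := fun P hP =>
    Ho.of hα (by positivity) (fun p hp => VZ_fd hn h.s0 h.s1 h.der P hp) ((h.b0 P (by omega)).mono k2)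
      ((wB.gr (fun j => h.b0 (j :: P) (by simp; omega)) (h.b1 P hP)).mono (kb K hK k1))
  have HΨ : ∀ i, ∀ P : List (Fin n), P.length ≤ 2 → Ho α (c4 * (cB n a M (Fintype.card ι) * K)) (VZ P (Ψ i)) := fun i P hP =>
    Ho.of hα (by positivity) (fun p hp => VZ_fd hn (hΨ i).s0 (hΨ i).s1 (hΨ i).der P hp) (((hΨ i).b0 P (by omega)).mono k2)
      ((wB.gr (fun j => (hΨ i).b0 (j :: P) (by simp; omega)) ((hΨ i).b1 P hP)).mono (kb K hK k1))
  have H1 : ∀ P : List (Fin n), P.length ≤ 1 → Ho α (c4 * (cB n a M (Fintype.card ι) * K)) (VZ P Φ') := fun P hP =>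
    Ho.of hα (by positivity) (fun p hp => VZ_fd hn h.s1 sd hd P hp) ((h.b1 P (by omega)).mono k2)
      ((wB.gr (fun j => h.b1 (j :: P) (by simp; omega)) (w2 P hP)).mono (kb _ (by positivity) (by gcongr; linarith)))
  set B := c4 * (cB n a M (Fintype.card ι) * K) with hB
  have hB0 : 0 ≤ B := by positivity
  have le : B ≤ cH n α a M (Fintype.card ι) * K := by
    have : cH n α a M (Fintype.card ι) * K = (1 + 2 * |a| + 2 * Fintype.card ι * M) * B := by unfold cH; ring
    rw [this]; exact le_mul_of_one_le_left hB0 (by linarith)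
  refine ⟨(H0 [] (by simp)).mono le, fun j => (H0 [j] (by simp)).mono le, (H1 [] (by simp)).mono le, fun j k => (H0 [k, j] (by simp)).mono le,
    fun j => (H1 [j] (by simp)).mono le, ?_, fun p hp => VZ_fd hn h.s0 h.s1 h.der [] hp, fun k p hp => VZ_fd hn h.s0 h.s1 h.der [k] hp, fun p hp => ?_⟩
  · have := ((H1 [] (by simp)).mul a0 hB0 (c := fun _ => a) (M := |a|) (fun _ _ => le_rfl) (fun t _ t' _ => by simp; positivity)).add
      (Ho.sum Finset.univ fun i => (HΨ i (Q i) (hQ i)).mul a0 hB0 (hc i) (hc' i))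
    refine this.mono ?_
    rw [Finset.card_univ]
    have e : cH n α a M (Fintype.card ι) * K = (1 + 2 * |a| + 2 * Fintype.card ι * M) * B := by unfold cH; ring
    rw [e]; linarith
  · have := VZ_fd hn h.s1 sd hd [] hp
    rwa [vz [] p hp] at this

lemma GF.congr {n : ℕ} {α K : ℝ} {Φ Φ' Ψ Ψ' : EE n → ℝ → ℂ} (h : GF α K Φ Φ') (e : ∀ ξ t, Ψ ξ t = Φ ξ t) (e' : ∀ ξ t, Ψ' ξ t = Φ' ξ t) :
    GF α K Ψ Ψ' := by
  have : Ψ = Φ := by funext ξ t; exact e ξ t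
  have : Ψ' = Φ' := by funext ξ t; exact e' ξ t
  subst Ψ; subst Ψ'; exact h

def Q00 {n : ℕ} (ηx : Fin n → EE n → ℝ) (η0 : EE n → ℝ) (c1 c2 : ℂ → ℝ → ℂ) (ξ : EE n) (t : ℝ) : ℂ :=
  c1 (lam ξ) (Real.exp (-t)) * (∑ l, zz ξ l * hat (ηx l) ξ) + c2 (lam ξ) (Real.exp (-t)) * hat η0 ξ
def Q0 {n : ℕ} (ηx : Fin n → EE n → ℝ) (η0 : EE n → ℝ) (d0 d1 d2 : ℂ → ℝ → ℂ) (j : Fin n) (ξ : EE n) (t : ℝ) : ℂ :=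
  d0 (lam ξ) (Real.exp (-t)) * hat (ηx j) ξ + zz ξ j * Q00 ηx η0 d1 d2 ξ t
def QX {n : ℕ} (ηx : Fin n → EE n → ℝ) (η0 : EE n → ℝ) (f0 f1 f2 f3 f4 : ℂ → ℝ → ℂ) (j k : Fin n) (ξ : EE n) (t : ℝ) : ℂ :=
  f0 (lam ξ) (Real.exp (-t)) * (zz ξ j * hat (ηx k) ξ + zz ξ k * hat (ηx j) ξ) + zz ξ j * zz ξ k * Q00 ηx η0 f1 f2 ξ t
    + (if j = k then 1 else 0) * Q00 ηx η0 f3 f4 ξ t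

lemma GFQ {n : ℕ} (hn : 3 ≤ n) {α : ℝ} (hα : α ∈ Ioo (0:ℝ) 1) {g : ℕ} {c1 c11 c2 c21 : ℂ → ℝ → ℂ}
    (h1 : FC (pw (1 + (g + 1))) 1 c1 c11) (h2 : FC (pw (1 + g)) 1 c2 c21) :
    ∃ K > 0, ∀ (A : ℝ) (ηx : Fin n → EE n → ℝ) (η0 : EE n → ℝ), (∀ l, Dat2 α A (ηx l)) → Dat2 α A η0 → ∀ q : List (Fin n), q.length = g →
      GF α (K * A) (fun ξ t => zmon q ξ * Q00 ηx η0 c1 c2 ξ t) (fun ξ t => -(zmon q ξ * Q00 ηx η0 c11 c21 ξ t)) := by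
  obtain ⟨K1, k1, a1⟩ := GF.atom hn hα h1
  obtain ⟨K2, k2, a2⟩ := GF.atom hn hα h2
  refine ⟨n * K1 + K2, by positivity, fun A ηx η0 hx h0 q hq => ?_⟩
  have := (GF.sum (by omega) Finset.univ (fun l => a1 A (ηx l) (q ++ [l]) (hx l) (by simp [hq]))).add (by omega) (a2 A η0 q h0 hq)
  refine GF.congr (this.mono (by simp; apply le_of_eq; ring)) (fun ξ t => ?_) (fun ξ t => ?_)
  · simp only [asym, Q00, zmon_append, zmon_cons, mul_add, Finset.mul_sum]
    congr 1
    · refine Finset.sum_congr rfl fun l _ => ?_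
      simp [zmon]; ring
    · ring
  · simp only [asym, Q00, zmon_append, zmon_cons, mul_add, Finset.mul_sum, neg_add, Finset.sum_neg_distrib]
    congr 1
    · congr 1
      refine Finset.sum_congr rfl fun l _ => ?_
      simp [zmon]; ring
    · ring

lemma pk_of2 {n : ℕ} (hn : 2 ≤ n) {α K a : ℝ} (hα : α ∈ Ioo (0:ℝ) 1) (hK : 0 ≤ K) {ι : Type} [Fintype ι] {Φ Φ' : EE n → ℝ → ℂ} (h : GF α K Φ Φ')
    {Ψ Ψ' : ι → EE n → ℝ → ℂ} (hΨ : ∀ i, GF α K (Ψ i) (Ψ' i)) {Q : ι → List (Fin n)} (hQ : ∀ i, (Q i).length ≤ 2) {u v : ι → ℝ}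
    (hu : ∀ i, |u i| ≤ 2 * n + 8) (hv : ∀ i, |v i| ≤ 4)
    (hd : ∀ ξ, ξ ≠ 0 → ∀ t > 0, HasDerivAt (Φ' ξ) (((a : ℝ) : ℂ) * Φ' ξ t + ∑ i, ((u i + v i * Real.exp (-2 * t) : ℝ) : ℂ) * (zmon (Q i) ξ * Ψ i ξ t)) t) :
    Pk α (cH n α a (2 * n + 16) (Fintype.card ι) * K) (VZ [] Φ) (fun j => VZ [j] Φ) (VZ [] Φ') (fun k j => VZ [j, k] Φ) (fun j => VZ [j] Φ')
      (fun p => a * VZ [] Φ' p + ∑ i, (u i + v i * Real.exp (-2 * p.2)) * VZ (Q i) (Ψ i) p) := by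
  have e1 : ∀ t > (0:ℝ), |Real.exp (-2 * t)| ≤ 1 := fun t ht => by
    rw [abs_of_pos (Real.exp_pos _)]; exact Real.exp_le_one_iff.2 (by linarith)
  have e2 : ∀ t > (0:ℝ), ∀ t' > t, |Real.exp (-2 * t) - Real.exp (-2 * t')| ≤ 2 * |t - t'| ^ α := fun t ht t' ht' => by
    have h1 := e1 t ht
    rw [abs_of_pos (Real.exp_pos _)] at h1
    have h2 := Real.exp_pos (-2 * t')
    have h3 : Real.exp (-2 * t') ≤ Real.exp (-2 * t) := Real.exp_le_exp.2 (by linarith)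
    rw [abs_of_nonneg (by linarith), abs_sub_comm, abs_of_pos (by linarith)]
    rcases le_total (t' - t) 1 with hc | hc
    · have h4 := rho_le hα (by linarith : 0 ≤ t' - t) hc
      have h5 := Real.add_one_le_exp (-(2 * (t' - t)))
      have h6 : Real.exp (-2 * t') = Real.exp (-2 * t) * Real.exp (-(2 * (t' - t))) := by rw [← Real.exp_add]; congr 1; ring
      have h7 : 1 - 2 * (t' - t) ≤ 1 := by linarith
      have h8 := Real.exp_le_one_iff.2 (by linarith : -(2 * (t' - t)) ≤ 0)
      nlinarith
    · have := Real.one_le_rpow hc hα.1.le; linarith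
  refine pk_of (M := 2 * n + 16) (c := fun i t => u i + v i * Real.exp (-2 * t)) hn hα hK (by positivity) h hΨ hQ (fun i t ht => ?_) (fun i t ht t' ht' => ?_) hd
  · have := abs_add_le (u i) (v i * Real.exp (-2 * t))
    rw [abs_mul] at this
    have := e1 t ht; have := hu i; have := hv i; have := abs_nonneg (v i)
    nlinarith
  · have : |Real.exp (-2 * t) - Real.exp (-2 * t')| ≤ 2 * |t - t'| ^ α := by
      rcases lt_trichotomy t t' with h | h | h
      · exact e2 t ht t' h
      · subst h; simp [Real.zero_rpow hα.1.ne']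
      · rw [abs_sub_comm, abs_sub_comm t]; exact e2 t' ht' t h
    have hp : 0 ≤ |t - t'| ^ α := by positivity
    rw [show u i + v i * Real.exp (-2 * t) - (u i + v i * Real.exp (-2 * t')) = v i * (Real.exp (-2 * t) - Real.exp (-2 * t')) by ring, abs_mul]
    have := mul_le_mul (hv i) this (abs_nonneg _) (by norm_num)
    have hn0 : (0:ℝ) ≤ n := by positivity
    nlinarith

section fields
variable {n : ℕ} (ηx : Fin n → EE n → ℝ) (η0 : EE n → ℝ)
def P00 : EE n → ℝ → ℂ := Q00 ηx η0 (Sy.C1 n) (Sy.C2 n)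
def P00' : EE n → ℝ → ℂ := fun ξ t => -Q00 ηx η0 (Sy.C11 n) (Sy.C21 n) ξ t
def P0 (j : Fin n) : EE n → ℝ → ℂ := Q0 ηx η0 (Sy.D0 n) (Sy.D1 n) (Sy.D2 n) j
def P0' (j : Fin n) : EE n → ℝ → ℂ := fun ξ t => -Q0 ηx η0 (Sy.D01 n) (Sy.D11 n) (Sy.D21 n) j ξ t
def PX (j k : Fin n) : EE n → ℝ → ℂ := QX ηx η0 (Sy.F0 n) (Sy.F1 n) (Sy.F2 n) (Sy.F3 n) (Sy.F4 n) j k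
def PX' (j k : Fin n) : EE n → ℝ → ℂ := fun ξ t => -QX ηx η0 (Sy.F01 n) (Sy.F11 n) (Sy.F21 n) (Sy.F31 n) (Sy.F41 n) j k ξ t
end fields

structure AllGF {n : ℕ} (α K : ℝ) (ηx : Fin n → EE n → ℝ) (η0 : EE n → ℝ) : Prop where
  tt : GF α K (P00 ηx η0) (P00' ηx η0)
  x0 : ∀ j, GF α K (P0 ηx η0 j) (P0' ηx η0 j)
  xx : ∀ j k, GF α K (PX ηx η0 j k) (PX' ηx η0 j k)

lemma allGF {n : ℕ} (hn : 3 ≤ n) {α : ℝ} (hα : α ∈ Ioo (0:ℝ) 1) : ∃ K > 0, ∀ (A : ℝ) (ηx : Fin n → EE n → ℝ) (η0 : EE n → ℝ),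
    (∀ l, Dat2 α A (ηx l)) → Dat2 α A η0 → AllGF α (K * A) ηx η0 := by
  have hN : (3:ℝ) ≤ n := by exact_mod_cast hn
  have hn2 : 2 ≤ n := by omega
  have tf : ∀ {k : ℕ} {m m1 : ℂ → ℝ → ℂ}, FC (pw k) (n - 2) m m1 → FC (pw k) 1 m m1 := fun h => h.mono 1 (pw_nn _) (fun r _ => (one_mul _).ge) (by linarith)
  obtain ⟨K1, k1, g1⟩ := GFQ hn hα (g := 0) ((Sy.C1_FC hN).topw (by linarith)) ((Sy.C2_FC hN).topw (by linarith))
  obtain ⟨K2, k2, g2⟩ := GFQ hn hα (g := 1) ((Sy.D1_FC hN).topw (by linarith)) ((Sy.D2_FC hN).topw (by linarith))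
  obtain ⟨K3, k3, g3⟩ := GFQ hn hα (g := 2) (tf (Sy.F1_P hN).1) (tf (Sy.F2_P hN).1)
  obtain ⟨K4, k4, g4⟩ := GFQ hn hα (g := 0) (tf (Sy.F3_P hN).1) (tf (Sy.F4_P hN).1)
  obtain ⟨K5, k5, g5⟩ := GF.atom hn hα (g := 0) ((Sy.D0_FC hN).topw (by linarith))
  obtain ⟨K6, k6, g6⟩ := GF.atom hn hα (g := 1) (tf (Sy.F0_P hN).1)
  refine ⟨K1 + K2 + K3 + K4 + K5 + 2 * K6, by positivity, fun A ηx η0 hx h0 => ?_⟩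
  have hA := h0.d0.A0
  have m1 := mul_nonneg k1.le hA
  have m2 := mul_nonneg k2.le hA
  have m3 := mul_nonneg k3.le hA
  have m4 := mul_nonneg k4.le hA
  have m5 := mul_nonneg k5.le hA
  have m6 := mul_nonneg k6.le hA
  refine ⟨?_, fun j => ?_, fun j k => ?_⟩
  · refine GF.congr ((g1 A ηx η0 hx h0 [] rfl).mono (by linarith)) (fun ξ t => ?_) (fun ξ t => ?_)
    · simp [P00, zmon]
    · simp [P00', zmon]
  · refine GF.congr (((g5 A (ηx j) [] (hx j) rfl).add hn2 (g2 A ηx η0 hx h0 [j] rfl)).mono (by linarith)) (fun ξ t => ?_) (fun ξ t => ?_)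
    · simp [P0, Q0, zmon, asym]
    · simp [P0', Q0, zmon, asym]; ring
  · refine GF.congr (((((g6 A (ηx k) [j] (hx k) rfl).add hn2 (g6 A (ηx j) [k] (hx j) rfl)).add hn2 (g3 A ηx η0 hx h0 [j, k] rfl)).add hn2
      ((g4 A ηx η0 hx h0 [] rfl).ite m4 (j = k))).mono (by linarith)) (fun ξ t => ?_) (fun ξ t => ?_)
    · simp [PX, QX, zmon, asym]; ring
    · simp [PX', QX, zmon, asym]; ring

lemma sumzz {n : ℕ} (ξ : EE n) : ∑ i, zz ξ i * zz ξ i = -lam ξ := by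
  have h : ∀ i, zz ξ i * zz ξ i = ((-(4 * π ^ 2) * ξ i ^ 2 : ℝ) : ℂ) := fun i => by
    unfold zz; push_cast; linear_combination (4 * (π:ℂ) ^ 2 * (ξ i : ℂ) ^ 2) * Complex.I_sq
  simp only [h, lam]
  rw [EuclideanSpace.norm_sq_eq]
  simp only [Real.norm_eq_abs, sq_abs, Finset.mul_sum]
  push_cast
  rw [← Finset.sum_neg_distrib]
  exact Finset.sum_congr rfl fun i _ => by ring

lemma sumQ0 {n : ℕ} (ηx : Fin n → EE n → ℝ) (η0 : EE n → ℝ) (d0 d1 d2 : ℂ → ℝ → ℂ) (ξ : EE n) (t : ℝ) :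
    ∑ i, zz ξ i * Q0 ηx η0 d0 d1 d2 i ξ t = d0 (lam ξ) (Real.exp (-t)) * (∑ l, zz ξ l * hat (ηx l) ξ) - lam ξ * Q00 ηx η0 d1 d2 ξ t := by
  have := sumzz ξ
  rw [sub_eq_add_neg, ← neg_mul, ← this, Finset.mul_sum, Finset.sum_mul, ← Finset.sum_add_distrib]
  exact Finset.sum_congr rfl fun i _ => by unfold Q0; ring

lemma sumQX {n : ℕ} (ηx : Fin n → EE n → ℝ) (η0 : EE n → ℝ) (f0 f1 f2 f3 f4 : ℂ → ℝ → ℂ) (j : Fin n) (ξ : EE n) (t : ℝ) :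
    ∑ i, zz ξ i * QX ηx η0 f0 f1 f2 f3 f4 i j ξ t = f0 (lam ξ) (Real.exp (-t)) * (zz ξ j * (∑ l, zz ξ l * hat (ηx l) ξ) - lam ξ * hat (ηx j) ξ)
      - lam ξ * zz ξ j * Q00 ηx η0 f1 f2 ξ t + zz ξ j * Q00 ηx η0 f3 f4 ξ t := by
  have h2 : ∀ i, zz ξ i * QX ηx η0 f0 f1 f2 f3 f4 i j ξ t = (f0 (lam ξ) (Real.exp (-t)) * zz ξ j) * (zz ξ i * hat (ηx i) ξ) +
      zz ξ i * zz ξ i * (f0 (lam ξ) (Real.exp (-t)) * hat (ηx j) ξ + zz ξ j * Q00 ηx η0 f1 f2 ξ t) +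
      (if i = j then zz ξ i * Q00 ηx η0 f3 f4 ξ t else 0) := fun i => by
    unfold QX; split_ifs <;> ring
  simp only [h2, Finset.sum_add_distrib, ← Finset.mul_sum, ← Finset.sum_mul, sumzz, Finset.sum_ite_eq', Finset.mem_univ, if_true]
  ring

lemma trQX {n : ℕ} (ηx : Fin n → EE n → ℝ) (η0 : EE n → ℝ) (f0 f1 f2 f3 f4 : ℂ → ℝ → ℂ) (ξ : EE n) (t : ℝ) :
    ∑ i, QX ηx η0 f0 f1 f2 f3 f4 i i ξ t = 2 * f0 (lam ξ) (Real.exp (-t)) * (∑ l, zz ξ l * hat (ηx l) ξ)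
      - lam ξ * Q00 ηx η0 f1 f2 ξ t + n * Q00 ηx η0 f3 f4 ξ t := by
  have h2 : ∀ i, QX ηx η0 f0 f1 f2 f3 f4 i i ξ t = (2 * f0 (lam ξ) (Real.exp (-t))) * (zz ξ i * hat (ηx i) ξ) +
      zz ξ i * zz ξ i * (Q00 ηx η0 f1 f2 ξ t) + Q00 ηx η0 f3 f4 ξ t := fun i => by
    unfold QX; rw [if_pos rfl]; ring
  simp only [h2, Finset.sum_add_distrib, ← Finset.mul_sum, ← Finset.sum_mul, sumzz]
  simp; ring

lemma QX_symm {n : ℕ} (ηx : Fin n → EE n → ℝ) (η0 : EE n → ℝ) (f0 f1 f2 f3 f4 : ℂ → ℝ → ℂ) (j k : Fin n) :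
    QX ηx η0 f0 f1 f2 f3 f4 j k = QX ηx η0 f0 f1 f2 f3 f4 k j := by
  funext ξ t; unfold QX; simp only [eq_comm (a := k)]; ring

section dd
variable {n : ℕ} {ηx : Fin n → EE n → ℝ} {η0 : EE n → ℝ}

lemma IsSol.dt {r1 r2 t : ℝ} {l : ℂ} {Y Y1 S : ℝ → ℂ} (h : IsSol r1 r2 l Y Y1 S) :
    HasDerivAt (fun t => Y1 (Real.exp (-t))) (-(((r1:ℂ) + r2) * Y1 (Real.exp (-t)) - r1 * r2 * Y (Real.exp (-t)) +
      l * (Real.exp (-t) : ℝ) ^ 2 * Y (Real.exp (-t)) + S (Real.exp (-t)))) t := exp_comp (h _ (Real.exp_pos _)).2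

lemma cexp2 (t : ℝ) : ((Real.exp (-2 * t) : ℝ) : ℂ) = ((Real.exp (-t) : ℝ) : ℂ) ^ 2 := by
  rw [← Complex.ofReal_pow, ← Real.exp_nat_mul]; congr 2; push_cast; ring

lemma d00 (hn : 3 ≤ n) {ξ : EE n} (hξ : ξ ≠ 0) (t : ℝ) : HasDerivAt (P00' ηx η0 ξ) (-n * P00' ηx η0 ξ t + 2 * n * P00 ηx η0 ξ t
    + lam ξ * (Real.exp (-t) : ℝ) ^ 2 * P00 ηx η0 ξ t + 4 * (Real.exp (-t) : ℝ) ^ 2 * ∑ i, zz ξ i * P0 ηx η0 i ξ t) t := by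
  have hN : (3:ℝ) ≤ n := by exact_mod_cast hn
  have hl := lam_sec hξ
  have e1 := Sy.N01 hN hl _ (Real.exp_pos (-t))
  have e2 := Sy.N02 hN hl _ (Real.exp_pos (-t))
  unfold P0 P00 P00'
  rw [sumQ0]
  refine HasDerivAt.congr_deriv ((((Sy.C1_sol hN hl).dt (t := t)).mul_const _).fun_add (((Sy.C2_sol hN hl).dt (t := t)).mul_const _)).fun_neg ?_
  unfold Q00
  push_cast at e1 e2 ⊢
  linear_combination (-4 * ∑ l, zz ξ l * hat (ηx l) ξ) * e1 - 4 * hat η0 ξ * e2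

lemma d0 (hn : 3 ≤ n) {ξ : EE n} (hξ : ξ ≠ 0) (t : ℝ) (j : Fin n) : HasDerivAt (P0' ηx η0 j ξ) (-(n - 2) * P0' ηx η0 j ξ t + 2 * n * P0 ηx η0 j ξ t
    + lam ξ * (Real.exp (-t) : ℝ) ^ 2 * P0 ηx η0 j ξ t - 2 * zz ξ j * P00 ηx η0 ξ t + 2 * (Real.exp (-t) : ℝ) ^ 2 * ∑ i, zz ξ i * PX ηx η0 i j ξ t) t := by
  have hN : (3:ℝ) ≤ n := by exact_mod_cast hn
  have hl := lam_sec hξ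
  have e1 := Sy.W1 hN hl _ (Real.exp_pos (-t))
  have e2 := Sy.W2 hN hl _ (Real.exp_pos (-t))
  have e3 := Sy.W3 hN hl _ (Real.exp_pos (-t))
  unfold P0 P0' P00 PX
  rw [sumQX]
  refine HasDerivAt.congr_deriv ((((Sy.D0_sol hN hl).dt (t := t)).mul_const (hat (ηx j) ξ)).fun_add (((((Sy.D1_sol hN hl).dt (t := t)).mul_const _).fun_add
    (((Sy.D2_sol hN hl).dt (t := t)).mul_const _)).const_mul _)).fun_neg ?_
  unfold Q0 Q00
  push_cast at e1 e2 e3 ⊢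
  linear_combination (-2 * hat (ηx j) ξ) * e1 - 2 * (zz ξ j * ∑ l, zz ξ l * hat (ηx l) ξ) * e2 - 2 * zz ξ j * hat η0 ξ * e3

lemma trP (hn : 3 ≤ n) {ξ : EE n} (hξ : ξ ≠ 0) (t : ℝ) : (Real.exp (-t) : ℝ) ^ 2 * ∑ i, PX ηx η0 i i ξ t = - P00 ηx η0 ξ t := by
  have hN : (3:ℝ) ≤ n := by exact_mod_cast hn
  have hl := lam_sec hξ
  have e1 := Sy.W4 hN hl _ (Real.exp_pos (-t))
  have e2 := Sy.W5 hN hl _ (Real.exp_pos (-t))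
  unfold P00 PX
  rw [trQX]
  unfold Q00
  push_cast at e1 e2 ⊢
  linear_combination (∑ l, zz ξ l * hat (ηx l) ξ) * e1 + hat η0 ξ * e2

lemma dX (hn : 3 ≤ n) {ξ : EE n} (hξ : ξ ≠ 0) (t : ℝ) (j k : Fin n) : HasDerivAt (PX' ηx η0 j k ξ) (-(n - 4) * PX' ηx η0 j k ξ t - (4 - 2 * n) * PX ηx η0 j k ξ t
    + lam ξ * (Real.exp (-t) : ℝ) ^ 2 * PX ηx η0 j k ξ t + 2 * (if j = k then 1 else 0) * ∑ i, PX ηx η0 i i ξ t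
    - 2 * zz ξ j * P0 ηx η0 k ξ t - 2 * zz ξ k * P0 ηx η0 j ξ t) t := by
  have hN : (3:ℝ) ≤ n := by exact_mod_cast hn
  have hl := lam_sec hξ
  have e1 := trP (ηx := ηx) (η0 := η0) hn hξ t
  have hs : ((Real.exp (-t) : ℝ) : ℂ) ≠ 0 := by exact_mod_cast (Real.exp_pos (-t)).ne'
  have e2 : ∑ i, PX ηx η0 i i ξ t = -(((Real.exp (-t) : ℝ) : ℂ) ^ 2)⁻¹ * P00 ηx η0 ξ t := by
    rw [neg_mul, ← mul_neg, ← e1, ← mul_assoc, inv_mul_cancel₀ (pow_ne_zero 2 hs), one_mul]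
  rw [e2]
  unfold P0 P00 PX PX'
  refine HasDerivAt.congr_deriv ((((((Sy.F0_P hN).2 _ hl).dt (t := t)).mul_const (zz ξ j * hat (ηx k) ξ + zz ξ k * hat (ηx j) ξ)).fun_add
    ((((((Sy.F1_P hN).2 _ hl).dt (t := t)).mul_const _).fun_add ((((Sy.F2_P hN).2 _ hl).dt (t := t)).mul_const _)).const_mul (zz ξ j * zz ξ k))).fun_add
    ((((((Sy.F3_P hN).2 _ hl).dt (t := t)).mul_const _).fun_add ((((Sy.F4_P hN).2 _ hl).dt (t := t)).mul_const _)).const_mul (if j = k then 1 else 0))).fun_neg ?_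
  unfold QX Q0 Q00
  push_cast
  ring
end dd

lemma fou_eq {n : ℕ} (f : EE n → ℂ) (ξ : EE n) : FourierTransform.fourier f ξ = ∫ y, ee (-y) ξ * f y := by
  rw [Real.fourier_eq']
  congr 1; ext y
  unfold ee
  rw [smul_eq_mul]
  congr 2
  rw [PiLp.inner_apply]
  push_cast
  rw [Finset.mul_sum, Finset.mul_sum, Finset.sum_mul]
  refine Finset.sum_congr rfl fun j _ => ?_
  simp; ring
lemma ee_neg_symm {n : ℕ} (x ξ : EE n) : ee (-x) (-ξ) = ee x ξ := by unfold ee; simp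
lemma ee_swap {n : ℕ} (x ξ : EE n) : ee x ξ = ee ξ x := by unfold ee; simp only [mul_comm]

lemma flipk {n : ℕ} {k : EE n → EE n → ℂ} (hk : Continuous (fun q : EE n × EE n => k q.1 q.2)) (hk1 : ∀ x ξ, ‖k x ξ‖ ≤ 1) {F G : EE n → ℂ}
    (hF : Integrable F) (hG : Integrable G) : ∫ x, (∫ ξ, k x ξ * F ξ) * G x = ∫ ξ, F ξ * ∫ x, k x ξ * G x := by
  have : Integrable (Function.uncurry fun x ξ => k x ξ * (G x * F ξ)) (volume.prod volume) :=
    (hG.mul_prod hF).bdd_mul (c := 1) hk.aestronglyMeasurable (Filter.Eventually.of_forall fun q => hk1 q.1 q.2)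
  have := integral_integral_swap this
  calc _ = ∫ x, ∫ ξ, k x ξ * (G x * F ξ) := by
        refine integral_congr_ae (Filter.Eventually.of_forall fun x => ?_)
        simp only
        rw [← integral_mul_const]; congr 1; funext ξ; ring
    _ = _ := this
    _ = _ := by
        refine integral_congr_ae (Filter.Eventually.of_forall fun x => ?_)
        simp only
        rw [← integral_const_mul]; congr 1; funext ξ; ring

theorem bdry {n : ℕ} (hn : 2 ≤ n) {ω : EE n → ℝ → ℂ} (hω : SDec ω) {b : Pt n → ℝ} (hb : Continuous b) (hbV : ∀ p : Pt n, 0 < p.2 → b p = Vf ω p)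
    {η : EE n → ℝ} (hη : Continuous η) (hηi : Integrable η) {M : ℝ} (hM : ∀ ξ, ξ ≠ 0 → ∀ t > 0, ‖ω ξ t‖ ≤ M)
    (hlim : ∀ ξ, ξ ≠ 0 → Filter.Tendsto (ω ξ) (𝓝[>] 0) (𝓝 (hat η ξ))) (x : EE n) : b (x, 0) = η x := by
  have hb0 : Continuous fun x : EE n => b (x, 0) := by fun_prop
  refine congrFun (Continuous.ae_eq_iff_eq volume hb0 hη |>.1 ?_) x
  refine ae_eq_of_integral_contDiff_smul_eq hb0.locallyIntegrable hη.locallyIntegrable fun g gd gs => ?_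
  have gc := gd.continuous
  have gsC : HasCompactSupport (fun x => (g x : ℂ)) := gs.comp_left (g := Complex.ofReal) rfl
  let gS : SchwartzMap (EE n) ℂ := gsC.toSchwartzMap (Complex.ofRealCLM.contDiff.comp gd)
  have gS' : ∀ x, gS x = (g x : ℂ) := fun x => rfl
  let φ : SchwartzMap (EE n) ℂ := FourierTransformInv.fourierInv gS
  have hφ : ∀ ξ, φ ξ = ∫ x, ee x ξ * (g x : ℂ) := fun ξ => by
    show (FourierTransformInv.fourierInv gS : SchwartzMap (EE n) ℂ) ξ = _
    rw [SchwartzMap.fourierInv_coe, Real.fourierInv_eq_fourier_neg, fou_eq]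
    simp only [ee_neg_symm]; rfl
  have inv : ∀ y, ∫ ξ, ee (-y) ξ * φ ξ = (g y : ℂ) := fun y => by
    have : (FourierTransform.fourier φ : SchwartzMap (EE n) ℂ) = gS := FourierTransform.fourier_fourierInv_eq gS
    rw [← gS', ← this, SchwartzMap.fourier_coe, fou_eq]
    congr 1; funext ξ
    congr 1; unfold ee; simp [mul_comm]
  have gi : Integrable (fun x => (g x : ℂ)) := gS.integrable
  have φi : Integrable φ := φ.integrable
  -- limit in the frequency side
  have l1 : Filter.Tendsto (fun t => ∫ ξ, ω ξ t * φ ξ) (𝓝[>] 0) (𝓝 (∫ ξ, hat η ξ * φ ξ)) := by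
    refine tendsto_integral_filter_of_dominated_convergence (fun ξ => M * ‖φ ξ‖) ?_ ?_ (φi.norm.const_mul M) ?_
    · filter_upwards [self_mem_nhdsWithin] with t ht
      exact (hω.meas t ht).mul φ.continuous.aestronglyMeasurable
    · filter_upwards [self_mem_nhdsWithin] with t ht
      filter_upwards [ae_ne_zero hn] with ξ hξ
      rw [norm_mul]; exact mul_le_mul_of_nonneg_right (hM ξ hξ t ht) (norm_nonneg _)
    · filter_upwards [ae_ne_zero hn] with ξ hξ
      exact (hlim ξ hξ).mul_const _
  have e1 : ∫ ξ, hat η ξ * φ ξ = ((∫ y, g y * η y : ℝ) : ℂ) := by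
    have := flipk (k := fun ξ y => ee (-y) ξ) (by unfold ee; fun_prop) (fun x ξ => (ee_norm _ _).le) (F := fun y => (η y : ℂ)) (G := φ) hηi.ofReal φi
    simp only [inv] at this
    unfold hat
    rw [this, ← integral_complex_ofReal]
    congr 1; funext y; push_cast; ring
  have e2 : ∀ t > 0, (∫ ξ, ω ξ t * φ ξ).re = ∫ x, g x * b (x, t) := fun t ht => by
    have := flipk (k := ee) ee_cont2 (fun x ξ => (ee_norm _ _).le) (hω.int hn ht) gi
    simp only [← hφ] at this
    rw [← this, ← Complex.reCLM_apply, ← ContinuousLinearMap.integral_comp_comm]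
    · congr 1; funext x
      rw [hbV (x, t) ht, Complex.reCLM_apply, mul_comm, Complex.re_ofReal_mul]; rfl
    · refine gi.bdd_mul (c := ∫ ξ, ‖ω ξ t‖) ?_ (Filter.Eventually.of_forall fun x => ?_)
      · refine Continuous.aestronglyMeasurable ?_
        refine continuous_of_dominated (F := fun x ξ => ee x ξ * ω ξ t) (bound := fun ξ => ‖ω ξ t‖) (fun x => ((ee_cont x).aestronglyMeasurable.mul (hω.meas t ht)))
          (fun x => Filter.Eventually.of_forall fun ξ => by simp [ee_norm]) (hω.int hn ht).norm (Filter.Eventually.of_forall fun ξ => ?_)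
        refine Continuous.mul ?_ continuous_const
        simp only [ee_swap _ ξ]; exact ee_cont ξ
      · refine (norm_integral_le_integral_norm _).trans (le_of_eq ?_)
        congr 1; funext ξ; simp [ee_norm]
  have l2 : Filter.Tendsto (fun t => ∫ x, g x * b (x, t)) (𝓝[>] 0) (𝓝 (∫ x, g x * b (x, 0))) := by
    have hc : Continuous (fun t : ℝ => ∫ x in tsupport g, g x * b (x, t)) :=
      continuous_parametric_integral_of_continuous (f := fun t x => g x * b (x, t)) (by fun_prop) gs
    have : ∀ t : ℝ, ∫ x in tsupport g, g x * b (x, t) = ∫ x, g x * b (x, t) := fun t => by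
      refine setIntegral_eq_integral_of_forall_compl_eq_zero fun x hx => ?_
      rw [image_eq_zero_of_notMem_tsupport hx, zero_mul]
    simp only [this] at hc
    exact (hc.tendsto 0).mono_left nhdsWithin_le_nhds
  have l3 : Filter.Tendsto (fun t => ∫ x, g x * b (x, t)) (𝓝[>] 0) (𝓝 (∫ y, g y * η y)) := by
    have := (Complex.continuous_re.tendsto _).comp l1
    rw [e1, Complex.ofReal_re] at this
    refine this.congr' ?_
    filter_upwards [self_mem_nhdsWithin] with t ht
    exact e2 t ht
  simpa using tendsto_nhds_unique l2 l3

lemma FC.bdl {n k : ℕ} {q : ℝ} {m m1 : ℂ → ℝ → ℂ} (h : FC (gk k) q m m1) (hq : 0 ≤ q) :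
    ∃ C, ∀ ξ : EE n, ξ ≠ 0 → ∀ t > 0, ∀ p : List (Fin n), p.length ≤ k → ‖zmon p ξ * m (lam ξ) (Real.exp (-t))‖ ≤ C := by
  obtain ⟨C, hC, κ, hκ, hb⟩ := h.bd
  refine ⟨C, fun ξ hξ t ht p hp => ?_⟩
  have hs := et_mem' ht
  have h1 := hb _ (lam_sec hξ) _ hs
  have h2 : Real.exp (-t) ^ q ≤ 1 := Real.rpow_le_one hs.1.le hs.2 hq
  have hr : 0 ≤ rh (lam ξ) := by rw [rh_lam]; positivity
  have h3 : Real.exp (-(κ * rh (lam ξ) * (1 - Real.exp (-t)))) ≤ 1 :=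
    Real.exp_le_one_iff.2 (by have := dt_pos ht; have := mul_nonneg (mul_nonneg hκ.le hr) this.le; linarith)
  have hz := zmon_norm p ξ
  rw [← rh_lam] at hz
  have h4 : rh (lam ξ) ^ p.length ≤ (1 + rh (lam ξ)) ^ k :=
    (pow_le_pow_left₀ hr (by linarith) _).trans (pow_le_pow_right₀ (by linarith) hp)
  have hg : 0 ≤ gk k (rh (lam ξ)) := by unfold gk; positivity
  rw [norm_mul]
  calc _ ≤ (1 + rh (lam ξ)) ^ k * (C * gk k (rh (lam ξ)) * 1 * 1) :=
        mul_le_mul (hz.trans h4) (h1.trans (mul_le_mul (mul_le_mul_of_nonneg_left h2 (by positivity)) h3 (by positivity) (by positivity))) (norm_nonneg _) (by positivity)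
    _ = C := by unfold gk; field_simp

lemma FC.lim1 {W : ℝ → ℝ} {q : ℝ} {m m1 : ℂ → ℝ → ℂ} (h : FC W q m m1) {l : ℂ} (hl : l ∈ Sec) :
    Filter.Tendsto (fun t => m l (Real.exp (-t))) (𝓝[>] 0) (𝓝 (m l 1)) := by
  have h1 : Filter.Tendsto (fun t : ℝ => Real.exp (-t)) (𝓝[>] 0) (𝓝 1) := by
    have : Continuous fun t : ℝ => Real.exp (-t) := by fun_prop
    simpa using (this.tendsto 0).mono_left nhdsWithin_le_nhds
  exact ((h.der l hl 1 one_pos).continuousAt.tendsto).comp h1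

section om
variable {n : ℕ} (ηx : Fin n → EE n → ℝ) (η0 : EE n → ℝ)
def om0 (ξ : EE n) (t : ℝ) : ℂ := ((Real.exp (-2 * t) : ℝ) : ℂ) * (∑ i, zz ξ i * P0 ηx η0 i ξ t) + (((n:ℝ):ℂ) * P00 ηx η0 ξ t + (P00' ηx η0 ξ t + P00 ηx η0 ξ t))
def omX (j : Fin n) (ξ : EE n) (t : ℝ) : ℂ := ((Real.exp (-2 * t) : ℝ) : ℂ) * (∑ i, zz ξ i * PX ηx η0 i j ξ t) + (P0' ηx η0 j ξ t + ((n:ℝ):ℂ) * P0 ηx η0 j ξ t)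
end om

lemma om0_eq {n : ℕ} (hn : 3 ≤ n) (ηx : Fin n → EE n → ℝ) (η0 : EE n → ℝ) {ξ : EE n} (hξ : ξ ≠ 0) (t : ℝ) :
    om0 ηx η0 ξ t = Q00 ηx η0 (Sy.A1 n) (Sy.A2 n) ξ t := by
  have hN : (3:ℝ) ≤ n := by exact_mod_cast hn
  have hl := lam_sec hξ
  have e1 := Sy.N01 hN hl _ (Real.exp_pos (-t))
  have e2 := Sy.N02 hN hl _ (Real.exp_pos (-t))
  unfold om0 P0 P00 P00'
  rw [sumQ0, cexp2]
  unfold Q00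
  push_cast at e1 e2 ⊢
  linear_combination (∑ l, zz ξ l * hat (ηx l) ξ) * e1 + hat η0 ξ * e2
lemma omX_eq {n : ℕ} (hn : 3 ≤ n) (ηx : Fin n → EE n → ℝ) (η0 : EE n → ℝ) (j : Fin n) {ξ : EE n} (hξ : ξ ≠ 0) (t : ℝ) :
    omX ηx η0 j ξ t = Q0 ηx η0 (Sy.HP n) (Sy.B1 n) (Sy.B2 n) j ξ t := by
  have hN : (3:ℝ) ≤ n := by exact_mod_cast hn
  have hl := lam_sec hξ
  have e1 := Sy.W1 hN hl _ (Real.exp_pos (-t))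
  have e2 := Sy.W2 hN hl _ (Real.exp_pos (-t))
  have e3 := Sy.W3 hN hl _ (Real.exp_pos (-t))
  unfold omX P0 P0' PX
  rw [sumQX, cexp2]
  unfold Q0 Q00
  push_cast at e1 e2 e3 ⊢
  linear_combination hat (ηx j) ξ * e1 + (zz ξ j * ∑ l, zz ξ l * hat (ηx l) ξ) * e2 + zz ξ j * hat η0 ξ * e3

lemma ex2_norm (t : ℝ) (ht : 0 < t) : ‖((Real.exp (-2 * t) : ℝ) : ℂ)‖ ≤ 1 := by
  rw [Complex.norm_real, Real.norm_of_nonneg (Real.exp_pos _).le]; exact Real.exp_le_one_iff.2 (by linarith)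

lemma om0_bdry {n : ℕ} (hn : 3 ≤ n) {α K : ℝ} {ηx : Fin n → EE n → ℝ} {η0 : EE n → ℝ} (hG : AllGF α K ηx η0) (hx : ∀ l, Integrable (ηx l))
    (h0 : Integrable η0) (hc : Continuous η0) {b : Pt n → ℝ} (hb : Continuous b) (hbV : ∀ p : Pt n, 0 < p.2 → b p = Vf (om0 ηx η0) p) (x : EE n) : b (x, 0) = η0 x := by
  have hN : (3:ℝ) ≤ n := by exact_mod_cast hn
  have s : SDec (om0 ηx η0) := ((SDec.sum Finset.univ fun i => (hG.x0 i).s0.zmul i).tmul (fun t => ((Real.exp (-2 * t) : ℝ) : ℂ)) ex2_norm).add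
    ((hG.tt.s0.cmul _).add (hG.tt.s1.add hG.tt.s0))
  obtain ⟨C1, c1⟩ := (Sy.A1_FC hN).bdl (n := n) (by linarith)
  obtain ⟨C2, c2⟩ := (Sy.A2_FC hN).bdl (n := n) (by linarith)
  refine bdry (by omega) s hb hbV hc h0 (M := (∑ l, C1 * (∫ y, |ηx l y|)) + C2 * ∫ y, |η0 y|) (fun ξ hξ t ht => ?_) (fun ξ hξ => ?_) x
  · rw [om0_eq hn _ _ hξ]
    unfold Q00
    rw [Finset.mul_sum]
    have d1 := fun l => c1 ξ hξ t ht [l] (by simp)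
    have d2 := c2 ξ hξ t ht [] (by simp)
    simp only [zmon, List.map_cons, List.map_nil, List.prod_cons, List.prod_nil, mul_one, one_mul] at d1 d2
    refine (norm_add_le _ _).trans (add_le_add ((norm_sum_le _ _).trans (Finset.sum_le_sum fun l _ => ?_)) ?_)
    · rw [← mul_assoc, norm_mul, mul_comm (Sy.A1 _ _ _)]
      exact mul_le_mul (d1 l) (hat_norm _ _) (norm_nonneg _) ((norm_nonneg _).trans (d1 l))
    · rw [norm_mul]
      exact mul_le_mul d2 (hat_norm _ _) (norm_nonneg _) ((norm_nonneg _).trans d2)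
  · have hl := lam_sec hξ
    have := (((Sy.A1_FC hN).lim1 hl).mul_const (∑ l, zz ξ l * hat (ηx l) ξ)).add (((Sy.A2_FC hN).lim1 hl).mul_const (hat η0 ξ))
    rw [Sy.A1_at, Sy.A2_at hN hl, zero_mul, one_mul, zero_add] at this
    exact this.congr fun t => (om0_eq hn _ _ hξ t).symm

lemma omX_bdry {n : ℕ} (hn : 3 ≤ n) {α K : ℝ} {ηx : Fin n → EE n → ℝ} {η0 : EE n → ℝ} (hG : AllGF α K ηx η0) (hx : ∀ l, Integrable (ηx l))
    (j : Fin n) (hc : Continuous (ηx j)) {b : Pt n → ℝ} (hb : Continuous b) (hbV : ∀ p : Pt n, 0 < p.2 → b p = Vf (omX ηx η0 j) p) (x : EE n) : b (x, 0) = ηx j x := by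
  have hN : (3:ℝ) ≤ n := by exact_mod_cast hn
  have s : SDec (omX ηx η0 j) := ((SDec.sum Finset.univ fun i => (hG.xx i j).s0.zmul i).tmul (fun t => ((Real.exp (-2 * t) : ℝ) : ℂ)) ex2_norm).add
    ((hG.x0 j).s1.add ((hG.x0 j).s0.cmul _))
  obtain ⟨C0, c0⟩ := (Sy.HP_FC hN).bdl (n := n) (by linarith)
  obtain ⟨C1, c1⟩ := (Sy.B1_FC hN).bdl (n := n) (by linarith)
  obtain ⟨C2, c2⟩ := (Sy.B2_FC hN).bdl (n := n) (by linarith)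
  refine bdry (by omega) s hb hbV hc (hx j) (M := C0 * (∫ y, |ηx j y|) + (∑ l, C1 * (∫ y, |ηx l y|) + C2 * ∫ y, |η0 y|)) (fun ξ hξ t ht => ?_) (fun ξ hξ => ?_) x
  · rw [omX_eq hn _ _ _ hξ]
    unfold Q0 Q00
    rw [mul_add, Finset.mul_sum, Finset.mul_sum]
    have d0 := c0 ξ hξ t ht [] (by simp)
    have d1 := fun l => c1 ξ hξ t ht [j, l] (by simp)
    have d2 := c2 ξ hξ t ht [j] (by simp)
    simp only [zmon, List.map_cons, List.map_nil, List.prod_cons, List.prod_nil, mul_one, one_mul] at d0 d1 d2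
    refine (norm_add_le _ _).trans (add_le_add ?_ ((norm_add_le _ _).trans (add_le_add ((norm_sum_le _ _).trans (Finset.sum_le_sum fun l _ => ?_)) ?_)))
    · rw [norm_mul]
      exact mul_le_mul d0 (hat_norm _ _) (norm_nonneg _) ((norm_nonneg _).trans d0)
    · rw [show ∀ a b c d : ℂ, a * (b * (c * d)) = (a * c * b) * d by intros; ring, norm_mul]
      exact mul_le_mul (d1 l) (hat_norm _ _) (norm_nonneg _) ((norm_nonneg _).trans (d1 l))
    · rw [← mul_assoc, norm_mul]
      exact mul_le_mul d2 (hat_norm _ _) (norm_nonneg _) ((norm_nonneg _).trans d2)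
  · have hl := lam_sec hξ
    have := (((Sy.HP_FC hN).lim1 hl).mul_const (hat (ηx j) ξ)).add ((((Sy.B1_FC hN).lim1 hl).mul_const (∑ l, zz ξ l * hat (ηx l) ξ)).add
      (((Sy.B2_FC hN).lim1 hl).mul_const (hat η0 ξ)) |>.const_mul (zz ξ j))
    rw [Sy.B1_at, Sy.HP_at hN hl, Sy.B2_at, zero_mul, one_mul, zero_mul, zero_add, mul_zero, add_zero] at this
    exact this.congr fun t => (omX_eq hn _ _ _ hξ t).symm

def Hs (n : ℕ) : Set (Pt n) := {p | 0 < p.2}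
def exU {n : ℕ} (u : Pt n → ℝ) (p : Pt n) : ℝ := extendFrom (Hs n) u (p.1, |p.2|)

lemma Hs_eq (n : ℕ) : Hs n = (univ : Set (EE n)) ×ˢ Ioi (0:ℝ) := by ext p; simp [Hs]
lemma Hs_cl (n : ℕ) : closure (Hs n) = {p | 0 ≤ p.2} := by
  rw [Hs_eq, closure_prod_eq, closure_univ, closure_Ioi]; ext p; simp
lemma wn_le_one {n : ℕ} (y : EE n) : wn y ≤ 1 :=
  inv_le_one_of_one_le₀ (one_le_pow₀ (by linarith [norm_nonneg y]))

lemma Ho.K0 {n : ℕ} {α K : ℝ} {u : Pt n → ℝ} (h : Ho α K u) : 0 ≤ K := by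
  have := (abs_nonneg _).trans (h.bd (0, 1) one_pos)
  by_contra hK
  have h2 := mul_pos (wn_pos (0 : EE n)) (Real.exp_pos (-1))
  simp only [mul_assoc] at this
  nlinarith

lemma Ho.uc {n : ℕ} {α K : ℝ} (hα : α ∈ Ioo (0:ℝ) 1) {u : Pt n → ℝ} (h : Ho α K u) : UniformContinuousOn u (Hs n) := by
  have K0 := h.K0
  have h1 : ∀ p q : Pt n, 0 < p.2 → 0 < q.2 → |u p - u q| ≤ (K + 1) * ‖p - q‖ ^ α := fun p q hp hq => by
    refine (h.ho p q hp hq).trans (mul_le_mul_of_nonneg_right ?_ (by positivity))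
    have a1 := max_le (wn_le_one p.1) (wn_le_one q.1)
    have a2 : Real.exp (-min p.2 q.2) ≤ 1 := Real.exp_le_one_iff.2 (by have := le_min hp.le hq.le; linarith)
    have a3 : max (wn p.1) (wn q.1) * Real.exp (-min p.2 q.2) ≤ 1 := mul_le_one₀ a1 (Real.exp_pos _).le a2
    nlinarith
  rw [Metric.uniformContinuousOn_iff]
  intro ε hε
  refine ⟨(ε / (K + 1)) ^ (1 / α), by positivity, fun p hp q hq hpq => ?_⟩
  rw [Real.dist_eq]
  refine (h1 p q hp hq).trans_lt ?_
  rw [dist_eq_norm] at hpq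
  have h2 : ‖p - q‖ ^ α < ((ε / (K + 1)) ^ (1 / α)) ^ α := Real.rpow_lt_rpow (norm_nonneg _) hpq hα.1
  rw [← Real.rpow_mul (by positivity), one_div, inv_mul_cancel₀ hα.1.ne', Real.rpow_one, lt_div_iff₀ (by linarith)] at h2
  linarith

lemma ext_cont {n : ℕ} {α K : ℝ} (hα : α ∈ Ioo (0:ℝ) 1) {u : Pt n → ℝ} (h : Ho α K u) : Continuous (exU u) := by
  have : ContinuousOn (extendFrom (Hs n) u) {p | 0 ≤ p.2} := by
    refine continuousOn_extendFrom (Hs_cl n).ge fun p hp => ?_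
    have hp' : p ∈ closure (Hs n) := (Hs_cl n).ge hp
    have : (𝓝[Hs n] p).NeBot := mem_closure_iff_nhdsWithin_neBot.1 hp'
    have hc : Cauchy (𝓝[Hs n] p) := cauchy_nhds.mono nhdsWithin_le_nhds
    exact cauchy_map_iff_exists_tendsto.1 (hc.map_of_le (h.uc hα) inf_le_right)
  exact this.comp_continuous (by fun_prop) fun p => abs_nonneg p.2

lemma ext_eq {n : ℕ} {α K : ℝ} (hα : α ∈ Ioo (0:ℝ) 1) {u : Pt n → ℝ} (h : Ho α K u) {p : Pt n} (hp : 0 < p.2) : exU u p = u p := by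
  have : ((p.1, |p.2|) : Pt n) = p := by rw [abs_of_pos hp]
  rw [exU, this]
  exact extendFrom_extends (h.uc hα).continuousOn p hp
lemma ext_neg {n : ℕ} (u : Pt n → ℝ) (x : EE n) (t : ℝ) : exU u (x, -t) = exU u (x, t) := by simp [exU]

def sh {n : ℕ} (p : Pt n) (k : ℕ) : Pt n := (p.1, p.2 + 1 / ((k:ℝ) + 1))
lemma sh_lim {n : ℕ} (p : Pt n) : Filter.Tendsto (sh p) Filter.atTop (𝓝 p) := by
  have := (tendsto_const_nhds (x := p.2)).add (tendsto_one_div_add_atTop_nhds_zero_nat (𝕜 := ℝ))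
  rw [add_zero] at this
  exact (tendsto_const_nhds (x := p.1)).prodMk_nhds this
lemma sh_pos {n : ℕ} {p : Pt n} (hp : 0 ≤ p.2) (k : ℕ) : 0 < (sh p k).2 := by
  simp only [sh]; positivity

lemma ext_bd {n : ℕ} {α K : ℝ} (hα : α ∈ Ioo (0:ℝ) 1) {u : Pt n → ℝ} (h : Ho α K u) {p : Pt n} (hp : 0 ≤ p.2) :
    |exU u p| ≤ K * wn p.1 * Real.exp (-p.2) := by
  have h1 := ((ext_cont hα h).abs.tendsto p).comp (sh_lim p)
  have h2 : Filter.Tendsto (fun k => K * wn p.1 * Real.exp (-(sh p k).2)) Filter.atTop (𝓝 (K * wn p.1 * Real.exp (-p.2))) :=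
    ((show Continuous fun q : Pt n => K * wn p.1 * Real.exp (-q.2) by fun_prop).tendsto p).comp (sh_lim p)
  refine le_of_tendsto_of_tendsto' h1 h2 fun k => ?_
  have := h.bd (sh p k) (sh_pos hp k)
  rwa [← ext_eq hα h (sh_pos hp k)] at this
lemma ext_ho {n : ℕ} {α K : ℝ} (hα : α ∈ Ioo (0:ℝ) 1) {u : Pt n → ℝ} (h : Ho α K u) {p q : Pt n} (hp : 0 ≤ p.2) (hq : 0 ≤ q.2) :
    |exU u p - exU u q| ≤ K * (max (wn p.1) (wn q.1) * Real.exp (-min p.2 q.2)) * ‖p - q‖ ^ α := by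
  have hc := ext_cont hα h
  have hl2 : ∀ p : Pt n, Filter.Tendsto (fun k => (sh p k).2) Filter.atTop (𝓝 p.2) := fun p => (continuous_snd.tendsto p).comp (sh_lim p)
  have h1 : Filter.Tendsto (fun k => |exU u (sh p k) - exU u (sh q k)|) Filter.atTop (𝓝 |exU u p - exU u q|) :=
    (((hc.tendsto p).comp (sh_lim p)).sub ((hc.tendsto q).comp (sh_lim q))).abs
  have h2 : Filter.Tendsto (fun k => K * (max (wn p.1) (wn q.1) * Real.exp (-min (sh p k).2 (sh q k).2)) * ‖p - q‖ ^ α) Filter.atTop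
      (𝓝 (K * (max (wn p.1) (wn q.1) * Real.exp (-min p.2 q.2)) * ‖p - q‖ ^ α)) :=
    (((((Real.continuous_exp.tendsto _).comp ((hl2 p).min (hl2 q)).neg)).const_mul _).const_mul _).mul_const _
  refine le_of_tendsto_of_tendsto' h1 h2 fun k => ?_
  have := h.ho (sh p k) (sh q k) (sh_pos hp k) (sh_pos hq k)
  rw [← ext_eq hα h (sh_pos hp k), ← ext_eq hα h (sh_pos hq k)] at this
  have e : sh p k - sh q k = p - q := by ext <;> simp [sh]
  rwa [e] at this

def Rx {n : ℕ} (c : Fin 3 → ℝ) (u : Pt n → ℝ) (p : Pt n) : ℝ :=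
  if 0 ≤ p.2 then exU u p else ∑ i, c i * exU u (p.1, ((i:ℕ) + 1 : ℝ) * p.2)
def Rn (c : Fin 3 → ℝ) (i : Fin 3) : ℝ := -((i:ℕ) + 1 : ℝ) * c i

lemma Rx_cont {n : ℕ} {α K : ℝ} (hα : α ∈ Ioo (0:ℝ) 1) {u : Pt n → ℝ} (h : Ho α K u) {c : Fin 3 → ℝ} (hc : ∑ i, c i = 1) :
    Continuous (Rx c u) := by
  have := ext_cont hα h
  refine Continuous.if_le this (by fun_prop) continuous_const continuous_snd fun p hp => ?_
  rw [← hp]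
  simp only [mul_zero, ← Finset.sum_mul, hc, one_mul]
  rw [show p = (p.1, p.2) from rfl, ← hp]

lemma gr_cont {n : ℕ} {a : Fin n → Pt n → ℝ} {b : Pt n → ℝ} (ha : ∀ j, Continuous (a j)) (hb : Continuous b) :
    Continuous (fun p => gr (fun j => a j p) (b p)) := by
  unfold gr; fun_prop

lemma Rx_nn {n : ℕ} {c : Fin 3 → ℝ} {u : Pt n → ℝ} {p : Pt n} (hp : 0 ≤ p.2) : Rx c u p = exU u p := if_pos hp
lemma Rx_pos {n : ℕ} {α K : ℝ} (hα : α ∈ Ioo (0:ℝ) 1) {u : Pt n → ℝ} (h : Ho α K u) {c : Fin 3 → ℝ} {p : Pt n} (hp : 0 < p.2) :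
    Rx c u p = u p := (if_pos hp.le).trans (ext_eq hα h hp)

theorem Rx_deriv {n : ℕ} {α K : ℝ} (hα : α ∈ Ioo (0:ℝ) 1) {u : Pt n → ℝ} {v : Fin n → Pt n → ℝ} {v0 : Pt n → ℝ} (h : Ho α K u)
    (hv : ∀ j, Ho α K (v j)) (hv0 : Ho α K v0) (hd : ∀ p : Pt n, 0 < p.2 → HasFDerivAt u (gr (fun j => v j p) (v0 p)) p)
    {c : Fin 3 → ℝ} (hc : ∑ i, c i = 1) (hc' : ∑ i, Rn c i = 1) (p : Pt n) :
    HasFDerivAt (Rx c u) (gr (fun j => Rx c (v j) p) (Rx (Rn c) v0 p)) p := by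
  have hpos : ∀ p : Pt n, 0 < p.2 → HasFDerivAt (Rx c u) (gr (fun j => Rx c (v j) p) (Rx (Rn c) v0 p)) p := fun p hp => by
    simp only [fun j => Rx_pos hα (hv j) (c := c) hp, Rx_pos hα hv0 hp]
    refine (hd p hp).congr_of_eventuallyEq ?_
    filter_upwards [(isOpen_lt continuous_const continuous_snd).mem_nhds hp] with q hq
    exact Rx_pos hα h hq
  have hneg : ∀ p : Pt n, p.2 < 0 → HasFDerivAt (Rx c u) (gr (fun j => Rx c (v j) p) (Rx (Rn c) v0 p)) p := fun p hp => by
    have h1 : ∀ i : Fin 3, HasFDerivAt (fun q : Pt n => exU u (q.1, ((i:ℕ) + 1 : ℝ) * q.2))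
        (gr (fun j => exU (v j) (p.1, ((i:ℕ) + 1 : ℝ) * p.2)) (-((i:ℕ) + 1 : ℝ) * exU v0 (p.1, ((i:ℕ) + 1 : ℝ) * p.2))) p := fun i => by
      set s : ℝ := (i:ℕ) + 1 with hs
      have s0 : 0 < s := by positivity
      have hq : ∀ q : Pt n, q.2 < 0 → 0 < -(s * q.2) := fun q hq => by nlinarith
      have e : ∀ {w : Pt n → ℝ}, Ho α K w → ∀ q : Pt n, q.2 < 0 → exU w (q.1, s * q.2) = w (q.1, -(s * q.2)) := fun {w} hw q hq' => by
        rw [← ext_neg, ext_eq hα hw (p := (q.1, -(s * q.2))) (hq q hq')]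
      simp only [fun j => e (hv j) p hp, e hv0 p hp]
      let A : Pt n →L[ℝ] Pt n := (ContinuousLinearMap.fst ℝ (EE n) ℝ).prod ((-s) • ContinuousLinearMap.snd ℝ (EE n) ℝ)
      have hA : ∀ q : Pt n, A q = (q.1, -(s * q.2)) := fun q => by simp [A]
      have h2 := (hd (p.1, -(s * p.2)) (hq p hp))
      rw [← hA p] at h2
      have h3 := h2.comp p A.hasFDerivAt
      refine HasFDerivAt.congr_of_eventuallyEq (HasFDerivAt.congr_fderiv h3 ?_) ?_
      · refine ContinuousLinearMap.ext fun w => ?_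
        rw [ContinuousLinearMap.comp_apply, gr_apply, gr_apply, hA, hA]; ring
      · filter_upwards [(isOpen_lt continuous_snd continuous_const).mem_nhds hp] with q hq'
        rw [e h q hq', Function.comp, hA]
    have h2 := HasFDerivAt.fun_sum fun i (_ : i ∈ Finset.univ) => (h1 i).const_mul (c i)
    refine HasFDerivAt.congr_of_eventuallyEq (HasFDerivAt.congr_fderiv h2 ?_) ?_
    · refine ContinuousLinearMap.ext fun w => ?_
      simp only [sum_apply, smul_apply, gr_apply, Rx, if_neg (not_le.2 hp), smul_eq_mul, mul_add,
        Finset.sum_add_distrib, Finset.sum_mul, Finset.mul_sum]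
      congr 1
      · rw [Finset.sum_comm]; simp only [mul_assoc]
      · exact Finset.sum_congr rfl fun i _ => by rw [Rn]; ring
    · filter_upwards [(isOpen_lt continuous_snd continuous_const).mem_nhds hp] with q hq
      exact if_neg (not_le.2 hq)
  rcases lt_trichotomy 0 p.2 with hp | hp | hp
  · exact hpos p hp
  · have hcont := gr_cont (fun j => Rx_cont hα (hv j) hc) (Rx_cont hα hv0 hc')
    have cl' : closure ((univ : Set (EE n)) ×ˢ Iio (0:ℝ)) = {p : Pt n | p.2 ≤ 0} := by
      rw [closure_prod_eq, closure_univ, closure_Iio]; ext p; simp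
    have w1 : HasFDerivWithinAt (Rx c u) (gr (fun j => Rx c (v j) p) (Rx (Rn c) v0 p)) {p | 0 ≤ p.2} p := by
      rw [← Hs_cl n, Hs_eq]
      refine hasFDerivWithinAt_closure_of_tendsto_fderiv (fun q hq => (hpos q hq.2).differentiableAt.differentiableWithinAt)
        (convex_univ.prod (convex_Ioi 0)) (isOpen_univ.prod isOpen_Ioi) (fun q _ => (Rx_cont hα h hc).continuousWithinAt) ?_
      refine (hcont.continuousWithinAt (x := p)).tendsto.congr' ?_
      filter_upwards [self_mem_nhdsWithin] with q hq using (hpos q hq.2).fderiv.symm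
    have w2 : HasFDerivWithinAt (Rx c u) (gr (fun j => Rx c (v j) p) (Rx (Rn c) v0 p)) {p | p.2 ≤ 0} p := by
      rw [← cl']
      refine hasFDerivWithinAt_closure_of_tendsto_fderiv (fun q hq => (hneg q hq.2).differentiableAt.differentiableWithinAt)
        (convex_univ.prod (convex_Iio 0)) (isOpen_univ.prod isOpen_Iio) (fun q _ => (Rx_cont hα h hc).continuousWithinAt) ?_
      refine (hcont.continuousWithinAt (x := p)).tendsto.congr' ?_
      filter_upwards [self_mem_nhdsWithin] with q hq using (hneg q hq.2).fderiv.symm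
    have := w1.union w2
    rwa [show {p : Pt n | 0 ≤ p.2} ∪ {p | p.2 ≤ 0} = univ from eq_univ_of_forall fun q => le_total 0 q.2, hasFDerivWithinAt_univ] at this
  · exact hneg p hp

def T0 : Fin 3 → ℝ := ![6, -8, 3]
lemma T0s : ∑ i, T0 i = 1 := by simp [T0, Fin.sum_univ_three]; norm_num
lemma T1s : ∑ i, Rn T0 i = 1 := by simp [T0, Rn, Fin.sum_univ_three]; norm_num
lemma T2s : ∑ i, Rn (Rn T0) i = 1 := by simp [T0, Rn, Fin.sum_univ_three]; norm_num

lemma gr_deriv {n : ℕ} {a : Fin n → Pt n → ℝ} {b : Pt n → ℝ} {a' : Fin n → Pt n →L[ℝ] ℝ} {b' : Pt n →L[ℝ] ℝ} {p : Pt n}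
    (ha : ∀ j, HasFDerivAt (a j) (a' j) p) (hb : HasFDerivAt b b' p) :
    HasFDerivAt (fun p => gr (fun j => a j p) (b p))
      (∑ j, (a' j).smulRight ((EuclideanSpace.proj j : EE n →L[ℝ] ℝ).comp (ContinuousLinearMap.fst ℝ (EE n) ℝ)) +
        b'.smulRight (ContinuousLinearMap.snd ℝ (EE n) ℝ)) p := by
  unfold gr
  exact (HasFDerivAt.fun_sum fun j _ => (ha j).smul_const _).fun_add (hb.smul_const (ContinuousLinearMap.snd ℝ (EE n) ℝ))

lemma mul_bd {n : ℕ} (M : ContinuousMultilinearMap ℝ (fun _ : Fin 2 => Pt n) ℝ) {A : Fin n → Fin n → ℝ} {B C : Fin n → ℝ} {D E : ℝ}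
    (hM : ∀ m, M m = ∑ j, gr (A j) (B j) (m 0) * (m 1).1 j + gr C D (m 0) * (m 1).2) (hA : ∀ j k, |A j k| ≤ E) (hB : ∀ j, |B j| ≤ E)
    (hC : ∀ j, |C j| ≤ E) (hD : |D| ≤ E) : ‖M‖ ≤ ((n:ℝ) + 1) ^ 2 * E := by
  have E0 : 0 ≤ E := (abs_nonneg _).trans hD
  have g : ∀ {a : Fin n → ℝ} {b : ℝ}, (∀ j, |a j| ≤ E) → |b| ≤ E → ∀ v : Pt n, |gr a b v| ≤ ((n:ℝ) + 1) * E * ‖v‖ := fun {a b} ha hb v => by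
    refine ((gr a b).le_opNorm v).trans (mul_le_mul_of_nonneg_right ((gr_norm a b).trans ?_) (norm_nonneg v))
    have := Finset.sum_le_sum fun j (_ : j ∈ Finset.univ) => ha j
    simp only [Finset.sum_const, Finset.card_univ, Fintype.card_fin, nsmul_eq_mul] at this
    linarith
  refine ContinuousMultilinearMap.opNorm_le_bound (by positivity) fun m => ?_
  rw [hM, Fin.prod_univ_two]
  have h1 : ∀ j, ‖gr (A j) (B j) (m 0) * (m 1).1 j‖ ≤ ((n:ℝ) + 1) * E * ‖m 0‖ * ‖m 1‖ := fun j => by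
    rw [norm_mul]
    exact mul_le_mul (g (hA j) (hB j) _) ((coord_le (m 1).1 j).trans (norm_fst_le (m 1))) (norm_nonneg _) (by positivity)
  have h2 : ‖gr C D (m 0) * (m 1).2‖ ≤ ((n:ℝ) + 1) * E * ‖m 0‖ * ‖m 1‖ := by
    rw [norm_mul]
    exact mul_le_mul (g hC hD _) (norm_snd_le (m 1)) (norm_nonneg _) (by positivity)
  have h3 := norm_sum_le_of_le Finset.univ fun j (_ : j ∈ Finset.univ) => h1 j
  simp only [Finset.sum_const, Finset.card_univ, Fintype.card_fin, nsmul_eq_mul] at h3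
  refine (norm_add_le _ _).trans ((add_le_add h3 h2).trans_eq ?_)
  ring

section
variable {n : ℕ} {α K : ℝ} {f : Pt n → ℝ} {fj : Fin n → Pt n → ℝ} {ft : Pt n → ℝ} {fjk : Fin n → Fin n → Pt n → ℝ}
    {fjt : Fin n → Pt n → ℝ} {ftt : Pt n → ℝ}

lemma Pk.D0 (hα : α ∈ Ioo (0:ℝ) 1) (P : Pk α K f fj ft fjk fjt ftt) (p : Pt n) :
    HasFDerivAt (Rx T0 f) (gr (fun j => Rx T0 (fj j) p) (Rx (Rn T0) ft p)) p := Rx_deriv hα P.h0 P.hj P.ht P.d0 T0s T1s p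
lemma Pk.Dj (hα : α ∈ Ioo (0:ℝ) 1) (P : Pk α K f fj ft fjk fjt ftt) (k : Fin n) (p : Pt n) :
    HasFDerivAt (Rx T0 (fj k)) (gr (fun j => Rx T0 (fjk k j) p) (Rx (Rn T0) (fjt k) p)) p :=
  Rx_deriv hα (P.hj k) (P.hjk k) (P.hjt k) (P.dj k) T0s T1s p
lemma Pk.Dt (hα : α ∈ Ioo (0:ℝ) 1) (P : Pk α K f fj ft fjk fjt ftt) (p : Pt n) :
    HasFDerivAt (Rx (Rn T0) ft) (gr (fun j => Rx (Rn T0) (fjt j) p) (Rx (Rn (Rn T0)) ftt p)) p :=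
  Rx_deriv hα P.ht P.hjt P.htt P.dt T1s T2s p

lemma Pk.fd (hα : α ∈ Ioo (0:ℝ) 1) (P : Pk α K f fj ft fjk fjt ftt) :
    fderiv ℝ (Rx T0 f) = fun p => gr (fun j => Rx T0 (fj j) p) (Rx (Rn T0) ft p) := funext fun p => (P.D0 hα p).fderiv

lemma Pk.cd (hα : α ∈ Ioo (0:ℝ) 1) (P : Pk α K f fj ft fjk fjt ftt) : ContDiff ℝ 2 (Rx T0 f) := by
  have hj : ∀ k, ContDiff ℝ 1 (Rx T0 (fj k)) := fun k => by
    refine contDiff_one_iff_fderiv.2 ⟨fun p => (P.Dj hα k p).differentiableAt, ?_⟩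
    rw [funext fun p => (P.Dj hα k p).fderiv]
    exact gr_cont (fun j => Rx_cont hα (P.hjk k j) T0s) (Rx_cont hα (P.hjt k) T1s)
  have ht : ContDiff ℝ 1 (Rx (Rn T0) ft) := by
    refine contDiff_one_iff_fderiv.2 ⟨fun p => (P.Dt hα p).differentiableAt, ?_⟩
    rw [funext fun p => (P.Dt hα p).fderiv]
    exact gr_cont (fun j => Rx_cont hα (P.hjt j) T1s) (Rx_cont hα P.htt T2s)
  rw [show (2 : WithTop ℕ∞) = 1 + 1 by norm_num, contDiff_succ_iff_fderiv]
  refine ⟨fun p => (P.D0 hα p).differentiableAt, by simp, ?_⟩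
  rw [P.fd hα]
  unfold gr
  exact (ContDiff.sum fun j _ => (hj j).smul contDiff_const).add (ht.smul contDiff_const)

lemma Pk.two (hα : α ∈ Ioo (0:ℝ) 1) (P : Pk α K f fj ft fjk fjt ftt) (p : Pt n) (m : Fin 2 → Pt n) :
    iteratedFDeriv ℝ 2 (Rx T0 f) p m = ∑ j, gr (fun k => Rx T0 (fjk j k) p) (Rx (Rn T0) (fjt j) p) (m 0) * (m 1).1 j +
      gr (fun j => Rx (Rn T0) (fjt j) p) (Rx (Rn (Rn T0)) ftt p) (m 0) * (m 1).2 := by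
  rw [iteratedFDeriv_two_apply, P.fd hα, (gr_deriv (fun j => P.Dj hα j p) (P.Dt hα p)).fderiv]
  simp

theorem Pk.bound (hα : α ∈ Ioo (0:ℝ) 1) (P : Pk α K f fj ft fjk fjt ftt) {S : Set (Pt n)} {W : ℝ} (hS : ∀ p ∈ S, 0 ≤ p.2 ∧ wn p.1 ≤ W) :
    ∀ r ∈ holderSet 2 α 1 S (Rx T0 f), r ≤ ((n:ℝ) + 1) ^ 2 * (K * W) := by
  have K0 := P.h0.K0
  have hb : ∀ {u : Pt n → ℝ} (c : Fin 3 → ℝ), Ho α K u → ∀ p ∈ S, |Rx c u p| ≤ K * W * Real.exp (-p.2) := fun {u} c hu p hp => by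
    rw [Rx_nn (hS p hp).1]
    refine (ext_bd hα hu (hS p hp).1).trans ?_
    have := (hS p hp).2
    gcongr
  have hh : ∀ {u : Pt n → ℝ} (c : Fin 3 → ℝ), Ho α K u → ∀ p ∈ S, ∀ q ∈ S, |Rx c u p - Rx c u q| ≤ K * W * Real.exp (-min p.2 q.2) * ‖p - q‖ ^ α :=
    fun {u} c hu p hp q hq => by
    rw [Rx_nn (hS p hp).1, Rx_nn (hS q hq).1]
    refine (ext_ho hα hu (hS p hp).1 (hS q hq).1).trans ?_
    have := max_le (hS p hp).2 (hS q hq).2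
    rw [← mul_assoc]
    gcongr
  have ee : ∀ (t X : ℝ), X ≤ ((n:ℝ) + 1) ^ 2 * (K * W * Real.exp (-t)) → Real.exp (1 * t) * X ≤ ((n:ℝ) + 1) ^ 2 * (K * W) := fun t X h => by
    refine (mul_le_mul_of_nonneg_left h (Real.exp_pos _).le).trans_eq ?_
    rw [one_mul, show Real.exp t * (((n:ℝ) + 1) ^ 2 * (K * W * Real.exp (-t))) = ((n:ℝ) + 1) ^ 2 * (K * W) * (Real.exp t * Real.exp (-t)) by ring,
      ← Real.exp_add, add_neg_cancel, Real.exp_zero, mul_one]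
  have hn1 : (1:ℝ) ≤ (n:ℝ) + 1 := by linarith [Nat.cast_nonneg (α := ℝ) n]
  intro r hr
  rcases hr with hr | ⟨p, hp, q, hq, hpq, rfl⟩
  · simp only [mem_iUnion, Finset.mem_range] at hr
    obtain ⟨j, hj, p, hp, rfl⟩ := hr
    have E0 : 0 ≤ K * W * Real.exp (-p.2) := (abs_nonneg _).trans (hb T0 P.h0 p hp)
    refine ee p.2 _ ?_
    interval_cases j
    · rw [norm_iteratedFDeriv_zero]
      exact (hb T0 P.h0 p hp).trans (le_mul_of_one_le_left E0 (one_le_pow₀ hn1))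
    · rw [norm_iteratedFDeriv_one, P.fd hα]
      refine (gr_norm _ _).trans ((add_le_add (Finset.sum_le_sum fun j _ => hb T0 (P.hj j) p hp) (hb (Rn T0) P.ht p hp)).trans ?_)
      simp only [Finset.sum_const, Finset.card_univ, Fintype.card_fin, nsmul_eq_mul]
      nlinarith [mul_nonneg (mul_nonneg (Nat.cast_nonneg (α := ℝ) n) (by linarith : (0:ℝ) ≤ n + 1)) E0]
    · exact mul_bd _ (P.two hα p) (fun j k => hb T0 (P.hjk j k) p hp) (fun j => hb (Rn T0) (P.hjt j) p hp) (fun j => hb (Rn T0) (P.hjt j) p hp)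
        (hb _ P.htt p hp)
  · have h0 : 0 < ‖p - q‖ ^ α := Real.rpow_pos_of_pos (norm_pos_iff.2 (sub_ne_zero.2 hpq)) _
    rw [mul_div_assoc]
    refine ee _ _ ?_
    rw [div_le_iff₀ h0, mul_assoc]
    refine mul_bd _ (fun m => ?_) (fun j k => hh T0 (P.hjk j k) p hp q hq) (fun j => hh (Rn T0) (P.hjt j) p hp q hq)
      (fun j => hh (Rn T0) (P.hjt j) p hp q hq) (hh (Rn (Rn T0)) P.htt p hp q hq)
    rw [sub_apply, P.two hα, P.two hα]
    simp only [gr_apply, sub_mul, Finset.sum_sub_distrib, add_mul, Finset.sum_add_distrib]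
    ring
end

lemma wn_ann {n : ℕ} {δ R : ℝ} (hδ : 0 < δ) (hR : 0 < R) {p : Pt n} (hp : p ∈ annRegion n R) :
    0 ≤ p.2 ∧ wn p.1 ≤ 2 ^ (n + 1) * (1 + R) ^ (-(n:ℝ) - 1 + δ) := by
  obtain ⟨h1, h2, h3⟩ := hp
  refine ⟨h3, ?_⟩
  have h4 : (1 + R) / 2 ≤ 1 + ‖p.1‖ := by linarith [norm_nonneg p.1]
  have h5 : wn p.1 ≤ (((1 + R) / 2) ^ (n + 1))⁻¹ := inv_anti₀ (by positivity) (pow_le_pow_left₀ (by positivity) h4 _)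
  have h6 : (((1 + R) / 2) ^ (n + 1))⁻¹ = 2 ^ (n + 1) * (1 + R) ^ (-(n:ℝ) - 1) := by
    rw [div_pow, inv_div, div_eq_mul_inv, ← Real.rpow_natCast (1 + R), ← Real.rpow_neg (by positivity)]
    congr 2; push_cast; ring
  rw [h6] at h5
  exact h5.trans (mul_le_mul_of_nonneg_left (Real.rpow_le_rpow_of_exponent_le (by linarith) (by linarith)) (by positivity))

abbrev PkZ {n : ℕ} (α K : ℝ) (Φ Φ' : EE n → ℝ → ℂ) (ftt : Pt n → ℝ) : Prop :=
  Pk α K (VZ [] Φ) (fun j => VZ [j] Φ) (VZ [] Φ') (fun k j => VZ [j, k] Φ) (fun j => VZ [j] Φ') ftt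

lemma Pk.mono {n : ℕ} {α K K' : ℝ} {f : Pt n → ℝ} {fj : Fin n → Pt n → ℝ} {ft : Pt n → ℝ} {fjk : Fin n → Fin n → Pt n → ℝ}
    {fjt : Fin n → Pt n → ℝ} {ftt : Pt n → ℝ} (P : Pk α K f fj ft fjk fjt ftt) (h : K ≤ K') : Pk α K' f fj ft fjk fjt ftt :=
  ⟨P.h0.mono h, fun j => (P.hj j).mono h, P.ht.mono h, fun j k => (P.hjk j k).mono h, fun j => (P.hjt j).mono h, P.htt.mono h, P.d0, P.dj, P.dt⟩

section
variable {n : ℕ} (ηx : Fin n → EE n → ℝ) (η0 : EE n → ℝ)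
def S00 (p : Pt n) : ℝ := -(n:ℝ) * VZ [] (P00' ηx η0) p + (2 * n * VZ [] (P00 ηx η0) p + (∑ i, -Real.exp (-2 * p.2) * VZ [i, i] (P00 ηx η0) p +
  ∑ i, 4 * Real.exp (-2 * p.2) * VZ [i] (P0 ηx η0 i) p))
def S0 (j : Fin n) (p : Pt n) : ℝ := -((n:ℝ) - 2) * VZ [] (P0' ηx η0 j) p + ((2 * n * VZ [] (P0 ηx η0 j) p + -2 * VZ [j] (P00 ηx η0) p) +
  (∑ i, -Real.exp (-2 * p.2) * VZ [i, i] (P0 ηx η0 j) p + ∑ i, 2 * Real.exp (-2 * p.2) * VZ [i] (PX ηx η0 i j) p))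
def SX (j k : Fin n) (p : Pt n) : ℝ := -((n:ℝ) - 4) * VZ [] (PX' ηx η0 j k) p + ((-(4 - 2 * n) * VZ [] (PX ηx η0 j k) p + (-2 * VZ [j] (P0 ηx η0 k) p +
  -2 * VZ [k] (P0 ηx η0 j) p)) + (∑ i, -Real.exp (-2 * p.2) * VZ [i, i] (PX ηx η0 j k) p + ∑ i, (2 * if j = k then 1 else 0) * VZ [] (PX ηx η0 i i) p))
end

structure Pks {n : ℕ} (α K : ℝ) (ηx : Fin n → EE n → ℝ) (η0 : EE n → ℝ) : Prop where
  tt : PkZ α K (P00 ηx η0) (P00' ηx η0) (S00 ηx η0)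
  x0 : ∀ j, PkZ α K (P0 ηx η0 j) (P0' ηx η0 j) (S0 ηx η0 j)
  xx : ∀ j k, PkZ α K (PX ηx η0 j k) (PX' ηx η0 j k) (SX ηx η0 j k)

lemma zmon1 {n : ℕ} (j : Fin n) (ξ : EE n) : zmon [j] ξ = zz ξ j := by simp [zmon]
lemma zmon0 {n : ℕ} (ξ : EE n) : zmon [] ξ = 1 := by simp [zmon]
lemma zmon2 {n : ℕ} (j k : Fin n) (ξ : EE n) : zmon [j, k] ξ = zz ξ j * zz ξ k := by simp [zmon]

lemma lam_sum {n : ℕ} (ξ : EE n) (s A : ℂ) : ∑ i, (-s) * (zz ξ i * zz ξ i * A) = lam ξ * s * A := by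
  rw [← Finset.mul_sum, ← Finset.sum_mul, sumzz]; ring

theorem pks {n : ℕ} (hn : 3 ≤ n) {α : ℝ} (hα : α ∈ Ioo (0:ℝ) 1) : ∃ c > 0, ∀ (K : ℝ) (ηx : Fin n → EE n → ℝ) (η0 : EE n → ℝ), 0 ≤ K →
    AllGF α K ηx η0 → Pks α (c * K) ηx η0 := by
  have N0 : (3:ℝ) ≤ n := by exact_mod_cast hn
  have n2 : 2 ≤ n := by omega
  set c1 := cH n α (-(n:ℝ)) (2 * n + 16) (Fintype.card (Unit ⊕ (Fin n ⊕ Fin n)))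
  set c2 := cH n α (-((n:ℝ) - 2)) (2 * n + 16) (Fintype.card ((Unit ⊕ Unit) ⊕ (Fin n ⊕ Fin n)))
  set c3 := cH n α (-((n:ℝ) - 4)) (2 * n + 16) (Fintype.card ((Unit ⊕ (Unit ⊕ Unit)) ⊕ (Fin n ⊕ Fin n)))
  refine ⟨|c1| + |c2| + |c3| + 1, by positivity, fun K ηx η0 hK hG => ⟨?_, fun j => ?_, fun j k => ?_⟩⟩
  · refine Pk.mono (K := c1 * K) ?_ (mul_le_mul_of_nonneg_right (by linarith [le_abs_self c1, abs_nonneg c2, abs_nonneg c3]) hK)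
    have := pk_of2 n2 (a := -(n:ℝ)) hα hK (ι := Unit ⊕ (Fin n ⊕ Fin n)) hG.tt
      (Ψ := Sum.elim (fun _ => P00 ηx η0) (Sum.elim (fun _ => P00 ηx η0) (fun i => P0 ηx η0 i)))
      (Ψ' := Sum.elim (fun _ => P00' ηx η0) (Sum.elim (fun _ => P00' ηx η0) (fun i => P0' ηx η0 i)))
      (by rintro (_ | _ | i) <;> simp only [Sum.elim_inl, Sum.elim_inr] <;> first | exact hG.tt | exact hG.x0 _)
      (Q := Sum.elim (fun _ => []) (Sum.elim (fun i => [i, i]) (fun i => [i]))) (by rintro (_ | _ | i) <;> simp)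
      (u := Sum.elim (fun _ => 2 * n) (Sum.elim (fun _ => 0) (fun _ => 0))) (v := Sum.elim (fun _ => 0) (Sum.elim (fun _ => -1) (fun _ => 4)))
      (by rintro (_ | _ | i) <;> simp <;> positivity)
      (by rintro (_ | _ | i) <;> simp) (fun ξ hξ t ht => HasDerivAt.congr_deriv (d00 hn hξ t) (by
        simp only [Fintype.sum_sum_type, Sum.elim_inl, Sum.elim_inr, zmon0, zmon1, zmon2, Finset.univ_unique, Finset.sum_singleton]
        simp only [Complex.ofReal_mul, Complex.ofReal_add, Complex.ofReal_sub, Complex.ofReal_neg, Complex.ofReal_one, Complex.ofReal_zero, Complex.ofReal_ofNat,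
          Complex.ofReal_natCast, cexp2, zero_mul, zero_add, add_zero, neg_one_mul, one_mul, apply_ite Complex.ofReal]
        rw [lam_sum]
        simp only [← Finset.mul_sum]
        ring))
    simp only [Fintype.sum_sum_type, Sum.elim_inl, Sum.elim_inr, Finset.univ_unique, Finset.sum_singleton, zero_mul, zero_add, add_zero,
      neg_one_mul] at this
    exact this
  · refine Pk.mono (K := c2 * K) ?_ (mul_le_mul_of_nonneg_right (by linarith [le_abs_self c2, abs_nonneg c1, abs_nonneg c3]) hK)
    have := pk_of2 n2 (a := -((n:ℝ) - 2)) hα hK (ι := (Unit ⊕ Unit) ⊕ (Fin n ⊕ Fin n)) (hG.x0 j)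
      (Ψ := Sum.elim (Sum.elim (fun _ => P0 ηx η0 j) (fun _ => P00 ηx η0)) (Sum.elim (fun _ => P0 ηx η0 j) (fun i => PX ηx η0 i j)))
      (Ψ' := Sum.elim (Sum.elim (fun _ => P0' ηx η0 j) (fun _ => P00' ηx η0)) (Sum.elim (fun _ => P0' ηx η0 j) (fun i => PX' ηx η0 i j)))
      (by rintro ((_ | _) | _ | i) <;> simp only [Sum.elim_inl, Sum.elim_inr] <;> first | exact hG.tt | exact hG.x0 _ | exact hG.xx _ _)
      (Q := Sum.elim (Sum.elim (fun _ => []) (fun _ => [j])) (Sum.elim (fun i => [i, i]) (fun i => [i]))) (by rintro ((_ | _) | _ | i) <;> simp)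
      (u := Sum.elim (Sum.elim (fun _ => 2 * n) (fun _ => -2)) (Sum.elim (fun _ => 0) (fun _ => 0)))
      (v := Sum.elim (Sum.elim (fun _ => 0) (fun _ => 0)) (Sum.elim (fun _ => -1) (fun _ => 2)))
      (by rintro ((_ | _) | _ | i) <;> simp <;> linarith)
      (by rintro ((_ | _) | _ | i) <;> simp <;> norm_num) (fun ξ hξ t ht => HasDerivAt.congr_deriv (d0 hn hξ t j) (by
        simp only [Fintype.sum_sum_type, Sum.elim_inl, Sum.elim_inr, zmon0, zmon1, zmon2, Finset.univ_unique, Finset.sum_singleton]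
        simp only [Complex.ofReal_mul, Complex.ofReal_add, Complex.ofReal_sub, Complex.ofReal_neg, Complex.ofReal_one, Complex.ofReal_zero, Complex.ofReal_ofNat,
          Complex.ofReal_natCast, cexp2, zero_mul, zero_add, add_zero, neg_one_mul, one_mul, apply_ite Complex.ofReal]
        rw [lam_sum]
        simp only [← Finset.mul_sum]
        ring))
    simp only [Fintype.sum_sum_type, Sum.elim_inl, Sum.elim_inr, Finset.univ_unique, Finset.sum_singleton, zero_mul, zero_add, add_zero,
      neg_one_mul] at this
    exact this
  · refine Pk.mono (K := c3 * K) ?_ (mul_le_mul_of_nonneg_right (by linarith [le_abs_self c3, abs_nonneg c1, abs_nonneg c2]) hK)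
    have := pk_of2 n2 (a := -((n:ℝ) - 4)) hα hK (ι := (Unit ⊕ (Unit ⊕ Unit)) ⊕ (Fin n ⊕ Fin n)) (hG.xx j k)
      (Ψ := Sum.elim (Sum.elim (fun _ => PX ηx η0 j k) (Sum.elim (fun _ => P0 ηx η0 k) (fun _ => P0 ηx η0 j)))
        (Sum.elim (fun _ => PX ηx η0 j k) (fun i => PX ηx η0 i i)))
      (Ψ' := Sum.elim (Sum.elim (fun _ => PX' ηx η0 j k) (Sum.elim (fun _ => P0' ηx η0 k) (fun _ => P0' ηx η0 j)))
        (Sum.elim (fun _ => PX' ηx η0 j k) (fun i => PX' ηx η0 i i)))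
      (by rintro ((_ | _ | _) | _ | i) <;> simp only [Sum.elim_inl, Sum.elim_inr] <;> first | exact hG.x0 _ | exact hG.xx _ _)
      (Q := Sum.elim (Sum.elim (fun _ => []) (Sum.elim (fun _ => [j]) (fun _ => [k]))) (Sum.elim (fun i => [i, i]) (fun i => [])))
      (by rintro ((_ | _ | _) | _ | i) <;> simp)
      (u := Sum.elim (Sum.elim (fun _ => -(4 - 2 * n)) (Sum.elim (fun _ => -2) (fun _ => -2))) (Sum.elim (fun _ => 0) (fun _ => 2 * if j = k then 1 else 0)))
      (v := Sum.elim (Sum.elim (fun _ => 0) (Sum.elim (fun _ => 0) (fun _ => 0))) (Sum.elim (fun _ => -1) (fun _ => 0)))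
      (by rintro ((_ | _ | _) | _ | i) <;> simp only [Sum.elim_inl, Sum.elim_inr] <;> rw [abs_le] <;> (try split_ifs) <;> constructor <;> linarith)
      (by rintro ((_ | _ | _) | _ | i) <;> simp) (fun ξ hξ t ht => HasDerivAt.congr_deriv (dX hn hξ t j k) (by
        simp only [Fintype.sum_sum_type, Sum.elim_inl, Sum.elim_inr, zmon0, zmon1, zmon2, Finset.univ_unique, Finset.sum_singleton]
        simp only [Complex.ofReal_mul, Complex.ofReal_add, Complex.ofReal_sub, Complex.ofReal_neg, Complex.ofReal_one, Complex.ofReal_zero, Complex.ofReal_ofNat,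
          Complex.ofReal_natCast, cexp2, zero_mul, zero_add, add_zero, neg_one_mul, one_mul, apply_ite Complex.ofReal]
        rw [lam_sum]
        simp only [← Finset.mul_sum]
        ring))
    simp only [Fintype.sum_sum_type, Sum.elim_inl, Sum.elim_inr, Finset.univ_unique, Finset.sum_singleton, zero_mul, zero_add, add_zero,
      neg_one_mul] at this
    exact this

def hSol {n : ℕ} (ηx : Fin n → EE n → ℝ) (η0 : EE n → ℝ) : Tensor2 n :=
  ⟨fun j k => Rx T0 (VZ [] (PX ηx η0 j k)), fun j => Rx T0 (VZ [] (P0 ηx η0 j)), Rx T0 (VZ [] (P00 ηx η0))⟩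

section
variable {n : ℕ} {α K : ℝ} {Φ Φ' : EE n → ℝ → ℂ} {ftt : Pt n → ℝ}
lemma pdx_of {f : Pt n → ℝ} {a : Fin n → ℝ} {b : ℝ} {p : Pt n} (h : HasFDerivAt f (gr a b) p) (i : Fin n) : pdx i f p = a i := by
  rw [pdx, h.fderiv, gr_apply]
  simp
lemma pdt_of {f : Pt n → ℝ} {a : Fin n → ℝ} {b : ℝ} {p : Pt n} (h : HasFDerivAt f (gr a b) p) : pdt f p = b := by
  rw [pdt, h.fderiv, gr_apply]
  simp
lemma Pk.x (hα : α ∈ Ioo (0:ℝ) 1) (P : PkZ α K Φ Φ' ftt) (i : Fin n) : pdx i (Rx T0 (VZ [] Φ)) = Rx T0 (VZ [i] Φ) :=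
  funext fun p => pdx_of (P.D0 hα p) i
lemma Pk.t (hα : α ∈ Ioo (0:ℝ) 1) (P : PkZ α K Φ Φ' ftt) : pdt (Rx T0 (VZ [] Φ)) = Rx (Rn T0) (VZ [] Φ') :=
  funext fun p => pdt_of (P.D0 hα p)
lemma Pk.x2 (hα : α ∈ Ioo (0:ℝ) 1) (P : PkZ α K Φ Φ' ftt) (i : Fin n) : pdx i (Rx T0 (VZ [i] Φ)) = Rx T0 (VZ [i, i] Φ) :=
  funext fun p => pdx_of (P.Dj hα i p) i
lemma Pk.t2 (hα : α ∈ Ioo (0:ℝ) 1) (P : PkZ α K Φ Φ' ftt) : pdt (Rx (Rn T0) (VZ [] Φ')) = Rx (Rn (Rn T0)) ftt :=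
  funext fun p => pdt_of (P.Dt hα p)

lemma cE : Continuous fun p : Pt n => Real.exp (-2 * p.2) := by fun_prop
lemma cS {F : Fin n → Pt n → ℝ} (h : ∀ i, Continuous (F i)) : Continuous fun p => ∑ i, F i p := continuous_finsetSum _ fun i _ => h i
lemma eq_of_pos {F : Pt n → ℝ} (hc : Continuous F) (h : ∀ p : Pt n, 0 < p.2 → F p = 0) {p : Pt n} (hp : 0 ≤ p.2) : F p = 0 :=
  tendsto_nhds_unique ((hc.tendsto p).comp (sh_lim p)) ((tendsto_const_nhds (x := (0:ℝ))).congr fun k => (h _ (sh_pos hp k)).symm)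
end

section
variable {n : ℕ} {α K : ℝ} {ηx : Fin n → EE n → ℝ} {η0 : EE n → ℝ}

lemma trV (hn : 3 ≤ n) (hG : AllGF α K ηx η0) (Q : List (Fin n)) {p : Pt n} (hp : 0 < p.2) :
    Real.exp (-2 * p.2) * ∑ k, VZ Q (PX ηx η0 k k) p = -VZ Q (P00 ηx η0) p := by
  have n2 : 2 ≤ n := by omega
  have e := Vf_tmul (fun ξ t => zmon Q ξ * P00 ηx η0 ξ t) (fun _ => (-1:ℝ)) p
  have e2 := Vf_tmul (fun ξ t => ∑ k, zmon Q ξ * PX ηx η0 k k ξ t) (fun t => Real.exp (-2 * t)) p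
  rw [Vf_sum n2 _ (fun k => (hG.xx k k).s0.monmul Q) hp] at e2
  unfold VZ
  rw [neg_one_mul] at e
  rw [← e2, ← e]
  refine Vf_congr n2 fun ξ hξ => ?_
  have := trP (ηx := ηx) (η0 := η0) hn hξ p.2
  rw [← cexp2] at this
  rw [← Finset.mul_sum, mul_left_comm, this]; push_cast; ring

lemma trP' (hn : 3 ≤ n) (hG : AllGF α K ηx η0) {ξ : EE n} (hξ : ξ ≠ 0) {t : ℝ} (ht : 0 < t) :
    ((Real.exp (-2 * t) : ℝ) : ℂ) * ∑ i, PX' ηx η0 i i ξ t = -P00' ηx η0 ξ t - 2 * P00 ηx η0 ξ t := by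
  have h1 : HasDerivAt (fun t : ℝ => Real.exp (-2 * t)) (Real.exp (-2 * t) * (-2)) t := by
    simpa using ((hasDerivAt_id t).const_mul (-2)).exp
  have h2 := h1.ofReal_comp.mul (HasDerivAt.fun_sum fun i (_ : i ∈ Finset.univ) => (hG.xx i i).der ξ hξ t ht)
  have h3 := ((hG.tt.der ξ hξ t ht).neg).unique (h2.congr_of_eventuallyEq (Filter.Eventually.of_forall fun τ => ?_))
  · have := trP (ηx := ηx) (η0 := η0) hn hξ t
    rw [← cexp2] at this
    push_cast at h3 this ⊢
    linear_combination -h3 + 2 * this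
  · have := trP (ηx := ηx) (η0 := η0) hn hξ τ
    rw [← cexp2] at this
    simp only [Pi.neg_apply, Pi.mul_apply, ← this]

lemma trV' (hn : 3 ≤ n) (hG : AllGF α K ηx η0) {p : Pt n} (hp : 0 < p.2) :
    Real.exp (-2 * p.2) * ∑ k, VZ [] (PX' ηx η0 k k) p = -VZ [] (P00' ηx η0) p - 2 * VZ [] (P00 ηx η0) p := by
  have n2 : 2 ≤ n := by omega
  have e := Vf_tmul (fun ξ t => zmon [] ξ * P00' ηx η0 ξ t) (fun _ => (-1:ℝ)) p
  have e' := Vf_tmul (fun ξ t => zmon [] ξ * P00 ηx η0 ξ t) (fun _ => (-2:ℝ)) p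
  have e3 := Vf_add n2 ((hG.tt.s1.monmul []).cmul ((-1:ℝ):ℂ)) ((hG.tt.s0.monmul []).cmul ((-2:ℝ):ℂ)) hp
  have e2 := Vf_tmul (fun ξ t => ∑ k, zmon [] ξ * PX' ηx η0 k k ξ t) (fun t => Real.exp (-2 * t)) p
  rw [Vf_sum n2 _ (fun k => (hG.xx k k).s1.monmul []) hp] at e2
  unfold VZ
  rw [← e2, show ∀ a b : ℝ, -a - 2 * b = -1 * a + -2 * b from fun a b => by ring, ← e, ← e', ← e3]
  refine Vf_congr n2 fun ξ hξ => ?_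
  rw [← Finset.mul_sum, mul_left_comm, trP' hn hG hξ hp]; push_cast; ring

lemma VZ0 (Φ : EE n → ℝ → ℂ) : VZ [] Φ = Vf Φ := by simp only [VZ, zmon0, one_mul]
lemma VZ1 (i : Fin n) (Φ : EE n → ℝ → ℂ) : VZ [i] Φ = Vf (fun ξ t => zz ξ i * Φ ξ t) := by simp only [VZ, zmon1]

lemma Vom0 (hn : 3 ≤ n) (hG : AllGF α K ηx η0) {p : Pt n} (hp : 0 < p.2) : Vf (om0 ηx η0) p =
    Real.exp (-2 * p.2) * ∑ i, VZ [i] (P0 ηx η0 i) p + (n * VZ [] (P00 ηx η0) p + (VZ [] (P00' ηx η0) p + VZ [] (P00 ηx η0) p)) := by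
  have n2 : 2 ≤ n := by omega
  have s1 := (SDec.sum Finset.univ fun i => (hG.x0 i).s0.zmul i)
  simp only [VZ0, VZ1]
  rw [← Vf_sum n2 _ (fun i => (hG.x0 i).s0.zmul i) hp, ← Vf_tmul _ (fun t => Real.exp (-2 * t)), ← Vf_tmul _ (fun _ => (n:ℝ)),
    ← Vf_add n2 hG.tt.s1 hG.tt.s0 hp, ← Vf_add n2 (hG.tt.s0.cmul _) (hG.tt.s1.add hG.tt.s0) hp,
    ← Vf_add n2 (s1.tmul (fun t => ((Real.exp (-2 * t) : ℝ) : ℂ)) ex2_norm) ((hG.tt.s0.cmul _).add (hG.tt.s1.add hG.tt.s0)) hp]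
  rfl

lemma VomX (hn : 3 ≤ n) (hG : AllGF α K ηx η0) (j : Fin n) {p : Pt n} (hp : 0 < p.2) : Vf (omX ηx η0 j) p =
    Real.exp (-2 * p.2) * ∑ i, VZ [i] (PX ηx η0 i j) p + (VZ [] (P0' ηx η0 j) p + n * VZ [] (P0 ηx η0 j) p) := by
  have n2 : 2 ≤ n := by omega
  have s1 := (SDec.sum Finset.univ fun i => (hG.xx i j).s0.zmul i)
  simp only [VZ0, VZ1]
  rw [← Vf_sum n2 _ (fun i => (hG.xx i j).s0.zmul i) hp, ← Vf_tmul _ (fun t => Real.exp (-2 * t)), ← Vf_tmul _ (fun _ => (n:ℝ)),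
    ← Vf_add n2 (hG.x0 j).s1 ((hG.x0 j).s0.cmul _) hp,
    ← Vf_add n2 (s1.tmul (fun t => ((Real.exp (-2 * t) : ℝ) : ℂ)) ex2_norm) ((hG.x0 j).s1.add ((hG.x0 j).s0.cmul _)) hp]
  rfl

lemma PX_symm (j k : Fin n) : PX ηx η0 j k = PX ηx η0 k j := QX_symm _ _ _ _ _ _ _ j k

variable {K' : ℝ}
theorem sol_L (hα : α ∈ Ioo (0:ℝ) 1) (P : Pks α K ηx η0) : LEqOn (hSol ηx η0) (Tensor2.zero n) (halfSp n) := by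
  have cx : ∀ j k i, Continuous (Rx T0 (VZ [i] (PX ηx η0 j k))) := fun j k i => Rx_cont hα ((P.xx j k).hj i) T0s
  have c0 : ∀ j i, Continuous (Rx T0 (VZ [i] (P0 ηx η0 j))) := fun j i => Rx_cont hα ((P.x0 j).hj i) T0s
  have ct : ∀ i, Continuous (Rx T0 (VZ [i] (P00 ηx η0))) := fun i => Rx_cont hα (P.tt.hj i) T0s
  have cx' : ∀ j k, Continuous (Rx T0 (VZ [] (PX ηx η0 j k))) := fun j k => Rx_cont hα ((P.xx j k).h0) T0s
  have gen : ∀ {Φ Φ' : EE n → ℝ → ℂ} {ftt : Pt n → ℝ} (_ : PkZ α K Φ Φ' ftt), Continuous (Rx T0 (VZ [] Φ)) ∧ Continuous (Rx (Rn T0) (VZ [] Φ')) ∧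
      Continuous (Rx (Rn (Rn T0)) ftt) ∧ ∀ i, Continuous (Rx T0 (VZ [i, i] Φ)) := fun Q =>
    ⟨Rx_cont hα Q.h0 T0s, Rx_cont hα Q.ht T1s, Rx_cont hα Q.htt T2s, fun i => Rx_cont hα (Q.hjk i i) T0s⟩
  intro p hp
  refine ⟨fun j k => eq_of_pos (F := Lxx (hSol ηx η0) j k) ?_ (fun p hp => ?_) hp, fun j => eq_of_pos (F := Lx0 (hSol ηx η0) j) ?_ (fun p hp => ?_) hp,
    eq_of_pos (F := Ltt (hSol ηx η0)) ?_ (fun p hp => ?_) hp⟩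
  · obtain ⟨q1, q2, q3, q4⟩ := gen (P.xx j k)
    unfold Lxx
    simp only [hSol, (P.xx j k).x hα, (P.xx j k).x2 hα, (P.xx j k).t hα, (P.xx j k).t2 hα, fun j => (P.x0 j).x hα]
    exact (((((cE.mul (cS q4)).add q3).add (continuous_const.mul q2)).add (continuous_const.mul q1)).sub ((continuous_const.mul (cS fun i => cx' i i)).mul continuous_const)).add (continuous_const.mul ((c0 k j).add (c0 j k)))
  · unfold Lxx
    simp only [hSol, (P.xx j k).x hα, (P.xx j k).x2 hα, (P.xx j k).t hα, (P.xx j k).t2 hα, fun j => (P.x0 j).x hα]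
    simp only [fun i => Rx_pos hα ((P.xx j k).hjk i i) (c := T0) hp, Rx_pos hα (P.xx j k).htt hp, Rx_pos hα (P.xx j k).ht hp,
      fun j k => Rx_pos hα (P.xx j k).h0 (c := T0) hp, fun j i => Rx_pos hα ((P.x0 j).hj i) (c := T0) hp, SX, ← Finset.mul_sum]
    ring
  · obtain ⟨q1, q2, q3, q4⟩ := gen (P.x0 j)
    unfold Lx0
    simp only [hSol, (P.x0 j).x hα, (P.x0 j).x2 hα, (P.x0 j).t hα, (P.x0 j).t2 hα, P.tt.x hα, fun j k => (P.xx j k).x hα]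
    exact (((((cE.mul (cS q4)).add q3).add (continuous_const.mul q2)).sub (continuous_const.mul q1)).add (continuous_const.mul (ct j))).sub ((continuous_const.mul cE).mul (cS fun i => cx i j i))
  · unfold Lx0
    simp only [hSol, (P.x0 j).x hα, (P.x0 j).x2 hα, (P.x0 j).t hα, (P.x0 j).t2 hα, P.tt.x hα, fun j k => (P.xx j k).x hα]
    simp only [fun i => Rx_pos hα ((P.x0 j).hjk i i) (c := T0) hp, Rx_pos hα (P.x0 j).htt hp, Rx_pos hα (P.x0 j).ht hp,
      Rx_pos hα (P.x0 j).h0 hp, fun j k i => Rx_pos hα ((P.xx j k).hj i) (c := T0) hp, fun i => Rx_pos hα (P.tt.hj i) (c := T0) hp, S0, ← Finset.mul_sum]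
    ring
  · obtain ⟨q1, q2, q3, q4⟩ := gen P.tt
    unfold Ltt
    simp only [hSol, P.tt.x hα, P.tt.x2 hα, P.tt.t hα, P.tt.t2 hα, fun j => (P.x0 j).x hα]
    exact ((((cE.mul (cS q4)).add q3).add (continuous_const.mul q2)).sub (continuous_const.mul q1)).sub ((continuous_const.mul cE).mul (cS fun i => c0 i i))
  · unfold Ltt
    simp only [hSol, P.tt.x hα, P.tt.x2 hα, P.tt.t hα, P.tt.t2 hα, fun j => (P.x0 j).x hα]
    simp only [fun i => Rx_pos hα (P.tt.hjk i i) (c := T0) hp, Rx_pos hα P.tt.htt hp, Rx_pos hα P.tt.ht hp,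
      Rx_pos hα P.tt.h0 hp, fun j i => Rx_pos hα ((P.x0 j).hj i) (c := T0) hp, S00, ← Finset.mul_sum]
    ring

lemma tr_d (hα : α ∈ Ioo (0:ℝ) 1) (P : Pks α K ηx η0) (p : Pt n) : HasFDerivAt (fun q => ∑ k, (hSol ηx η0).xx k k q)
    (gr (fun j => ∑ k, Rx T0 (VZ [j] (PX ηx η0 k k)) p) (∑ k, Rx (Rn T0) (VZ [] (PX' ηx η0 k k)) p)) p := by
  refine HasFDerivAt.congr_fderiv (HasFDerivAt.fun_sum fun k (_ : k ∈ Finset.univ) => (P.xx k k).D0 hα p) ?_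
  refine ContinuousLinearMap.ext fun w => ?_
  simp only [sum_apply, gr_apply, Finset.sum_add_distrib, Finset.sum_mul]
  rw [Finset.sum_comm]

theorem sol_BX (hn : 3 ≤ n) (hα : α ∈ Ioo (0:ℝ) 1) (hG : AllGF α K' ηx η0) (P : Pks α K ηx η0) (hx : ∀ l, Integrable (ηx l))
    (hc : ∀ j, Continuous (ηx j)) (j : Fin n) (x : EE n) : BianX (hSol ηx η0) j (x, 0) = ηx j x := by
  have e : BianX (hSol ηx η0) j = fun p => Real.exp (-2 * p.2) * (∑ i, Rx T0 (VZ [i] (PX ηx η0 j i)) p) + Rx (Rn T0) (VZ [] (P0' ηx η0 j)) p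
      + n * Rx T0 (VZ [] (P0 ηx η0 j)) p - 1 / 2 * Real.exp (-2 * p.2) * (∑ k, Rx T0 (VZ [j] (PX ηx η0 k k)) p) - 1 / 2 * Rx T0 (VZ [j] (P00 ηx η0)) p := by
    funext p
    unfold BianX
    rw [pdx_of (tr_d hα P p)]
    simp only [hSol, (P.x0 j).t hα, P.tt.x hα, fun j k => (P.xx j k).x hα]
  have cx : ∀ j k i, Continuous (Rx T0 (VZ [i] (PX ηx η0 j k))) := fun j k i => Rx_cont hα ((P.xx j k).hj i) T0s
  have ct : ∀ i, Continuous (Rx T0 (VZ [i] (P00 ηx η0))) := fun i => Rx_cont hα (P.tt.hj i) T0s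
  have q1 := Rx_cont hα (P.x0 j).h0 T0s
  have q2 := Rx_cont hα (P.x0 j).ht T1s
  refine omX_bdry hn hG hx j (hc j) (b := BianX (hSol ηx η0) j) ?_ (fun p hp => ?_) x
  · rw [e]
    exact ((((cE.mul (cS fun i => cx j i i)).add q2).add (continuous_const.mul q1)).sub ((continuous_const.mul cE).mul (cS fun k => cx k k j))).sub (continuous_const.mul (ct j))
  · rw [VomX hn hG j hp, e]
    simp only [fun j k i => Rx_pos hα ((P.xx j k).hj i) (c := T0) hp, fun i => Rx_pos hα (P.tt.hj i) (c := T0) hp, Rx_pos hα (P.x0 j).h0 hp,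
      Rx_pos hα (P.x0 j).ht hp, PX_symm j]
    linear_combination (-1/2) * trV hn hG [j] hp

theorem sol_BT (hn : 3 ≤ n) (hα : α ∈ Ioo (0:ℝ) 1) (hG : AllGF α K' ηx η0) (P : Pks α K ηx η0) (hx : ∀ l, Integrable (ηx l))
    (h0 : Integrable η0) (hc : Continuous η0) (x : EE n) : BianT (hSol ηx η0) (x, 0) = η0 x := by
  have e : BianT (hSol ηx η0) = fun p => Real.exp (-2 * p.2) * (∑ i, Rx T0 (VZ [i] (P0 ηx η0 i)) p) + n * Rx T0 (VZ [] (P00 ηx η0)) p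
      + 1 / 2 * Rx (Rn T0) (VZ [] (P00' ηx η0)) p - 1 / 2 * Real.exp (-2 * p.2) * (∑ k, Rx (Rn T0) (VZ [] (PX' ηx η0 k k)) p) := by
    funext p
    unfold BianT
    rw [pdt_of (tr_d hα P p)]
    simp only [hSol, P.tt.t hα, fun j => (P.x0 j).x hα]
  have cx : ∀ j k, Continuous (Rx (Rn T0) (VZ [] (PX' ηx η0 j k))) := fun j k => Rx_cont hα (P.xx j k).ht T1s
  have c0 : ∀ j i, Continuous (Rx T0 (VZ [i] (P0 ηx η0 j))) := fun j i => Rx_cont hα ((P.x0 j).hj i) T0s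
  have q1 := Rx_cont hα P.tt.h0 T0s
  have q2 := Rx_cont hα P.tt.ht T1s
  refine om0_bdry hn hG hx h0 hc (b := BianT (hSol ηx η0)) ?_ (fun p hp => ?_) x
  · rw [e]
    exact (((cE.mul (cS fun i => c0 i i)).add (continuous_const.mul q1)).add (continuous_const.mul q2)).sub ((continuous_const.mul cE).mul (cS fun k => cx k k))
  · rw [Vom0 hn hG hp, e]
    simp only [fun j k => Rx_pos hα (P.xx j k).ht (c := Rn T0) hp, fun j i => Rx_pos hα ((P.x0 j).hj i) (c := T0) hp, Rx_pos hα P.tt.h0 hp,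
      Rx_pos hα P.tt.ht hp]
    linear_combination (-1/2) * trV' hn hG hp
end

/-- Proposition 3.10 / `prop:Hinverse2` of the paper.
Solving the homogeneous problem `Lh = 0` with prescribed Bianchi boundary
values `η`, assuming decay of `η` and vanishing of its zeroth and first
moments. -/
theorem statement2 (n : ℕ) (hn : 3 ≤ n) (α : ℝ) (hα : α ∈ Set.Ioo (0 : ℝ) 1)
    (C : ℝ) (hC : 0 < C) (δ : ℝ) (hδ : δ ∈ Set.Ioo (0 : ℝ) 1) :
    ∃ C' > (0 : ℝ),
      ∀ (ηx : Fin n → EuclideanSpace ℝ (Fin n) → ℝ)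
        (η0 : EuclideanSpace ℝ (Fin n) → ℝ),
        (∀ i, ContDiff ℝ 1 (ηx i)) → ContDiff ℝ 1 η0 →
        (∀ i, BddAbove (eHolderSet 1 α Set.univ (ηx i))) →
        BddAbove (eHolderSet 1 α Set.univ η0) →
        oNorm 1 α Set.univ ηx η0 ≤ C →
        (∀ R > (1 : ℝ), oNorm 1 α (eShell n R) ηx η0 ≤ C * R ^ (-2 * (n : ℝ) + 1 / 2)) →
        (∀ a, (∫ x, ηx a x = 0) ∧ ∀ i : Fin n, ∫ x, x i * ηx a x = 0) →
        ((∫ x, η0 x = 0) ∧ ∀ i : Fin n, ∫ x, x i * η0 x = 0) →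
        ∃ h : Tensor2 n, h.Symm ∧ tSmooth 2 h ∧ tBdd 2 α 1 (halfSp n) h ∧
          LEqOn h (Tensor2.zero n) (halfSp n) ∧
          (∀ i x, BianX h i (x, 0) = ηx i x) ∧ (∀ x, BianT h (x, 0) = η0 x) ∧
          ∀ R > (0 : ℝ),
            tNorm 2 α 1 (annRegion n R) h ≤ C' * (1 + R) ^ (-(n : ℝ) - 1 + δ) := by
  obtain ⟨A, hA, hdata⟩ := data_of hn hα hC
  obtain ⟨K, hK, hGF⟩ := allGF hn hα
  obtain ⟨c, hc, hP⟩ := pks hn hα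
  refine ⟨((n:ℝ) * n + n + 1) * (((n:ℝ) + 1) ^ 2 * (c * (K * A) * 2 ^ (n + 1))), by positivity, fun ηx η0 cx c0 bx b0 hu hs mx m0 => ?_⟩
  have ox : ∀ (S : Set (EE n)) l, eNorm 1 α S (ηx l) ≤ oNorm 1 α S ηx η0 := fun S l =>
    (Finset.single_le_sum (f := fun i => eNorm 1 α S (ηx i)) (fun _ _ => eNorm_nn) (Finset.mem_univ l)).trans (le_add_of_nonneg_right eNorm_nn)
  have o0 : ∀ S : Set (EE n), eNorm 1 α S η0 ≤ oNorm 1 α S ηx η0 := fun S => le_add_of_nonneg_left (Finset.sum_nonneg fun _ _ => eNorm_nn)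
  have dx : ∀ l, Dat2 α A (ηx l) := fun l => hdata _ (cx l) (bx l) ((ox _ l).trans hu) (fun R hR => (ox _ l).trans (hs R hR)) (mx l).1 (mx l).2
  have d0 : Dat2 α A η0 := hdata _ c0 b0 ((o0 _).trans hu) (fun R hR => (o0 _).trans (hs R hR)) m0.1 m0.2
  have hG := hGF A ηx η0 dx d0
  have P := hP (K * A) ηx η0 (by positivity) hG
  have ix : ∀ l, Integrable (ηx l) := fun l => (dx l).d0.int hn
  have hS : ∀ p ∈ halfSp n, 0 ≤ p.2 ∧ wn p.1 ≤ 1 := fun p hp => ⟨hp, wn_le_one _⟩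
  refine ⟨hSol ηx η0, fun j k => ?_, ⟨fun j k => Pk.cd hα (P.xx j k), fun j => Pk.cd hα (P.x0 j), Pk.cd hα P.tt⟩,
    ⟨fun j k => ⟨_, Pk.bound hα (P.xx j k) hS⟩, fun j => ⟨_, Pk.bound hα (P.x0 j) hS⟩, ⟨_, Pk.bound hα P.tt hS⟩⟩, sol_L hα P,
    fun j x => sol_BX hn hα hG P ix (fun j => (cx j).continuous) j x, fun x => sol_BT hn hα hG P ix (d0.d0.int hn) c0.continuous x, fun R hR => ?_⟩
  · simp only [hSol, PX_symm j k]
  · have hT : ∀ p ∈ annRegion n R, 0 ≤ p.2 ∧ wn p.1 ≤ 2 ^ (n + 1) * (1 + R) ^ (-(n:ℝ) - 1 + δ) := fun p hp => wn_ann hδ.1 hR hp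
    have hR1 : 0 < 1 + R := by linarith
    set B : ℝ := ((n:ℝ) + 1) ^ 2 * (c * (K * A) * (2 ^ (n + 1) * (1 + R) ^ (-(n:ℝ) - 1 + δ))) with hB
    have hB0 : 0 ≤ B := by positivity
    have h1 : ∀ j k, hNorm 2 α 1 (annRegion n R) ((hSol ηx η0).xx j k) ≤ B := fun j k => Real.sSup_le (Pk.bound hα (P.xx j k) hT) hB0
    have h2 : ∀ j, hNorm 2 α 1 (annRegion n R) ((hSol ηx η0).x0 j) ≤ B := fun j => Real.sSup_le (Pk.bound hα (P.x0 j) hT) hB0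
    have h3 : hNorm 2 α 1 (annRegion n R) (hSol ηx η0).tt ≤ B := Real.sSup_le (Pk.bound hα P.tt hT) hB0
    refine (add_le_add (add_le_add (Finset.sum_le_sum fun j _ => Finset.sum_le_sum fun k _ => h1 j k) (Finset.sum_le_sum fun j _ => h2 j)) h3).trans (le_of_eq ?_)
    simp only [Finset.sum_const, Finset.card_univ, Fintype.card_fin, nsmul_eq_mul, hB]
    ring

end
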